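/- There exist constants c₁, c₂, C > 0 such that for every prime p and all integers L, N with 0 < L+1 < L+N < p and c₂·p^(7/8)·log p ≤ N ≤ c₁·p^(13/14)·(log p)^(4/7), one has |A_N / A_N| ≥ p − C·p^(5/6)·K^(4/3)·(log p)^(4/3), where K = p/N (as a real number). -/

import Mathlib

/-- For a prime `p` and integers `L, N`, `A_N = {n! mod p : L+1 ≤ n ≤ L+N} ⊆ ZMod p`. -/
def intervalFactorials (p L N : ℕ) : Finset (ZMod p) :=
  (Finset.Icc (L + 1) (L + N)).image (fun n => (n.factorial : ZMod p))

/-- The ratio set `A_N / A_N = {a·b⁻¹ : a, b ∈ A_N}`. -/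
def intervalFactorialsRatio (p L N : ℕ) : Finset (ZMod p) :=
  Finset.image₂ (fun a b => a * b⁻¹) (intervalFactorials p L N) (intervalFactorials p L N)

section

open Polynomial

/-- An exhaustive-style increasing multiplicative filtration on a commutative ring. -/
structure DegFilt (S : Type*) [CommRing S] where
  D : ℤ → AddSubgroup S
  mono : ∀ {m n : ℤ}, m ≤ n → D m ≤ D n
  one_mem : (1 : S) ∈ D 0
  mul_mem : ∀ {m n : ℤ} {a b : S}, a ∈ D m → b ∈ D n → a * b ∈ D (m + n)

namespace DegFilt

variable {S : Type*} [CommRing S] (𝒟 : DegFilt S)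

theorem pow_mem {a : S} {m : ℤ} (ha : a ∈ 𝒟.D m) (n : ℕ) : a ^ n ∈ 𝒟.D (n * m) := by
  induction n with
  | zero => simpa using 𝒟.one_mem
  | succ n ih =>
    have := 𝒟.mul_mem ih ha
    rw [pow_succ]
    convert this using 2
    push_cast; ring

theorem prod_mem {ι : Type*} (s : Finset ι) (f : ι → S) (d : ι → ℤ)
    (h : ∀ i ∈ s, f i ∈ 𝒟.D (d i)) : ∏ i ∈ s, f i ∈ 𝒟.D (∑ i ∈ s, d i) := by
  classical
  induction s using Finset.induction_on with
  | empty => simpa using 𝒟.one_mem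
  | insert a s ha ih =>
    rw [Finset.prod_insert ha, Finset.sum_insert ha]
    exact 𝒟.mul_mem (h a (by simp)) (ih fun i hi => h i (by simp [hi]))

theorem det_mem {ι : Type*} [Fintype ι] [DecidableEq ι] (M : Matrix ι ι S) (n : ℤ) (c : ι → ℤ)
    (h : ∀ i j, M i j ∈ 𝒟.D (n + c j - c i)) : M.det ∈ 𝒟.D (Fintype.card ι * n) := by
  rw [Matrix.det_apply]
  refine AddSubgroup.sum_mem _ fun σ _ => ?_
  have h1 : ∏ i, M (σ i) i ∈ 𝒟.D (Fintype.card ι * n) := by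
    have := 𝒟.prod_mem Finset.univ (fun i => M (σ i) i) (fun i => n + c i - c (σ i))
      (fun i _ => h _ _)
    convert this using 2
    rw [Finset.sum_sub_distrib, Finset.sum_add_distrib, Equiv.sum_comp σ c]
    simp
  rw [Units.smul_def]
  exact AddSubgroup.zsmul_mem _ h1 _

theorem prod_sub_one_mem {ι : Type*} (s : Finset ι) (f : ι → S) {n : ℤ} (hn : 0 ≤ n)
    (h : ∀ i ∈ s, f i - 1 ∈ 𝒟.D (-n)) : ∏ i ∈ s, f i - 1 ∈ 𝒟.D (-n) := by
  classical
  induction s using Finset.induction_on with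
  | empty => simp
  | insert a s ha ih =>
    rw [Finset.prod_insert ha]
    have h1 := h a (by simp)
    have h2 := ih fun i hi => h i (by simp [hi])
    have h3 := 𝒟.mono (by lia : -n + -n ≤ -n) (𝒟.mul_mem h1 h2)
    have : f a * ∏ i ∈ s, f i - 1 = (f a - 1) * (∏ i ∈ s, f i - 1) + (f a - 1)
        + (∏ i ∈ s, f i - 1) := by ring
    rw [this]
    exact add_mem (add_mem h3 h1) h2

theorem det_sub_one_mem {ι : Type*} [Fintype ι] [DecidableEq ι] (M : Matrix ι ι S) {n : ℤ}
    (hn : 0 ≤ n) (c : ι → ℤ) (h : ∀ i j, (M - 1) i j ∈ 𝒟.D (-n + c j - c i)) :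
    M.det - 1 ∈ 𝒟.D (-n) := by
  rw [Matrix.det_apply, ← Finset.add_sum_erase _ _ (Finset.mem_univ (1 : Equiv.Perm ι)),
    add_sub_right_comm]
  refine add_mem ?_ (AddSubgroup.sum_mem _ fun σ hσ => ?_)
  · simp only [Equiv.Perm.sign_one, Equiv.Perm.coe_one, id_eq, one_smul]
    refine 𝒟.prod_sub_one_mem _ _ hn fun i _ => ?_
    simpa using h i i
  · rw [Units.smul_def]
    refine AddSubgroup.zsmul_mem _ ?_ _
    obtain ⟨a, ha⟩ : ∃ a, σ a ≠ a := by
      by_contra! hc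
      exact (Finset.ne_of_mem_erase hσ) (Equiv.ext hc)
    have hM : ∀ i j, i ≠ j → M i j ∈ 𝒟.D (-n + c j - c i) := fun i j hij => by
      simpa [Matrix.one_apply, hij] using h i j
    have hM' : ∀ i j, M i j ∈ 𝒟.D (c j - c i) := fun i j => by
      by_cases hij : i = j
      · subst hij
        have h1 := 𝒟.mono (by lia : -n + c i - c i ≤ 0) (h i i)
        have : M i i = (M - 1) i i + 1 := by simp
        rw [this, sub_self]
        exact add_mem h1 𝒟.one_mem
      · exact 𝒟.mono (by lia) (hM i j hij)
    rw [← Finset.mul_prod_erase _ _ (Finset.mem_univ a)]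
    have h1 := 𝒟.mul_mem (hM _ _ ha) (𝒟.prod_mem (Finset.univ.erase a) (fun i => M (σ i) i)
      (fun i => c i - c (σ i)) (fun i _ => hM' _ _))
    convert h1 using 2
    have h2 : ∑ i, (c i - c (σ i)) = 0 := by
      rw [Finset.sum_sub_distrib, Equiv.sum_comp σ c]; simp
    rw [← Finset.add_sum_erase _ _ (Finset.mem_univ a)] at h2
    lia

/-- Weighted degree filtration on polynomials where the variable has weight `c`. -/
def poly (c : ℤ) : DegFilt S[X] where
  D n :=
    { carrier := {P | ∀ i : ℕ, P.coeff i ∈ 𝒟.D (n - c * i)}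
      zero_mem' := fun i => by simp
      add_mem' := fun ha hb i => by
        rw [coeff_add]; exact add_mem (ha i) (hb i)
      neg_mem' := fun ha i => by
        rw [coeff_neg]; exact neg_mem (ha i) }
  mono := fun h P hP i => 𝒟.mono (by lia) (hP i)
  one_mem := fun i => by
    rw [coeff_one]
    split_ifs with h
    · subst h; simpa using 𝒟.one_mem
    · simp
  mul_mem := fun {m n a b} ha hb i => by
    rw [coeff_mul]
    refine AddSubgroup.sum_mem _ fun x hx => ?_
    have := 𝒟.mul_mem (ha x.1) (hb x.2)
    convert this using 2
    rw [← Finset.HasAntidiagonal.mem_antidiagonal.1 hx]; push_cast; ring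

theorem mem_poly {c n : ℤ} {P : S[X]} :
    P ∈ (𝒟.poly c).D n ↔ ∀ i : ℕ, P.coeff i ∈ 𝒟.D (n - c * i) := Iff.rfl

theorem C_mem_poly {c n : ℤ} {a : S} (ha : a ∈ 𝒟.D n) : C a ∈ (𝒟.poly c).D n := by
  intro i
  rw [coeff_C]
  split_ifs with h
  · subst h; simpa using ha
  · simp

theorem X_mem_poly {c : ℤ} : (X : S[X]) ∈ (𝒟.poly c).D c := by
  intro i
  rw [coeff_X]
  split_ifs with h
  · subst h; simpa using 𝒟.one_mem
  · simp

/-- Monic polynomials which are weighted-homogeneous of degree `c * natDegree`. -/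
def Good (c : ℤ) (F : S[X]) : Prop := F ∈ (𝒟.poly c).D (c * F.natDegree)

variable {𝒟}

theorem exists_dvd_sub_of_mem [Nontrivial S] {c n : ℤ} {F : S[X]} (hF : F.Monic) (hG : 𝒟.Good c F) (d : ℕ) :
    ∀ P : S[X], P.natDegree < d + F.natDegree → P ∈ (𝒟.poly c).D n →
      ∃ R ∈ (𝒟.poly c).D n, R.degree < F.degree ∧ F ∣ P - R := by
  have hFd : F.degree = F.natDegree := degree_eq_natDegree hF.ne_zero
  induction d with
  | zero =>
    intro P hd hP
    refine ⟨P, hP, ?_, by simp⟩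
    exact degree_lt_degree (by simpa using hd)
  | succ d ih =>
    intro P hd hP
    set Q : S[X] := P - F * (C (P.coeff (d + F.natDegree)) * X ^ d) with hQ
    have hQm : Q ∈ (𝒟.poly c).D n := by
      refine sub_mem hP ?_
      have h1 := (𝒟.poly c).mul_mem hG ((𝒟.poly c).mul_mem (𝒟.C_mem_poly (c := c)
        (hP (d + F.natDegree))) ((𝒟.poly c).pow_mem 𝒟.X_mem_poly d))
      convert h1 using 2
      push_cast; ring
    have hdeg : Q.natDegree < d + F.natDegree ∨ Q = 0 := by
      rw [or_iff_not_imp_right]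
      intro h0
      rw [natDegree_lt_iff_degree_lt h0, degree_lt_iff_coeff_zero]
      intro k hk
      rcases hk.eq_or_lt with rfl | hk
      · rw [hQ, coeff_sub, mul_left_comm, coeff_C_mul, add_comm d, coeff_mul_X_pow,
          coeff_natDegree, hF.leadingCoeff]
        simp
      · apply coeff_eq_zero_of_natDegree_lt
        refine lt_of_le_of_lt (natDegree_sub_le _ _) (max_lt (by lia) ?_)
        refine lt_of_le_of_lt natDegree_mul_le ?_
        have := natDegree_C_mul_X_pow_le (P.coeff (d + F.natDegree)) d
        lia
    rcases hdeg with hdeg | h0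
    · obtain ⟨R, hR, hlt, hdvd⟩ := ih Q hdeg hQm
      refine ⟨R, hR, hlt, ?_⟩
      have : P - R = (Q - R) + F * (C (P.coeff (d + F.natDegree)) * X ^ d) := by
        rw [hQ]; ring
      rw [this]
      exact dvd_add hdvd (dvd_mul_right _ _)
    · refine ⟨0, zero_mem _, by simp [hFd], ?_⟩
      rw [sub_zero, sub_eq_zero.1 h0]
      exact dvd_mul_right _ _

theorem modByMonic_mem [Nontrivial S] {c n : ℤ} {F : S[X]} (hF : F.Monic) (hG : 𝒟.Good c F) {P : S[X]}
    (hP : P ∈ (𝒟.poly c).D n) : P %ₘ F ∈ (𝒟.poly c).D n := by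
  obtain ⟨R, hR, hlt, T, hT⟩ :=
    exists_dvd_sub_of_mem hF hG (P.natDegree + 1) P (by lia) hP
  rw [(div_modByMonic_unique T R hF ⟨by rw [← hT]; ring, hlt⟩).2]
  exact hR

variable (𝒟) in
/-- The filtration induced on `S[y] = S[Y] / (F)`. -/
noncomputable def adj (c : ℤ) (F : S[X]) : DegFilt (AdjoinRoot F) where
  D n := ((𝒟.poly c).D n).map (AdjoinRoot.mk F).toAddMonoidHom
  mono := fun h => AddSubgroup.map_mono ((𝒟.poly c).mono h)
  one_mem := ⟨1, (𝒟.poly c).one_mem, map_one (AdjoinRoot.mk F)⟩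
  mul_mem := by
    rintro m n _ _ ⟨a, ha, rfl⟩ ⟨b, hb, rfl⟩
    exact ⟨a * b, (𝒟.poly c).mul_mem ha hb, map_mul (AdjoinRoot.mk F) _ _⟩

theorem mk_mem_adj {c n : ℤ} {F : S[X]} {P : S[X]} (hP : P ∈ (𝒟.poly c).D n) :
    AdjoinRoot.mk F P ∈ (𝒟.adj c F).D n := ⟨P, hP, rfl⟩

theorem of_mem_adj {c n : ℤ} {F : S[X]} {a : S} (ha : a ∈ 𝒟.D n) :
    AdjoinRoot.of F a ∈ (𝒟.adj c F).D n := mk_mem_adj (𝒟.C_mem_poly ha)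

theorem root_mem_adj {c : ℤ} {F : S[X]} : AdjoinRoot.root F ∈ (𝒟.adj c F).D c :=
  mk_mem_adj 𝒟.X_mem_poly

theorem mem_adj_iff [Nontrivial S] {c n : ℤ} {F : S[X]} (hF : F.Monic) (hG : 𝒟.Good c F) {f : AdjoinRoot F} :
    f ∈ (𝒟.adj c F).D n ↔ AdjoinRoot.modByMonicHom hF f ∈ (𝒟.poly c).D n := by
  constructor
  · rintro ⟨P, hP, rfl⟩
    exact modByMonic_mem hF hG hP
  · intro h
    exact ⟨_, h, AdjoinRoot.mk_leftInverse hF f⟩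

theorem leftMulMatrix_mem [Nontrivial S] {c n : ℤ} {F : S[X]} (hF : F.Monic) (hG : 𝒟.Good c F)
    {f : AdjoinRoot F} (hf : f ∈ (𝒟.adj c F).D n) (i j : Fin (AdjoinRoot.powerBasis' hF).dim) :
    Algebra.leftMulMatrix (AdjoinRoot.powerBasis' hF).basis f i j ∈
      𝒟.D (n + c * (j : ℕ) - c * (i : ℕ)) := by
  rw [Algebra.leftMulMatrix_eq_repr_mul]
  have h1 : f * AdjoinRoot.root F ^ (j : ℕ) ∈ (𝒟.adj c F).D (n + c * (j : ℕ)) := by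
    have := (𝒟.adj c F).mul_mem hf ((𝒟.adj c F).pow_mem (root_mem_adj (𝒟 := 𝒟) (c := c)) j)
    rwa [mul_comm ((j : ℕ) : ℤ)] at this
  have h2 := (mem_adj_iff hF hG).1 h1 i
  convert h2
  rw [PowerBasis.coe_basis]
  exact AdjoinRoot.powerBasisAux'_repr_apply_to_fun hF _ _

theorem norm_mem [Nontrivial S] {c n : ℤ} {F : S[X]} (hF : F.Monic) (hG : 𝒟.Good c F)
    {f : AdjoinRoot F} (hf : f ∈ (𝒟.adj c F).D n) :
    Algebra.norm S f ∈ 𝒟.D (F.natDegree * n) := by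
  classical
  rw [Algebra.norm_eq_matrix_det (AdjoinRoot.powerBasis' hF).basis]
  have := 𝒟.det_mem (Algebra.leftMulMatrix (AdjoinRoot.powerBasis' hF).basis f) n
    (fun i => c * (i : ℕ)) (leftMulMatrix_mem hF hG hf)
  convert this using 2
  simp

theorem norm_sub_one_mem [Nontrivial S] {c n : ℤ} {F : S[X]} (hF : F.Monic) (hG : 𝒟.Good c F) (hn : 0 ≤ n)
    {f : AdjoinRoot F} (hf : f - 1 ∈ (𝒟.adj c F).D (-n)) :
    Algebra.norm S f - 1 ∈ 𝒟.D (-n) := by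
  classical
  rw [Algebra.norm_eq_matrix_det (AdjoinRoot.powerBasis' hF).basis]
  refine 𝒟.det_sub_one_mem _ hn (fun i => c * (i : ℕ)) ?_
  have := leftMulMatrix_mem hF hG hf
  intro i j
  have h := this i j
  rwa [map_sub, map_one] at h

/-- The degree filtration on a polynomial ring. -/
def deg (A : Type*) [CommRing A] : DegFilt A[X] where
  D n :=
    { carrier := {a | ∀ i : ℕ, n < i → a.coeff i = 0}
      zero_mem' := fun i _ => by simp
      add_mem' := fun ha hb i hi => by rw [coeff_add, ha i hi, hb i hi, add_zero]
      neg_mem' := fun ha i hi => by rw [coeff_neg, ha i hi, neg_zero] }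
  mono := fun h a ha i hi => ha i (by lia)
  one_mem := fun i hi => by rw [coeff_one, if_neg]; rintro rfl; simp at hi
  mul_mem := fun {m n a b} ha hb i hi => by
    rw [coeff_mul]
    refine Finset.sum_eq_zero fun x hx => ?_
    have hx := Finset.HasAntidiagonal.mem_antidiagonal.1 hx
    rcases lt_or_ge m x.1 with h | h
    · rw [ha _ h, zero_mul]
    · rw [hb _ (by lia), mul_zero]

theorem mem_deg {A : Type*} [CommRing A] {a : A[X]} {n : ℤ} :
    a ∈ (deg A).D n ↔ ∀ i : ℕ, n < i → a.coeff i = 0 := Iff.rfl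

theorem mem_deg_nat {A : Type*} [CommRing A] {a : A[X]} {n : ℕ} :
    a ∈ (deg A).D n ↔ a.natDegree ≤ n := by
  rw [mem_deg, natDegree_le_iff_coeff_eq_zero]
  exact ⟨fun h i hi => h i (by exact_mod_cast hi), fun h i hi => h i (by exact_mod_cast hi)⟩

theorem good_deg_iff {A : Type*} [CommRing A] {F : A[X][X]} (hF : F.Monic) {c : ℕ} :
    (deg A).Good c F ↔ ∀ i < F.natDegree, (F.coeff i).natDegree ≤ c * (F.natDegree - i) := by
  constructor
  · intro h i hi
    have := h i
    rw [← mem_deg_nat]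
    convert this using 2
    push_cast [Nat.cast_sub hi.le]; ring
  · intro h i
    rcases lt_trichotomy i F.natDegree with hi | rfl | hi
    · have := mem_deg_nat.2 (h i hi)
      convert this using 2
      push_cast [Nat.cast_sub hi.le]; ring
    · rw [coeff_natDegree, hF.leadingCoeff, sub_self]
      exact (deg A).one_mem
    · rw [coeff_eq_zero_of_natDegree_lt hi]
      exact zero_mem _

end DegFilt

end

section

open PowerSeries

theorem powerSeries_frob_indep {Λ : Type*} [Field Λ] {p : ℕ} [Fact p.Prime] [CharP Λ p] (μ : ℕ)
    (V : Submodule Λ Λ⟦X⟧) (hV : ∀ s ∈ V, (X : Λ⟦X⟧) ^ p ^ μ ∣ s → s = 0) {ι : Type*}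
    (n : ℕ) : ∀ (I : Finset ι) (t s : ι → Λ⟦X⟧), I.card = n →
    (∀ g : ι → Λ, ∑ i ∈ I, g i • t i = 0 → ∀ i ∈ I, g i = 0) → (∀ i ∈ I, s i ∈ V) →
    ∑ i ∈ I, s i * t i ^ p ^ μ = 0 → ∀ i ∈ I, s i = 0 := by
  classical
  have : CharP Λ⟦X⟧ p := charP_of_injective_algebraMap
    (algebraMap Λ Λ⟦X⟧).injective p
  set Q := p ^ μ with hQ
  have hQ0 : 0 < Q := pow_pos (Fact.out : p.Prime).pos _
  induction n with
  | zero =>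
    intro I t s hI
    rw [Finset.card_eq_zero] at hI
    simp [hI]
  | succ n ih =>
    intro I t s hI hLI hs h0
    have hne : I.Nonempty := by rw [← Finset.card_pos]; lia
    obtain ⟨i₀, hi₀, hmin⟩ := I.exists_min_image (fun i => (t i).order) hne
    have ht0 : t i₀ ≠ 0 := by
      intro h
      have := hLI (fun i => if i = i₀ then 1 else 0) (by simp [h, hi₀]) i₀ hi₀
      simp at this
    set o := (t i₀).order.toNat with ho
    have ho' : (t i₀).order = o := (ENat.natCast_toNat (by simpa using ht0)).symm
    have hdiv : ∀ i ∈ I, (X : Λ⟦X⟧) ^ o ∣ t i := fun i hi => by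
      rw [PowerSeries.X_pow_dvd_iff]
      intro m hm
      apply coeff_of_lt_order
      refine lt_of_lt_of_le ?_ (hmin i hi)
      rw [ho']; exact_mod_cast hm
    have hc0 : coeff o (t i₀) ≠ 0 := by
      rw [ho]; exact coeff_order ht0
    set c : ι → Λ := fun i => coeff o (t i) / coeff o (t i₀) with hc
    set t' : ι → Λ⟦X⟧ := fun i => t i - c i • t i₀ with ht'
    have hdiv' : ∀ i ∈ I, (X : Λ⟦X⟧) ^ (o + 1) ∣ t' i := fun i hi => by
      rw [PowerSeries.X_pow_dvd_iff]
      intro m hm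
      rcases (Nat.lt_succ_iff.1 hm).eq_or_lt with rfl | hm
      · simp [ht', hc, hc0]
      · have h1 := PowerSeries.X_pow_dvd_iff.1 (hdiv i hi) m hm
        have h2 := PowerSeries.X_pow_dvd_iff.1 (hdiv i₀ hi₀) m hm
        simp [ht', h1, h2]
    set s₀ : Λ⟦X⟧ := s i₀ + ∑ i ∈ I.erase i₀, (c i) ^ Q • s i with hs₀
    have hs₀V : s₀ ∈ V := add_mem (hs _ hi₀) (sum_mem fun i hi =>
      V.smul_mem _ (hs _ (Finset.mem_of_mem_erase hi)))
    have hsum : ∑ i ∈ I.erase i₀, s i * t' i ^ Q + s₀ * t i₀ ^ Q = 0 := by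
      rw [← h0, ← Finset.add_sum_erase _ _ hi₀, hs₀, add_mul, Finset.sum_mul, add_left_comm,
        ← Finset.sum_add_distrib]
      congr 1
      refine Finset.sum_congr rfl fun i _ => ?_
      have : t i ^ Q = t' i ^ Q + (c i) ^ Q • t i₀ ^ Q := by
        have : t i = t' i + c i • t i₀ := by simp [ht']
        rw [this, hQ, add_pow_char_pow, _root_.smul_pow]
      rw [this, mul_add]
      simp
    have hs₀0 : s₀ = 0 := by
      apply hV _ hs₀V
      obtain ⟨u, hu⟩ := hdiv i₀ hi₀
      have hu1 : IsUnit u := by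
        rw [isUnit_iff_constantCoeff, isUnit_iff_ne_zero, ← coeff_zero_eq_constantCoeff_apply]
        have h3 : coeff o (t i₀) = coeff 0 u := by
          rw [hu]; simpa using coeff_X_pow_mul u o 0
        rwa [← h3]
      have h1 : (X : Λ⟦X⟧) ^ (o * Q + Q) ∣ s₀ * t i₀ ^ Q := by
        rw [← neg_eq_of_add_eq_zero_right hsum, dvd_neg]
        refine Finset.dvd_sum fun i hi => Dvd.dvd.mul_left ?_ _
        have := pow_dvd_pow_of_dvd (hdiv' i (Finset.mem_of_mem_erase hi)) Q
        rwa [← pow_mul, add_mul, one_mul] at this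
      rw [hu, mul_pow, ← pow_mul, pow_add, mul_left_comm] at h1
      have h2 := (mul_dvd_mul_iff_left (pow_ne_zero _ PowerSeries.X_ne_zero)).1 h1
      exact ((hu1.pow Q).dvd_mul_right).1 h2
    rw [hs₀0, zero_mul, add_zero] at hsum
    have hrest := ih (I.erase i₀) t' s (by rw [Finset.card_erase_of_mem hi₀]; lia) ?_
      (fun i hi => hs _ (Finset.mem_of_mem_erase hi)) hsum
    · intro i hi
      by_cases hii : i = i₀
      · rw [hii]
        rw [hs₀, Finset.sum_eq_zero, add_zero] at hs₀0
        · exact hs₀0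
        · intro j hj; rw [hrest j hj, smul_zero]
      · exact hrest i (Finset.mem_erase.2 ⟨hii, hi⟩)
    · intro g hg i hi
      set b : Λ := - ∑ j ∈ I.erase i₀, g j * c j with hb
      have := hLI (fun j => if j = i₀ then b else g j) ?_ i (Finset.mem_of_mem_erase hi)
      · simpa [Finset.ne_of_mem_erase hi] using this
      · rw [← Finset.add_sum_erase _ _ hi₀, ← hg]
        simp only [if_true, hb, neg_smul, Finset.sum_smul, ht', smul_sub, Finset.sum_sub_distrib,
          smul_smul]
        rw [add_comm, sub_eq_add_neg]
        congr 1
        refine Finset.sum_congr rfl fun j hj => ?_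
        rw [if_neg (Finset.ne_of_mem_erase hj)]

end

section

open Polynomial

variable {Λ : Type*} [Field Λ]

/-- Evaluation of the coordinate ring of a plane curve at a point. -/
noncomputable def curveEval {F : Λ[X][X]} {w y : Λ} (h : F.eval₂ (evalRingHom w) y = 0) :
    AdjoinRoot F →ₐ[Λ] Λ :=
  { AdjoinRoot.lift (evalRingHom w) y h with
    commutes' := fun r => by
      have : algebraMap Λ (AdjoinRoot F) r = AdjoinRoot.of F (C r) := rfl
      rw [this]
      simp }

@[simp] theorem curveEval_of {F : Λ[X][X]} {w y : Λ} (h : F.eval₂ (evalRingHom w) y = 0)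
    (a : Λ[X]) : curveEval h (AdjoinRoot.of F a) = a.eval w :=
  AdjoinRoot.lift_of (i := evalRingHom w) (a := y) h

@[simp] theorem curveEval_root {F : Λ[X][X]} {w y : Λ} (h : F.eval₂ (evalRingHom w) y = 0) :
    curveEval h (AdjoinRoot.root F) = y :=
  AdjoinRoot.lift_root (i := evalRingHom w) (a := y) h

theorem curveEval_mk {F : Λ[X][X]} {w y : Λ} (h : F.eval₂ (evalRingHom w) y = 0) (P : Λ[X][X]) :
    curveEval h (AdjoinRoot.mk F P) = P.eval₂ (evalRingHom w) y :=
  AdjoinRoot.lift_mk (i := evalRingHom w) (a := y) h P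

variable {F : Λ[X][X]}

theorem dvd_algebraMap_norm {R S : Type*} [CommRing R] [CommRing S] [Algebra R S]
    [Module.Free R S] [Module.Finite R S] (x : S) : x ∣ algebraMap R S (Algebra.norm R x) := by
  have h1 := LinearMap.aeval_self_charpoly (Algebra.lmul R S x)
  have h2 := LinearMap.det_eq_sign_charpoly_coeff (Algebra.lmul R S x)
  rw [Algebra.norm_apply]
  change x ∣ algebraMap R S (LinearMap.det (Algebra.lmul R S x))
  rw [h2, map_mul]
  refine Dvd.dvd.mul_left ?_ _
  rw [Polynomial.aeval_algHom_apply, ← Polynomial.divX_mul_X_add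
    (LinearMap.charpoly (Algebra.lmul R S x))] at h1
  have h3 := DFunLike.congr_fun h1 1
  simp only [map_add, map_mul, aeval_X, aeval_C, Module.End.mul_apply, LinearMap.add_apply,
    Algebra.coe_lmul_eq_mul, LinearMap.mul_apply', mul_one, LinearMap.zero_apply] at h3
  rw [Algebra.coe_lmul_eq_mul, ← neg_eq_of_add_eq_zero_right h3, dvd_neg]
  exact dvd_mul_left _ _

theorem norm_adjoinRoot_ne_zero (hF : F.Monic) (hirr : Irreducible F) {G : AdjoinRoot F}
    (hG : G ≠ 0) : Algebra.norm Λ[X] G ≠ 0 := by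
  have := AdjoinRoot.isDomain_of_prime hirr.prime
  have := hF.free_adjoinRoot
  have := hF.finite_adjoinRoot
  exact Algebra.norm_ne_zero_iff.2 hG

theorem card_points_le_natDegree_norm (hF : F.Monic) (hirr : Irreducible F) {G : AdjoinRoot F}
    (hG : G ≠ 0) (P : Finset (Λ × Λ))
    (hP : ∀ x ∈ P, ∃ h : F.eval₂ (evalRingHom x.1) x.2 = 0, curveEval h G = 0) :
    P.card ≤ (Algebra.norm Λ[X] G).natDegree := by
  classical
  have := AdjoinRoot.isDomain_of_prime hirr.prime
  rw [← finrank_quotient_span_eq_natDegree_norm (AdjoinRoot.powerBasis' hF).basis hG]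
  have : FiniteDimensional Λ (AdjoinRoot F ⧸ Ideal.span {G}) := by
    have := Ideal.span_singleton_eq_bot.not.2 hG
    exact Module.Finite.equiv (Ideal.quotientEquivDirectSum Λ
      (AdjoinRoot.powerBasis' hF).basis this).symm
  refine le_trans ?_ (card_algHom_le_finrank Λ (AdjoinRoot F ⧸ Ideal.span {G}) Λ)
  rw [← Nat.card_eq_finsetCard]
  refine Nat.card_le_card_of_injective (fun x : P => Ideal.Quotient.liftₐ (Ideal.span {G})
    (curveEval (hP x x.2).choose) (fun a ha => by
      obtain ⟨b, rfl⟩ := Ideal.mem_span_singleton.1 ha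
      rw [map_mul, (hP x x.2).choose_spec, zero_mul])) ?_
  intro x x' hxx
  have key : ∀ a, curveEval (hP x x.2).choose a = curveEval (hP x' x'.2).choose a := fun a => by
    exact DFunLike.congr_fun hxx (Ideal.Quotient.mk _ a)
  have h1 := key (AdjoinRoot.of F X)
  have h2 := key (AdjoinRoot.root F)
  simp at h1 h2
  exact Subtype.ext (Prod.ext h1 h2)

theorem exists_powerSeries_param (hF : F.Monic) (hirr : Irreducible F) {w₀ y₀ : Λ}
    (h0 : F.eval₂ (evalRingHom w₀) y₀ = 0)
    (h1 : (derivative F).eval₂ (evalRingHom w₀) y₀ ≠ 0) :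
    ∃ ι : AdjoinRoot F →ₐ[Λ] PowerSeries Λ, Function.Injective ι ∧
      ∀ (s : AdjoinRoot F) (n : ℕ), s ≠ 0 → (PowerSeries.X : PowerSeries Λ) ^ n ∣ ι s →
        n ≤ (Algebra.norm Λ[X] s).natDegree := by
  classical
  have := AdjoinRoot.isDomain_of_prime hirr.prime
  set φ : Λ[X] →+* PowerSeries Λ :=
    (Polynomial.coeToPowerSeries.ringHom).comp (taylorAlgHom w₀ : Λ[X] →ₐ[Λ] Λ[X]) with hφ
  have hφC : ∀ a : Λ[X], PowerSeries.constantCoeff (φ a) = a.eval w₀ := fun a => by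
    simp only [hφ, RingHom.comp_apply, RingHom.coe_coe,
      coeToPowerSeries.ringHom_apply]
    rw [← PowerSeries.coeff_zero_eq_constantCoeff_apply, Polynomial.coeff_coe]
    exact taylor_coeff_zero w₀ a
  have hev : ∀ P : Λ[X][X], PowerSeries.constantCoeff ((P.map φ).eval (PowerSeries.C y₀)) =
      P.eval₂ (evalRingHom w₀) y₀ := fun P => by
    rw [eval_map, hom_eval₂]
    congr 1
    ext <;> simp [hφC]
  obtain ⟨a, ha, ha0⟩ := HenselianRing.is_henselian (I := Ideal.span {(PowerSeries.X : PowerSeries Λ)})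
    (F.map φ) (hF.map φ) (PowerSeries.C y₀) (by
      rw [Ideal.mem_span_singleton, PowerSeries.X_dvd_iff, hev, h0]) (by
      refine IsUnit.map _ ?_
      rw [PowerSeries.isUnit_iff_constantCoeff, derivative_map, hev]
      exact isUnit_iff_ne_zero.2 h1)
  obtain ⟨ι, hιof⟩ : ∃ ι : AdjoinRoot F →ₐ[Λ] PowerSeries Λ,
      ∀ b, ι (AdjoinRoot.of F b) = φ b := by
    have hl : F.eval₂ φ a = 0 := by rw [← eval_map]; exact ha
    refine ⟨{ AdjoinRoot.lift φ a hl with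
      commutes' := fun r => ?_ }, fun b => AdjoinRoot.lift_of (i := φ) (a := a) hl⟩
    refine (AdjoinRoot.lift_of (i := φ) (a := a) (x := C r) hl).trans ?_
    change ((taylor w₀ (C r) : Λ[X]) : PowerSeries Λ) = PowerSeries.C r
    rw [taylor_C, Polynomial.coe_C]
  have key : ∀ (s : AdjoinRoot F) (n : ℕ), s ≠ 0 → (PowerSeries.X : PowerSeries Λ) ^ n ∣ ι s →
        n ≤ (Algebra.norm Λ[X] s).natDegree := by
    intro s n hs hdvd
    have := hF.free_adjoinRoot
    have := hF.finite_adjoinRoot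
    have hN := norm_adjoinRoot_ne_zero hF hirr hs
    have h2 : ι s ∣ φ (Algebra.norm Λ[X] s) := by
      rw [← hιof]
      exact map_dvd ι (dvd_algebraMap_norm (R := Λ[X]) s)
    by_contra! hlt
    apply hN
    have h3 : taylor w₀ (Algebra.norm Λ[X] s) = 0 := by
      ext m
      by_cases hm : m < n
      · have := PowerSeries.X_pow_dvd_iff.1 (hdvd.trans h2) m hm
        simpa [hφ] using this
      · rw [coeff_zero]
        apply coeff_eq_zero_of_natDegree_lt
        rw [natDegree_taylor]; lia
    exact taylor_injective w₀ (by rw [h3, map_zero])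
  refine ⟨ι, ?_, key⟩
  rw [injective_iff_map_eq_zero]
  intro s hs
  by_contra hne
  have := key s ((Algebra.norm Λ[X] s).natDegree + 1) hne (by simp [hs])
  lia

end

section

open Polynomial

variable {Λ : Type*} [Field Λ] {F : Λ[X][X]}

/-- The monomial `x ^ a * y ^ b` in the coordinate ring. -/
noncomputable def curveMono (F : Λ[X][X]) (i : ℕ × Fin F.natDegree) : AdjoinRoot F :=
  AdjoinRoot.of F (X ^ i.1) * AdjoinRoot.root F ^ (i.2 : ℕ)

theorem linearIndependent_curveMono (hF : F.Monic) : LinearIndependent Λ (curveMono F) := by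
  have h := ((Polynomial.basisMonomials Λ).smulTower (AdjoinRoot.powerBasis' hF).basis).linearIndependent
  have h2 : curveMono F = ((Polynomial.basisMonomials Λ).smulTower
      (AdjoinRoot.powerBasis' hF).basis) := by
    funext i
    refine Eq.trans ?_ (Module.Basis.smulTower_apply (Polynomial.basisMonomials Λ)
      (AdjoinRoot.powerBasis' hF).basis i).symm
    rw [PowerBasis.coe_basis, coe_basisMonomials, Algebra.smul_def]
    change _ = AdjoinRoot.of F (monomial i.1 1) * AdjoinRoot.root F ^ (i.2 : ℕ)
    rw [monomial_one_right_eq_X_pow]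
    rfl
  rw [h2]
  exact h

theorem curveMono_mem {c n : ℕ} (i : ℕ × Fin F.natDegree) (h : i.1 + c * F.natDegree ≤ n) :
    curveMono F i ∈ ((DegFilt.deg Λ).adj c F).D n := by
  have h1 : (X ^ i.1 : Λ[X]) ∈ (DegFilt.deg Λ).D (i.1 : ℕ) :=
    DegFilt.mem_deg_nat.2 (natDegree_X_pow_le _)
  have h2 := ((DegFilt.deg Λ).adj c F).mul_mem (DegFilt.of_mem_adj (c := c) (F := F) h1)
    (((DegFilt.deg Λ).adj c F).pow_mem (DegFilt.root_mem_adj (𝒟 := DegFilt.deg Λ) (c := c)) i.2)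
  refine ((DegFilt.deg Λ).adj c F).mono ?_ h2
  have h3 : (i.2 : ℕ) * c ≤ c * F.natDegree := by
    rw [mul_comm]; exact Nat.mul_le_mul_left _ i.2.2.le
  zify at h3 h
  lia

theorem coeff_modByMonicHom_of_le {S : Type*} [CommRing S] [Nontrivial S] {F : S[X]}
    (hF : F.Monic) (f : AdjoinRoot F) {i : ℕ} (hi : F.natDegree ≤ i) :
    (AdjoinRoot.modByMonicHom hF f).coeff i = 0 := by
  obtain ⟨P, rfl⟩ := AdjoinRoot.mk_surjective f
  rw [AdjoinRoot.modByMonicHom_mk]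
  apply coeff_eq_zero_of_degree_lt
  exact (degree_modByMonic_lt P hF).trans_le (degree_le_natDegree.trans (by exact_mod_cast hi))

theorem algebraMap_mem_adj {c : ℤ} (a : Λ) :
    algebraMap Λ (AdjoinRoot F) a ∈ ((DegFilt.deg Λ).adj c F).D 0 :=
  DegFilt.of_mem_adj (c := c) (F := F)
    (DegFilt.mem_deg_nat (n := 0).2 (natDegree_C a).le : (C a : Λ[X]) ∈ (DegFilt.deg Λ).D (0 : ℕ))

theorem card_fin_coords {c : ℕ} (hF : F.Monic) (hFc : (DegFilt.deg Λ).Good c F)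
    {H : (AdjoinRoot F)[X]} (hH : H.Monic) (hHc : ((DegFilt.deg Λ).adj c F).Good c H)
    (hnt : Nontrivial (AdjoinRoot F)) (n : ℕ) {ι : Type*} [Fintype ι] (v : ι → AdjoinRoot H)
    (hv : ∀ i, v i ∈ (((DegFilt.deg Λ).adj c F).adj c H).D n)
    (hcard : H.natDegree * (F.natDegree * (n + 1)) < Fintype.card ι) :
    ∃ z : ι → Λ, z ≠ 0 ∧ ∑ i, algebraMap Λ (AdjoinRoot H) (z i) * v i = 0 := by
  classical
  let T := Fin H.natDegree × (Fin F.natDegree × Fin (n + 1))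
  let co : AdjoinRoot H → T → Λ := fun f t =>
    (((AdjoinRoot.modByMonicHom hF) ((AdjoinRoot.modByMonicHom hH f).coeff t.1)).coeff t.2.1).coeff
      t.2.2
  have hadd : ∀ f g, co (f + g) = co f + co g := fun f g => by
    funext t; simp [co]
  have hsmul : ∀ (a : Λ) f, co (algebraMap Λ (AdjoinRoot H) a * f) = a • co f := fun a f => by
    funext t
    have h1 : algebraMap Λ (AdjoinRoot H) a * f = (AdjoinRoot.of F (C a)) • f := by
      rw [Algebra.smul_def]; rfl
    have h2 : ∀ g : AdjoinRoot F, (AdjoinRoot.of F (C a)) • g = (C a : Λ[X]) • g := fun g => by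
      rw [Algebra.smul_def (C a : Λ[X]), smul_eq_mul]; rfl
    simp only [co, h1, map_smul, coeff_smul, h2, smul_eq_mul, coeff_C_mul, Pi.smul_apply]
  let L : (ι → Λ) →ₗ[Λ] (T → Λ) :=
    { toFun := fun z => ∑ i, z i • co (v i)
      map_add' := fun z z' => by simp [add_smul, Finset.sum_add_distrib]
      map_smul' := fun a z => by simp [Finset.smul_sum, smul_smul] }
  have hker : LinearMap.ker L ≠ ⊥ := by
    apply LinearMap.ker_ne_bot_of_finrank_lt
    simpa [T] using hcard
  obtain ⟨z, hz, hz0⟩ := Submodule.exists_mem_ne_zero_of_ne_bot hker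
  refine ⟨z, hz0, ?_⟩
  set f := ∑ i, algebraMap Λ (AdjoinRoot H) (z i) * v i with hf
  have hcof : co f = 0 := by
    have hco0 : co 0 = 0 := by simpa using hadd 0 0
    let coH : AdjoinRoot H →+ (T → Λ) := ⟨⟨co, hco0⟩, hadd⟩
    have : co f = coH (∑ i, algebraMap Λ (AdjoinRoot H) (z i) * v i) := rfl
    rw [this, map_sum]
    simp only [coH, AddMonoidHom.coe_mk, ZeroHom.coe_mk, hsmul]
    exact hz
  have hfm : f ∈ (((DegFilt.deg Λ).adj c F).adj c H).D n := by
    refine sum_mem fun i _ => ?_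
    have h1 := (((DegFilt.deg Λ).adj c F).adj c H).mul_mem
      (DegFilt.of_mem_adj (c := c) (F := H) (algebraMap_mem_adj (c := c) (F := F) (z i))) (hv i)
    rwa [zero_add] at h1
  rw [DegFilt.mem_adj_iff hH hHc] at hfm
  have key : AdjoinRoot.modByMonicHom hH f = 0 := by
    ext j
    rw [coeff_zero]
    by_cases hj : j < H.natDegree
    · have h1 := (DegFilt.mem_adj_iff hF hFc).1 (hfm j)
      have h2 : AdjoinRoot.modByMonicHom hF ((AdjoinRoot.modByMonicHom hH f).coeff j) = 0 := by
        ext i k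
        rw [coeff_zero, coeff_zero]
        by_cases hi : i < F.natDegree
        · by_cases hk : k < n + 1
          · exact congrFun hcof (⟨j, hj⟩, ⟨i, hi⟩, ⟨k, hk⟩)
          · refine h1 i k ?_
            have : (0 : ℤ) ≤ c * j := by positivity
            have : (0 : ℤ) ≤ c * i := by positivity
            lia
        · rw [coeff_modByMonicHom_of_le hF _ (not_lt.1 hi), coeff_zero]
      rw [← AdjoinRoot.mk_leftInverse hF ((AdjoinRoot.modByMonicHom hH f).coeff j), h2, map_zero]
    · exact coeff_modByMonicHom_of_le hH _ (not_lt.1 hj)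
  rw [← AdjoinRoot.mk_leftInverse hH f, key, map_zero]

theorem stepanov_aux {p : ℕ} [Fact p.Prime] [CharP Λ p] [IsAlgClosed Λ] {c : ℕ} (hF : F.Monic)
    (hirr : Irreducible F) (hFc : (DegFilt.deg Λ).Good c F) {w₀ y₀ : Λ}
    (h0 : F.eval₂ (evalRingHom w₀) y₀ = 0)
    (h1 : (derivative F).eval₂ (evalRingHom w₀) y₀ ≠ 0)
    {H : (AdjoinRoot F)[X]} (hH : H.Monic) (hHc : ((DegFilt.deg Λ).adj c F).Good c H)
    (τ : Λ) (μ l m A M : ℕ) (hl : F.natDegree * l < p ^ μ)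
    (hA : A + c * F.natDegree ≤ l + 1) (hM : M + c * F.natDegree ≤ m + 1)
    (hAM : H.natDegree * (F.natDegree * (l * p ^ μ + m + 1)) <
      (A * F.natDegree) * (M * F.natDegree))
    (P : Finset (Λ × Λ))
    (hP : ∀ x ∈ P, ∃ h : F.eval₂ (evalRingHom x.1) x.2 = 0,
      x.1 ^ (p ^ μ) ^ 2 = x.1 + τ ∧
      H.eval₂ (curveEval h : AdjoinRoot F →+* Λ) (x.2 ^ (p ^ μ) ^ 2) = 0) :
    P.card ≤ F.natDegree * (l + m * p ^ μ) := by
  classical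
  have hdom := AdjoinRoot.isDomain_of_prime hirr.prime
  set Q := p ^ μ with hQ
  have hQ0 : 0 < Q := pow_pos (Fact.out : p.Prime).pos _
  have hchR : CharP (AdjoinRoot F) p :=
    charP_of_injective_algebraMap (algebraMap Λ (AdjoinRoot F)).injective p
  let ιA := Fin A × Fin F.natDegree
  let ιM := Fin M × Fin F.natDegree
  let mA : ιA → AdjoinRoot F := fun i => curveMono F (i.1, i.2)
  let mM : ιM → AdjoinRoot F := fun i => curveMono F (i.1, i.2)
  let oR : AdjoinRoot F →+* AdjoinRoot H := AdjoinRoot.of H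
  let mM' : ιM → AdjoinRoot H := fun i =>
    oR (AdjoinRoot.of F ((X + C τ) ^ (i.1 : ℕ))) * AdjoinRoot.root H ^ (i.2 : ℕ)
  have hmA : ∀ i, mA i ∈ ((DegFilt.deg Λ).adj c F).D l := fun i =>
    curveMono_mem _ (by have := i.1.2; simp only; lia)
  have hmM : ∀ i, mM i ∈ ((DegFilt.deg Λ).adj c F).D m := fun i =>
    curveMono_mem _ (by have := i.1.2; simp only; lia)
  have hmM' : ∀ i, mM' i ∈ (((DegFilt.deg Λ).adj c F).adj c H).D m := fun i => by
    have h1 : ((X + C τ) ^ (i.1 : ℕ) : Λ[X]) ∈ (DegFilt.deg Λ).D (i.1 : ℕ) :=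
      DegFilt.mem_deg_nat.2 ((natDegree_pow_le).trans (by simp))
    have h2 := (((DegFilt.deg Λ).adj c F).adj c H).mul_mem
      (DegFilt.of_mem_adj (c := c) (F := H) (DegFilt.of_mem_adj (c := c) (F := F) h1))
      ((((DegFilt.deg Λ).adj c F).adj c H).pow_mem
        (DegFilt.root_mem_adj (𝒟 := (DegFilt.deg Λ).adj c F) (c := c)) i.2)
    refine (((DegFilt.deg Λ).adj c F).adj c H).mono ?_ h2
    have h3 : (i.2 : ℕ) * c ≤ c * F.natDegree := by
      rw [mul_comm]; exact Nat.mul_le_mul_left _ i.2.2.le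
    have := i.1.2
    zify at h3 hM this
    lia
  obtain ⟨z, hz0, hz⟩ := card_fin_coords hF hFc hH hHc inferInstance (l * Q + m)
    (ι := ιA × ιM) (fun i => oR (mA i.1 ^ Q) * mM' i.2) (fun i => by
      have h2 := (((DegFilt.deg Λ).adj c F).adj c H).mul_mem
        (DegFilt.of_mem_adj (c := c) (F := H) (((DegFilt.deg Λ).adj c F).pow_mem (hmA i.1) Q))
        (hmM' i.2)
      convert h2 using 2
      push_cast; ring) (by simpa [ιA, ιM] using hAM)
  choose r hr using fun a : Λ => IsAlgClosed.exists_pow_nat_eq a hQ0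
  let s : ιM → AdjoinRoot F := fun j => ∑ i, (r (z (i, j))) • mA i
  have hs : ∀ j, s j ∈ ((DegFilt.deg Λ).adj c F).D l := fun j => by
    refine sum_mem fun i _ => ?_
    have h1 := ((DegFilt.deg Λ).adj c F).mul_mem (algebraMap_mem_adj (r (z (i, j)))) (hmA i)
    rwa [zero_add, ← Algebra.smul_def] at h1
  set G : AdjoinRoot F := ∑ j, s j * mM j ^ Q with hG
  have hGm : G ∈ ((DegFilt.deg Λ).adj c F).D ((l + m * Q : ℕ) : ℤ) := by
    refine sum_mem fun j _ => ?_
    have := ((DegFilt.deg Λ).adj c F).mul_mem (hs j) (((DegFilt.deg Λ).adj c F).pow_mem (hmM j) Q)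
    convert this using 2
    push_cast; ring
  have hLI := linearIndependent_curveMono hF
  have hG0 : G ≠ 0 := by
    intro hGz
    obtain ⟨ι, hinj, hord⟩ := exists_powerSeries_param hF hirr h0 h1
    let V : Submodule Λ (PowerSeries Λ) := Submodule.map ι.toLinearMap
      { carrier := ((DegFilt.deg Λ).adj c F).D l
        add_mem' := add_mem
        zero_mem' := zero_mem _
        smul_mem' := fun a x hx => by
          have h1 := ((DegFilt.deg Λ).adj c F).mul_mem (algebraMap_mem_adj a) hx
          rwa [zero_add, ← Algebra.smul_def] at h1 }
    have hsz : ∀ j, ι (s j) = 0 := fun j => by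
      refine powerSeries_frob_indep μ V ?_ _ Finset.univ (fun j => ι (mM j)) (fun j => ι (s j)) rfl
        ?_ (fun j _ => ⟨s j, hs j, rfl⟩) ?_ j (Finset.mem_univ _)
      · rintro _ ⟨x, hx, rfl⟩ hdvd
        by_cases hx0 : x = 0
        · rw [hx0, map_zero]
        exfalso
        have h3 := hord x _ hx0 hdvd
        have h4 := DegFilt.norm_mem hF hFc hx
        have h5 := (DegFilt.mem_deg_nat (n := F.natDegree * l)).1 (by exact_mod_cast h4)
        lia
      · intro g hg j _
        have h3 : ∑ j, g j • mM j = 0 := by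
          apply hinj
          simpa using hg
        have h4 : LinearIndependent Λ mM := hLI.comp (fun i : ιM => ((i.1 : ℕ), i.2))
          (fun a b hab => by
            simp only [Prod.mk.injEq, Fin.val_inj] at hab
            exact Prod.ext hab.1 hab.2)
        exact Fintype.linearIndependent_iff.1 h4 g h3 j
      · have := congrArg ι hGz
        simpa [hG] using this
    apply hz0
    funext ij
    have h3 : s ij.2 = 0 := hinj (by rw [hsz, map_zero])
    have h4 : LinearIndependent Λ mA := hLI.comp (fun i : ιA => ((i.1 : ℕ), i.2))
      (fun a b hab => by
            simp only [Prod.mk.injEq, Fin.val_inj] at hab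
            exact Prod.ext hab.1 hab.2)
    have h5 := Fintype.linearIndependent_iff.1 h4 (fun i => r (z (i, ij.2))) h3 ij.1
    rw [← hr (z ij)]
    rw [h5, zero_pow hQ0.ne']; rfl
  have hfin := card_points_le_natDegree_norm hF hirr hG0 P (fun x hx => by
    obtain ⟨h, hw, hHx⟩ := hP x hx
    refine ⟨h, ?_⟩
    have h3 : (curveEval h G) ^ Q = 0 := by
      let ev2 : AdjoinRoot H →+* Λ := AdjoinRoot.lift (curveEval h : AdjoinRoot F →+* Λ) _ hHx
      have hev2o : ∀ a, ev2 (oR a) = curveEval h a := fun a => AdjoinRoot.lift_of hHx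
      have hev2r : ev2 (AdjoinRoot.root H) = x.2 ^ Q ^ 2 := AdjoinRoot.lift_root hHx
      have hev2a : ∀ a : Λ, ev2 (algebraMap Λ _ a) = a := fun a => by
        have : algebraMap Λ (AdjoinRoot H) a = oR (AdjoinRoot.of F (C a)) := rfl
        rw [this, hev2o]; simp
      rw [← map_zero ev2, ← hz, hG]
      simp only [map_sum, map_mul, map_pow, hev2a, hev2o, s, hQ]
      rw [sum_pow_char_pow]
      refine Eq.trans ?_ (Fintype.sum_prod_type_right (α₁ := ιA) (α₂ := ιM) _).symm
      refine Finset.sum_congr rfl fun j _ => ?_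
      rw [mul_pow, sum_pow_char_pow, Finset.sum_mul]
      refine Finset.sum_congr rfl fun i _ => ?_
      simp only [← hQ, mM', map_mul, map_pow, hev2o, hev2r, mM, curveMono, curveEval_of,
        curveEval_root, map_smul, smul_eq_mul, eval_add, eval_X, eval_C, ← hw, mul_pow,
        hr]
      ring
    exact pow_eq_zero_iff hQ0.ne' |>.1 h3)
  refine hfin.trans ?_
  have h4 := DegFilt.norm_mem hF hFc hGm
  exact (DegFilt.mem_deg_nat (n := F.natDegree * (l + m * Q))).1 (by exact_mod_cast h4)

end

section

open Polynomial

variable {Λ : Type*} [Field Λ] {F : Λ[X][X]}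

theorem stepanov {p : ℕ} [Fact p.Prime] [CharP Λ p] [IsAlgClosed Λ] {c : ℕ} (hF : F.Monic)
    (hirr : Irreducible F) (hFc : (DegFilt.deg Λ).Good c F) {w₀ y₀ : Λ}
    (h0 : F.eval₂ (evalRingHom w₀) y₀ = 0)
    (h1 : (derivative F).eval₂ (evalRingHom w₀) y₀ ≠ 0)
    {H : (AdjoinRoot F)[X]} (hH : H.Monic) (hHc : ((DegFilt.deg Λ).adj c F).Good c H)
    (hH0 : 0 < H.natDegree) :
    ∃ C μ₀ : ℕ, ∀ (τ : Λ) (μ : ℕ), μ₀ ≤ μ → ∀ P : Finset (Λ × Λ),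
      (∀ x ∈ P, ∃ h : F.eval₂ (evalRingHom x.1) x.2 = 0,
        x.1 ^ (p ^ μ) ^ 2 = x.1 + τ ∧
        H.eval₂ (curveEval h : AdjoinRoot F →+* Λ) (x.2 ^ (p ^ μ) ^ 2) = 0) →
      P.card ≤ H.natDegree * (p ^ μ) ^ 2 + C * p ^ μ := by
  have he : 0 < F.natDegree := by
    by_contra hn
    have : F = 1 := hF.natDegree_eq_zero.1 (by lia)
    exact hirr.1 (this ▸ isUnit_one)
  set e := F.natDegree with hedef
  set h := H.natDegree with hhdef
  obtain ⟨κ, hκ⟩ : ∃ κ, κ = c * e + h := ⟨_, rfl⟩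
  refine ⟨1 + h * e * (κ + 1) + c * e ^ 2, e * (κ * (c * e ^ 2 + h) + c * e + 1), ?_⟩
  intro τ μ hμ P hP
  have hQ : e * (κ * (c * e ^ 2 + h) + c * e + 1) < p ^ μ :=
    hμ.trans_lt (Nat.lt_pow_self (Fact.out : p.Prime).one_lt)
  set Q := p ^ μ with hQdef
  obtain ⟨l, hl1, hl2⟩ : ∃ l, e * l + 1 ≤ Q ∧ Q ≤ e * (l + 1) := by
    refine ⟨(Q - 1) / e, ?_, ?_⟩
    · have := Nat.mul_div_le (Q - 1) e
      lia
    · have := Nat.lt_mul_div_succ (Q - 1) he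
      lia
  have ht : κ * (c * e ^ 2 + h) + c * e + 1 < l + 1 := by
    by_contra hcon
    have := Nat.mul_le_mul_left e (not_lt.1 hcon)
    lia
  obtain ⟨A, hA⟩ : ∃ A, A + c * e = l + 1 := ⟨l + 1 - c * e, by
    have : c * e ≤ l + 1 := by lia
    lia⟩
  obtain ⟨m, hm⟩ : ∃ m, h * (l + κ + 1) + c * e = m + 1 := ⟨h * (l + κ + 1) + c * e - 1, by
    have : 0 < h * (l + κ + 1) := by positivity
    lia⟩
  have key := stepanov_aux hF hirr hFc h0 h1 hH hHc τ μ l m A (h * (l + κ + 1)) (by lia)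
    (by lia) (by lia) (by
      rw [← hedef, ← hhdef, ← hQdef]
      have e1 : h * (e * (l * Q + m + 1)) ≤
          h * (e * (e * l * (l + 1) + (h * (l + κ + 1) + c * e))) := by
        have : l * Q + m + 1 ≤ e * l * (l + 1) + (h * (l + κ + 1) + c * e) := by
          have := Nat.mul_le_mul_left l hl2
          nlinarith
        gcongr
      refine e1.trans_lt ?_
      have e2 : A * e * (h * (l + κ + 1) * e) = h * (e * (e * (A * (l + κ + 1)))) := by ring
      rw [e2]
      refine Nat.mul_lt_mul_of_pos_left (Nat.mul_lt_mul_of_pos_left ?_ he) hH0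
      zify at hA hκ ht ⊢
      have hA' : (A : ℤ) = l + 1 - c * e := by lia
      rw [hA']
      have he' : (1 : ℤ) ≤ e := by exact_mod_cast he
      have hh' : (1 : ℤ) ≤ h := by exact_mod_cast hH0
      have hc' : (0 : ℤ) ≤ c := by positivity
      have h3 : (0 : ℤ) ≤ (l + 1) * ((e - 1) * (h + 1)) := by
        have : (0:ℤ) ≤ l := by positivity
        have := sub_nonneg.2 he'
        positivity
      have hh4 : (e : ℤ) * ((l + 1 - c * e) * (l + κ + 1)) -
          (e * l * (l + 1) + (h * (l + κ + 1) + c * e)) =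
          (l + 1) * ((e - 1) * (h + 1)) + ((l + 1) - (κ * (c * e ^ 2 + h) + c * e)) +
           e * (l + 1) * (κ - c * e - h) := by ring
      rw [hκ] at *
      have : (e : ℤ) * (l + 1) * (c * e + h - c * e - h) = 0 := by ring
      lia) P hP
  refine key.trans ?_
  rw [← hedef, ← hQdef]
  have e3 : e * (l + (m + 1) * Q) ≤ h * Q ^ 2 + (1 + h * e * (κ + 1) + c * e ^ 2) * Q := by
    rw [← hm]
    nlinarith [Nat.mul_le_mul_left (h * Q) hl1]
  refine le_trans ?_ e3
  gcongr
  lia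

end

section

open Polynomial

variable {Λ : Type*} [Field Λ] {F : Λ[X][X]}

theorem good_X_sub_C_root {c : ℕ} (hirr : Irreducible F) :
    ((DegFilt.deg Λ).adj c F).Good c (X - C (AdjoinRoot.root F)) := by
  have := AdjoinRoot.isDomain_of_prime hirr.prime
  unfold DegFilt.Good
  rw [natDegree_X_sub_C]
  refine AddSubgroup.sub_mem _ ?_ ?_
  · simpa using ((DegFilt.deg Λ).adj c F).X_mem_poly (c := c)
  · refine DegFilt.C_mem_poly _ ?_
    simpa using (DegFilt.deg Λ).root_mem_adj (c := c) (F := F)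

theorem curveEval_of_comp {w y : Λ} (h : F.eval₂ (evalRingHom w) y = 0) :
    (curveEval h : AdjoinRoot F →+* Λ).comp (AdjoinRoot.of F) = evalRingHom w :=
  RingHom.ext fun a => by simp

theorem exists_quotient_good {c : ℕ} (hF : F.Monic) (hirr : Irreducible F)
    (hFc : (DegFilt.deg Λ).Good c F) :
    ∃ H : (AdjoinRoot F)[X], H.Monic ∧ ((DegFilt.deg Λ).adj c F).Good c H ∧
      H.natDegree = F.natDegree - 1 ∧
      (X - C (AdjoinRoot.root F)) * H = F.map (AdjoinRoot.of F) := by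
  have := AdjoinRoot.isDomain_of_prime hirr.prime
  have hm : (X - C (AdjoinRoot.root F)).Monic := monic_X_sub_C _
  have hr : (F.map (AdjoinRoot.of F)).IsRoot (AdjoinRoot.root F) := by
    rw [IsRoot, eval_map]; exact AdjoinRoot.eval₂_root F
  have hmul := mul_divByMonic_eq_iff_isRoot.2 hr
  have hFm := hF.map (AdjoinRoot.of F)
  have hdeg : (F.map (AdjoinRoot.of F)).natDegree = F.natDegree := hF.natDegree_map _
  have hHdeg : (F.map (AdjoinRoot.of F) /ₘ (X - C (AdjoinRoot.root F))).natDegree =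
      F.natDegree - 1 := by
    rw [natDegree_divByMonic _ hm, hdeg, natDegree_X_sub_C]
  refine ⟨F.map (AdjoinRoot.of F) /ₘ (X - C (AdjoinRoot.root F)), ?_, ?_, hHdeg, hmul⟩
  · exact hm.of_mul_monic_left (by rw [hmul]; exact hFm)
  · unfold DegFilt.Good
    rw [hHdeg, DegFilt.mem_poly]
    intro i
    rw [coeff_divByMonic_X_sub_C, hdeg]
    refine AddSubgroup.sum_mem _ fun k hk => ?_
    rw [Finset.mem_Icc] at hk
    have h1 := ((DegFilt.deg Λ).adj c F).pow_mem ((DegFilt.deg Λ).root_mem_adj (c := c) (F := F)) (k - (i + 1))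
    have h2 := (DegFilt.deg Λ).of_mem_adj (c := c) (F := F) ((DegFilt.mem_poly _).1 hFc k)
    rw [coeff_map]
    have h3 := ((DegFilt.deg Λ).adj c F).mul_mem h1 h2
    convert h3 using 2
    obtain ⟨d, rfl⟩ := Nat.exists_eq_add_of_le hk.1
    obtain ⟨d', hd'⟩ := Nat.exists_eq_add_of_le hk.2
    rw [hd']
    have : i + 1 + d + d' - 1 = i + d + d' := by lia
    rw [this, Nat.add_sub_cancel_left]
    push_cast
    ring

theorem mk_derivative_ne_zero (hF : F.Monic) (he : (F.natDegree : Λ) ≠ 0) :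
    AdjoinRoot.mk F (derivative F) ≠ 0 := by
  rw [Ne, AdjoinRoot.mk_eq_zero]
  have h0 : F.natDegree ≠ 0 := fun h => he (by simp [h])
  have h1 : (derivative F).coeff (F.natDegree - 1) ≠ 0 := by
    rw [coeff_derivative, Nat.sub_add_cancel (by lia), hF.coeff_natDegree, one_mul,
      ← Nat.cast_succ, Nat.succ_eq_add_one, Nat.sub_add_cancel (by lia)]
    intro h
    apply he
    have := congrArg (evalRingHom (0 : Λ)) h
    simpa using this
  refine hF.not_dvd_of_natDegree_lt (fun h => h1 (by simp [h])) ?_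
  exact natDegree_derivative_lt h0

theorem exists_finite_bad (hF : F.Monic) (hirr : Irreducible F) (he : (F.natDegree : Λ) ≠ 0)
    [IsAlgClosed Λ] :
    ∃ D : ℕ, ∀ B : Finset Λ, (∀ w ∈ B, ∃ y, F.eval₂ (evalRingHom w) y = 0 ∧
      (derivative F).eval₂ (evalRingHom w) y = 0) → B.card ≤ D := by
  classical
  refine ⟨(Algebra.norm Λ[X] (AdjoinRoot.mk F (derivative F))).natDegree, fun B hB => ?_⟩
  choose! y hy1 hy2 using hB
  rw [← Finset.card_image_of_injective (f := fun w => (w, y w)) B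
    (fun a b h => (Prod.ext_iff.1 h).1)]
  refine card_points_le_natDegree_norm hF hirr (mk_derivative_ne_zero hF he) _ ?_
  intro x hx
  obtain ⟨w, hw, rfl⟩ := Finset.mem_image.1 hx
  exact ⟨hy1 w hw, by rw [curveEval_mk]; exact hy2 w hw⟩

theorem card_roots_toFinset_of_good [IsAlgClosed Λ] [DecidableEq Λ] (hF : F.Monic) {w : Λ}
    (h : ∀ y, F.eval₂ (evalRingHom w) y = 0 → (derivative F).eval₂ (evalRingHom w) y ≠ 0) :
    (F.map (evalRingHom w)).roots.toFinset.card = F.natDegree := by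
  have hm := hF.map (evalRingHom w)
  rw [Multiset.toFinset_card_of_nodup, splits_iff_card_roots.1 (IsAlgClosed.splits _),
    hF.natDegree_map]
  rw [Multiset.nodup_iff_count_le_one]
  intro y
  rw [count_roots]
  by_contra! hlt
  obtain ⟨h1, h2⟩ := (one_lt_rootMultiplicity_iff_isRoot hm.ne_zero).1 hlt
  rw [IsRoot, eval_map] at h1
  rw [IsRoot, derivative_map, eval_map] at h2
  exact h y h1 h2

theorem card_fixed_points_approx {p : ℕ} [Fact p.Prime] [CharP Λ p] [IsAlgClosed Λ] {c : ℕ}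
    (hF : F.Monic) (hirr : Irreducible F) (hFc : (DegFilt.deg Λ).Good c F)
    (he2 : 2 ≤ F.natDegree) (he : (F.natDegree : Λ) ≠ 0) :
    ∃ C μ₀ : ℕ, ∀ (τ : Λ) (μ : ℕ), μ₀ ≤ μ → ∀ T : Finset Λ, T.card = (p ^ μ) ^ 2 →
      (∀ w ∈ T, w ^ (p ^ μ) ^ 2 = w + τ) →
      (∀ w ∈ T, ∀ y, F.eval₂ (evalRingHom w) y = 0 →
        F.eval₂ (evalRingHom w) (y ^ (p ^ μ) ^ 2) = 0) →
      ∀ A : Finset (Λ × Λ), (∀ x, x ∈ A ↔ x.1 ∈ T ∧ F.eval₂ (evalRingHom x.1) x.2 = 0 ∧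
        x.2 ^ (p ^ μ) ^ 2 = x.2) →
      A.card ≤ (p ^ μ) ^ 2 + C * p ^ μ ∧ (p ^ μ) ^ 2 ≤ A.card + C * p ^ μ := by
  classical
  have := AdjoinRoot.isDomain_of_prime hirr.prime
  obtain ⟨D, hD⟩ := exists_finite_bad hF hirr he
  obtain ⟨w₀, y₀, h0, h1⟩ : ∃ w₀ y₀, F.eval₂ (evalRingHom w₀) y₀ = 0 ∧
      (derivative F).eval₂ (evalRingHom w₀) y₀ ≠ 0 := by
    by_contra! hcon
    obtain ⟨B, hB⟩ := Infinite.exists_subset_card_eq Λ (D + 1)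
    have := hD B fun w _ => by
      obtain ⟨y, hy⟩ := IsAlgClosed.exists_root (F.map (evalRingHom w)) (by
        rw [hF.degree_map, degree_eq_natDegree hF.ne_zero]
        exact_mod_cast (by lia : F.natDegree ≠ 0))
      rw [IsRoot, eval_map] at hy
      exact ⟨y, hy, hcon _ _ hy⟩
    lia
  obtain ⟨H, hHm, hHg, hHd, hmul⟩ := exists_quotient_good hF hirr hFc
  obtain ⟨C₁, μ₁, hC₁⟩ := stepanov hF hirr hFc h0 h1 (monic_X_sub_C (AdjoinRoot.root F))
    (good_X_sub_C_root hirr) (by rw [natDegree_X_sub_C]; exact one_pos)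
  obtain ⟨C₂, μ₂, hC₂⟩ := stepanov hF hirr hFc h0 h1 hHm hHg (by lia)
  refine ⟨C₁ + C₂ + F.natDegree * D, max μ₁ μ₂, fun τ μ hμ T hT hT2 hT3 A hA => ?_⟩
  have hQ : 0 < p ^ μ := pow_pos (Fact.out : p.Prime).pos _
  have hA1 := hC₁ τ μ (by lia) A fun x hx => by
    obtain ⟨hx1, hx2, hx3⟩ := (hA x).1 hx
    refine ⟨hx2, hT2 _ hx1, ?_⟩
    simp [hx3]
  rw [natDegree_X_sub_C, one_mul] at hA1
  refine ⟨hA1.trans (by gcongr; lia), ?_⟩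
  let P : Finset (Λ × Λ) := T.biUnion fun w =>
    (F.map (evalRingHom w)).roots.toFinset.image fun y => (w, y)
  have hPmem : ∀ x, x ∈ P ↔ x.1 ∈ T ∧ F.eval₂ (evalRingHom x.1) x.2 = 0 := by
    rintro ⟨w, y⟩
    simp only [P, Finset.mem_biUnion, Finset.mem_image, Multiset.mem_toFinset,
      mem_roots (hF.map _).ne_zero, IsRoot, eval_map, Prod.mk.injEq]
    constructor
    · rintro ⟨w', hw', y', hy', rfl, rfl⟩; exact ⟨hw', hy'⟩
    · rintro ⟨h, h'⟩; exact ⟨w, h, y, h', rfl, rfl⟩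
  have hPA : (P \ A).card ≤ (F.natDegree - 1) * (p ^ μ) ^ 2 + C₂ * p ^ μ := by
    rw [← hHd]
    refine hC₂ τ μ (by lia) _ fun x hx => ?_
    obtain ⟨hx1, hx2⟩ := Finset.mem_sdiff.1 hx
    rw [hPmem] at hx1
    rw [hA] at hx2
    refine ⟨hx1.2, hT2 _ hx1.1, ?_⟩
    have h3 := hT3 _ hx1.1 _ hx1.2
    have h4 := congrArg (eval₂ (curveEval hx1.2 : AdjoinRoot F →+* Λ) (x.2 ^ (p ^ μ) ^ 2)) hmul
    rw [eval₂_map, curveEval_of_comp, h3, eval₂_mul] at h4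
    refine (mul_eq_zero.1 h4).resolve_left ?_
    simp only [eval₂_sub, eval₂_X, eval₂_C, RingHom.coe_coe, curveEval_root]
    intro h5
    exact hx2 ⟨hx1.1, hx1.2, sub_eq_zero.1 h5⟩
  have hP2 : P.card ≤ A.card + (P \ A).card := by
    refine (Finset.card_le_card (t := A ∪ (P \ A)) ?_).trans (Finset.card_union_le _ _)
    rw [Finset.union_sdiff_self_eq_union]; exact Finset.subset_union_right
  have hPc : F.natDegree * (p ^ μ) ^ 2 ≤ P.card + F.natDegree * D := by
    let B := T.filter fun w => ∃ y, F.eval₂ (evalRingHom w) y = 0 ∧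
      (derivative F).eval₂ (evalRingHom w) y = 0
    have hB : B.card ≤ D := hD B fun w hw => (Finset.mem_filter.1 hw).2
    have hP3 : P.card = ∑ w ∈ T, (F.map (evalRingHom w)).roots.toFinset.card := by
      rw [Finset.card_biUnion]
      · refine Finset.sum_congr rfl fun w _ => ?_
        rw [Finset.card_image_of_injective _ (fun a b h => (Prod.ext_iff.1 h).2)]
      · intro w _ w' _ hne
        rw [Function.onFun, Finset.disjoint_left]
        intro x hx hx'
        obtain ⟨_, _, rfl⟩ := Finset.mem_image.1 hx
        obtain ⟨_, _, h⟩ := Finset.mem_image.1 hx'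
        exact hne (Prod.ext_iff.1 h).1.symm
    have h6 : ∑ w ∈ T, F.natDegree ≤ ∑ w ∈ T, ((F.map (evalRingHom w)).roots.toFinset.card +
        if w ∈ B then F.natDegree else 0) := by
      refine Finset.sum_le_sum fun w hw => ?_
      split_ifs with hwB
      · lia
      · rw [card_roots_toFinset_of_good hF]
        · lia
        · intro y hy hy'
          exact hwB (Finset.mem_filter.2 ⟨hw, y, hy, hy'⟩)
    rw [Finset.sum_add_distrib, ← hP3, Finset.sum_const, ← Finset.sum_filter, Finset.sum_const,
      smul_eq_mul, smul_eq_mul, hT] at h6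
    have h7 : (T.filter (· ∈ B)).card ≤ B.card := by
      refine Finset.card_le_card fun w hw => (Finset.mem_filter.1 hw).2
    have h8 := Nat.mul_le_mul_right F.natDegree (h7.trans hB)
    lia
  have h9 : F.natDegree * (p ^ μ) ^ 2 = (F.natDegree - 1) * (p ^ μ) ^ 2 + (p ^ μ) ^ 2 := by
    obtain ⟨d, hd⟩ : ∃ d, F.natDegree = d + 1 := ⟨F.natDegree - 1, by lia⟩
    rw [hd, Nat.add_sub_cancel]; ring
  have h10 : F.natDegree * D ≤ F.natDegree * D * p ^ μ := Nat.le_mul_of_pos_right _ hQ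
  have h11 : (C₁ + C₂ + F.natDegree * D) * p ^ μ =
      C₁ * p ^ μ + C₂ * p ^ μ + F.natDegree * D * p ^ μ := by ring
  rw [h11]
  have h12 : 0 ≤ C₁ * p ^ μ := Nat.zero_le _
  lia

end

section

open Polynomial

variable (k : Type*) [Field k]

/-- The degree filtration on rational functions. -/
noncomputable def ratDeg : DegFilt (RatFunc k) where
  D n :=
    { carrier := {f | f = 0 ∨ f.intDegree ≤ n}
      zero_mem' := Or.inl rfl
      add_mem' := by
        rintro a b (rfl | ha) (rfl | hb)
        · left; simp
        · right; simpa using hb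
        · right; simpa using ha
        · by_cases hb0 : b = 0
          · right; simpa [hb0] using ha
          by_cases h : a + b = 0
          · exact Or.inl h
          · exact Or.inr ((RatFunc.intDegree_add_le hb0 h).trans (max_le ha hb))
      neg_mem' := by
        rintro a (rfl | ha)
        · left; simp
        · right; rwa [RatFunc.intDegree_neg] }
  mono := by
    rintro m n h a (rfl | ha)
    · exact Or.inl rfl
    · exact Or.inr (ha.trans h)
  one_mem := Or.inr (by simp)
  mul_mem := by
    rintro m n a b (rfl | ha) (rfl | hb)
    · left; simp
    · left; simp
    · left; simp
    · by_cases ha0 : a = 0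
      · left; simp [ha0]
      by_cases hb0 : b = 0
      · left; simp [hb0]
      right; rw [RatFunc.intDegree_mul ha0 hb0]; exact add_le_add ha hb

variable {k}

theorem mem_ratDeg {f : RatFunc k} {n : ℤ} : f ∈ (ratDeg k).D n ↔ f = 0 ∨ f.intDegree ≤ n := Iff.rfl

theorem algebraMap_mem_ratDeg {P : k[X]} {n : ℤ} :
    algebraMap k[X] (RatFunc k) P ∈ (ratDeg k).D n ↔ P = 0 ∨ (P.natDegree : ℤ) ≤ n := by
  rw [mem_ratDeg, RatFunc.intDegree_polynomial, map_eq_zero_iff _ (RatFunc.algebraMap_injective k)]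

theorem ratDeg_X_zpow (n : ℤ) : (RatFunc.X ^ n : RatFunc k) ∈ (ratDeg k).D n := by
  have hX : (RatFunc.X : RatFunc k) ≠ 0 := RatFunc.X_ne_zero
  have hn : ∀ m : ℕ, (RatFunc.X ^ m : RatFunc k).intDegree = m := by
    intro m
    rw [← RatFunc.algebraMap_X, ← map_pow, RatFunc.intDegree_polynomial, natDegree_X_pow]
  right
  rcases n with m | m
  · simp [hn]
  · rw [zpow_negSucc, RatFunc.intDegree_inv, hn]; rfl

theorem ratDeg_C (a : k) : algebraMap k (RatFunc k) a ∈ (ratDeg k).D 0 := by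
  right
  rw [RatFunc.algebraMap_eq_C, RatFunc.intDegree_C]

theorem exists_sub_C_mul_X_zpow {f : RatFunc k} {n : ℤ} (hf : f ∈ (ratDeg k).D n) :
    ∃ a : k, f - algebraMap k _ a * RatFunc.X ^ n ∈ (ratDeg k).D (n - 1) := by
  rcases hf with rfl | hf
  · exact ⟨0, by simp⟩
  rcases lt_or_eq_of_le hf with hlt | heq
  · exact ⟨0, by
      rw [map_zero, zero_mul, sub_zero]
      exact Or.inr (by omega : f.intDegree ≤ n - 1)⟩
  by_cases hf0 : f = 0
  · exact ⟨0, by simp [hf0]⟩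
  have hX : (RatFunc.X : RatFunc k) ≠ 0 := RatFunc.X_ne_zero
  set a := f.num.leadingCoeff / f.denom.leadingCoeff with ha
  have hnum : f.num ≠ 0 := RatFunc.num_ne_zero hf0
  have hden : f.denom ≠ 0 := f.denom_ne_zero
  have hdenR : algebraMap k[X] (RatFunc k) f.denom ≠ 0 := RatFunc.algebraMap_ne_zero hden
  have ha0 : a ≠ 0 := div_ne_zero (leadingCoeff_ne_zero.2 hnum) (leadingCoeff_ne_zero.2 hden)
  rw [RatFunc.intDegree] at heq
  -- write `n = i - j`
  let i := n.toNat
  let j := (-n).toNat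
  have hij : n = (i : ℤ) - j := by omega
  refine ⟨a, ?_⟩
  have h1 : f - algebraMap k _ a * RatFunc.X ^ n =
      algebraMap k[X] (RatFunc k) (f.num * X ^ j - C a * X ^ i * f.denom) *
        (algebraMap k[X] (RatFunc k) (f.denom * X ^ j))⁻¹ := by
    rw [← div_eq_mul_inv, eq_div_iff (RatFunc.algebraMap_ne_zero (mul_ne_zero hden (pow_ne_zero _ X_ne_zero)))]
    have hf' : algebraMap k[X] _ f.num = f * algebraMap k[X] _ f.denom := by
      conv_rhs => enter [1]; rw [← RatFunc.num_div_denom f]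
      rw [div_mul_cancel₀ _ hdenR]
    rw [hij, zpow_sub₀ hX, zpow_natCast, zpow_natCast]
    simp only [map_sub, map_mul, map_pow, RatFunc.algebraMap_X, RatFunc.algebraMap_C,
      RatFunc.algebraMap_eq_C, hf']
    field_simp
  have h2 : (algebraMap k[X] (RatFunc k) (f.denom * X ^ j))⁻¹ ∈
      (ratDeg k).D (-((f.denom.natDegree + j : ℕ) : ℤ)) := by
    right
    rw [RatFunc.intDegree_inv, RatFunc.intDegree_polynomial, natDegree_mul hden (pow_ne_zero _ X_ne_zero),
      natDegree_X_pow]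
  have hdeg : f.num.natDegree + j = f.denom.natDegree + i := by omega
  have h3 : algebraMap k[X] (RatFunc k) (f.num * X ^ j - C a * X ^ i * f.denom) ∈
      (ratDeg k).D (((f.num.natDegree + j : ℕ) : ℤ) - 1) := by
    rw [algebraMap_mem_ratDeg]
    by_cases h0 : f.num * X ^ j - C a * X ^ i * f.denom = 0
    · exact Or.inl h0
    right
    have hd1 : (f.num * X ^ j).degree = ((f.num.natDegree + j : ℕ) : WithBot ℕ) := by
      rw [degree_mul, degree_X_pow, degree_eq_natDegree hnum]; rfl
    have hd2 : (C a * X ^ i * f.denom).degree = ((f.num.natDegree + j : ℕ) : WithBot ℕ) := by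
      rw [degree_mul, degree_C_mul_X_pow _ ha0, degree_eq_natDegree hden, hdeg, add_comm]; rfl
    have := degree_sub_lt_left (hd1.trans hd2.symm) (by
      rw [Ne, mul_eq_zero, not_or]; exact ⟨hnum, pow_ne_zero _ X_ne_zero⟩) (by
      rw [leadingCoeff_mul, leadingCoeff_X_pow, mul_one, leadingCoeff_mul, leadingCoeff_mul,
        leadingCoeff_C, leadingCoeff_X_pow, mul_one, ha, div_mul_cancel₀ _ (leadingCoeff_ne_zero.2 hden)])
    rw [hd1, degree_eq_natDegree h0] at this
    have : (f.num * X ^ j - C a * X ^ i * f.denom).natDegree < f.num.natDegree + j := by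
      exact_mod_cast this
    omega
  rw [h1]
  exact (ratDeg k).mono (by omega) ((ratDeg k).mul_mem h3 h2)

theorem exists_polynomial_sub_mem (f : RatFunc k) :
    ∃ P : k[X], f - algebraMap k[X] _ P ∈ (ratDeg k).D (-1) := by
  have hden : f.denom ≠ 0 := f.denom_ne_zero
  have hdenR : algebraMap k[X] (RatFunc k) f.denom ≠ 0 := RatFunc.algebraMap_ne_zero hden
  refine ⟨f.num /ₘ f.denom, ?_⟩
  have h1 : f - algebraMap k[X] _ (f.num /ₘ f.denom) =
      algebraMap k[X] _ (f.num %ₘ f.denom) * (algebraMap k[X] _ f.denom)⁻¹ := by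
    rw [← div_eq_mul_inv, eq_div_iff hdenR, sub_mul]
    conv_lhs => enter [1, 1]; rw [← RatFunc.num_div_denom f]
    rw [div_mul_cancel₀ _ hdenR, ← map_mul, ← map_sub]
    congr 1
    linear_combination -modByMonic_add_div f.num f.denom
  rw [h1]
  by_cases h0 : f.num %ₘ f.denom = 0
  · rw [h0, map_zero, zero_mul]; exact zero_mem _
  have h2 := natDegree_lt_natDegree h0 (degree_modByMonic_lt f.num f.monic_denom)
  refine (ratDeg k).mono (by omega : ((f.num %ₘ f.denom).natDegree : ℤ) +
    -(f.denom.natDegree : ℤ) ≤ -1) ((ratDeg k).mul_mem (algebraMap_mem_ratDeg.2 (Or.inr le_rfl)) ?_)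
  right
  rw [RatFunc.intDegree_inv, RatFunc.intDegree_polynomial]

theorem exists_polynomial_sub_sum_mem (M : ℕ) (f : RatFunc k) :
    ∃ (P : k[X]) (c : Fin M → k), f - algebraMap k[X] _ P -
      ∑ l, c l • (RatFunc.X : RatFunc k) ^ (-(l : ℤ) - 1) ∈ (ratDeg k).D (-(M : ℤ) - 1) := by
  induction M with
  | zero =>
    obtain ⟨P, hP⟩ := exists_polynomial_sub_mem f
    exact ⟨P, 0, by simpa using hP⟩
  | succ M ih =>
    obtain ⟨P, c, h⟩ := ih
    obtain ⟨a, ha⟩ := exists_sub_C_mul_X_zpow h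
    refine ⟨P, Fin.snoc c a, ?_⟩
    rw [Fin.sum_univ_castSucc]
    simp only [Fin.snoc_castSucc, Fin.snoc_last, Fin.val_castSucc, Fin.val_last]
    rw [← Algebra.smul_def] at ha
    have h1 : (-((M + 1 : ℕ) : ℤ) - 1) = -(M : ℤ) - 1 - 1 := by push_cast; ring
    rwa [h1, ← sub_sub]

end

section

open Polynomial

theorem trace_eq_add_of_exact {k U V Q : Type*} [Field k] [AddCommGroup U] [AddCommGroup V]
    [AddCommGroup Q] [Module k U] [Module k V] [Module k Q] [FiniteDimensional k U]
    [FiniteDimensional k V] [FiniteDimensional k Q] {i : U →ₗ[k] V} {q : V →ₗ[k] Q}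
    (hi : Function.Injective i) (hq : Function.Surjective q) (hiq : LinearMap.range i = q.ker)
    (u : U →ₗ[k] U) (v : V →ₗ[k] V) (w : Q →ₗ[k] Q) (hu : v ∘ₗ i = i ∘ₗ u)
    (hw : q ∘ₗ v = w ∘ₗ q) :
    LinearMap.trace k V v = LinearMap.trace k U u + LinearMap.trace k Q w := by
  obtain ⟨s, hs⟩ := q.exists_rightInverse_of_surjective (LinearMap.range_eq_top.2 hq)
  have hmem : ∀ x, (LinearMap.id - s ∘ₗ q : V →ₗ[k] V) x ∈ LinearMap.range i := fun x => by
    rw [hiq, LinearMap.mem_ker]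
    simp only [LinearMap.sub_apply, LinearMap.id_apply, LinearMap.comp_apply, map_sub]
    rw [← LinearMap.comp_apply, hs, LinearMap.id_apply, sub_self]
  let r : V →ₗ[k] U := (LinearEquiv.ofInjective i hi).symm.toLinearMap ∘ₗ
    (LinearMap.id - s ∘ₗ q : V →ₗ[k] V).codRestrict (LinearMap.range i) hmem
  have hir : i ∘ₗ r = LinearMap.id - s ∘ₗ q := by
    ext x
    have h := LinearEquiv.apply_symm_apply (LinearEquiv.ofInjective i hi)
      ((LinearMap.id - s ∘ₗ q : V →ₗ[k] V).codRestrict (LinearMap.range i) hmem x)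
    exact congrArg Subtype.val h
  have hqi : q ∘ₗ i = 0 := by
    ext x
    have : i x ∈ q.ker := hiq ▸ ⟨x, rfl⟩
    exact this
  have hri : r ∘ₗ i = LinearMap.id := by
    ext x
    apply hi
    have := LinearMap.congr_fun hir (i x)
    simp only [LinearMap.comp_apply, LinearMap.sub_apply, LinearMap.id_apply] at this ⊢
    rw [this, ← LinearMap.comp_apply q i, hqi]; simp
  have hv : v = i ∘ₗ (u ∘ₗ r) + (v ∘ₗ s) ∘ₗ q := by
    have : v = v ∘ₗ (i ∘ₗ r + s ∘ₗ q) := by rw [hir, sub_add_cancel, LinearMap.comp_id]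
    rwa [LinearMap.comp_add, ← LinearMap.comp_assoc, hu, LinearMap.comp_assoc,
      ← LinearMap.comp_assoc (f := q)] at this
  conv_lhs => rw [hv]
  rw [map_add, LinearMap.trace_comp_comm', LinearMap.comp_assoc, hri, LinearMap.comp_id,
    LinearMap.trace_comp_comm', ← LinearMap.comp_assoc, hw, LinearMap.comp_assoc, hs,
    LinearMap.comp_id]

section

variable (k : Type*) {A : Type*} [Field k] [CommRing A] [IsDedekindDomain A] [Algebra k A]

theorem exists_mul_mem_iff {I J : Ideal A} (hI : I ≠ ⊥) (hJ : J ≠ ⊥) :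
    ∃ a ∈ I, (∀ x, a * x ∈ I * J ↔ x ∈ J) ∧ I * J ⊔ Ideal.span {a} = I := by
  have hIJ : I * J ≠ 0 := mul_ne_zero hI hJ
  obtain ⟨a, ha⟩ := IsDedekindDomain.exists_sup_span_eq (Ideal.mul_le_left : I * J ≤ I) hIJ
  have haI : a ∈ I := by
    rw [← ha]; exact Ideal.mem_sup_right (Ideal.mem_span_singleton_self a)
  refine ⟨a, haI, fun x => ⟨fun h => ?_, fun h => Ideal.mul_mem_mul haI h⟩, ha⟩
  obtain ⟨Cc, hC⟩ := Ideal.dvd_iff_le.2 ((Ideal.span_singleton_le_iff_mem I).2 haI)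
  have hcop : J ⊔ Cc = ⊤ := by
    rw [hC, ← Ideal.mul_sup] at ha
    have : I * (J ⊔ Cc) = I * ⊤ := by rw [ha, Ideal.mul_top]
    exact mul_left_cancel₀ hI this
  have h1 : Ideal.span {a} * Ideal.span {x} ≤ I * J := by
    rw [Ideal.span_singleton_mul_span_singleton, Ideal.span_singleton_le_iff_mem]; exact h
  rw [hC, mul_assoc, ← Ideal.dvd_iff_le, mul_dvd_mul_iff_left hI, Ideal.dvd_iff_le] at h1
  have h2 : Ideal.span {x} ≤ J := by
    calc Ideal.span {x} = (J ⊔ Cc) * Ideal.span {x} := by rw [hcop, Ideal.top_mul]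
      _ ≤ J := by
        rw [Ideal.sup_mul]
        exact sup_le Ideal.mul_le_left h1
  exact (Ideal.span_singleton_le_iff_mem J).1 h2

theorem finrank_trace_quotient_mul
    (hfin : ∀ I : Ideal A, I ≠ ⊥ → FiniteDimensional k (A ⧸ I)) (x : A) {I J : Ideal A} (hI : I ≠ ⊥) (hJ : J ≠ ⊥) :
    Module.finrank k (A ⧸ I * J) = Module.finrank k (A ⧸ I) + Module.finrank k (A ⧸ J) ∧
    Algebra.trace k (A ⧸ I * J) (Ideal.Quotient.mk _ x) =
      Algebra.trace k (A ⧸ I) (Ideal.Quotient.mk _ x) +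
      Algebra.trace k (A ⧸ J) (Ideal.Quotient.mk _ x) := by
  have hIJ : I * J ≠ ⊥ := mul_ne_zero hI hJ
  have := hfin I hI
  have := hfin J hJ
  have := hfin _ hIJ
  obtain ⟨a, ha, hmem, hsup⟩ := exists_mul_mem_iff hI hJ
  let i : (A ⧸ J) →ₗ[A] A ⧸ I * J := Submodule.mapQ J (I * J) (LinearMap.mulLeft A a)
    (fun y hy => (hmem y).2 hy)
  let q : (A ⧸ I * J) →ₗ[A] A ⧸ I := Submodule.factor Ideal.mul_le_left
  have hi : Function.Injective i := by
    rw [← LinearMap.ker_eq_bot, LinearMap.ker_eq_bot']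
    intro y hy
    obtain ⟨y, rfl⟩ := Ideal.Quotient.mk_surjective y
    have h1 : Ideal.Quotient.mk (I * J) (a * y) = 0 := hy
    rw [Ideal.Quotient.eq_zero_iff_mem, hmem] at h1
    exact Ideal.Quotient.eq_zero_iff_mem.2 h1
  have hq : Function.Surjective q := Submodule.factor_surjective _
  have hiq : LinearMap.range i = q.ker := by
    ext y
    obtain ⟨y, rfl⟩ := Ideal.Quotient.mk_surjective y
    constructor
    · rintro ⟨z, hz⟩
      obtain ⟨z, rfl⟩ := Ideal.Quotient.mk_surjective z
      rw [← hz]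
      exact Ideal.Quotient.eq_zero_iff_mem.2 (I.mul_mem_right z ha)
    · intro hy
      have h1 : y ∈ I := Ideal.Quotient.eq_zero_iff_mem.1 (show Ideal.Quotient.mk I y = 0 from hy)
      rw [← hsup] at h1
      obtain ⟨b, hb, c, hc, rfl⟩ := Submodule.mem_sup.1 h1
      obtain ⟨d, rfl⟩ := Ideal.mem_span_singleton'.1 hc
      refine ⟨Ideal.Quotient.mk J d, ?_⟩
      change Ideal.Quotient.mk (I * J) (a * d) = Ideal.Quotient.mk (I * J) (b + d * a)
      rw [map_add, Ideal.Quotient.eq_zero_iff_mem.2 hb, zero_add, mul_comm a d]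
  constructor
  · have h1 := LinearMap.finrank_range_add_finrank_ker (q.restrictScalars k)
    rw [LinearMap.range_eq_top.2 (show Function.Surjective (q.restrictScalars k) from hq),
      finrank_top] at h1
    have h2 : LinearMap.ker (q.restrictScalars k) = LinearMap.range (i.restrictScalars k) := by
      rw [LinearMap.ker_restrictScalars, ← hiq]; rfl
    rw [h2, LinearMap.finrank_range_of_inj (show Function.Injective (i.restrictScalars k) from hi)]
      at h1
    omega
  · rw [Algebra.trace_apply, Algebra.trace_apply, Algebra.trace_apply, add_comm]
    refine trace_eq_add_of_exact (i := i.restrictScalars k) (q := q.restrictScalars k) hi hq ?_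
      (Algebra.lmul k _ (Ideal.Quotient.mk J x)) (Algebra.lmul k _ (Ideal.Quotient.mk (I * J) x))
      (Algebra.lmul k _ (Ideal.Quotient.mk I x)) (LinearMap.ext fun y => ?_)
      (LinearMap.ext fun y => ?_)
    · rw [LinearMap.ker_restrictScalars, ← hiq]; rfl
    · exact (i.map_smul x y).symm
    · exact q.map_smul x y

end

end

section

open Polynomial

theorem trace_pi_map {k ι : Type*} [Field k] [Fintype ι] [DecidableEq ι] {V : ι → Type*}
    [∀ i, AddCommGroup (V i)] [∀ i, Module k (V i)] [∀ i, FiniteDimensional k (V i)]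
    (f : ∀ i, V i →ₗ[k] V i) :
    LinearMap.trace k (∀ i, V i) (LinearMap.pi fun i => f i ∘ₗ LinearMap.proj i) =
      ∑ i, LinearMap.trace k (V i) (f i) := by
  have h : (LinearMap.pi fun i => f i ∘ₗ LinearMap.proj i : (∀ i, V i) →ₗ[k] ∀ i, V i) =
      ∑ i, LinearMap.single k V i ∘ₗ (f i ∘ₗ LinearMap.proj i) := by
    refine LinearMap.ext fun x => funext fun j => ?_
    simp [LinearMap.sum_apply, Finset.sum_apply]
  rw [h, map_sum]
  refine Finset.sum_congr rfl fun i _ => ?_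
  rw [LinearMap.trace_comp_comm', LinearMap.comp_assoc, LinearMap.proj_comp_single_same,
    LinearMap.comp_id]

theorem trace_quotient_span_X {k : Type*} [Field k] {g : k[X]} (hg : g.Monic) :
    Algebra.trace k (k[X] ⧸ Ideal.span {g}) (Ideal.Quotient.mk _ X) = - g.nextCoeff := by
  by_cases h1 : g = 1
  · subst h1
    have : Subsingleton (k[X] ⧸ Ideal.span {(1 : k[X])}) :=
      Ideal.Quotient.subsingleton_iff.2 Ideal.span_singleton_one
    rw [Subsingleton.elim (Ideal.Quotient.mk (Ideal.span {(1 : k[X])}) X) 0, map_zero,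
      ← C_1, nextCoeff_C_eq_zero, neg_zero]
  have hd : g.degree ≠ 0 := fun h => h1 (hg.degree_le_zero_iff_eq_one.1 h.le)
  have := AdjoinRoot.nontrivial g hd
  have h := PowerBasis.trace_gen_eq_nextCoeff_minpoly (AdjoinRoot.powerBasis hg.ne_zero)
  rw [AdjoinRoot.minpoly_powerBasis_gen_of_monic hg] at h
  exact h

variable {k A ι : Type*} [Field k] [CommRing A] [IsDomain A] [Algebra k A] [Algebra k[X] A]
  [IsScalarTower k k[X] A] [Finite ι]

theorem trace_quotient_span_singleton (b : Module.Basis ι k[X] A) {f : A} (hf : f ≠ 0)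
    {g : k[X]} (hg : g.Monic) (hgf : Associated (Algebra.norm k[X] f) g) :
    Algebra.trace k (A ⧸ Ideal.span {f}) (Ideal.Quotient.mk _ (algebraMap k[X] A X)) =
      - g.nextCoeff := by
  classical
  have := Fintype.ofFinite ι
  have h := Ideal.span_singleton_eq_bot.not.2 hf
  let a : ι → k[X] := fun i => Ideal.smithCoeffs b _ h i * C (Ideal.smithCoeffs b _ h i).leadingCoeff⁻¹
  have hs : ∀ i, Ideal.smithCoeffs b _ h i ≠ 0 := Ideal.smithCoeffs_ne_zero b _ h
  have ha : ∀ i, (a i).Monic := fun i => monic_mul_leadingCoeff_inv (hs i)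
  have hass : ∀ i, Associated (Ideal.smithCoeffs b _ h i) (a i) := fun i =>
    associated_mul_unit_right _ _ (isUnit_C.2 (isUnit_iff_ne_zero.2
      (inv_ne_zero (leadingCoeff_ne_zero.2 (hs i)))))
  have hsp : ∀ i, Ideal.span {Ideal.smithCoeffs b _ h i} = Ideal.span {a i} := fun i =>
    Ideal.span_singleton_eq_span_singleton.2 (hass i)
  have hn : g = ∏ i, a i := by
    refine eq_of_monic_of_associated hg (monic_prod_of_monic _ _ fun i _ => ha i) ?_
    refine hgf.symm.trans ((associated_norm_prod_smith b hf).trans ?_)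
    exact Associated.prod _ _ _ fun i _ => hass i
  rw [hn, Monic.nextCoeff_prod _ _ fun i _ => ha i, ← Finset.sum_neg_distrib]
  let e := (Ideal.quotientEquivPiSpan _ b h).restrictScalars k
  let v : ∀ i, (k[X] ⧸ Ideal.span {Ideal.smithCoeffs b _ h i}) →ₗ[k]
    (k[X] ⧸ Ideal.span {Ideal.smithCoeffs b _ h i}) := fun i =>
      Algebra.lmul k _ (Ideal.Quotient.mk _ X)
  have h1 : Algebra.trace k (A ⧸ Ideal.span {f}) (Ideal.Quotient.mk _ (algebraMap k[X] A X)) =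
      ∑ i, LinearMap.trace k _ (v i) := by
    rw [← trace_pi_map, Algebra.trace_apply, ← LinearMap.trace_conj' _ e]
    congr 1
    refine LinearMap.ext fun x => ?_
    obtain ⟨y, rfl⟩ := e.surjective x
    rw [LinearEquiv.conj_apply]
    simp only [LinearMap.comp_apply, LinearEquiv.coe_coe, LinearEquiv.symm_apply_apply]
    obtain ⟨y, rfl⟩ := Ideal.Quotient.mk_surjective y
    have : (Algebra.lmul k (A ⧸ Ideal.span {f})) (Ideal.Quotient.mk _ (algebraMap k[X] A X))
        (Ideal.Quotient.mk _ y) = (X : k[X]) • (Ideal.Quotient.mk (Ideal.span {f}) y) := by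
      change _ = Ideal.Quotient.mk _ ((X : k[X]) • y)
      rw [Algebra.smul_def]; rfl
    rw [this]
    refine ((Ideal.quotientEquivPiSpan _ b h).map_smul X _).trans (funext fun i => ?_)
    have hv : ∀ z, (X : k[X]) • z = v i z := fun z => by
      obtain ⟨z, rfl⟩ := Ideal.Quotient.mk_surjective z
      rfl
    exact hv (e (Ideal.Quotient.mk _ y) i)
  rw [h1]
  refine Finset.sum_congr rfl fun i _ => ?_
  rw [← trace_quotient_span_X (ha i)]
  change Algebra.trace k (k[X] ⧸ Ideal.span {Ideal.smithCoeffs b _ h i}) (Ideal.Quotient.mk _ X) = _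
  rw [hsp i]

end

section

open Finset

variable {M : Type*} [CommMonoidWithZero M] [IsCancelMulZero M] [UniqueFactorizationMonoid M]
  [Subsingleton Mˣ]

theorem sum_divisorsAntidiagonal_Icc {R : Type*} [AddCommMonoid R] (n : ℕ) (F : ℕ → ℕ → R) :
    ∑ j ∈ Icc 1 n, ∑ x ∈ j.divisorsAntidiagonal, F x.1 x.2 =
      ∑ d ∈ Icc 1 n, ∑ m ∈ Icc 1 n, if d * m ≤ n then F d m else 0 := by
  rw [← sum_product', ← sum_filter, sum_sigma']
  refine sum_nbij' (fun x => x.2) (fun x => ⟨x.1 * x.2, x⟩) ?_ ?_ ?_ ?_ ?_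
  · rintro ⟨j, a, b⟩ h
    simp only [mem_sigma, mem_Icc, Nat.mem_divisorsAntidiagonal, mem_filter, mem_product] at h ⊢
    obtain ⟨⟨h1, h2⟩, rfl, h3⟩ := h
    have ha : 0 < a := Nat.pos_of_ne_zero (left_ne_zero_of_mul h3)
    have hb : 0 < b := Nat.pos_of_ne_zero (right_ne_zero_of_mul h3)
    exact ⟨⟨⟨ha, by nlinarith⟩, hb, by nlinarith⟩, h2⟩
  · rintro ⟨a, b⟩ h
    simp only [mem_sigma, mem_Icc, Nat.mem_divisorsAntidiagonal, mem_filter, mem_product] at h ⊢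
    obtain ⟨⟨⟨h1, h2⟩, h3, h4⟩, h5⟩ := h
    exact ⟨⟨Nat.mul_pos h1 h3, h5⟩, trivial, by positivity⟩
  · rintro ⟨j, a, b⟩ h
    simp only [mem_sigma, mem_Icc, Nat.mem_divisorsAntidiagonal] at h
    obtain ⟨-, rfl, -⟩ := h
    rfl
  · rintro ⟨a, b⟩ h; rfl
  · rintro ⟨j, a, b⟩ h; rfl

theorem deg_eq_sum_factors (deg : M → ℕ) (hdeg : ∀ a b, a ≠ 0 → b ≠ 0 → deg (a * b) = deg a + deg b)
    (hpos : ∀ a, a ≠ 0 → a ≠ 1 → 0 < deg a) (I : ℕ → Finset M)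
    (hI : ∀ n a, a ∈ I n ↔ a ≠ 0 ∧ deg a = n) [DecidablePred (Prime : M → Prop)]
    [DecidableRel (Dvd.dvd : M → M → Prop)] {n : ℕ} {a : M} (ha : a ∈ I n) :
    deg a = ∑ d ∈ Icc 1 n, ∑ m ∈ Icc 1 n, ∑ π ∈ I d with Prime π, if π ^ m ∣ a then d else 0 := by
  classical
  obtain ⟨ha0, rfl⟩ := (hI _ _).1 ha
  have hone : deg 1 = 0 := by
    have : (1 : M) ≠ 0 := fun h => ha0 (by rw [← mul_one a, h, mul_zero])
    have := hdeg 1 1 this this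
    rw [mul_one] at this; omega
  have hpow : ∀ (b : M), b ≠ 0 → ∀ m, deg (b ^ m) = m * deg b := by
    intro b hb m
    have : NoZeroDivisors M := inferInstance
    have : Nontrivial M := ⟨b, 0, hb⟩
    induction m with
    | zero => simp [hone]
    | succ m ih => rw [pow_succ, hdeg _ _ (pow_ne_zero m hb) hb, ih]; ring
  have hdvd : ∀ b, b ∣ a → deg b ≤ deg a := by
    rintro b ⟨c, rfl⟩
    rw [hdeg _ _ (left_ne_zero_of_mul ha0) (right_ne_zero_of_mul ha0)]; omega
  set n := deg a with hn
  let f := UniqueFactorizationMonoid.normalizedFactors a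
  have hprod : f.prod = a := associated_iff_eq.1 (UniqueFactorizationMonoid.prod_normalizedFactors ha0)
  have hprime : ∀ π ∈ f, Prime π := fun π h => UniqueFactorizationMonoid.prime_of_normalized_factor π h
  have hcount : ∀ (π : M), Prime π → ∀ m, π ^ m ∣ a ↔ m ≤ f.count π := by
    intro π hπ m
    rw [pow_dvd_iff_le_emultiplicity,
      UniqueFactorizationMonoid.emultiplicity_eq_count_normalizedFactors hπ.irreducible ha0,
      normalize_eq, Nat.cast_le]
  have hprimepos : ∀ π, Prime π → 0 < deg π := fun π hπ => hpos π hπ.ne_zero hπ.ne_one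
  have hcn : ∀ π, Prime π → f.count π ≤ n := by
    intro π hπ
    have h := hdvd _ ((hcount π hπ _).2 le_rfl)
    rw [hpow π hπ.ne_zero] at h
    exact (Nat.le_mul_of_pos_right _ (hprimepos π hπ)).trans h
  have hs1 : ∀ d ∈ Icc 1 n, (∑ m ∈ Icc 1 n, ∑ π ∈ I d with Prime π, if π ^ m ∣ a then d else 0) =
      ∑ π ∈ I d with Prime π, f.count π * deg π := by
    intro d _
    rw [sum_comm]
    refine sum_congr rfl fun π hπ => ?_
    rw [mem_filter, hI] at hπ
    rw [← sum_filter, sum_const, smul_eq_mul, hπ.1.2]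
    congr 1
    have : {m ∈ Icc 1 n | π ^ m ∣ a} = Icc 1 (f.count π) := by
      ext m
      have := hcn π hπ.2
      simp only [mem_filter, mem_Icc, hcount π hπ.2]
      omega
    rw [this, Nat.card_Icc]; omega
  rw [sum_congr rfl hs1]
  have hs2 : n = ∑ π ∈ f.toFinset, f.count π * deg π := by
    have h1 : ∀ (t : Multiset M), (∀ π ∈ t, Prime π) → deg t.prod = (t.map deg).sum := by
      intro t
      induction t using Multiset.induction_on with
      | empty => intro _; simpa using hone
      | cons b t ih =>
        intro h
        have hb := h b (Multiset.mem_cons_self _ _)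
        have : Nontrivial M := ⟨b, 0, hb.ne_zero⟩
        rw [Multiset.prod_cons, Multiset.map_cons, Multiset.sum_cons, hdeg _ _ hb.ne_zero
          (Multiset.prod_ne_zero fun h0 => (h 0 (Multiset.mem_cons_of_mem h0)).ne_zero rfl),
          ih fun π hπ => h π (Multiset.mem_cons_of_mem hπ)]
    rw [hn, ← hprod, h1 f hprime, sum_multiset_map_count]
    simp only [smul_eq_mul, f]
  have hmem : ∀ π ∈ f.toFinset, deg π ∈ Icc 1 n := by
    intro π hπ
    rw [Multiset.mem_toFinset] at hπ
    exact mem_Icc.2 ⟨hprimepos π (hprime π hπ),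
      hdvd π (UniqueFactorizationMonoid.dvd_of_mem_normalizedFactors hπ)⟩
  refine hs2.trans ?_
  rw [← sum_fiberwise_of_maps_to hmem]
  refine sum_congr rfl fun d _ => sum_subset (fun π hπ => ?_) fun π hπ hπ' => ?_
  · rw [mem_filter, Multiset.mem_toFinset] at hπ
    rw [mem_filter, hI]
    exact ⟨⟨(hprime π hπ.1).ne_zero, hπ.2⟩, hprime π hπ.1⟩
  · rw [mem_filter, hI] at hπ
    rw [mem_filter, Multiset.mem_toFinset] at hπ'
    have : π ∉ f := fun h => hπ' ⟨h, hπ.1.2⟩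
    rw [Multiset.count_eq_zero_of_notMem this, zero_mul]

theorem mul_sum_eq_sum_primes (deg : M → ℕ)
    (hdeg : ∀ a b, a ≠ 0 → b ≠ 0 → deg (a * b) = deg a + deg b)
    (hpos : ∀ a, a ≠ 0 → a ≠ 1 → 0 < deg a) (I : ℕ → Finset M)
    (hI : ∀ n a, a ∈ I n ↔ a ≠ 0 ∧ deg a = n) [DecidablePred (Prime : M → Prop)]
    (χ : M → ℂ) (hχ : ∀ a b, a ≠ 0 → b ≠ 0 → χ (a * b) = χ a * χ b) (hχ1 : χ 1 = 1) (n : ℕ) :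
    (n : ℂ) * ∑ a ∈ I n, χ a = ∑ j ∈ Icc 1 n,
      (∑ x ∈ j.divisorsAntidiagonal, ∑ π ∈ I x.1 with Prime π, (x.1 : ℂ) * χ π ^ x.2) *
        ∑ b ∈ I (n - j), χ b := by
  classical
  have hpow : ∀ (b : M), b ≠ 0 → ∀ m, deg (b ^ m) = m * deg b ∧ χ (b ^ m) = χ b ^ m := by
    intro b hb m
    have : Nontrivial M := ⟨b, 0, hb⟩
    have hone : deg 1 = 0 := by
      have := hdeg 1 1 one_ne_zero one_ne_zero
      rw [mul_one] at this; omega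
    induction m with
    | zero => simp [hone, hχ1]
    | succ m ih =>
      rw [pow_succ, hdeg _ _ (pow_ne_zero m hb) hb, ih.1, hχ _ _ (pow_ne_zero m hb) hb, ih.2]
      exact ⟨by ring, by ring⟩
  simp_rw [sum_mul]
  have hR : ∀ j ∈ Icc 1 n, (∑ x ∈ j.divisorsAntidiagonal,
      (∑ π ∈ I x.1 with Prime π, (x.1 : ℂ) * χ π ^ x.2) * ∑ b ∈ I (n - j), χ b) =
      ∑ x ∈ j.divisorsAntidiagonal,
      (∑ π ∈ I x.1 with Prime π, (x.1 : ℂ) * χ π ^ x.2) * ∑ b ∈ I (n - x.1 * x.2), χ b :=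
    fun j _ => sum_congr rfl fun x hx => by rw [(Nat.mem_divisorsAntidiagonal.1 hx).1]
  have hL : (n : ℂ) * ∑ a ∈ I n, χ a = ∑ a ∈ I n, ∑ d ∈ Icc 1 n, ∑ m ∈ Icc 1 n,
      ∑ π ∈ I d with Prime π, if π ^ m ∣ a then (d : ℂ) * χ a else 0 := by
    rw [mul_sum]
    refine sum_congr rfl fun a ha => ?_
    have h := deg_eq_sum_factors deg hdeg hpos I hI ha
    rw [((hI _ _).1 ha).2] at h
    conv_lhs => rw [h]
    push_cast
    simp_rw [sum_mul, ite_mul, zero_mul]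
  rw [hL]
  have := sum_divisorsAntidiagonal_Icc n (fun d m =>
    (∑ π ∈ I d with Prime π, (d : ℂ) * χ π ^ m) * ∑ b ∈ I (n - d * m), χ b)
  simp_rw [sum_mul] at this hR
  rw [sum_congr rfl hR, this, sum_comm]
  refine sum_congr rfl fun d _ => ?_
  rw [sum_comm]
  refine sum_congr rfl fun m _ => ?_
  rw [sum_comm]
  split_ifs with hdm
  · refine sum_congr rfl fun π hπ => ?_
    rw [mem_filter, hI] at hπ
    obtain ⟨⟨hπ0, hπd⟩, hπp⟩ := hπ
    have : Nontrivial M := ⟨π, 0, hπ0⟩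
    rw [← sum_filter, mul_sum]
    symm
    refine sum_bij (fun b _ => π ^ m * b) (fun b hb => ?_) (fun b _ b' _ h => ?_) (fun a ha => ?_)
      (fun b hb => ?_)
    · rw [hI] at hb
      rw [mem_filter, hI, hdeg _ _ (pow_ne_zero m hπ0) hb.1, (hpow π hπ0 m).1, hπd, hb.2]
      refine ⟨⟨mul_ne_zero (pow_ne_zero m hπ0) hb.1, ?_⟩, dvd_mul_right _ _⟩
      rw [mul_comm m d]; omega
    · exact mul_left_cancel₀ (pow_ne_zero m hπ0) h
    · rw [mem_filter, hI] at ha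
      obtain ⟨⟨ha0, hda⟩, b, rfl⟩ := ha
      refine ⟨b, ?_, rfl⟩
      have hb0 := right_ne_zero_of_mul ha0
      rw [hI]
      rw [hdeg _ _ (pow_ne_zero m hπ0) hb0, (hpow π hπ0 m).1, hπd, mul_comm m d] at hda
      exact ⟨hb0, by omega⟩
    · rw [hI] at hb
      rw [hχ _ _ (pow_ne_zero m hπ0) hb.1, (hpow π hπ0 m).2]; ring
  · refine sum_eq_zero fun π hπ => sum_eq_zero fun a ha => if_neg fun ⟨b, hb⟩ => hdm ?_
    rw [mem_filter, hI] at hπ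
    rw [hI] at ha
    obtain ⟨⟨hπ0, hπd⟩, hπp⟩ := hπ
    have : Nontrivial M := ⟨π, 0, hπ0⟩
    have hb0 : b ≠ 0 := by rintro rfl; exact ha.1 (by rw [hb, mul_zero])
    have := ha.2
    rw [hb, hdeg _ _ (pow_ne_zero m hπ0) hb0, (hpow π hπ0 m).1, hπd, mul_comm m d] at this
    omega

end

section

open Finset

theorem PowerSeries.geom_log_deriv (ω : ℂ) :
    (PowerSeries.mk fun n => if n = 0 then 0 else ω ^ n : PowerSeries ℂ) *
      (1 - PowerSeries.C ω * PowerSeries.X) = PowerSeries.C ω * PowerSeries.X := by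
  ext n
  rw [mul_sub, mul_one, map_sub, mul_comm (PowerSeries.C ω), ← mul_assoc, PowerSeries.coeff_mul_C]
  cases n with
  | zero => simp
  | succ n =>
    rw [PowerSeries.coeff_succ_mul_X, PowerSeries.coeff_mk, PowerSeries.coeff_mk,
      mul_comm PowerSeries.X, PowerSeries.coeff_succ_mul_X, PowerSeries.coeff_C]
    cases n with
    | zero => simp
    | succ n => simp [pow_succ]

theorem exists_polynomial_eq_prod_one_sub (P : Polynomial ℂ) (hP : P.coeff 0 = 1) :
    ∃ s : Multiset ℂ, s.card ≤ P.natDegree ∧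
      P = (s.map fun ω => 1 - Polynomial.C ω * Polynomial.X).prod := by
  have hP0 : P ≠ 0 := by rintro rfl; simp at hP
  have hr : ∀ r ∈ P.roots, r ≠ 0 := by
    rintro r hr rfl
    have := (Polynomial.mem_roots hP0).1 hr
    rw [Polynomial.IsRoot, ← Polynomial.coeff_zero_eq_eval_zero, hP] at this
    exact one_ne_zero this
  refine ⟨P.roots.map fun r => r⁻¹, by rw [Multiset.card_map]; exact P.card_roots', ?_⟩
  have h := (IsAlgClosed.splits P).eq_prod_roots
  have h2 : (P.roots.map fun a => Polynomial.X - Polynomial.C a).prod =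
      Polynomial.C (P.roots.map fun r => - r).prod *
        ((P.roots.map fun r => r⁻¹).map fun ω => 1 - Polynomial.C ω * Polynomial.X).prod := by
    rw [map_multiset_prod, Multiset.map_map, Multiset.map_map, ← Multiset.prod_map_mul]
    refine congrArg Multiset.prod (Multiset.map_congr rfl fun r hr' => ?_)
    simp only [Function.comp_apply]
    rw [mul_sub, mul_one, ← mul_assoc, ← Polynomial.C_mul, neg_mul, mul_inv_cancel₀ (hr r hr')]
    simp only [map_neg, map_one]; ring
  rw [h2, ← mul_assoc, ← Polynomial.C_mul] at h
  have h3 := congrArg (Polynomial.eval 0) h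
  rw [← Polynomial.coeff_zero_eq_eval_zero, hP, Polynomial.eval_mul, Polynomial.eval_C,
    Polynomial.eval_multiset_prod, Multiset.map_map, Multiset.map_map] at h3
  have h4 : (P.roots.map ((Polynomial.eval 0 ∘ fun ω => 1 - Polynomial.C ω * Polynomial.X) ∘
      fun r => r⁻¹)).prod = 1 :=
    Multiset.prod_eq_one fun x hx => by
      obtain ⟨r, -, rfl⟩ := Multiset.mem_map.1 hx
      simp
  rw [h4, mul_one] at h3
  rw [← h3, Polynomial.C_1, one_mul] at h
  exact h

theorem exists_power_sums (c S : ℕ → ℂ) (hc : c 0 = 1)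
    (hS : ∀ n : ℕ, (n : ℂ) * c n = ∑ j ∈ Icc 1 n, S j * c (n - j)) (ρ : ℂ) (D : ℕ)
    (hD : ∀ n, D ≤ n → c (n + 1) = ρ * c n) :
    ∃ s : Multiset ℂ, s.card ≤ D ∧ ∀ n, 1 ≤ n → S n = ρ ^ n - (s.map fun ω => ω ^ n).sum := by
  let G : ℂ → PowerSeries ℂ := fun ω => PowerSeries.mk fun n => if n = 0 then 0 else ω ^ n
  let Z : PowerSeries ℂ := PowerSeries.mk fun n => if n = 0 then 0 else S n
  let Lc : PowerSeries ℂ := PowerSeries.mk c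
  let E : ℂ → PowerSeries ℂ := fun ω => 1 - PowerSeries.C ω * PowerSeries.X
  let d := PowerSeries.derivative ℂ
  have hE : ∀ ω, PowerSeries.X * d (E ω) = - G ω * E ω := by
    intro ω
    have := PowerSeries.geom_log_deriv ω
    simp only [G, E, d, neg_mul, this]
    simp [mul_comm]
  have hL : PowerSeries.X * d Lc = Z * Lc := by
    ext n
    cases n with
    | zero => simp [Z, PowerSeries.coeff_mul]
    | succ n =>
      have h1 := hS (n + 1)
      rw [mul_comm, PowerSeries.coeff_succ_mul_X, PowerSeries.coeff_mul,
        Finset.Nat.sum_antidiagonal_eq_sum_range_succ_mk, Finset.range_eq_Ico,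
        Finset.sum_eq_sum_Ico_succ_bot (by omega)]
      simp only [Z, Lc, d, PowerSeries.coeff_mk, if_pos, zero_mul, zero_add]
      rw [PowerSeries.coeff_derivative, PowerSeries.coeff_mk]
      push_cast at h1
      rw [mul_comm, h1]
      refine Finset.sum_congr rfl fun j hj => ?_
      rw [if_neg (by have := (mem_Icc.1 hj).1; omega)]
  obtain ⟨P, hP⟩ : ∃ P : Polynomial ℂ, (P : PowerSeries ℂ) = E ρ * Lc ∧ P.natDegree ≤ D ∧
      P.coeff 0 = 1 := by
    have hco : ∀ n, PowerSeries.coeff (n + 1) (E ρ * Lc) = c (n + 1) - ρ * c n := by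
      intro n
      simp only [E, Lc]
      rw [sub_mul, one_mul, map_sub, mul_assoc, PowerSeries.coeff_C_mul, mul_comm PowerSeries.X,
        PowerSeries.coeff_succ_mul_X, PowerSeries.coeff_mk, PowerSeries.coeff_mk]
    have hcoP : ∀ n, (PowerSeries.trunc (D + 1) (E ρ * Lc)).coeff n =
        PowerSeries.coeff n (E ρ * Lc) := by
      intro n
      rw [PowerSeries.coeff_trunc]
      split_ifs with h
      · rfl
      · obtain ⟨m, rfl⟩ : ∃ m, n = m + 1 := ⟨n - 1, by omega⟩
        rw [hco, hD m (by omega), sub_self]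
    refine ⟨PowerSeries.trunc (D + 1) (E ρ * Lc), ?_, ?_, ?_⟩
    · ext n
      rw [Polynomial.coeff_coe, hcoP]
    · exact Nat.lt_succ_iff.1 (PowerSeries.natDegree_trunc_lt _ _)
    · rw [hcoP]
      simp [E, Lc, PowerSeries.coeff_mul, hc]
  obtain ⟨hP1, hP2, hP3⟩ := hP
  obtain ⟨s, hs1, hs2⟩ := exists_polynomial_eq_prod_one_sub P hP3
  have hPs : (P : PowerSeries ℂ) = (s.map E).prod := by
    rw [hs2, ← Polynomial.coeToPowerSeries.ringHom_apply, map_multiset_prod, Multiset.map_map]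
    refine congrArg Multiset.prod (Multiset.map_congr rfl fun r _ => ?_)
    simp [E]
  have hprod : ∀ t : Multiset ℂ, PowerSeries.X * d (t.map E).prod =
      - (t.map G).sum * (t.map E).prod := by
    intro t
    induction t using Multiset.induction_on with
    | empty => simp [d]
    | cons a t ih =>
      rw [Multiset.map_cons, Multiset.map_cons, Multiset.prod_cons, Multiset.sum_cons,
        Derivation.leibniz, smul_eq_mul, smul_eq_mul]
      linear_combination (E a) * ih + (Multiset.map E t).prod * hE a
  have hP0 : (P : PowerSeries ℂ) ≠ 0 := by
    intro h
    have := congrArg (PowerSeries.coeff 0) h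
    rw [Polynomial.coeff_coe, hP3] at this
    simp at this
  have hkey : Z = G ρ - (s.map G).sum := by
    apply mul_right_cancel₀ hP0
    have h1 : PowerSeries.X * d (P : PowerSeries ℂ) = - (s.map G).sum * (P : PowerSeries ℂ) := by rw [hPs, hprod]
    have h2 : PowerSeries.X * d (P : PowerSeries ℂ) = (Z - G ρ) * (P : PowerSeries ℂ) := by
      rw [hP1, Derivation.leibniz, smul_eq_mul, smul_eq_mul]
      linear_combination (E ρ) * hL + Lc * hE ρ
    linear_combination h2.symm.trans h1
  refine ⟨s, hs1.trans hP2, fun n hn => ?_⟩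
  have h := congrArg (PowerSeries.coeff n) hkey
  rw [map_sub, map_multiset_sum, Multiset.map_map] at h
  have hn0 : n ≠ 0 := by omega
  simpa [Z, G, hn0] using h

end

section

open nonZeroDivisors

structure InftyFilt (k A K : Type*) [Field k] [CommRing A] [IsDomain A] [Algebra k A] [Field K]
    [Algebra A K] [Algebra k K] [IsScalarTower k A K] (x : A) where
  B : ℤ → Submodule k K
  mono : ∀ {m n}, m ≤ n → B m ≤ B n
  mul_mem : ∀ {m n a b}, a ∈ B m → b ∈ B n → a * b ∈ B (m + n)
  one_mem : 1 ∈ B 0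
  x_mem : algebraMap A K x ∈ B 1
  x_inv_mem : (algebraMap A K x)⁻¹ ∈ B (-1)
  x_sub_ne : ∀ a : k, x - algebraMap k A a ≠ 0
  eq_zero : ∀ a : A, algebraMap A K a ∈ B (-1) → a = 0
  N : ℕ
  surj : ∀ z : K, ∃ a : A, z - algebraMap A K a ∈ B N
  codim : ℕ
  finite_quot : FiniteDimensional k
    (K ⧸ (LinearMap.range (IsScalarTower.toAlgHom k A K).toLinearMap ⊔ B (-(N + 3))))
  finrank_quot_le : Module.finrank k
    (K ⧸ (LinearMap.range (IsScalarTower.toAlgHom k A K).toLinearMap ⊔ B (-(N + 3)))) ≤ codim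
  inv_sub_one_mem : ∀ {θ}, θ ∈ B (-1) → (1 + θ)⁻¹ - 1 ∈ B (-1)
  finrank_eq : ∀ c d : A, c ≠ 0 → d ≠ 0 → algebraMap A K c / algebraMap A K d - 1 ∈ B (-1) →
    Module.finrank k (A ⧸ Ideal.span {c}) = Module.finrank k (A ⧸ Ideal.span {d})
  e : k
  e_ne : e ≠ 0
  trace_eq : ∀ (c d : A) (s : k), c ≠ 0 → d ≠ 0 →
    algebraMap A K c / algebraMap A K d - 1 - s • (algebraMap A K x)⁻¹ ∈ B (-2) →
    Algebra.trace k (A ⧸ Ideal.span {c}) (Ideal.Quotient.mk _ x) =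
      Algebra.trace k (A ⧸ Ideal.span {d}) (Ideal.Quotient.mk _ x) + e * s
  finite_ideal_quot : ∀ I : Ideal A, I ≠ ⊥ → FiniteDimensional k (A ⧸ I)
  finite_ideals : ∀ n, {I : Ideal A | I ≠ ⊥ ∧ Module.finrank k (A ⧸ I) = n}.Finite

namespace InftyFilt

variable {k A K : Type*} [Field k] [CommRing A] [IsDedekindDomain A] [Algebra k A] [Field K]
    [Algebra A K] [Algebra k K] [IsScalarTower k A K] [IsFractionRing A K] {x : A}
    (F : InftyFilt k A K x)

theorem exists_mem_inv {I : Ideal A} (hI : I ≠ ⊥) (hD : F.codim < Module.finrank k (A ⧸ I)) :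
    ∃ g ∈ (I : FractionalIdeal A⁰ K)⁻¹, g ≠ 0 ∧ g ∈ F.B (-(F.N + 3)) := by
  obtain ⟨d, hdI, hd⟩ := Submodule.exists_mem_ne_zero_of_ne_bot hI
  obtain ⟨J, hJ⟩ := Ideal.dvd_iff_le.2 ((Ideal.span_singleton_le_iff_mem I).2 hdI)
  have hd0 : Ideal.span {d} ≠ ⊥ := by rwa [Ne, Ideal.span_singleton_eq_bot]
  have hJ0 : J ≠ ⊥ := by rintro rfl; exact hd0 (by rw [hJ, Ideal.mul_bot])
  obtain ⟨a, haJ, ha, -⟩ := exists_mul_mem_iff hJ0 hI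
  rw [mul_comm, ← hJ] at ha
  have hdK : algebraMap A K d ≠ 0 := by
    rwa [Ne, IsFractionRing.to_map_eq_zero_iff]
  set u : K := algebraMap A K a / algebraMap A K d with hu
  have := F.finite_quot
  have := F.finite_ideal_quot I hI
  let W := LinearMap.range (IsScalarTower.toAlgHom k A K).toLinearMap ⊔ F.B (-(F.N + 3))
  let φ : A →ₗ[k] K ⧸ W := W.mkQ ∘ₗ LinearMap.mulLeft k u ∘ₗ
    (IsScalarTower.toAlgHom k A K).toLinearMap
  obtain ⟨s, hs⟩ := (Ideal.Quotient.mkₐ k I).toLinearMap.exists_rightInverse_of_surjective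
    (LinearMap.range_eq_top.2 (Ideal.Quotient.mkₐ_surjective k I))
  obtain ⟨y, hy, hy0⟩ := Submodule.exists_mem_ne_zero_of_ne_bot
    (LinearMap.ker_ne_bot_of_finrank_lt (f := φ ∘ₗ s) (F.finrank_quot_le.trans_lt hD))
  have h1 : u * algebraMap A K (s y) ∈ W := (Submodule.Quotient.mk_eq_zero _).1 hy
  obtain ⟨_, ⟨b, rfl⟩, g, hg, hbg⟩ := Submodule.mem_sup.1 h1
  have hsy : s y ∉ I := fun h => hy0 (by
    rw [← LinearMap.id_apply (R := k) y, ← hs]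
    exact Ideal.Quotient.eq_zero_iff_mem.2 h)
  have hgu : g = u * algebraMap A K (s y) - algebraMap A K b := by
    rw [← hbg]; simp
  have hI0 : (I : FractionalIdeal A⁰ K) ≠ 0 := FractionalIdeal.coeIdeal_ne_zero.2 hI
  refine ⟨g, ?_, ?_, hg⟩
  · rw [FractionalIdeal.mem_inv_iff hI0]
    intro z hz
    obtain ⟨z, hzI, rfl⟩ := (FractionalIdeal.mem_coeIdeal _).1 hz
    have h2 := (ha z).2 hzI
    obtain ⟨w, hw⟩ := Ideal.mem_span_singleton'.1 h2
    have h3 : u * algebraMap A K z = algebraMap A K w := by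
      rw [hu, div_mul_eq_mul_div, ← map_mul, ← hw, map_mul, mul_div_cancel_right₀ _ hdK]
    rw [FractionalIdeal.mem_one_iff]
    exact ⟨w * s y - b * z, by rw [hgu, map_sub, map_mul, map_mul, ← h3]; ring⟩
  · rintro rfl
    apply hsy
    rw [← ha]
    rw [add_zero] at hbg
    refine Ideal.mem_span_singleton'.2 ⟨b, ?_⟩
    apply IsFractionRing.injective A K
    rw [map_mul, map_mul]
    have : algebraMap A K b = u * algebraMap A K (s y) := hbg
    rw [this, hu]
    field_simp

theorem exists_sub_mem {M : FractionalIdeal A⁰ K} {g : K} (hg : g ∈ M) (hg0 : g ≠ 0)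
    (hgB : g ∈ F.B (-(F.N + 2))) (z : K) : ∃ m ∈ M, z - m ∈ F.B (-2) := by
  obtain ⟨a, ha⟩ := F.surj (z / g)
  refine ⟨a • g, M.val.smul_mem a hg, ?_⟩
  have := F.mul_mem hgB ha
  rw [mul_sub, mul_div_cancel₀ _ hg0] at this
  rw [Algebra.smul_def, mul_comm]
  convert! this using 2
  ring

theorem one_add_ne_zero {θ : K} (h : θ ∈ F.B (-1)) : 1 + θ ≠ 0 := by
  intro h0
  have h1 : algebraMap A K (-1) ∈ F.B (-1) := by
    rw [map_neg, map_one]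
    rwa [← eq_neg_of_add_eq_zero_right h0]
  have := F.eq_zero _ h1
  exact one_ne_zero (neg_eq_zero.1 this)

def IsOneUnit (η : K) : Prop := η - 1 ∈ F.B (-1)

variable {F}

theorem IsOneUnit.ne_zero {η : K} (h : F.IsOneUnit η) : η ≠ 0 := by
  have := F.one_add_ne_zero h
  rwa [add_sub_cancel] at this

theorem IsOneUnit.inv {η : K} (h : F.IsOneUnit η) : F.IsOneUnit η⁻¹ := by
  have := F.inv_sub_one_mem h
  rwa [add_sub_cancel] at this

theorem IsOneUnit.mul {η η' : K} (h : F.IsOneUnit η) (h' : F.IsOneUnit η') :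
    F.IsOneUnit (η * η') := by
  have h1 := F.mono (by norm_num : (-1 : ℤ) + (-1) ≤ -1) (F.mul_mem h h')
  have : η * η' - 1 = (η - 1) * (η' - 1) + (η - 1) + (η' - 1) := by ring
  rw [IsOneUnit, this]
  exact add_mem (add_mem h1 h) h'

theorem isOneUnit_one : F.IsOneUnit 1 := by
  rw [IsOneUnit, sub_self]; exact zero_mem _

theorem IsOneUnit.eq_one_of_mem {a : A} (h : F.IsOneUnit (algebraMap A K a)) : a = 1 :=
  sub_eq_zero.1 (F.eq_zero _ (by rwa [map_sub, map_one]))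

theorem IsOneUnit.mul_mem_of_mem {η b : K} {n : ℤ} (h : F.IsOneUnit η) (hb : b ∈ F.B n) :
    η * b ∈ F.B n := by
  have h1 := F.mono (by omega : (-1 : ℤ) + n ≤ n) (F.mul_mem h hb)
  have : η * b = (η - 1) * b + b := by ring
  rw [this]
  exact add_mem h1 hb

open FractionalIdeal

variable (F)

def Rel (M M' : FractionalIdeal A⁰ K) : Prop :=
  ∃ η, F.IsOneUnit η ∧ M' = spanSingleton A⁰ η * M

variable {F}

theorem Rel.refl (M : FractionalIdeal A⁰ K) : F.Rel M M :=
  ⟨1, isOneUnit_one, by simp⟩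

theorem Rel.symm {M M' : FractionalIdeal A⁰ K} (h : F.Rel M M') : F.Rel M' M := by
  obtain ⟨η, hη, rfl⟩ := h
  refine ⟨η⁻¹, hη.inv, ?_⟩
  rw [← mul_assoc, spanSingleton_mul_spanSingleton, inv_mul_cancel₀ hη.ne_zero, spanSingleton_one,
    one_mul]

theorem Rel.trans {M M' M'' : FractionalIdeal A⁰ K} (h : F.Rel M M') (h' : F.Rel M' M'') :
    F.Rel M M'' := by
  obtain ⟨η, hη, rfl⟩ := h
  obtain ⟨η', hη', rfl⟩ := h'
  exact ⟨η' * η, hη'.mul hη, by rw [← mul_assoc, spanSingleton_mul_spanSingleton]⟩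

theorem Rel.mul_left {M M' : FractionalIdeal A⁰ K} (P : FractionalIdeal A⁰ K) (h : F.Rel M M') :
    F.Rel (P * M) (P * M') := by
  obtain ⟨η, hη, rfl⟩ := h
  exact ⟨η, hη, by ring⟩

theorem exists_ideal_eq {M : FractionalIdeal A⁰ K} (hM : M ≠ 0) {η : K} (hη : η ∈ M⁻¹) :
    ∃ I : Ideal A, (I : FractionalIdeal A⁰ K) = spanSingleton A⁰ η * M := by
  refine le_one_iff_exists_coeIdeal.1 ?_
  rw [← inv_mul_cancel₀ hM]
  exact mul_le_mul_left (spanSingleton_le_iff_mem.2 hη) M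

theorem mem_inv_of_eq {M : FractionalIdeal A⁰ K} (hM : M ≠ 0) {η : K} {I : Ideal A}
    (h : (I : FractionalIdeal A⁰ K) = spanSingleton A⁰ η * M) : η ∈ M⁻¹ := by
  rw [← spanSingleton_le_iff_mem]
  have h1 : spanSingleton A⁰ η * M ≤ 1 := h ▸ coeIdeal_le_one
  calc spanSingleton A⁰ η = spanSingleton A⁰ η * M * M⁻¹ := by rw [mul_assoc, mul_inv_cancel₀ hM, mul_one]
    _ ≤ 1 * M⁻¹ := mul_le_mul_left h1 _
    _ = M⁻¹ := one_mul _

theorem eq_of_isOneUnit {M : FractionalIdeal A⁰ K} (hM : M ≠ 0) {η η' : K} (h : F.IsOneUnit η)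
    (h' : F.IsOneUnit η') (he : spanSingleton A⁰ η * M = spanSingleton A⁰ η' * M) : η = η' := by
  have h1 := mul_right_cancel₀ hM he
  have h2 : η ∈ spanSingleton A⁰ η' := h1 ▸ mem_spanSingleton_self A⁰ η
  obtain ⟨a, ha⟩ := (mem_spanSingleton A⁰).1 h2
  have h3 : algebraMap A K a = η * η'⁻¹ := by
    rw [← ha, Algebra.smul_def, mul_assoc, mul_inv_cancel₀ h'.ne_zero, mul_one]
  have h4 : F.IsOneUnit (algebraMap A K a) := h3 ▸ h.mul h'.inv
  rw [← ha, h4.eq_one_of_mem, one_smul]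

theorem span_mul_eq {I J : Ideal A} {c d : A} (hd : d ≠ 0)
    (h : (J : FractionalIdeal A⁰ K) =
      spanSingleton A⁰ (algebraMap A K c / algebraMap A K d) * I) :
    Ideal.span {c} * I = Ideal.span {d} * J := by
  rw [← IsFractionRing.mk'_eq_div (s := ⟨d, mem_nonZeroDivisors_of_ne_zero hd⟩)] at h
  exact (mk'_mul_coeIdeal_eq_coeIdeal K (mem_nonZeroDivisors_of_ne_zero hd)).1 h.symm

theorem Rel.ne_bot {I J : Ideal A} (h : F.Rel (I : FractionalIdeal A⁰ K) J) (hI : I ≠ ⊥) :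
    J ≠ ⊥ := by
  obtain ⟨η, hη, h⟩ := h
  rw [← coeIdeal_ne_zero (K := K), h]
  exact mul_ne_zero (spanSingleton_ne_zero_iff.2 hη.ne_zero) (coeIdeal_ne_zero.2 hI)

theorem Rel.finrank_eq {I J : Ideal A} (h : F.Rel (I : FractionalIdeal A⁰ K) J) (hI : I ≠ ⊥) :
    Module.finrank k (A ⧸ J) = Module.finrank k (A ⧸ I) := by
  have hJ := h.ne_bot hI
  obtain ⟨η, hη, h⟩ := h
  obtain ⟨c, d, hd, rfl⟩ := IsFractionRing.div_surjective (A := A) η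
  have hd := nonZeroDivisors.ne_zero hd
  have hc : c ≠ 0 := by
    rintro rfl
    exact hη.ne_zero (by simp)
  have h1 := span_mul_eq hd h
  have h2 := F.finrank_eq c d hc hd hη
  have hc' : Ideal.span {c} ≠ ⊥ := by rwa [Ne, Ideal.span_singleton_eq_bot]
  have hd' : Ideal.span {d} ≠ ⊥ := by rwa [Ne, Ideal.span_singleton_eq_bot]
  have h3 := (finrank_trace_quotient_mul k F.finite_ideal_quot x hc' hI).1
  have h4 := (finrank_trace_quotient_mul k F.finite_ideal_quot x hd' hJ).1
  rw [h1] at h3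
  omega

variable (F) in
theorem trace_eq_add {I J : Ideal A} {η : K} {s : k} (hI : I ≠ ⊥)
    (h : (J : FractionalIdeal A⁰ K) = spanSingleton A⁰ η * I)
    (hη : η - 1 - s • (algebraMap A K x)⁻¹ ∈ F.B (-2)) :
    Algebra.trace k (A ⧸ J) (Ideal.Quotient.mk _ x) =
      Algebra.trace k (A ⧸ I) (Ideal.Quotient.mk _ x) + F.e * s := by
  have h0 : F.IsOneUnit η := by
    have := add_mem (F.mono (by norm_num : (-2 : ℤ) ≤ -1) hη) ((F.B (-1)).smul_mem s F.x_inv_mem)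
    rwa [sub_add_cancel] at this
  have hJ : J ≠ ⊥ := Rel.ne_bot (F := F) ⟨η, h0, h⟩ hI
  obtain ⟨c, d, hd, rfl⟩ := IsFractionRing.div_surjective (A := A) η
  have hd := nonZeroDivisors.ne_zero hd
  have hc : c ≠ 0 := by
    rintro rfl
    exact h0.ne_zero (by simp)
  have h1 := span_mul_eq hd h
  have h2 := F.trace_eq c d s hc hd hη
  have hc' : Ideal.span {c} ≠ ⊥ := by rwa [Ne, Ideal.span_singleton_eq_bot]
  have hd' : Ideal.span {d} ≠ ⊥ := by rwa [Ne, Ideal.span_singleton_eq_bot]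
  have h3 := (finrank_trace_quotient_mul k F.finite_ideal_quot x hc' hI).2
  have h4 := (finrank_trace_quotient_mul k F.finite_ideal_quot x hd' hJ).2
  rw [h1] at h3
  rw [h3, h2] at h4
  linear_combination -h4

end InftyFilt

end

section

open nonZeroDivisors FractionalIdeal Finset

namespace InftyFilt

variable {k A K : Type*} [Field k] [CommRing A] [IsDedekindDomain A] [Algebra k A] [Field K]
    [Algebra A K] [Algebra k K] [IsScalarTower k A K] [IsFractionRing A K] {x : A}
    (F : InftyFilt k A K x)

open Classical in
noncomputable def toIdeal (M : FractionalIdeal A⁰ K) (η : K) : Ideal A :=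
  if h : ∃ I : Ideal A, (I : FractionalIdeal A⁰ K) = spanSingleton A⁰ η * M then h.choose else ⊥

theorem coe_toIdeal {M : FractionalIdeal A⁰ K} (hM : M ≠ 0) {η : K} (hη : η ∈ M⁻¹) :
    (toIdeal M η : FractionalIdeal A⁰ K) = spanSingleton A⁰ η * M := by
  have h := exists_ideal_eq hM hη
  rw [toIdeal, dif_pos h]
  exact h.choose_spec

def oneUnits (M : FractionalIdeal A⁰ K) : Set K := {η | F.IsOneUnit η ∧ η ∈ M⁻¹}

theorem bijOn_toIdeal {M : FractionalIdeal A⁰ K} (hM : M ≠ 0) :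
    Set.BijOn (toIdeal M) (F.oneUnits M) {I : Ideal A | F.Rel M I} := by
  refine ⟨fun η hη => ⟨η, hη.1, coe_toIdeal hM hη.2⟩, fun η hη η' hη' h => ?_, ?_⟩
  · refine eq_of_isOneUnit hM hη.1 hη'.1 ?_
    rw [← coe_toIdeal hM hη.2, ← coe_toIdeal hM hη'.2, h]
  · rintro I ⟨η, hη, h⟩
    have h1 := mem_inv_of_eq hM h
    exact ⟨η, ⟨hη, h1⟩, coeIdeal_injective (K := K) ((coe_toIdeal hM h1).trans h.symm)⟩

theorem finite_rel {M : FractionalIdeal A⁰ K} (hM : M ≠ 0) : {I : Ideal A | F.Rel M I}.Finite := by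
  rcases Set.eq_empty_or_nonempty {I : Ideal A | F.Rel M I} with h | ⟨I, hI⟩
  · rw [h]; exact Set.finite_empty
  have hI0 : I ≠ ⊥ := by
    obtain ⟨η, hη, h⟩ := hI
    rw [← coeIdeal_ne_zero (K := K), h]
    exact mul_ne_zero (spanSingleton_ne_zero_iff.2 hη.ne_zero) hM
  refine (F.finite_ideals (Module.finrank k (A ⧸ I))).subset fun J hJ => ?_
  have hIJ := (Rel.symm hI).trans hJ
  exact ⟨hIJ.ne_bot hI0, hIJ.finrank_eq hI0⟩

theorem finite_oneUnits {M : FractionalIdeal A⁰ K} (hM : M ≠ 0) : (F.oneUnits M).Finite :=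
  (F.bijOn_toIdeal hM).finite_iff_finite.2 (F.finite_rel hM)

noncomputable def ideals (n : ℕ) : Finset (Ideal A) := (F.finite_ideals n).toFinset

theorem mem_ideals {n : ℕ} {I : Ideal A} :
    I ∈ F.ideals n ↔ I ≠ ⊥ ∧ Module.finrank k (A ⧸ I) = n := by
  rw [ideals, Set.Finite.mem_toFinset]; rfl

noncomputable def char (ψ : AddChar k ℂ) (x : A) (I : Ideal A) : ℂ :=
  ψ (Algebra.trace k (A ⧸ I) (Ideal.Quotient.mk _ x))

def relSetoid : Setoid (Ideal A) where
  r I J := F.Rel (I : FractionalIdeal A⁰ K) J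
  iseqv := ⟨fun _ => Rel.refl _, fun h => h.symm, fun h h' => h.trans h'⟩

theorem sum_char_eq_zero {ψ : AddChar k ℂ} (hψ : ψ ≠ 1) {n : ℕ} (hn : F.codim < n) :
    ∑ I ∈ F.ideals n, char ψ x I = 0 := by
  classical
  refine Finset.sum_cancels_of_partition_cancels F.relSetoid fun I hI => ?_
  obtain ⟨hI0, hIn⟩ := F.mem_ideals.1 hI
  have hM : (I : FractionalIdeal A⁰ K) ≠ 0 := coeIdeal_ne_zero.2 hI0
  obtain ⟨t, ht⟩ : ∃ t, ψ (F.e * t) ≠ 1 := by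
    obtain ⟨y, hy⟩ := AddChar.ne_one_iff.1 hψ
    exact ⟨F.e⁻¹ * y, by rwa [mul_inv_cancel_left₀ F.e_ne]⟩
  obtain ⟨g, hg, hg0, hgB⟩ := F.exists_mem_inv hI0 (hIn ▸ hn)
  obtain ⟨θ, hθ, hθB⟩ := F.exists_sub_mem hg hg0 (F.mono (by omega) hgB) (t • (algebraMap A K x)⁻¹)
  have hθ1 : θ ∈ F.B (-1) := by
    have := sub_mem ((F.B (-1)).smul_mem t F.x_inv_mem) (F.mono (by norm_num : (-2 : ℤ) ≤ -1) hθB)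
    rwa [sub_sub_cancel] at this
  let E := (F.finite_oneUnits hM).toFinset
  have hE : ∀ η, η ∈ E ↔ η ∈ F.oneUnits (I : FractionalIdeal A⁰ K) := fun η =>
    Set.Finite.mem_toFinset _
  have hbij := F.bijOn_toIdeal hM
  have h1 : ∑ J ∈ F.ideals n with F.relSetoid.r J I, char ψ x J = ∑ η ∈ E, char ψ x (toIdeal I η) := by
    symm
    refine Finset.sum_bij (fun η _ => toIdeal I η) (fun η hη => ?_) (fun η hη η' hη' h => ?_)
      (fun J hJ => ?_) (fun η _ => rfl)
    · have h2 : F.Rel (I : FractionalIdeal A⁰ K) (toIdeal (I : FractionalIdeal A⁰ K) η) :=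
        hbij.mapsTo ((hE η).1 hη)
      rw [mem_filter, F.mem_ideals, h2.finrank_eq hI0]
      exact ⟨⟨h2.ne_bot hI0, hIn⟩, h2.symm⟩
    · exact hbij.injOn ((hE η).1 hη) ((hE η').1 hη') h
    · obtain ⟨η, hη, h⟩ := hbij.surjOn (show F.Rel _ _ from Rel.symm (mem_filter.1 hJ).2)
      exact ⟨η, (hE η).2 hη, h⟩
  have hadd : ∀ η ∈ F.oneUnits (I : FractionalIdeal A⁰ K), ∀ θ' ∈ (I : FractionalIdeal A⁰ K)⁻¹,
      θ' ∈ F.B (-1) → η + θ' ∈ F.oneUnits (I : FractionalIdeal A⁰ K) := by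
    rintro η ⟨h, h'⟩ θ' hθ' hB
    refine ⟨?_, Submodule.add_mem _ h' hθ'⟩
    rw [IsOneUnit, add_sub_right_comm]
    exact add_mem h hB
  have h2 : ∑ η ∈ E, char ψ x (toIdeal I (η + θ)) = ∑ η ∈ E, char ψ x (toIdeal I η) := by
    refine Finset.sum_nbij' (· + θ) (· - θ) (fun η hη => ?_) (fun η hη => ?_) (fun η _ => ?_)
      (fun η _ => ?_) (fun η _ => rfl)
    · exact (hE _).2 (hadd η ((hE η).1 hη) θ hθ hθ1)
    · rw [sub_eq_add_neg]
      exact (hE _).2 (hadd η ((hE η).1 hη) _ (Submodule.neg_mem _ hθ) (neg_mem hθ1))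
    · simp
    · simp
  have h3 : ∀ η ∈ E, char ψ x (toIdeal I (η + θ)) = ψ (F.e * t) * char ψ x (toIdeal I η) := by
    intro η hη
    rw [hE] at hη
    have hη0 := hη.1.ne_zero
    have h2 : F.Rel (I : FractionalIdeal A⁰ K) (toIdeal (I : FractionalIdeal A⁰ K) η) :=
        hbij.mapsTo hη
    have h4 : (toIdeal (I : FractionalIdeal A⁰ K) (η + θ) : FractionalIdeal A⁰ K) =
        spanSingleton A⁰ ((η + θ) * η⁻¹) * toIdeal (I : FractionalIdeal A⁰ K) η := by
      rw [coe_toIdeal hM hη.2, coe_toIdeal hM (hadd η hη θ hθ hθ1).2, ← mul_assoc,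
        spanSingleton_mul_spanSingleton, inv_mul_cancel_right₀ hη0]
    have h5 := F.trace_eq_add (s := t) (h2.ne_bot hI0) h4 (by
      have h6 := F.mono (by norm_num : (-1 : ℤ) + (-1) ≤ -2) (F.mul_mem hη.1.inv ((F.B (-1)).smul_mem t F.x_inv_mem))
      have h7 := hη.1.inv.mul_mem_of_mem hθB
      have : (η + θ) * η⁻¹ - 1 - t • (algebraMap A K x)⁻¹ =
        (η⁻¹ - 1) * (t • (algebraMap A K x)⁻¹) - η⁻¹ * (t • (algebraMap A K x)⁻¹ - θ) := by
        field_simp; ring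
      rw [this]
      exact sub_mem h6 h7)
    rw [char, h5, AddChar.map_add_eq_mul, mul_comm]; rfl
  have h8 : ∑ J ∈ F.ideals n with F.relSetoid.r J I, char ψ x J = 0 := by
    rw [h1]
    rw [sum_congr rfl h3, ← mul_sum] at h2
    have : (ψ (F.e * t) - 1) * ∑ η ∈ E, char ψ x (toIdeal I η) = 0 := by
      rw [sub_mul, h2]; ring
    exact (mul_eq_zero.1 this).resolve_left (sub_ne_zero.2 ht)
  exact h8

end InftyFilt

end

section

open nonZeroDivisors FractionalIdeal Finset

namespace InftyFilt

variable {k A K : Type*} [Field k] [CommRing A] [IsDedekindDomain A] [Algebra k A] [Field K]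
    [Algebra A K] [Algebra k K] [IsScalarTower k A K] [IsFractionRing A K] {x : A}
    (F : InftyFilt k A K x)

def smallPart (M : FractionalIdeal A⁰ K) : Set K := {θ | θ ∈ M⁻¹ ∧ θ ∈ F.B (-1)}

theorem ncard_rel_eq {M : FractionalIdeal A⁰ K} (hM : M ≠ 0) {I : Ideal A} (hI : F.Rel M I) :
    {J : Ideal A | F.Rel M J}.ncard = (F.smallPart M).ncard := by
  have h := F.bijOn_toIdeal hM
  obtain ⟨η, hη, -⟩ := h.surjOn hI
  rw [← h.image_eq, h.injOn.ncard_image]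
  symm
  refine Set.ncard_congr (fun θ _ => η + θ) (fun θ hθ => ?_) (fun a b _ _ hab => by simpa using hab)
    (fun ζ hζ => ⟨ζ - η, ⟨?_, ?_⟩, by simp⟩)
  · refine ⟨?_, Submodule.add_mem _ hη.2 hθ.1⟩
    rw [IsOneUnit, add_sub_right_comm]
    exact add_mem hη.1 hθ.2
  · exact Submodule.sub_mem _ hζ.2 hη.2
  · have := sub_mem hζ.1 hη.1
    rwa [sub_sub_sub_cancel_right] at this

theorem exists_add_algebraMap_mem {P : Ideal A} (hP1 : Module.finrank k (A ⧸ P) = 1) (y : A) :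
    ∃ c : k, y - algebraMap k A c ∈ P := by
  have : Nontrivial (A ⧸ P) := Module.nontrivial_of_finrank_pos (R := k) (by omega)
  obtain ⟨c, hc⟩ := (finrank_eq_one_iff_of_nonzero' (1 : A ⧸ P) one_ne_zero).1 hP1
    (Ideal.Quotient.mk P y)
  refine ⟨c, ?_⟩
  rw [← Ideal.Quotient.eq_zero_iff_mem, map_sub, sub_eq_zero, ← hc, Algebra.smul_def, mul_one]
  rfl

theorem ncard_smallPart_mul [Fintype k] {P : Ideal A} (hP : P.IsMaximal) (hP0 : P ≠ ⊥)
    (hP1 : Module.finrank k (A ⧸ P) = 1) {I : Ideal A} (hI : I ≠ ⊥)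
    (hn : F.codim < Module.finrank k (A ⧸ I)) :
    (F.smallPart ((P : FractionalIdeal A⁰ K) * I)).ncard =
      Fintype.card k * (F.smallPart (I : FractionalIdeal A⁰ K)).ncard := by
  set p : FractionalIdeal A⁰ K := (P : FractionalIdeal A⁰ K)
  set M : FractionalIdeal A⁰ K := (I : FractionalIdeal A⁰ K)
  have hp : p ≠ 0 := coeIdeal_ne_zero.2 hP0
  have hM : M ≠ 0 := coeIdeal_ne_zero.2 hI
  have hle : M⁻¹ ≤ (p * M)⁻¹ := by
    rw [mul_inv]
    calc M⁻¹ = 1 * M⁻¹ := (one_mul _).symm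
      _ ≤ p⁻¹ * M⁻¹ := mul_le_mul_left (by
        have : p ≤ 1 := coeIdeal_le_one
        calc 1 = p⁻¹ * p := (inv_mul_cancel₀ hp).symm
          _ ≤ p⁻¹ * 1 := mul_le_mul_right this _
          _ = p⁻¹ := mul_one _) _
  have hp1 : p ≠ 1 := by
    intro h
    rw [← coeIdeal_top] at h
    exact hP.ne_top (coeIdeal_injective (K := K) h)
  obtain ⟨t', ht', ht'M⟩ : ∃ t ∈ (p * M)⁻¹, t ∉ M⁻¹ := by
    by_contra! h
    have h1 : M⁻¹ = (p * M)⁻¹ := le_antisymm hle h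
    have h2 := inv_injective h1
    exact hp1 (mul_right_cancel₀ hM (h2.symm.trans (one_mul M).symm))
  obtain ⟨g, hg, hg0, hgB⟩ := F.exists_mem_inv hI hn
  obtain ⟨m, hm, hmB⟩ := F.exists_sub_mem hg hg0 (F.mono (by omega) hgB) t'
  set t := t' - m with ht
  have htB : t ∈ F.B (-1) := F.mono (by norm_num) hmB
  have htp : t ∈ (p * M)⁻¹ := Submodule.sub_mem _ ht' (hle hm)
  have htM : t ∉ M⁻¹ := fun h => ht'M (by
    have := Submodule.add_mem (M⁻¹ : FractionalIdeal A⁰ K).val h hm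
    rw [ht, sub_add_cancel] at this; exact this)
  have htP : ∀ π ∈ P, t * algebraMap A K π ∈ M⁻¹ := by
    intro π hπ
    have h1 : t * algebraMap A K π ∈ (p * M)⁻¹ * p := mul_mem_mul htp (mem_coeIdeal_of_mem _ hπ)
    rwa [mul_inv, mul_right_comm, inv_mul_cancel₀ hp, one_mul] at h1
  have hrep : ∀ m ∈ (p * M)⁻¹, ∃ c : k, m - c • t ∈ M⁻¹ := by
    have hlt : M⁻¹ ⊔ spanSingleton A⁰ t = (p * M)⁻¹ := by
      refine le_antisymm (sup_le hle (spanSingleton_le_iff_mem.2 htp)) ?_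
      set N := M⁻¹ ⊔ spanSingleton A⁰ t
      have hN : N ≤ (p * M)⁻¹ := sup_le hle (spanSingleton_le_iff_mem.2 htp)
      have h1 : N * (p * M) ≤ 1 := by
        rw [← inv_mul_cancel₀ (mul_ne_zero hp hM)]
        exact mul_le_mul_left hN _
      obtain ⟨Q, hQ⟩ := le_one_iff_exists_coeIdeal.1 h1
      have h2 : P ≤ Q := by
        rw [← coeIdeal_le_coeIdeal K, hQ]
        calc p = M⁻¹ * (p * M) := by rw [mul_left_comm, inv_mul_cancel₀ hM, mul_one]
          _ ≤ N * (p * M) := mul_le_mul_left le_sup_left _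
      rcases eq_or_ne Q ⊤ with h3 | h3'
      · rw [h3, coeIdeal_top] at hQ
        calc (p * M)⁻¹ = N * (p * M) * (p * M)⁻¹ := by rw [← hQ, one_mul]
          _ = N := by rw [mul_assoc, mul_inv_cancel₀ (mul_ne_zero hp hM), mul_one]
          _ ≤ N := le_rfl
      · exfalso
        have h3 : Q = P := (hP.eq_of_le h3' h2).symm
        have h4 : M⁻¹ * (p * M) = N * (p * M) := by
          rw [mul_left_comm, inv_mul_cancel₀ hM, mul_one, ← hQ, h3]
        have h5 := mul_right_cancel₀ (mul_ne_zero hp hM) h4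
        exact htM (by rw [h5]; exact spanSingleton_le_iff_mem.1 le_sup_right)
    intro m hm
    rw [← hlt, ← FractionalIdeal.mem_coe, coe_sup, Submodule.mem_sup] at hm
    obtain ⟨v, hv, w, hw, rfl⟩ := hm
    obtain ⟨y, rfl⟩ := (mem_spanSingleton A⁰).1 (FractionalIdeal.mem_coe.1 hw)
    obtain ⟨c, hc⟩ := exists_add_algebraMap_mem hP1 y
    refine ⟨c, ?_⟩
    have h1 := Submodule.add_mem _ hv (htP _ hc)
    have h2 : v + t * algebraMap A K (y - algebraMap k A c) = v + y • t - c • t := by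
      rw [map_sub, ← IsScalarTower.algebraMap_apply, Algebra.smul_def, Algebra.smul_def]; ring
    rw [h2] at h1
    exact h1
  have hsmul : ∀ c : k, c • t ∈ M⁻¹ → c = 0 := by
    intro c hc
    by_contra h0
    apply htM
    have h1 := Submodule.smul_mem (M⁻¹ : FractionalIdeal A⁰ K).val (algebraMap k A c⁻¹) hc
    rw [algebraMap_smul, smul_smul, inv_mul_cancel₀ h0, one_smul] at h1
    exact h1
  have hsmulp : ∀ c : k, c • t ∈ (p * M)⁻¹ := by
    intro c
    have h1 := Submodule.smul_mem ((p * M)⁻¹ : FractionalIdeal A⁰ K).val (algebraMap k A c) htp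
    rw [algebraMap_smul] at h1
    exact h1
  rw [← Nat.card_eq_fintype_card, ← Set.ncard_univ, ← Set.ncard_prod]
  symm
  refine Set.ncard_congr (fun cv _ => cv.1 • t + cv.2) (fun cv h => ⟨?_, ?_⟩)
    (fun a b ha hb hab => ?_) (fun m hm => ?_)
  · exact Submodule.add_mem _ (hsmulp _) (hle h.2.1)
  · exact add_mem ((F.B (-1)).smul_mem _ htB) h.2.2
  · have h1 : (a.1 - b.1) • t = b.2 - a.2 := by
      rw [sub_smul]; linear_combination hab
    have h2 : a.1 - b.1 = 0 := hsmul _ (by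
      rw [h1]; exact Submodule.sub_mem _ hb.2.1 ha.2.1)
    rw [h2, zero_smul] at h1
    exact Prod.ext (sub_eq_zero.1 h2) (sub_eq_zero.1 h1.symm).symm
  · obtain ⟨c, hc⟩ := hrep m hm.1
    exact ⟨(c, m - c • t), ⟨trivial, hc, sub_mem hm.2 ((F.B (-1)).smul_mem _ htB)⟩, by simp⟩

theorem card_ideals_succ [Fintype k] {P : Ideal A} (hP : P.IsMaximal) (hP0 : P ≠ ⊥)
    (hP1 : Module.finrank k (A ⧸ P) = 1) {n : ℕ} (hn : F.codim < n) :
    ((F.ideals (n + 1)).card : ℂ) = Fintype.card k * (F.ideals n).card := by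
  classical
  have hp : (P : FractionalIdeal A⁰ K) ≠ 0 := coeIdeal_ne_zero.2 hP0
  let c : FractionalIdeal A⁰ K → ℕ := fun M => {J : Ideal A | F.Rel M J}.ncard
  let r : Ideal A → Ideal A → Prop := fun I J =>
    F.Rel ((P : FractionalIdeal A⁰ K) * I) (J : FractionalIdeal A⁰ K)
  have hmul : ∀ I J : Ideal A, r I J ↔ F.Rel ((P * I : Ideal A) : FractionalIdeal A⁰ K) J := by
    intro I J; rw [coeIdeal_mul]
  have hfin : ∀ I : Ideal A, I ≠ ⊥ → Module.finrank k (A ⧸ (P * I)) =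
      Module.finrank k (A ⧸ I) + 1 := by
    intro I hI
    rw [(finrank_trace_quotient_mul k F.finite_ideal_quot x hP0 hI).1, hP1, add_comm]
  have hc : ∀ I ∈ F.ideals n, c ((P : FractionalIdeal A⁰ K) * I) =
      Fintype.card k * c (I : FractionalIdeal A⁰ K) := by
    intro I hI
    obtain ⟨hI0, hIn⟩ := F.mem_ideals.1 hI
    have hI0' : (I : FractionalIdeal A⁰ K) ≠ 0 := coeIdeal_ne_zero.2 hI0
    have h1 : F.Rel ((P : FractionalIdeal A⁰ K) * I) (P * I : Ideal A) := by
      rw [coeIdeal_mul]; exact Rel.refl _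
    change Set.ncard _ = _ * Set.ncard _
    rw [F.ncard_rel_eq (mul_ne_zero hp hI0') h1, F.ncard_rel_eq hI0' (Rel.refl _),
      F.ncard_smallPart_mul hP hP0 hP1 hI0 (hIn ▸ hn)]
  have hc0 : ∀ I ∈ F.ideals n, c (I : FractionalIdeal A⁰ K) ≠ 0 := by
    intro I hI
    have hI0' : (I : FractionalIdeal A⁰ K) ≠ 0 := coeIdeal_ne_zero.2 (F.mem_ideals.1 hI).1
    exact (Set.ncard_pos (F.finite_rel hI0')).2 ⟨I, Rel.refl _⟩ |>.ne'
  have hrow : ∀ I ∈ F.ideals n, ((F.ideals (n + 1)).filter (r I)).card =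
      c ((P : FractionalIdeal A⁰ K) * I) := by
    intro I hI
    obtain ⟨hI0, hIn⟩ := F.mem_ideals.1 hI
    rw [← Set.ncard_coe_finset]
    congr 1
    ext J
    simp only [coe_filter, F.mem_ideals, Set.mem_ofPred_eq]
    refine ⟨fun h => h.2, fun h => ⟨?_, h⟩⟩
    have h' := (hmul I J).1 h
    have hPI : P * I ≠ ⊥ := mul_ne_zero hP0 hI0
    exact ⟨h'.ne_bot hPI, by rw [h'.finrank_eq hPI, hfin I hI0, hIn]⟩
  have hcol : ∀ J ∈ F.ideals (n + 1), ∃ I ∈ F.ideals n, r I J := by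
    intro J hJ
    obtain ⟨hJ0, hJn⟩ := F.mem_ideals.1 hJ
    obtain ⟨g, hg, hg0, hgB⟩ := F.exists_mem_inv hJ0 (by omega)
    obtain ⟨a, ha⟩ := exists_add_algebraMap_mem hP1 x
    set y := x - algebraMap k A a with hy
    have hy0 : y ≠ 0 := F.x_sub_ne a
    have hyB : algebraMap A K y ∈ F.B 1 := by
      rw [hy, map_sub, ← IsScalarTower.algebraMap_apply k A K, Algebra.algebraMap_eq_smul_one (R := k)]
      exact sub_mem F.x_mem ((F.B 1).smul_mem _ (F.mono (by norm_num) F.one_mem))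
    have hJ0' : (J : FractionalIdeal A⁰ K) ≠ 0 := coeIdeal_ne_zero.2 hJ0
    set M : FractionalIdeal A⁰ K := (P : FractionalIdeal A⁰ K)⁻¹ * J with hM
    have hM0 : M ≠ 0 := mul_ne_zero (inv_ne_zero hp) hJ0'
    have hgy : algebraMap A K y * g ∈ M⁻¹ := by
      rw [hM, mul_inv, inv_inv]
      exact mul_mem_mul (mem_coeIdeal_of_mem _ ha) hg
    have hgy0 : algebraMap A K y * g ≠ 0 :=
      mul_ne_zero (by rwa [Ne, IsFractionRing.to_map_eq_zero_iff]) hg0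
    obtain ⟨m, hm, hmB⟩ := F.exists_sub_mem hgy hgy0
      (F.mono (by omega) (F.mul_mem hyB hgB)) 1
    have hm1 : F.IsOneUnit m := by
      have := neg_mem (F.mono (by norm_num : (-2 : ℤ) ≤ -1) hmB)
      rwa [neg_sub] at this
    obtain ⟨I, hI⟩ := exists_ideal_eq hM0 hm
    have hrel : F.Rel M I := ⟨m, hm1, hI⟩
    have h1 := (hrel.mul_left (P : FractionalIdeal A⁰ K)).symm
    have h0 : r I J := by
      have := h1.symm
      rw [hM, mul_inv_cancel_left₀ hp] at this
      exact this.symm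
    have hI0 : I ≠ ⊥ := by
      rw [← coeIdeal_ne_zero (K := K), hI]
      exact mul_ne_zero (spanSingleton_ne_zero_iff.2 hm1.ne_zero) hM0
    refine ⟨I, F.mem_ideals.2 ⟨hI0, ?_⟩, h0⟩
    have h2 := ((hmul I J).1 h0).finrank_eq (mul_ne_zero hP0 hI0)
    rw [hfin I hI0, hJn] at h2
    omega
  have hcolsum : ∀ J ∈ F.ideals (n + 1),
      ∑ I ∈ F.ideals n with r I J, (1 : ℂ) / c (I : FractionalIdeal A⁰ K) = 1 := by
    intro J hJ
    obtain ⟨I₀, hI₀, h₀⟩ := hcol J hJ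
    obtain ⟨hI0, hIn⟩ := F.mem_ideals.1 hI₀
    have hiff : ∀ I : Ideal A, r I J ↔ F.Rel (I₀ : FractionalIdeal A⁰ K) I := by
      intro I
      refine ⟨fun h => ?_, fun h => (h.mul_left _).symm.trans h₀⟩
      have := (Rel.trans h₀ h.symm).mul_left (P : FractionalIdeal A⁰ K)⁻¹
      rwa [inv_mul_cancel_left₀ hp, inv_mul_cancel_left₀ hp] at this
    have hset : (((F.ideals n).filter fun I => r I J : Finset (Ideal A)) : Set (Ideal A)) =
        {I : Ideal A | F.Rel (I₀ : FractionalIdeal A⁰ K) I} := by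
      ext I
      simp only [coe_filter, Set.mem_ofPred_eq, hiff, F.mem_ideals]
      exact ⟨fun h => h.2, fun h => ⟨⟨h.ne_bot hI0, (h.finrank_eq hI0).trans hIn⟩, h⟩⟩
    have hcard : ((F.ideals n).filter fun I => r I J).card = c (I₀ : FractionalIdeal A⁰ K) := by
      rw [← Set.ncard_coe_finset, hset]
    have hconst : ∀ I ∈ (F.ideals n).filter (fun I => r I J),
        (1 : ℂ) / c (I : FractionalIdeal A⁰ K) = 1 / c (I₀ : FractionalIdeal A⁰ K) := by
      intro I hI
      have h := (hiff I).1 (mem_filter.1 hI).2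
      have : {J : Ideal A | F.Rel (I : FractionalIdeal A⁰ K) J} =
          {J : Ideal A | F.Rel (I₀ : FractionalIdeal A⁰ K) J} := by
        ext J'
        exact ⟨fun h' => h.trans h', fun h' => h.symm.trans h'⟩
      change (1 : ℂ) / (Set.ncard _ : ℕ) = 1 / (Set.ncard _ : ℕ)
      rw [this]
    rw [sum_congr rfl hconst, sum_const, hcard, nsmul_eq_mul, mul_one_div_cancel]
    exact_mod_cast hc0 _ hI₀
  calc ((F.ideals (n + 1)).card : ℂ) = ∑ J ∈ F.ideals (n + 1), (1 : ℂ) := by simp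
    _ = ∑ J ∈ F.ideals (n + 1), ∑ I ∈ F.ideals n with r I J,
        (1 : ℂ) / c (I : FractionalIdeal A⁰ K) := (sum_congr rfl hcolsum).symm
    _ = ∑ I ∈ F.ideals n, ∑ J ∈ F.ideals (n + 1) with r I J,
        (1 : ℂ) / c (I : FractionalIdeal A⁰ K) := by
      simp only [sum_filter]; exact sum_comm
    _ = ∑ I ∈ F.ideals n, (Fintype.card k : ℂ) := by
      refine sum_congr rfl fun I hI => ?_
      rw [sum_const, hrow I hI, hc I hI, nsmul_eq_mul, Nat.cast_mul, mul_assoc,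
        mul_one_div_cancel (by exact_mod_cast hc0 I hI), mul_one]
    _ = Fintype.card k * (F.ideals n).card := by rw [sum_const, nsmul_eq_mul, mul_comm]

end InftyFilt

end

section

open nonZeroDivisors Finset

namespace InftyFilt

variable {k A K : Type*} [Field k] [CommRing A] [IsDedekindDomain A] [Algebra k A] [Field K]
    [Algebra A K] [Algebra k K] [IsScalarTower k A K] [IsFractionRing A K] {x : A}
    (F : InftyFilt k A K x)

open Classical in
noncomputable def primeSum (ψ : AddChar k ℂ) (n : ℕ) : ℂ :=
  ∑ y ∈ n.divisorsAntidiagonal, ∑ π ∈ F.ideals y.1 with Prime π, (y.1 : ℂ) * char ψ x π ^ y.2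

theorem eq_top_of_finrank_eq_zero (F : InftyFilt k A K x) {I : Ideal A} (hI : I ≠ ⊥)
    (h : Module.finrank k (A ⧸ I) = 0) : I = ⊤ := by
  have := F.finite_ideal_quot I hI
  have := Module.finrank_zero_iff.1 h
  exact Ideal.Quotient.subsingleton_iff.1 this

theorem exists_primeSum_eq [Fintype k] (ψ : AddChar k ℂ)
    (h : ψ = 1 → ∃ P : Ideal A, P.IsMaximal ∧ P ≠ ⊥ ∧ Module.finrank k (A ⧸ P) = 1) :
    ∃ s : Multiset ℂ, s.card ≤ F.codim + 1 ∧ ∀ n, 1 ≤ n →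
      F.primeSum ψ n = (if ψ = 1 then (Fintype.card k : ℂ) else 0) ^ n -
        (s.map fun ω => ω ^ n).sum := by
  classical
  have hone : char ψ x (1 : Ideal A) = 1 := by
    have : Subsingleton (A ⧸ (1 : Ideal A)) := Ideal.Quotient.subsingleton_iff.2 Ideal.one_eq_top
    rw [char, Subsingleton.elim (Ideal.Quotient.mk (1 : Ideal A) x) 0, map_zero, AddChar.map_zero_eq_one]
  refine exists_power_sums (fun n => ∑ I ∈ F.ideals n, char ψ x I) (F.primeSum ψ) ?_ ?_ _ _ ?_
  · have : F.ideals 0 = {1} := by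
      ext I
      rw [F.mem_ideals, mem_singleton]
      refine ⟨fun h => ?_, ?_⟩
      · rw [Ideal.one_eq_top]; exact F.eq_top_of_finrank_eq_zero h.1 h.2
      · rintro rfl
        refine ⟨one_ne_zero, ?_⟩
        have : Subsingleton (A ⧸ (1 : Ideal A)) := Ideal.Quotient.subsingleton_iff.2 Ideal.one_eq_top
        exact Module.finrank_zero_of_subsingleton
    simp only [this, sum_singleton, hone]
  · intro n
    refine mul_sum_eq_sum_primes (fun I : Ideal A => Module.finrank k (A ⧸ I)) (fun a b ha hb => ?_)
      (fun a ha ha1 => ?_) F.ideals (fun n a => F.mem_ideals) (char ψ x) (fun a b ha hb => ?_) hone n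
    · exact (finrank_trace_quotient_mul k F.finite_ideal_quot x ha hb).1
    · exact Nat.pos_of_ne_zero fun h0 => ha1 ((F.eq_top_of_finrank_eq_zero ha h0).trans Ideal.one_eq_top.symm)
    · rw [char, (finrank_trace_quotient_mul k F.finite_ideal_quot x ha hb).2,
        AddChar.map_add_eq_mul]; rfl
  · intro n hn
    by_cases hψ : ψ = 1
    · obtain ⟨P, hP, hP0, hP1⟩ := h hψ
      subst hψ
      have := F.card_ideals_succ hP hP0 hP1 (n := n) (by omega)
      simpa [char] using this
    · rw [if_neg hψ, zero_mul]
      exact F.sum_char_eq_zero hψ (by omega)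

end InftyFilt

end

section

open nonZeroDivisors Finset

theorem trace_algHom_eq {k κ L : Type*} [Field k] [Field κ] [Field L] [Algebra k κ] [Algebra k L]
    [Finite L] (f : κ →ₐ[k] L) {m : ℕ}
    (hm : Module.finrank k κ * m = Module.finrank k L) (x : κ) :
    Algebra.trace k L (f x) = m • Algebra.trace k κ x := by
  algebraize [f.toRingHom]
  have : FiniteDimensional κ L := Module.Finite.of_finite
  have : Finite κ := Finite.of_injective _ f.injective
  have : FiniteDimensional k κ := Module.Finite.of_finite
  have h1 : Algebra.trace k L (algebraMap κ L x) = _ :=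
    (Algebra.trace_trace (R := k) (S := κ) (T := L) _).symm
  have h2 := Module.finrank_mul_finrank k κ L
  have h3 : Module.finrank κ L = m :=
    Nat.eq_of_mul_eq_mul_left Module.finrank_pos (h2.trans hm.symm)
  rw [Algebra.trace_algebraMap, h3, map_nsmul] at h1
  exact h1

namespace InftyFilt

variable {k A K : Type*} [Field k] [CommRing A] [IsDedekindDomain A] [Algebra k A] [Field K]
    [Algebra A K] [Algebra k K] [IsScalarTower k A K] [IsFractionRing A K] {x : A}
    (F : InftyFilt k A K x)

theorem primeSum_eq [Finite k] [Infinite A] {L : Type*} [Field L] [Finite L] [Algebra k L]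
    [Fintype (A →ₐ[k] L)] (ψ : AddChar k ℂ) :
    F.primeSum ψ (Module.finrank k L) =
      ∑ φ : A →ₐ[k] L, ψ (Algebra.trace k L (φ x)) := by
  classical
  set n := Module.finrank k L with hn
  have : FiniteDimensional k L := Module.Finite.of_finite
  have hn0 : n ≠ 0 := Module.finrank_pos.ne'
  have hker0 : ∀ φ : A →ₐ[k] L, RingHom.ker φ ≠ ⊥ := fun φ h =>
    not_finite_iff_infinite.2 ‹Infinite A› (Finite.of_injective φ
      ((RingHom.injective_iff_ker_eq_bot φ).2 h))
  let deg : Ideal A → ℕ := fun I => Module.finrank k (A ⧸ I)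
  have hdvd : ∀ φ : A →ₐ[k] L, deg (RingHom.ker φ) ∣ n := by
    intro φ
    have hp : (RingHom.ker φ).IsPrime := RingHom.ker_isPrime φ
    have hmax := hp.isMaximal (hker0 φ)
    let : Field (A ⧸ RingHom.ker φ) := Ideal.Quotient.field _
    have := F.finite_ideal_quot _ (hker0 φ)
    have : Finite (A ⧸ RingHom.ker φ) := Module.finite_of_finite k
    exact FiniteField.nonempty_algHom_iff_finrank_dvd.1 ⟨Ideal.kerLiftAlg φ⟩
  let T := n.divisorsAntidiagonal.sigma fun y => (F.ideals y.1).filter Prime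
  let g : (A →ₐ[k] L) → (_ : ℕ × ℕ) × Ideal A := fun φ =>
    ⟨(deg (RingHom.ker φ), n / deg (RingHom.ker φ)), RingHom.ker φ⟩
  have hg : ∀ φ ∈ (univ : Finset (A →ₐ[k] L)), g φ ∈ T := by
    intro φ _
    have hp : (RingHom.ker φ).IsPrime := RingHom.ker_isPrime φ
    rw [mem_sigma, mem_filter, F.mem_ideals, Nat.mem_divisorsAntidiagonal]
    exact ⟨⟨Nat.mul_div_cancel' (hdvd φ), hn0⟩, ⟨hker0 φ, rfl⟩,
      Ideal.prime_of_isPrime (hker0 φ) hp⟩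
  rw [← sum_fiberwise_of_maps_to hg, sum_sigma, primeSum]
  refine sum_congr rfl fun y hy => sum_congr rfl fun π hπ => ?_
  obtain ⟨hyn, -⟩ := Nat.mem_divisorsAntidiagonal.1 hy
  obtain ⟨hπ1, hπ⟩ := mem_filter.1 hπ
  obtain ⟨hπ0, hπd⟩ := F.mem_ideals.1 hπ1
  have hpp : π.IsPrime := Ideal.isPrime_of_prime hπ
  have hmax := hpp.isMaximal hπ0
  let : Field (A ⧸ π) := Ideal.Quotient.field _
  have := F.finite_ideal_quot _ hπ0
  have : Finite (A ⧸ π) := Module.finite_of_finite k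
  have hd0 : y.1 ≠ 0 := by rintro h; rw [h, zero_mul] at hyn; exact hn0 hyn.symm
  have hfib : ∀ φ : A →ₐ[k] L, g φ = ⟨y, π⟩ ↔ RingHom.ker φ = π := by
    intro φ
    constructor
    · intro h
      exact eq_of_heq (Sigma.mk.inj h).2
    · rintro rfl
      refine Sigma.ext (Prod.ext hπd ?_) HEq.rfl
      change n / Module.finrank k _ = _
      rw [hπd, ← hyn, Nat.mul_div_cancel_left _ (Nat.pos_of_ne_zero hd0)]
  have hval : ∀ φ ∈ (univ : Finset (A →ₐ[k] L)).filter (fun φ => g φ = ⟨y, π⟩),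
      ψ (Algebra.trace k L (φ x)) = char ψ x π ^ y.2 := by
    intro φ hφ
    have hk := (hfib φ).1 (mem_filter.1 hφ).2
    subst hk
    have h1 := trace_algHom_eq (Ideal.kerLiftAlg φ) (m := y.2) (by rw [hπd, hyn])
      (Ideal.Quotient.mk _ x)
    have h2 : Ideal.kerLiftAlg φ (Ideal.Quotient.mk _ x) = φ x := rfl
    rw [h2] at h1
    rw [h1, AddChar.map_nsmul_eq_pow]; rfl
  have hcard : ((univ : Finset (A →ₐ[k] L)).filter (fun φ => g φ = ⟨y, π⟩)).card = y.1 := by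
    have h1 : Nat.card ((A ⧸ π) →ₐ[k] L) = y.1 := by
      rw [FiniteField.natCard_algHom_of_finrank_dvd, hπd]
      rw [hπd, ← hn, ← hyn]; exact dvd_mul_right _ _
    rw [← h1, ← Fintype.card_coe, ← Nat.card_eq_fintype_card]
    refine Nat.card_congr ⟨fun φ => Ideal.Quotient.liftₐ π φ.1 fun a ha => ?_,
      fun f => ⟨f.comp (Ideal.Quotient.mkₐ k π), ?_⟩, fun φ => ?_, fun f => ?_⟩
    · have hk := (hfib φ.1).1 (mem_filter.1 φ.2).2
      rw [← hk] at ha; exact ha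
    · rw [mem_filter, hfib]
      refine ⟨mem_univ _, ?_⟩
      ext a
      rw [RingHom.mem_ker, AlgHom.comp_apply, map_eq_zero_iff f (RingHom.injective (f : (A ⧸ π) →+* L))]
      exact Ideal.Quotient.eq_zero_iff_mem
    · ext a; rfl
    · apply Ideal.Quotient.algHom_ext
      ext a; rfl
  rw [sum_congr rfl hval, sum_const, hcard, nsmul_eq_mul]

end InftyFilt

end

section

open Polynomial nonZeroDivisors

variable {k : Type*} [Field k] (F : k[X][X])

/-- The generic fibre of `F`. -/
noncomputable abbrev genF : (RatFunc k)[X] := F.map (algebraMap k[X] (RatFunc k))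

/-- The function field of the plane curve `F = 0`. -/
noncomputable abbrev FunField := AdjoinRoot (genF F)

/-- The coordinate ring of the normalisation of the plane curve `F = 0`. -/
noncomputable abbrev CoordRing [Fact (Irreducible (genF F))] := integralClosure k[X] (FunField F)

variable {F}

theorem natDegree_genF : (genF F).natDegree = F.natDegree :=
  natDegree_map_eq_of_injective (RatFunc.algebraMap_injective k) _

theorem isSeparable_adjoinRoot {K : Type*} [Field K] (f : K[X]) [Fact (Irreducible f)]
    (hf : f.Separable) : Algebra.IsSeparable K (AdjoinRoot f) := by
  have hf0 : f ≠ 0 := (Fact.out : Irreducible f).ne_zero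
  have h1 : IsSeparable K (AdjoinRoot.root f) :=
    hf.of_dvd (minpoly.dvd K _ (by rw [AdjoinRoot.aeval_eq, AdjoinRoot.mk_self]))
  have h2 := (IntermediateField.isSeparable_adjoin_simple_iff_isSeparable _ _).2 h1
  have htop : IntermediateField.adjoin K {AdjoinRoot.root f} = ⊤ := by
    rw [← IntermediateField.toSubalgebra_inj, IntermediateField.top_toSubalgebra, eq_top_iff,
      ← AdjoinRoot.adjoinRoot_eq_top]
    exact IntermediateField.algebra_adjoin_le_adjoin K _
  rw [htop] at h2
  exact AlgEquiv.Algebra.isSeparable (IntermediateField.topEquiv (F := K) (E := AdjoinRoot f))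

theorem separable_of_natDegree_ne_zero {K : Type*} [Field K] {f : K[X]} (hf : Irreducible f)
    (h : (f.natDegree : K) ≠ 0) : f.Separable := by
  rw [separable_iff_derivative_ne_zero hf]
  intro h0
  have h1 := congrArg (fun g => g.coeff (f.natDegree - 1)) h0
  have hd : f.natDegree ≠ 0 := fun h' => h (by rw [h', Nat.cast_zero])
  simp only [coeff_derivative, coeff_zero] at h1
  rw [Nat.sub_add_cancel (Nat.one_le_iff_ne_zero.2 hd)] at h1
  have h2 : ((f.natDegree - 1 : ℕ) : K) + 1 = f.natDegree := by
    rw [Nat.cast_sub (Nat.one_le_iff_ne_zero.2 hd), Nat.cast_one, sub_add_cancel]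
  rw [h2] at h1
  exact mul_ne_zero (leadingCoeff_ne_zero.2 hf.ne_zero) h h1

variable [hirr : Fact (Irreducible (genF F))]

instance : FiniteDimensional (RatFunc k) (FunField F) :=
  (AdjoinRoot.powerBasis (Fact.out : Irreducible (genF F)).ne_zero).finite

theorem isSeparable_funField (he : (F.natDegree : k) ≠ 0) :
    Algebra.IsSeparable (RatFunc k) (FunField F) := by
  refine isSeparable_adjoinRoot _ (separable_of_natDegree_ne_zero Fact.out ?_)
  rw [natDegree_genF]
  rwa [← map_natCast (algebraMap k (RatFunc k)), Ne,
    map_eq_zero_iff _ (algebraMap k (RatFunc k)).injective]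

theorem finrank_funField : Module.finrank (RatFunc k) (FunField F) = F.natDegree := by
  rw [(AdjoinRoot.powerBasis (Fact.out : Irreducible (genF F)).ne_zero).finrank,
    AdjoinRoot.powerBasis_dim, natDegree_genF]

instance : IsFractionRing (CoordRing F) (FunField F) :=
  IsIntegralClosure.isFractionRing_of_finite_extension k[X] (RatFunc k) (FunField F) _

theorem algebraMap_funField_injective : Function.Injective (algebraMap k[X] (FunField F)) := by
  rw [IsScalarTower.algebraMap_eq k[X] (RatFunc k) (FunField F)]
  exact (algebraMap (RatFunc k) (FunField F)).injective.comp (RatFunc.algebraMap_injective k)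

instance : Module.IsTorsionFree k[X] (FunField F) :=
  Module.isTorsionFree_iff_algebraMap_injective.2 algebraMap_funField_injective

theorem isDedekindDomain_coordRing (he : (F.natDegree : k) ≠ 0) :
    IsDedekindDomain (CoordRing F) := by
  have := isSeparable_funField he
  exact integralClosure.isDedekindDomain k[X] (RatFunc k) (FunField F)

theorem finite_coordRing (he : (F.natDegree : k) ≠ 0) : Module.Finite k[X] (CoordRing F) := by
  have := isSeparable_funField he
  exact IsIntegralClosure.finite k[X] (RatFunc k) (FunField F) _

theorem free_coordRing (he : (F.natDegree : k) ≠ 0) : Module.Free k[X] (CoordRing F) := by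
  have := isSeparable_funField he
  exact IsIntegralClosure.module_free k[X] (RatFunc k) (FunField F) _

theorem algebraMap_norm_coordRing (he : (F.natDegree : k) ≠ 0) (a : CoordRing F) :
    algebraMap k[X] (RatFunc k) (Algebra.norm k[X] a) =
      Algebra.norm (RatFunc k) (algebraMap (CoordRing F) (FunField F) a) := by
  have := free_coordRing he
  have := finite_coordRing he
  have := IsIntegralClosure.isLocalization k[X] (RatFunc k) (FunField F) (CoordRing F)
  exact (Algebra.norm_localization k[X] k[X]⁰ a).symm

end

section

open Polynomial nonZeroDivisors

variable {k : Type*} [Field k] {F : k[X][X]}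

theorem good_genF (hG : (DegFilt.deg k).Good 2 F) : (ratDeg k).Good 2 (genF F) := by
  intro i
  have h := hG i
  rw [DegFilt.mem_deg] at h
  rw [coeff_map, natDegree_genF, algebraMap_mem_ratDeg]
  by_contra! hcon
  exact hcon.1 (leadingCoeff_eq_zero.1 (h _ hcon.2))

variable [hirr : Fact (Irreducible (genF F))]

variable (F) in
/-- The filtration of the function field by the order of the poles at infinity. -/
noncomputable def inftyB (n : ℤ) : Submodule k (FunField F) :=
  { ((ratDeg k).adj 2 (genF F)).D n with
    smul_mem' := by
      intro a z hz
      have h := ((ratDeg k).adj 2 (genF F)).mul_mem (DegFilt.of_mem_adj (ratDeg_C a)) hz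
      rw [zero_add] at h
      rw [Algebra.smul_def]
      exact h }

theorem inftyB_mono {m n : ℤ} (h : m ≤ n) : inftyB F m ≤ inftyB F n :=
  fun _ hz => ((ratDeg k).adj 2 (genF F)).mono h hz

theorem mul_mem_inftyB {m n l : ℤ} {y z : FunField F} (hy : y ∈ inftyB F m) (hz : z ∈ inftyB F n)
    (h : m + n ≤ l) : y * z ∈ inftyB F l :=
  inftyB_mono h (((ratDeg k).adj 2 (genF F)).mul_mem hy hz)

theorem one_mem_inftyB : (1 : FunField F) ∈ inftyB F 0 := ((ratDeg k).adj 2 (genF F)).one_mem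

theorem exists_eq_sum (hF : F.Monic) (z : FunField F) : ∃ f : Fin F.natDegree → RatFunc k,
    z = ∑ i, algebraMap (RatFunc k) (FunField F) (f i) * AdjoinRoot.root (genF F) ^ (i : ℕ) := by
  have hF' : (genF F).Monic := hF.map _
  refine ⟨fun i => (AdjoinRoot.modByMonicHom hF' z).coeff i, ?_⟩
  have h1 : AdjoinRoot.mk (genF F) (AdjoinRoot.modByMonicHom hF' z) = z :=
    AdjoinRoot.mk_leftInverse hF' z
  have hdeg : (AdjoinRoot.modByMonicHom hF' z).natDegree < F.natDegree := by
    obtain ⟨P, rfl⟩ := AdjoinRoot.mk_surjective z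
    rw [AdjoinRoot.modByMonicHom_mk, ← natDegree_genF]
    exact natDegree_modByMonic_lt _ hF' fun h => hirr.out.not_isUnit (h ▸ isUnit_one)
  conv_lhs => rw [← h1, as_sum_range_C_mul_X_pow' _ hdeg]
  rw [map_sum, ← Fin.sum_univ_eq_sum_range (fun i => AdjoinRoot.mk (genF F) (C _ * X ^ i))]
  refine Finset.sum_congr rfl fun i _ => ?_
  rw [map_mul, map_pow, AdjoinRoot.mk_C, AdjoinRoot.mk_X]
  rfl

theorem algebraMap_mul_root_pow_mem {n : ℤ} {f : RatFunc k} (hf : f ∈ (ratDeg k).D n) (i : ℕ) :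
    algebraMap (RatFunc k) (FunField F) f * AdjoinRoot.root (genF F) ^ i ∈ inftyB F (n + 2 * i) := by
  have h := ((ratDeg k).adj 2 (genF F)).mul_mem (DegFilt.of_mem_adj hf)
    (((ratDeg k).adj 2 (genF F)).pow_mem (DegFilt.root_mem_adj (c := 2) (F := genF F)) i)
  rw [mul_comm (i : ℤ)] at h
  exact h

theorem isIntegral_root_genF (hF : F.Monic) : IsIntegral k[X] (AdjoinRoot.root (genF F)) := by
  refine ⟨F, hF, ?_⟩
  have := AdjoinRoot.eval₂_root (genF F)
  rwa [eval₂_map] at this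

theorem exists_mem_inftyB (hF : F.Monic) (z : FunField F) : ∃ n : ℕ, z ∈ inftyB F n := by
  obtain ⟨f, rfl⟩ := exists_eq_sum hF z
  have : ∀ i, ∃ n : ℕ, f i ∈ (ratDeg k).D n := fun i =>
    ⟨(f i).intDegree.toNat, Or.inr (Int.self_le_toNat _)⟩
  choose n hn using this
  refine ⟨∑ i, (n i + 2 * i), Submodule.sum_mem _ fun i _ => ?_⟩
  have h := algebraMap_mul_root_pow_mem (F := F) (hn i) i
  refine inftyB_mono ?_ h
  exact_mod_cast Finset.single_le_sum (f := fun i : Fin F.natDegree => n i + 2 * (i : ℕ))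
    (fun _ _ => Nat.zero_le _) (Finset.mem_univ i)

theorem norm_mem_ratDeg (hF : F.Monic) (hG : (DegFilt.deg k).Good 2 F) {n : ℤ} {z : FunField F}
    (hz : z ∈ inftyB F n) : Algebra.norm (RatFunc k) z ∈ (ratDeg k).D (F.natDegree * n) := by
  have h := DegFilt.norm_mem (hF.map _) (good_genF hG) hz
  rwa [natDegree_genF] at h

theorem eq_zero_of_mem_inftyB (hF : F.Monic) (hG : (DegFilt.deg k).Good 2 F)
    (he : (F.natDegree : k) ≠ 0) (a : CoordRing F)
    (ha : algebraMap (CoordRing F) (FunField F) a ∈ inftyB F (-1)) : a = 0 := by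
  have hd : F.natDegree ≠ 0 := fun h' => he (by rw [h', Nat.cast_zero])
  have h := norm_mem_ratDeg hF hG ha
  rw [← algebraMap_norm_coordRing he, algebraMap_mem_ratDeg] at h
  have h0 : Algebra.norm k[X] a = 0 := h.resolve_right (by omega)
  have := free_coordRing he
  have := finite_coordRing he
  exact Algebra.norm_eq_zero_iff.1 h0

theorem one_add_ne_zero_of_mem_inftyB (hF : F.Monic) (hG : (DegFilt.deg k).Good 2 F)
    (he : (F.natDegree : k) ≠ 0) {θ : FunField F} (hθ : θ ∈ inftyB F (-1)) : 1 + θ ≠ 0 := by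
  intro h0
  have h1 : algebraMap (CoordRing F) (FunField F) (-1) ∈ inftyB F (-1) := by
    rwa [map_neg, map_one, show (-1 : FunField F) = θ by linear_combination -h0]
  have h2 := eq_zero_of_mem_inftyB hF hG he _ h1
  rw [neg_eq_zero] at h2
  exact one_ne_zero h2

theorem inv_sub_one_mem_inftyB (hF : F.Monic) (hG : (DegFilt.deg k).Good 2 F)
    (he : (F.natDegree : k) ≠ 0) {θ : FunField F} (hθ : θ ∈ inftyB F (-1)) :
    (1 + θ)⁻¹ - 1 ∈ inftyB F (-1) := by
  have h0 := one_add_ne_zero_of_mem_inftyB hF hG he hθ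
  have hu1 := mul_inv_cancel₀ h0
  generalize (1 + θ)⁻¹ = u at hu1 ⊢
  have hu : u - 1 = -(θ * u) := by linear_combination hu1
  have key : ∀ n : ℕ, u ∈ inftyB F n → u ∈ inftyB F 0 := by
    intro n
    induction n with
    | zero => exact fun h => h
    | succ n ih =>
      intro h
      apply ih
      have h1 : θ * u ∈ inftyB F n := mul_mem_inftyB hθ h (by push_cast; omega)
      have h2 : (1 : FunField F) ∈ inftyB F n := inftyB_mono (by omega) one_mem_inftyB
      have h3 := Submodule.sub_mem _ h2 h1
      rwa [show 1 - θ * u = u by linear_combination -hu] at h3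
  obtain ⟨n, hn⟩ := exists_mem_inftyB hF u
  rw [hu]
  exact Submodule.neg_mem _ (mul_mem_inftyB hθ (key n hn) (by omega))

/-- The integral elements with prescribed polynomial coordinates. -/
theorem exists_coordRing_eq (hF : F.Monic) (P : Fin F.natDegree → k[X]) : ∃ a : CoordRing F,
    algebraMap (CoordRing F) (FunField F) a = ∑ i, algebraMap (RatFunc k) (FunField F)
      (algebraMap k[X] (RatFunc k) (P i)) * AdjoinRoot.root (genF F) ^ (i : ℕ) := by
  refine ⟨∑ i, algebraMap k[X] _ (P i) * ⟨AdjoinRoot.root (genF F), isIntegral_root_genF hF⟩ ^ (i : ℕ), ?_⟩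
  simp only [map_sum, map_mul, map_pow]
  rfl

theorem surj_inftyB (hF : F.Monic) (z : FunField F) : ∃ a : CoordRing F,
    z - algebraMap (CoordRing F) (FunField F) a ∈ inftyB F ((2 * F.natDegree : ℕ) : ℤ) := by
  obtain ⟨f, rfl⟩ := exists_eq_sum hF z
  choose P hP using fun i => exists_polynomial_sub_mem (f i)
  obtain ⟨a, ha⟩ := exists_coordRing_eq hF P
  refine ⟨a, ?_⟩
  rw [ha, ← Finset.sum_sub_distrib]
  refine Submodule.sum_mem _ fun i _ => ?_
  rw [← sub_mul, ← map_sub]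
  refine inftyB_mono ?_ (algebraMap_mul_root_pow_mem (hP i) i)
  have := i.2
  push_cast; omega

theorem quot_inftyB (hF : F.Monic) :
    FiniteDimensional k (FunField F ⧸
      (LinearMap.range (IsScalarTower.toAlgHom k (CoordRing F) (FunField F)).toLinearMap ⊔
        inftyB F (-(((2 * F.natDegree : ℕ) : ℤ) + 3)))) ∧
    Module.finrank k (FunField F ⧸
      (LinearMap.range (IsScalarTower.toAlgHom k (CoordRing F) (FunField F)).toLinearMap ⊔
        inftyB F (-(((2 * F.natDegree : ℕ) : ℤ) + 3)))) ≤ 4 * F.natDegree ^ 2 := by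
  set W := LinearMap.range (IsScalarTower.toAlgHom k (CoordRing F) (FunField F)).toLinearMap ⊔
    inftyB F (-(((2 * F.natDegree : ℕ) : ℤ) + 3)) with hW
  let b : Fin F.natDegree × Fin (4 * F.natDegree) → FunField F ⧸ W := fun t =>
    W.mkQ (algebraMap (RatFunc k) (FunField F) (RatFunc.X ^ (-((t.2 : ℕ) : ℤ) - 1)) *
      AdjoinRoot.root (genF F) ^ (t.1 : ℕ))
  have hspan : (⊤ : Submodule k (FunField F ⧸ W)) = Submodule.span k (Set.range b) := by
    symm
    rw [eq_top_iff]
    rintro y -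
    obtain ⟨z, rfl⟩ := W.mkQ_surjective y
    obtain ⟨f, rfl⟩ := exists_eq_sum hF z
    choose P c hP using fun i => exists_polynomial_sub_sum_mem (4 * F.natDegree) (f i)
    obtain ⟨a, ha⟩ := exists_coordRing_eq hF P
    have hmem : (∑ i, algebraMap (RatFunc k) (FunField F) (f i) * AdjoinRoot.root (genF F) ^ (i : ℕ)) -
        ∑ i, ∑ l, c i l • (algebraMap (RatFunc k) (FunField F) (RatFunc.X ^ (-((l : ℕ) : ℤ) - 1)) *
          AdjoinRoot.root (genF F) ^ (i : ℕ)) ∈ W := by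
      have h1 : algebraMap (CoordRing F) (FunField F) a ∈ W :=
        Submodule.mem_sup_left ⟨a, rfl⟩
      have h2 : (∑ i, algebraMap (RatFunc k) (FunField F) (f i) * AdjoinRoot.root (genF F) ^ (i : ℕ)) -
        (∑ i, ∑ l, c i l • (algebraMap (RatFunc k) (FunField F) (RatFunc.X ^ (-((l : ℕ) : ℤ) - 1)) *
          AdjoinRoot.root (genF F) ^ (i : ℕ))) - algebraMap (CoordRing F) (FunField F) a ∈ W := by
        refine Submodule.mem_sup_right ?_
        rw [ha, ← Finset.sum_sub_distrib, ← Finset.sum_sub_distrib]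
        refine Submodule.sum_mem _ fun i _ => ?_
        have h3 := algebraMap_mul_root_pow_mem (F := F) (hP i) i
        have h4 : algebraMap (RatFunc k) (FunField F) (f i) * AdjoinRoot.root (genF F) ^ (i : ℕ) -
            (∑ l, c i l • (algebraMap (RatFunc k) (FunField F) (RatFunc.X ^ (-((l : ℕ) : ℤ) - 1)) *
              AdjoinRoot.root (genF F) ^ (i : ℕ))) - algebraMap (RatFunc k) (FunField F)
              (algebraMap k[X] (RatFunc k) (P i)) * AdjoinRoot.root (genF F) ^ (i : ℕ) =
            algebraMap (RatFunc k) (FunField F) (f i - algebraMap k[X] (RatFunc k) (P i) -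
              ∑ l, c i l • RatFunc.X ^ (-((l : ℕ) : ℤ) - 1)) * AdjoinRoot.root (genF F) ^ (i : ℕ) := by
          have h5 : ∀ l : Fin (4 * F.natDegree), algebraMap (RatFunc k) (FunField F)
              (c i l • RatFunc.X ^ (-((l : ℕ) : ℤ) - 1)) =
              c i l • algebraMap (RatFunc k) (FunField F) (RatFunc.X ^ (-((l : ℕ) : ℤ) - 1)) := by
            intro l
            rw [Algebra.smul_def, Algebra.smul_def, map_mul,
              ← IsScalarTower.algebraMap_apply k (RatFunc k) (FunField F)]
          simp only [map_sub, map_sum, h5, sub_mul, Finset.sum_mul, smul_mul_assoc]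
          ring
        rw [h4]
        refine inftyB_mono ?_ h3
        have := i.2
        push_cast; omega
      have := W.add_mem h2 h1
      rwa [sub_add_cancel] at this
    rw [← W.ker_mkQ, LinearMap.mem_ker, map_sub, sub_eq_zero] at hmem
    rw [hmem]
    simp only [map_sum, map_smul]
    exact Submodule.sum_mem _ fun i _ => Submodule.sum_mem _ fun l _ =>
      Submodule.smul_mem _ _ (Submodule.subset_span ⟨(i, l), rfl⟩)
  constructor
  · exact ⟨hspan ▸ Submodule.fg_span (Set.finite_range b)⟩
  · rw [← finrank_top, hspan]
    refine (finrank_range_le_card b).trans ?_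
    rw [Fintype.card_prod, Fintype.card_fin, Fintype.card_fin]
    exact le_of_eq (by ring)

end

section

open Polynomial nonZeroDivisors

variable {k : Type*} [Field k]

theorem natDegree_eq_of_div_sub_one_mem {P Q : k[X]} (hP : P ≠ 0) (hQ : Q ≠ 0)
    (h : algebraMap k[X] (RatFunc k) P / algebraMap k[X] (RatFunc k) Q - 1 ∈ (ratDeg k).D (-1)) :
    P.natDegree = Q.natDegree := by
  have hPR : algebraMap k[X] (RatFunc k) P ≠ 0 := RatFunc.algebraMap_ne_zero hP
  have hQR : algebraMap k[X] (RatFunc k) Q ≠ 0 := RatFunc.algebraMap_ne_zero hQ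
  have h1 := (ratDeg k).mul_mem h (algebraMap_mem_ratDeg.2 (Or.inr (le_refl (Q.natDegree : ℤ))))
  rw [sub_mul, div_mul_cancel₀ _ hQR, one_mul, ← map_sub, algebraMap_mem_ratDeg] at h1
  have h2 : P - Q = 0 ∨ (P - Q).natDegree < Q.natDegree := by
    refine h1.imp id fun h => by omega
  rcases h2 with h2 | h2
  · rw [sub_eq_zero.1 h2]
  · have := natDegree_add_eq_right_of_natDegree_lt h2
    rwa [sub_add_cancel] at this

theorem nextCoeff_eq_of_div_sub_one_sub_mem {P Q : k[X]} {t : k} (hP : P ≠ 0) (hQ : Q ≠ 0)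
    (h : algebraMap k[X] (RatFunc k) P / algebraMap k[X] (RatFunc k) Q - 1 -
      t • (RatFunc.X : RatFunc k)⁻¹ ∈ (ratDeg k).D (-2)) :
    P.leadingCoeff = Q.leadingCoeff ∧ P.nextCoeff = Q.nextCoeff + t * Q.leadingCoeff := by
  have hX : (RatFunc.X : RatFunc k) ≠ 0 := RatFunc.X_ne_zero
  have hPR : algebraMap k[X] (RatFunc k) P ≠ 0 := RatFunc.algebraMap_ne_zero hP
  have hQR : algebraMap k[X] (RatFunc k) Q ≠ 0 := RatFunc.algebraMap_ne_zero hQ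
  have h0 := (ratDeg k).mul_mem h (algebraMap_mem_ratDeg.2
    (Or.inr (le_refl ((X * Q : k[X]).natDegree : ℤ))))
  have h1 : (algebraMap k[X] (RatFunc k) P / algebraMap k[X] (RatFunc k) Q - 1 -
      t • (RatFunc.X : RatFunc k)⁻¹) * algebraMap k[X] (RatFunc k) (X * Q) =
      algebraMap k[X] (RatFunc k) (X * P - X * Q - C t * Q) := by
    rw [Algebra.smul_def]
    simp only [map_sub, map_mul, RatFunc.algebraMap_X, RatFunc.algebraMap_C,
      RatFunc.algebraMap_eq_C]
    field_simp
  rw [h1, natDegree_X_mul hQ, algebraMap_mem_ratDeg] at h0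
  have h2 : ∀ i, Q.natDegree ≤ i → (X * P - X * Q - C t * Q).coeff i = 0 := by
    intro i hi
    rcases h0 with h0 | h0
    · rw [h0, coeff_zero]
    · exact coeff_eq_zero_of_natDegree_lt (by push_cast at h0; omega)
  have h3 : ∀ i, Q.natDegree ≤ i + 1 → P.coeff i = Q.coeff i + t * Q.coeff (i + 1) := by
    intro i hi
    have := h2 (i + 1) hi
    simp only [coeff_sub, coeff_X_mul, coeff_C_mul] at this
    linear_combination this
  have hn : P.natDegree = Q.natDegree := by
    apply le_antisymm
    · refine natDegree_le_iff_coeff_eq_zero.2 fun i hi => ?_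
      rw [h3 i (by omega), coeff_eq_zero_of_natDegree_lt hi,
        coeff_eq_zero_of_natDegree_lt (by omega), mul_zero, add_zero]
    · refine le_natDegree_of_ne_zero ?_
      rw [h3 _ (by omega), coeff_eq_zero_of_natDegree_lt (Nat.lt_succ_self _), mul_zero, add_zero]
      exact leadingCoeff_ne_zero.2 hQ
  refine ⟨?_, ?_⟩
  · rw [leadingCoeff, hn, h3 _ (by omega), coeff_eq_zero_of_natDegree_lt (Nat.lt_succ_self _),
      mul_zero, add_zero]; rfl
  · rw [nextCoeff, nextCoeff, hn]
    split_ifs with hz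
    · have := h2 0 (by omega)
      simp only [coeff_sub, coeff_X_mul_zero, coeff_C_mul, sub_zero, zero_sub, neg_eq_zero] at this
      rw [leadingCoeff, hz, this, add_zero]
    · rw [h3 _ (by omega), Nat.sub_add_cancel (Nat.one_le_iff_ne_zero.2 hz)]; rfl

theorem one_add_pow_sub_mem (t : k) (e : ℕ) :
    (1 + t • (RatFunc.X : RatFunc k)⁻¹) ^ e - 1 - (e * t) • (RatFunc.X : RatFunc k)⁻¹ ∈
      (ratDeg k).D (-2) := by
  have hX : (RatFunc.X : RatFunc k)⁻¹ ∈ (ratDeg k).D (-1) := by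
    have := ratDeg_X_zpow (k := k) (-1)
    rwa [zpow_neg_one] at this
  have hs : ∀ s : k, s • (RatFunc.X : RatFunc k)⁻¹ ∈ (ratDeg k).D (-1) := by
    intro s
    rw [Algebra.smul_def]
    have := (ratDeg k).mul_mem (ratDeg_C s) hX
    rwa [zero_add] at this
  induction e with
  | zero => simp
  | succ e ih =>
    have h1 : (1 + t • (RatFunc.X : RatFunc k)⁻¹) ^ (e + 1) - 1 -
        ((e + 1 : ℕ) * t) • (RatFunc.X : RatFunc k)⁻¹ =
        ((1 + t • (RatFunc.X : RatFunc k)⁻¹) ^ e - 1 - (e * t) • (RatFunc.X : RatFunc k)⁻¹) +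
        ((1 + t • (RatFunc.X : RatFunc k)⁻¹) ^ e - 1 - (e * t) • (RatFunc.X : RatFunc k)⁻¹) *
          (t • (RatFunc.X : RatFunc k)⁻¹) +
        ((e * t) • (RatFunc.X : RatFunc k)⁻¹) * (t • (RatFunc.X : RatFunc k)⁻¹) := by
      push_cast
      rw [add_mul, one_mul, add_smul, pow_succ]
      ring
    rw [h1]
    refine add_mem (add_mem ih ?_) ?_
    · exact (ratDeg k).mono (by norm_num) ((ratDeg k).mul_mem ih (hs t))
    · exact (ratDeg k).mul_mem (hs _) (hs t)

variable {F : k[X][X]} [hirr : Fact (Irreducible (genF F))]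

theorem norm_div_funField (y z : FunField F) : Algebra.norm (RatFunc k) (y / z) =
    Algebra.norm (RatFunc k) y / Algebra.norm (RatFunc k) z := by
  rw [div_eq_mul_inv, map_mul, Algebra.norm_inv, div_eq_mul_inv]

theorem norm_sub_one_mem_ratDeg (hF : F.Monic) (hG : (DegFilt.deg k).Good 2 F) {n : ℕ}
    {z : FunField F} (hz : z - 1 ∈ inftyB F (-n)) :
    Algebra.norm (RatFunc k) z - 1 ∈ (ratDeg k).D (-n) :=
  DegFilt.norm_sub_one_mem (hF.map _) (good_genF hG) (Int.natCast_nonneg n) hz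

theorem norm_coordRing_ne_zero (he : (F.natDegree : k) ≠ 0) {a : CoordRing F} (ha : a ≠ 0) :
    Algebra.norm k[X] a ≠ 0 := by
  have := free_coordRing he
  have := finite_coordRing he
  exact Algebra.norm_ne_zero_iff.2 ha

theorem finrank_coordRing_quot (he : (F.natDegree : k) ≠ 0) {a : CoordRing F} (ha : a ≠ 0) :
    Module.finrank k (CoordRing F ⧸ Ideal.span {a}) = (Algebra.norm k[X] a).natDegree := by
  have := free_coordRing he
  have := finite_coordRing he
  exact finrank_quotient_span_eq_natDegree_norm (Module.Free.chooseBasis k[X] (CoordRing F)) ha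

theorem finrank_eq_coordRing (hF : F.Monic) (hG : (DegFilt.deg k).Good 2 F)
    (he : (F.natDegree : k) ≠ 0) (c d : CoordRing F) (hc : c ≠ 0) (hd : d ≠ 0)
    (h : algebraMap (CoordRing F) (FunField F) c / algebraMap (CoordRing F) (FunField F) d - 1 ∈
      inftyB F (-1)) :
    Module.finrank k (CoordRing F ⧸ Ideal.span {c}) =
      Module.finrank k (CoordRing F ⧸ Ideal.span {d}) := by
  rw [finrank_coordRing_quot he hc, finrank_coordRing_quot he hd]
  have h1 := norm_sub_one_mem_ratDeg (n := 1) hF hG h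
  rw [norm_div_funField, ← algebraMap_norm_coordRing he, ← algebraMap_norm_coordRing he] at h1
  exact natDegree_eq_of_div_sub_one_mem (norm_coordRing_ne_zero he hc)
    (norm_coordRing_ne_zero he hd) h1

theorem trace_coordRing_quot (he : (F.natDegree : k) ≠ 0) {a : CoordRing F} (ha : a ≠ 0) :
    Algebra.trace k (CoordRing F ⧸ Ideal.span {a})
      (Ideal.Quotient.mk _ (algebraMap k[X] (CoordRing F) X)) =
      -((Algebra.norm k[X] a).nextCoeff / (Algebra.norm k[X] a).leadingCoeff) := by
  have := free_coordRing he
  have := finite_coordRing he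
  have hn := norm_coordRing_ne_zero he ha
  have hl : (Algebra.norm k[X] a).leadingCoeff⁻¹ ≠ 0 := inv_ne_zero (leadingCoeff_ne_zero.2 hn)
  rw [trace_quotient_span_singleton (Module.Free.chooseBasis k[X] (CoordRing F)) ha
    (monic_mul_leadingCoeff_inv hn) (associated_mul_unit_right _ _ (isUnit_C.2 hl.isUnit))]
  rw [nextCoeff, nextCoeff, natDegree_mul_C hl, coeff_mul_C]
  split_ifs <;> simp [div_eq_mul_inv]

theorem trace_eq_coordRing (hF : F.Monic) (hG : (DegFilt.deg k).Good 2 F)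
    (he : (F.natDegree : k) ≠ 0) (c d : CoordRing F) (s : k) (hc : c ≠ 0) (hd : d ≠ 0)
    (h : algebraMap (CoordRing F) (FunField F) c / algebraMap (CoordRing F) (FunField F) d - 1 -
      s • (algebraMap (CoordRing F) (FunField F) (algebraMap k[X] (CoordRing F) X))⁻¹ ∈
      inftyB F (-2)) :
    Algebra.trace k (CoordRing F ⧸ Ideal.span {c})
      (Ideal.Quotient.mk _ (algebraMap k[X] (CoordRing F) X)) =
    Algebra.trace k (CoordRing F ⧸ Ideal.span {d})
      (Ideal.Quotient.mk _ (algebraMap k[X] (CoordRing F) X)) + -(F.natDegree : k) * s := by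
  have hX : (RatFunc.X : RatFunc k)⁻¹ ∈ (ratDeg k).D (-1) := by
    have := ratDeg_X_zpow (k := k) (-1)
    rwa [zpow_neg_one] at this
  have hs : s • (RatFunc.X : RatFunc k)⁻¹ ∈ (ratDeg k).D (-1) := by
    rw [Algebra.smul_def]
    have := (ratDeg k).mul_mem (ratDeg_C s) hX
    rwa [zero_add] at this
  have hx : s • (algebraMap (CoordRing F) (FunField F) (algebraMap k[X] (CoordRing F) X))⁻¹ =
      algebraMap (RatFunc k) (FunField F) (s • (RatFunc.X : RatFunc k)⁻¹) := by
    rw [Algebra.smul_def, Algebra.smul_def, map_mul, map_inv₀,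
      ← IsScalarTower.algebraMap_apply k (RatFunc k) (FunField F), ← RatFunc.algebraMap_X,
      ← IsScalarTower.algebraMap_apply k[X] (RatFunc k) (FunField F),
      ← IsScalarTower.algebraMap_apply k[X] (CoordRing F) (FunField F)]
  have hsB : algebraMap (RatFunc k) (FunField F) (s • (RatFunc.X : RatFunc k)⁻¹) ∈ inftyB F (-1) :=
    DegFilt.of_mem_adj hs
  rw [hx] at h
  set θ := s • (RatFunc.X : RatFunc k)⁻¹ with hθ
  have hv0 := one_add_ne_zero_of_mem_inftyB hF hG he hsB
  have hvinv : (1 + algebraMap (RatFunc k) (FunField F) θ)⁻¹ ∈ inftyB F 0 := by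
    have := add_mem (inftyB_mono (by norm_num) (inv_sub_one_mem_inftyB hF hG he hsB) :
      _ ∈ inftyB F 0) one_mem_inftyB
    rwa [sub_add_cancel] at this
  set u := algebraMap (CoordRing F) (FunField F) c / algebraMap (CoordRing F) (FunField F) d
    with hu
  have h1 : u * (1 + algebraMap (RatFunc k) (FunField F) θ)⁻¹ - 1 ∈ inftyB F (-(2 : ℕ)) := by
    have h2 := mul_mem_inftyB h hvinv (l := -(2 : ℕ)) (by norm_num)
    have h3 := mul_inv_cancel₀ hv0
    generalize (1 + algebraMap (RatFunc k) (FunField F) θ)⁻¹ = v at h2 h3 ⊢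
    rwa [show u * v - 1 = (u - 1 - algebraMap (RatFunc k) (FunField F) θ) * v by
      linear_combination h3]
  have h2 := norm_sub_one_mem_ratDeg hF hG h1
  have hvn : Algebra.norm (RatFunc k) (1 + algebraMap (RatFunc k) (FunField F) θ) =
      (1 + θ) ^ F.natDegree := by
    rw [← map_one (algebraMap (RatFunc k) (FunField F)), ← map_add, Algebra.norm_algebraMap,
      finrank_funField]
  have hθ0 : (1 + θ) ^ F.natDegree ≠ 0 := by
    rw [← hvn]; exact Algebra.norm_ne_zero_iff.2 hv0
  rw [map_mul, Algebra.norm_inv, hvn, hu, norm_div_funField, ← algebraMap_norm_coordRing he,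
    ← algebraMap_norm_coordRing he] at h2
  have h3 := one_add_pow_sub_mem s F.natDegree
  rw [← hθ] at h3
  have h4 : (1 + θ) ^ F.natDegree ∈ (ratDeg k).D 0 := by
    have h5 : (1 + θ) ∈ (ratDeg k).D 0 :=
      add_mem (ratDeg k).one_mem ((ratDeg k).mono (by norm_num) hs)
    simpa using (ratDeg k).pow_mem h5 F.natDegree
  have h5 := (ratDeg k).mul_mem h2 h4
  obtain ⟨h6, h7⟩ := nextCoeff_eq_of_div_sub_one_sub_mem (t := F.natDegree * s)
    (norm_coordRing_ne_zero he hc) (norm_coordRing_ne_zero he hd) (by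
      have h8 := add_mem h5 h3
      generalize algebraMap k[X] (RatFunc k) (Algebra.norm k[X] c) /
        algebraMap k[X] (RatFunc k) (Algebra.norm k[X] d) = w at h8 ⊢
      have h9 := inv_mul_cancel₀ hθ0
      rwa [show w - 1 - (F.natDegree * s) • (RatFunc.X : RatFunc k)⁻¹ =
        (w * ((1 + θ) ^ F.natDegree)⁻¹ - 1) * (1 + θ) ^ F.natDegree +
        ((1 + θ) ^ F.natDegree - 1 - (F.natDegree * s) • (RatFunc.X : RatFunc k)⁻¹) by
          linear_combination -w * h9])
  rw [trace_coordRing_quot he hc, trace_coordRing_quot he hd, h6, h7, add_div,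
    mul_div_cancel_right₀ _ (leadingCoeff_ne_zero.2 (norm_coordRing_ne_zero he hd))]
  ring

end

section

open Polynomial nonZeroDivisors

variable {k : Type*} [Field k]

theorem finite_ideals_of_finite {A : Type*} [CommRing A] [IsDomain A] [Algebra k A] [Finite k]
    (hfin : ∀ I : Ideal A, I ≠ ⊥ → FiniteDimensional k (A ⧸ I)) (x : A)
    (hx : Function.Injective (aeval (R := k) x)) (n : ℕ) :
    {I : Ideal A | I ≠ ⊥ ∧ Module.finrank k (A ⧸ I) = n}.Finite := by
  let m := Nat.card k ^ n
  let h : A := ∏ i ∈ Finset.range (m + 1), ∏ j ∈ Finset.range i, (x ^ i - x ^ j)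
  have hh : h ≠ 0 := by
    refine Finset.prod_ne_zero_iff.2 fun i _ => Finset.prod_ne_zero_iff.2 fun j hj h0 => ?_
    have h1 : (aeval x) (X ^ i : k[X]) = aeval x (X ^ j : k[X]) := by
      rw [map_pow, map_pow, aeval_X]; exact sub_eq_zero.1 h0
    have h2 := congrArg natDegree (hx h1)
    rw [natDegree_X_pow, natDegree_X_pow] at h2
    exact (Finset.mem_range.1 hj).ne h2.symm
  have hmem : ∀ I : Ideal A, I ≠ ⊥ → Module.finrank k (A ⧸ I) = n → h ∈ I := by
    intro I hI hn
    have := hfin I hI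
    have hcard : Nat.card (A ⧸ I) = m := by
      rw [Module.natCard_eq_pow_finrank (K := k), hn]
    have hfinite : Finite (A ⧸ I) := Module.finite_of_finite k
    have := Fintype.ofFinite (A ⧸ I)
    obtain ⟨a, b, hab, he⟩ := Fintype.exists_ne_map_eq_of_card_lt
      (fun i : Fin (m + 1) => (Ideal.Quotient.mk I x) ^ (i : ℕ)) (by
        rw [← Nat.card_eq_fintype_card, hcard, Fintype.card_fin]; exact Nat.lt_succ_self _)
    have key : ∀ i j : ℕ, i < m + 1 → j < i →
        (Ideal.Quotient.mk I x) ^ i = (Ideal.Quotient.mk I x) ^ j → h ∈ I := by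
      intro i j hi hj hij
      rw [← Ideal.Quotient.eq_zero_iff_mem, map_prod]
      refine Finset.prod_eq_zero (Finset.mem_range.2 hi) ?_
      rw [map_prod]
      refine Finset.prod_eq_zero (Finset.mem_range.2 hj) ?_
      rw [map_sub, map_pow, map_pow, hij, sub_self]
    rcases lt_or_gt_of_ne hab with hlt | hlt
    · exact key b a b.2 hlt he.symm
    · exact key a b a.2 hlt he
  have := hfin (Ideal.span {h}) (by rwa [Ne, Ideal.span_singleton_eq_bot])
  have hfinite : Finite (A ⧸ Ideal.span {h}) := Module.finite_of_finite k
  have hideals : Finite (Ideal (A ⧸ Ideal.span {h})) :=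
    Finite.of_injective (fun I => (I : Set (A ⧸ Ideal.span {h}))) SetLike.coe_injective
  refine (Set.finite_range fun J : Ideal (A ⧸ Ideal.span {h}) =>
    J.comap (Ideal.Quotient.mk _)).subset ?_
  rintro I ⟨hI, hn⟩
  refine ⟨I.map (Ideal.Quotient.mk _), ?_⟩
  simp only
  rw [Ideal.comap_map_of_surjective _ Ideal.Quotient.mk_surjective, sup_eq_left,
    ← RingHom.ker_eq_comap_bot, Ideal.mk_ker]
  exact (Ideal.span_singleton_le_iff_mem I).2 (hmem I hI hn)

variable {F : k[X][X]} [hirr : Fact (Irreducible (genF F))]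

theorem finite_coordRing_quot (he : (F.natDegree : k) ≠ 0) (I : Ideal (CoordRing F)) (hI : I ≠ ⊥) :
    FiniteDimensional k (CoordRing F ⧸ I) := by
  have := free_coordRing he
  have := finite_coordRing he
  let b := Module.Free.chooseBasis k[X] (CoordRing F)
  have : ∀ i, FiniteDimensional k (k[X] ⧸ Ideal.span ({I.smithCoeffs b hI i} : Set k[X])) :=
    fun i => inferInstance
  exact Module.Finite.equiv (I.quotientEquivDirectSum k b hI).symm

theorem aeval_coordRing_injective :
    Function.Injective (aeval (R := k) (algebraMap k[X] (CoordRing F) X)) := by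
  have h : ∀ P : k[X], aeval (algebraMap k[X] (CoordRing F) X) P = algebraMap k[X] (CoordRing F) P := by
    intro P
    rw [aeval_algebraMap_apply, aeval_X_left_apply]
  intro P Q hPQ
  rw [h, h] at hPQ
  have := congrArg (algebraMap (CoordRing F) (FunField F)) hPQ
  rw [← IsScalarTower.algebraMap_apply, ← IsScalarTower.algebraMap_apply] at this
  exact algebraMap_funField_injective this

/-- The filtration at infinity of a plane curve. -/
noncomputable def curveInftyFilt [Finite k] (hF : F.Monic) (hG : (DegFilt.deg k).Good 2 F)
    (he : (F.natDegree : k) ≠ 0) :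
    InftyFilt k (CoordRing F) (FunField F) (algebraMap k[X] (CoordRing F) X) where
  B := inftyB F
  mono := inftyB_mono
  mul_mem ha hb := mul_mem_inftyB ha hb le_rfl
  one_mem := one_mem_inftyB
  x_mem := by
    have h := ratDeg_X_zpow (k := k) 1
    rw [zpow_one, ← RatFunc.algebraMap_X] at h
    exact DegFilt.of_mem_adj h
  x_inv_mem := by
    have h := ratDeg_X_zpow (k := k) (-1)
    rw [← IsScalarTower.algebraMap_apply k[X] (CoordRing F) (FunField F),
      IsScalarTower.algebraMap_apply k[X] (RatFunc k) (FunField F), ← map_inv₀,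
      RatFunc.algebraMap_X, ← zpow_neg_one]
    exact DegFilt.of_mem_adj h
  x_sub_ne a h := by
    have h1 : aeval (algebraMap k[X] (CoordRing F) X) (X - C a) =
        aeval (algebraMap k[X] (CoordRing F) X) (0 : k[X]) := by
      rw [map_sub, aeval_X, aeval_C, map_zero, h]
    exact X_sub_C_ne_zero a (aeval_coordRing_injective h1)
  eq_zero := eq_zero_of_mem_inftyB hF hG he
  N := 2 * F.natDegree
  surj := surj_inftyB hF
  codim := 4 * F.natDegree ^ 2
  finite_quot := (quot_inftyB hF).1
  finrank_quot_le := (quot_inftyB hF).2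
  inv_sub_one_mem := inv_sub_one_mem_inftyB hF hG he
  finrank_eq := finrank_eq_coordRing hF hG he
  e := -F.natDegree
  e_ne := neg_ne_zero.2 he
  trace_eq := trace_eq_coordRing hF hG he
  finite_ideal_quot := finite_coordRing_quot he
  finite_ideals := finite_ideals_of_finite (finite_coordRing_quot he) _ aeval_coordRing_injective

end

section

open Polynomial nonZeroDivisors

variable {k : Type*} [Field k] {F : k[X][X]} [hirr : Fact (Irreducible (genF F))]

/-- The root of `F` in the coordinate ring. -/
noncomputable def coordY (hF : F.Monic) : CoordRing F :=
  ⟨AdjoinRoot.root (genF F), isIntegral_root_genF hF⟩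

theorem algebraMap_coordY (hF : F.Monic) :
    algebraMap (CoordRing F) (FunField F) (coordY hF) = AdjoinRoot.root (genF F) := rfl

theorem algebraMap_eval₂_coordY (hF : F.Monic) (P : k[X][X]) :
    algebraMap (CoordRing F) (FunField F) (P.eval₂ (algebraMap k[X] (CoordRing F)) (coordY hF)) =
      AdjoinRoot.mk (genF F) (P.map (algebraMap k[X] (RatFunc k))) := by
  rw [hom_eval₂, algebraMap_coordY, ← AdjoinRoot.aeval_eq, aeval_def, eval₂_map,
    ← IsScalarTower.algebraMap_eq k[X] (CoordRing F) (FunField F),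
    IsScalarTower.algebraMap_eq k[X] (RatFunc k) (FunField F)]

theorem eval₂_coordY_self (hF : F.Monic) :
    F.eval₂ (algebraMap k[X] (CoordRing F)) (coordY hF) = 0 := by
  apply FaithfulSMul.algebraMap_injective (CoordRing F) (FunField F)
  rw [algebraMap_eval₂_coordY, map_zero]
  exact AdjoinRoot.mk_self

theorem dvd_of_eval₂_coordY_eq_zero (hF : F.Monic) {P : k[X][X]}
    (h : P.eval₂ (algebraMap k[X] (CoordRing F)) (coordY hF) = 0) : F ∣ P := by
  have h1 := congrArg (algebraMap (CoordRing F) (FunField F)) h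
  rw [algebraMap_eval₂_coordY, map_zero, AdjoinRoot.mk_eq_zero] at h1
  exact (map_dvd_map _ (RatFunc.algebraMap_injective k) hF).1 h1

/-- A discriminant of `F` with respect to the second variable. -/
noncomputable def curveDisc (hF : F.Monic) : k[X] :=
  Algebra.norm k[X] (F.derivative.eval₂ (algebraMap k[X] (CoordRing F)) (coordY hF))

theorem derivative_eval₂_coordY_ne_zero (hF : F.Monic) (he : (F.natDegree : k) ≠ 0) :
    F.derivative.eval₂ (algebraMap k[X] (CoordRing F)) (coordY hF) ≠ 0 := by
  intro h
  have h1 := dvd_of_eval₂_coordY_eq_zero hF h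
  have hd : F.natDegree ≠ 0 := fun h' => he (by rw [h', Nat.cast_zero])
  have h2 : F.derivative ≠ 0 := by
    intro h0
    have h1 := congrArg (fun g => g.coeff (F.natDegree - 1)) h0
    simp only [coeff_derivative, coeff_zero] at h1
    rw [Nat.sub_add_cancel (Nat.one_le_iff_ne_zero.2 hd), hF.coeff_natDegree, one_mul,
      Nat.cast_sub (Nat.one_le_iff_ne_zero.2 hd), Nat.cast_one, sub_add_cancel,
      ← map_natCast (C : k →+* k[X]), C_eq_zero] at h1
    exact he h1
  have h3 := natDegree_le_of_dvd h1 h2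
  have h4 := natDegree_derivative_lt hd
  omega

theorem curveDisc_ne_zero (hF : F.Monic) (he : (F.natDegree : k) ≠ 0) : curveDisc hF ≠ 0 :=
  norm_coordRing_ne_zero he (derivative_eval₂_coordY_ne_zero hF he)

theorem natDegree_curveDisc_le (hF : F.Monic) (hG : (DegFilt.deg k).Good 2 F)
    (he : (F.natDegree : k) ≠ 0) : (curveDisc hF).natDegree ≤ 2 * F.natDegree ^ 2 := by
  have h1 : algebraMap (CoordRing F) (FunField F)
      (F.derivative.eval₂ (algebraMap k[X] (CoordRing F)) (coordY hF)) ∈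
      inftyB F (2 * F.natDegree) := by
    rw [algebraMap_eval₂_coordY]
    refine DegFilt.mk_mem_adj fun i => ?_
    have h2 := good_genF hG (i + 1)
    rw [natDegree_genF] at h2
    rw [← derivative_map, coeff_derivative]
    have h3 : ((i : RatFunc k) + 1) ∈ (ratDeg k).D 0 := by
      have := ratDeg_C (k := k) (i + 1)
      rwa [map_add, map_natCast, map_one] at this
    refine (ratDeg k).mono ?_ ((ratDeg k).mul_mem h2 h3)
    push_cast; omega
  have h2 := norm_mem_ratDeg hF hG h1
  rw [← algebraMap_norm_coordRing he, algebraMap_mem_ratDeg] at h2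
  have h3 := h2.resolve_left (curveDisc_ne_zero hF he)
  have h4 : ((curveDisc hF).natDegree : ℤ) ≤ ((2 * F.natDegree ^ 2 : ℕ) : ℤ) := by
    refine h3.trans (le_of_eq ?_)
    push_cast; ring
  exact_mod_cast h4

theorem exists_curveDisc_mul_eq (hF : F.Monic) (he : (F.natDegree : k) ≠ 0) (z : CoordRing F) :
    ∃ P : k[X][X], algebraMap k[X] (CoordRing F) (curveDisc hF) * z =
      P.eval₂ (algebraMap k[X] (CoordRing F)) (coordY hF) := by
  have := isSeparable_funField he
  have hF' : (genF F).Monic := hF.map _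
  let B := AdjoinRoot.powerBasis hF'.ne_zero
  have hgen : B.gen = AdjoinRoot.root (genF F) := AdjoinRoot.powerBasis_gen _
  have hint : IsIntegral k[X] B.gen := hgen ▸ isIntegral_root_genF hF
  have h1 := Algebra.discr_mul_isIntegral_mem_adjoin (R := k[X]) (RatFunc k) hint
    (z := algebraMap (CoordRing F) (FunField F) z) z.2
  have hmin : minpoly (RatFunc k) B.gen = genF F := AdjoinRoot.minpoly_powerBasis_gen_of_monic hF'
  have h2 : Algebra.norm (RatFunc k) (aeval B.gen (minpoly (RatFunc k) B.gen).derivative) =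
      algebraMap k[X] (RatFunc k) (curveDisc hF) := by
    rw [curveDisc, algebraMap_norm_coordRing he, algebraMap_eval₂_coordY, hmin, hgen,
      derivative_map, AdjoinRoot.aeval_eq]
  rw [Algebra.discr_powerBasis_eq_norm, h2] at h1
  have h3 : algebraMap (CoordRing F) (FunField F) (algebraMap k[X] (CoordRing F) (curveDisc hF) * z) ∈
      Algebra.adjoin k[X] {AdjoinRoot.root (genF F)} := by
    rw [← hgen]
    set N := Module.finrank (RatFunc k) (FunField F) * (Module.finrank (RatFunc k) (FunField F) - 1) / 2
    have h4 : ((-1 : k[X]) ^ N) • (((-1) ^ N * algebraMap k[X] (RatFunc k) (curveDisc hF)) •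
        algebraMap (CoordRing F) (FunField F) z) =
        algebraMap (CoordRing F) (FunField F) (algebraMap k[X] (CoordRing F) (curveDisc hF) * z) := by
      rw [Algebra.smul_def, Algebra.smul_def, map_mul, map_mul,
        ← IsScalarTower.algebraMap_apply k[X] (CoordRing F) (FunField F),
        ← IsScalarTower.algebraMap_apply k[X] (RatFunc k) (FunField F)]
      simp only [map_pow, map_neg, map_one]
      rw [← mul_assoc, ← mul_assoc, ← mul_pow, neg_one_mul, neg_neg, one_pow, one_mul]
    rw [← h4]
    exact Subalgebra.smul_mem _ h1 _
  rw [Algebra.adjoin_singleton_eq_range_aeval] at h3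
  obtain ⟨P, hP⟩ := h3
  refine ⟨P, FaithfulSMul.algebraMap_injective (CoordRing F) (FunField F) ?_⟩
  rw [← hP, hom_eval₂, algebraMap_coordY, ← IsScalarTower.algebraMap_eq]
  rfl

variable {L : Type*} [Field L] [Algebra k L]

theorem algHom_eval₂_coordY (hF : F.Monic) (φ : CoordRing F →ₐ[k] L) (P : k[X][X]) :
    φ (P.eval₂ (algebraMap k[X] (CoordRing F)) (coordY hF)) =
      P.eval₂ (eval₂RingHom (algebraMap k L) (φ (algebraMap k[X] (CoordRing F) X)))
        (φ (coordY hF)) := by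
  have h : ((φ : CoordRing F →+* L)).comp (algebraMap k[X] (CoordRing F)) =
      eval₂RingHom (algebraMap k L) (φ (algebraMap k[X] (CoordRing F) X)) := by
    ext a
    · simp only [RingHom.comp_apply, coe_eval₂RingHom, eval₂_C]
      rw [← algebraMap_eq, ← IsScalarTower.algebraMap_apply k k[X] (CoordRing F)]
      exact φ.commutes a
    · simp
  rw [← h]
  exact hom_eval₂ P _ (φ : CoordRing F →+* L) _

theorem algHom_algebraMap (φ : CoordRing F →ₐ[k] L) (P : k[X]) :
    φ (algebraMap k[X] (CoordRing F) P) =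
      P.eval₂ (algebraMap k L) (φ (algebraMap k[X] (CoordRing F) X)) := by
  have h : ((φ : CoordRing F →+* L)).comp (algebraMap k[X] (CoordRing F)) =
      eval₂RingHom (algebraMap k L) (φ (algebraMap k[X] (CoordRing F) X)) := by
    ext a
    · simp only [RingHom.comp_apply, coe_eval₂RingHom, eval₂_C]
      rw [← algebraMap_eq, ← IsScalarTower.algebraMap_apply k k[X] (CoordRing F)]
      exact φ.commutes a
    · simp
  exact congrArg (fun g : k[X] →+* L => g P) h

theorem algHom_eq_of_curveDisc_ne_zero (hF : F.Monic) (he : (F.natDegree : k) ≠ 0)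
    (φ χ : CoordRing F →ₐ[k] L)
    (hx : φ (algebraMap k[X] (CoordRing F) X) = χ (algebraMap k[X] (CoordRing F) X))
    (hy : φ (coordY hF) = χ (coordY hF))
    (hD : (curveDisc hF).eval₂ (algebraMap k L) (φ (algebraMap k[X] (CoordRing F) X)) ≠ 0) :
    φ = χ := by
  ext z
  obtain ⟨P, hP⟩ := exists_curveDisc_mul_eq hF he z
  have h1 := congrArg φ hP
  have h2 := congrArg χ hP
  rw [map_mul, algHom_eval₂_coordY, algHom_algebraMap] at h1 h2
  rw [← hx, ← hy, ← h1] at h2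
  exact (mul_left_cancel₀ hD h2).symm

theorem exists_algHom_of_curveDisc_ne_zero (hF : F.Monic) (he : (F.natDegree : k) ≠ 0)
    {a y : L} (h : F.eval₂ (eval₂RingHom (algebraMap k L) a) y = 0)
    (hD : (curveDisc hF).eval₂ (algebraMap k L) a ≠ 0) :
    ∃ φ : CoordRing F →ₐ[k] L, φ (algebraMap k[X] (CoordRing F) X) = a ∧ φ (coordY hF) = y := by
  set ev : k[X][X] →+* L := eval₂RingHom (eval₂RingHom (algebraMap k L) a) y with hev
  set sp : k[X][X] →+* CoordRing F := eval₂RingHom (algebraMap k[X] (CoordRing F)) (coordY hF) with hsp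
  set δ := (curveDisc hF).eval₂ (algebraMap k L) a with hδ
  have hevC : ∀ P : k[X], ev (C P) = P.eval₂ (algebraMap k L) a := fun P => by simp [hev]
  have hspC : ∀ P : k[X], sp (C P) = algebraMap k[X] (CoordRing F) P := fun P => by simp [hsp]
  have hwd : ∀ P Q : k[X][X], sp P = sp Q → ev P = ev Q := by
    intro P Q hPQ
    have h1 : F ∣ P - Q := dvd_of_eval₂_coordY_eq_zero hF (by
      rw [← coe_eval₂RingHom, ← hsp, map_sub, hPQ, sub_self])
    obtain ⟨R, hR⟩ := h1
    rw [← sub_eq_zero, ← map_sub, hR, map_mul]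
    rw [show ev F = 0 from h, zero_mul]
  choose P hP using exists_curveDisc_mul_eq hF he
  have hP' : ∀ z, algebraMap k[X] (CoordRing F) (curveDisc hF) * z = sp (P z) := hP
  have key : ∀ z Q, algebraMap k[X] (CoordRing F) (curveDisc hF) * z = sp Q →
      ev (P z) / δ = ev Q / δ := fun z Q hQ => by
    rw [hwd (P z) Q (by rw [← hP', hQ])]
  have keyC : ∀ R : k[X], ev (P (algebraMap k[X] (CoordRing F) R)) / δ = R.eval₂ (algebraMap k L) a := by
    intro R
    rw [key _ (C (curveDisc hF * R)) (by rw [hspC, map_mul]), hevC, eval₂_mul,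
      mul_div_cancel_left₀ _ hD]
  have hmul : ∀ z w, ev (P (z * w)) / δ = ev (P z) / δ * (ev (P w) / δ) := by
    intro z w
    have h1 : ev (C (curveDisc hF) * P (z * w)) = ev (P z * P w) := hwd _ _ (by
      rw [map_mul, map_mul, hspC, ← hP', ← hP', ← hP']; ring)
    rw [map_mul, map_mul, hevC] at h1
    field_simp
    linear_combination h1
  have hadd : ∀ z w, ev (P (z + w)) / δ = ev (P z) / δ + ev (P w) / δ := by
    intro z w
    rw [key _ (P z + P w) (by rw [map_add, ← hP', ← hP', mul_add]), map_add, add_div]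
  have halg : ∀ c : k, ev (P (algebraMap k (CoordRing F) c)) / δ = algebraMap k L c := by
    intro c
    rw [IsScalarTower.algebraMap_apply k k[X] (CoordRing F), keyC, algebraMap_eq, eval₂_C]
  refine ⟨{ toFun := fun z => ev (P z) / δ
            map_one' := by simpa using halg 1
            map_mul' := hmul
            map_zero' := by simpa using halg 0
            map_add' := hadd
            commutes' := halg }, ?_, ?_⟩
  · change ev (P _) / δ = a
    rw [keyC, eval₂_X]
  · change ev (P _) / δ = y
    rw [key _ (C (curveDisc hF) * X) (by
      rw [map_mul, hspC]; simp [hsp]), map_mul, hevC, mul_div_cancel_left₀ _ hD]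
    simp [hev]

end

section

open Polynomial nonZeroDivisors

variable {k : Type*} [Field k] {F : k[X][X]} [hirr : Fact (Irreducible (genF F))]

variable {L : Type*} [Field L] [Algebra k L]

theorem algHom_over_le (he : (F.natDegree : k) ≠ 0) (a : L) :
    Finite {φ : CoordRing F →ₐ[k] L // φ (algebraMap k[X] (CoordRing F) X) = a} ∧
    Nat.card {φ : CoordRing F →ₐ[k] L // φ (algebraMap k[X] (CoordRing F) X) = a} ≤
      F.natDegree := by
  have := free_coordRing he
  have := finite_coordRing he
  let _ : Algebra k[X] L := (eval₂RingHom (algebraMap k L) a).toAlgebra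
  let f : {φ : CoordRing F →ₐ[k] L // φ (algebraMap k[X] (CoordRing F) X) = a} →
      (CoordRing F →ₐ[k[X]] L) := fun φ =>
    { φ.1 with
      commutes' := fun P => (algHom_algebraMap φ.1 P).trans (by rw [φ.2]; rfl) }
  have hf : Function.Injective f := by
    intro φ χ h
    ext z
    exact congrArg (fun g : CoordRing F →ₐ[k[X]] L => g z) h
  refine ⟨Finite.of_injective f hf, (Nat.card_le_card_of_injective f hf).trans ?_⟩
  refine (card_algHom_le_finrank k[X] (CoordRing F) L).trans (le_of_eq ?_)
  rw [← finrank_funField (F := F)]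
  have := isSeparable_funField he
  exact (IsIntegralClosure.rank k[X] (RatFunc k) (FunField F) (CoordRing F))

theorem finite_algHom_coordRing (he : (F.natDegree : k) ≠ 0) [Finite L] :
    Finite (CoordRing F →ₐ[k] L) := by
  have := fun a : L => (algHom_over_le (F := F) he a).1
  exact Finite.of_equiv _ (Equiv.sigmaFiberEquiv fun φ : CoordRing F →ₐ[k] L =>
    φ (algebraMap k[X] (CoordRing F) X))

/-- The points of the curve `F = 0` with a given first coordinate. -/
noncomputable def fibrePts (F : k[X][X]) [Fintype L] [DecidableEq L] (a : L) : Finset L :=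
  Finset.univ.filter fun y => F.eval₂ (eval₂RingHom (algebraMap k L) a) y = 0

theorem card_fibrePts_le [Fintype L] [DecidableEq L] (hF : F.Monic) (a : L) :
    (fibrePts F a).card ≤ F.natDegree := by
  have hm : (F.map (eval₂RingHom (algebraMap k L) a)).Monic := hF.map _
  rw [← hF.natDegree_map (eval₂RingHom (algebraMap k L) a)]
  refine le_trans (Finset.card_le_card ?_) ((Multiset.toFinset_card_le _).trans (card_roots' _))
  intro y hy
  rw [fibrePts, Finset.mem_filter] at hy
  rw [Multiset.mem_toFinset, mem_roots hm.ne_zero, IsRoot.def, eval_map]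
  exact hy.2

theorem norm_sum_algHom_sub_le [Fintype L] [DecidableEq L] [Fintype (CoordRing F →ₐ[k] L)]
    (hF : F.Monic) (hG : (DegFilt.deg k).Good 2 F) (he : (F.natDegree : k) ≠ 0) (f : L → ℂ)
    (hf : ∀ a, ‖f a‖ ≤ 1) :
    ‖∑ φ : CoordRing F →ₐ[k] L, f (φ (algebraMap k[X] (CoordRing F) X)) -
      ∑ a : L, (fibrePts F a).card * f a‖ ≤ 2 * F.natDegree ^ 3 := by
  classical
  let n : L → ℕ := fun a => (Finset.univ.filter fun φ : CoordRing F →ₐ[k] L =>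
    φ (algebraMap k[X] (CoordRing F) X) = a).card
  have hn : ∀ a, n a ≤ F.natDegree := by
    intro a
    have := (algHom_over_le (F := F) he a).2
    rwa [Nat.card_eq_fintype_card, Fintype.card_subtype] at this
  have h1 : ∑ φ : CoordRing F →ₐ[k] L, f (φ (algebraMap k[X] (CoordRing F) X)) =
      ∑ a, (n a : ℂ) * f a := by
    rw [← Finset.sum_fiberwise (s := Finset.univ)
      (g := fun φ : CoordRing F →ₐ[k] L => φ (algebraMap k[X] (CoordRing F) X))]
    refine Finset.sum_congr rfl fun a _ => ?_
    rw [Finset.sum_congr rfl (g := fun _ => f a), Finset.sum_const, nsmul_eq_mul]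
    intro φ hφ
    rw [(Finset.mem_filter.1 hφ).2]
  let Z := ((curveDisc hF).map (algebraMap k L)).roots.toFinset
  have hD0 : (curveDisc hF).map (algebraMap k L) ≠ 0 :=
    map_ne_zero (curveDisc_ne_zero hF he)
  have hZ : Z.card ≤ 2 * F.natDegree ^ 2 :=
    (Multiset.toFinset_card_le _).trans ((card_roots' _).trans
      ((natDegree_map_le).trans (natDegree_curveDisc_le hF hG he)))
  have heq : ∀ a ∉ Z, n a = (fibrePts F a).card := by
    intro a ha
    have hDa : (curveDisc hF).eval₂ (algebraMap k L) a ≠ 0 := by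
      intro h0
      apply ha
      rw [Multiset.mem_toFinset, mem_roots hD0, IsRoot.def, eval_map]
      exact h0
    refine Finset.card_bij (fun φ _ => φ (coordY hF)) ?_ ?_ ?_
    · intro φ hφ
      rw [Finset.mem_filter] at hφ
      rw [fibrePts, Finset.mem_filter]
      refine ⟨Finset.mem_univ _, ?_⟩
      rw [← hφ.2, ← algHom_eval₂_coordY, eval₂_coordY_self, map_zero]
    · intro φ hφ χ hχ h
      rw [Finset.mem_filter] at hφ hχ
      exact algHom_eq_of_curveDisc_ne_zero hF he φ χ (hφ.2.trans hχ.2.symm) h (by rwa [hφ.2])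
    · intro y hy
      rw [fibrePts, Finset.mem_filter] at hy
      obtain ⟨φ, hφ, hφy⟩ := exists_algHom_of_curveDisc_ne_zero hF he hy.2 hDa
      exact ⟨φ, by rw [Finset.mem_filter]; exact ⟨Finset.mem_univ _, hφ⟩, hφy⟩
  rw [h1, ← Finset.sum_sub_distrib, ← Finset.sum_subset (Finset.subset_univ Z)
    (fun a _ ha => by rw [heq a ha, sub_self])]
  refine (norm_sum_le_of_le Z (n := fun _ => (F.natDegree : ℝ)) fun a _ => ?_).trans ?_
  · rw [← sub_mul, norm_mul]
    refine (mul_le_of_le_one_right (norm_nonneg _) (hf a)).trans ?_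
    have h2 := hn a
    have h3 := card_fibrePts_le hF a
    have h4 : (n a : ℂ) - (fibrePts F a).card = (((n a : ℝ) - (fibrePts F a).card : ℝ) : ℂ) := by
      push_cast; rfl
    rw [h4, Complex.norm_real, Real.norm_eq_abs, abs_le]
    have h2' : (n a : ℝ) ≤ F.natDegree := by exact_mod_cast h2
    have h3' : ((fibrePts F a).card : ℝ) ≤ F.natDegree := by exact_mod_cast h3
    constructor
    · linarith [Nat.cast_nonneg (α := ℝ) (n a)]
    · linarith [Nat.cast_nonneg (α := ℝ) (fibrePts F a).card]
  · rw [Finset.sum_const, nsmul_eq_mul]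
    calc (Z.card : ℝ) * F.natDegree ≤ (2 * F.natDegree ^ 2 : ℕ) * F.natDegree := by
          gcongr
      _ = 2 * F.natDegree ^ 3 := by push_cast; ring

end

section

open Polynomial

theorem norm_le_one_of_bounded_power_sums (s : Multiset ℂ) (C : ℝ) (n₀ : ℕ)
    (h : ∀ n ≥ n₀, ‖(s.map fun ω => ω ^ n).sum‖ ≤ C) : ∀ ω ∈ s, ‖ω‖ ≤ 1 := by
  classical
  intro ω hω
  let Q : ℂ[X] := ∏ β ∈ s.toFinset.erase ω, (X - Polynomial.C β)
  have hQω : Q.eval ω ≠ 0 := by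
    rw [eval_prod, Finset.prod_ne_zero_iff]
    intro β hβ
    rw [eval_sub, eval_X, eval_C, sub_ne_zero]
    exact (Finset.ne_of_mem_erase hβ).symm
  have hQ : ∀ β ∈ s.toFinset, β ≠ ω → Q.eval β = 0 := by
    intro β hβ hne
    rw [eval_prod]
    exact Finset.prod_eq_zero (Finset.mem_erase.2 ⟨hne, hβ⟩) (by simp)
  have key : ∀ n, ∑ l ∈ Finset.range (Q.natDegree + 1),
      Q.coeff l * (s.map fun β => β ^ (n + l)).sum = s.count ω * (ω ^ n * Q.eval ω) := by
    intro n
    have h1 : ∀ l, (s.map fun β => β ^ (n + l)).sum =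
        ∑ β ∈ s.toFinset, (s.count β : ℂ) * β ^ (n + l) := by
      intro l
      rw [Finset.sum_multiset_map_count]
      simp only [nsmul_eq_mul]
    simp only [h1, Finset.mul_sum]
    rw [Finset.sum_comm]
    have h2 : ∀ β, ∑ l ∈ Finset.range (Q.natDegree + 1), Q.coeff l * ((s.count β : ℂ) * β ^ (n + l)) =
        s.count β * (β ^ n * Q.eval β) := by
      intro β
      rw [eval_eq_sum_range, Finset.mul_sum, Finset.mul_sum]
      refine Finset.sum_congr rfl fun l _ => ?_
      ring
    simp only [h2]
    rw [Finset.sum_eq_single ω]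
    · intro β hβ hne
      rw [hQ β hβ hne]; ring
    · intro h0; exact absurd (Multiset.mem_toFinset.2 hω) h0
  by_contra! hgt
  have hcount : (0 : ℝ) < s.count ω := by exact_mod_cast Multiset.count_pos.2 hω
  have hpos : 0 < ‖Q.eval ω‖ := norm_pos_iff.2 hQω
  let B := ∑ l ∈ Finset.range (Q.natDegree + 1), ‖Q.coeff l‖ * C
  have hb : ∀ n ≥ n₀, s.count ω * (‖ω‖ ^ n * ‖Q.eval ω‖) ≤ B := by
    intro n hn
    have h1 := congrArg norm (key n)
    rw [norm_mul, norm_mul, norm_pow, Complex.norm_natCast] at h1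
    rw [← h1]
    refine (norm_sum_le _ _).trans (Finset.sum_le_sum fun l _ => ?_)
    rw [norm_mul]
    exact mul_le_mul_of_nonneg_left (h _ (by omega)) (norm_nonneg _)
  obtain ⟨n, hn⟩ := pow_unbounded_of_one_lt (B / (s.count ω * ‖Q.eval ω‖)) hgt
  have h2 : ‖ω‖ ^ n ≤ ‖ω‖ ^ (max n n₀) := pow_le_pow_right₀ hgt.le (le_max_left _ _)
  have h3 := hb _ (le_max_right n n₀)
  have h4 := (div_lt_iff₀ (mul_pos hcount hpos)).1 (hn.trans_le h2)
  nlinarith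

theorem norm_sum_le_of_even_power_sums (s : Multiset ℂ) {r : ℝ} (hr : 0 < r) (C : ℝ) (n₀ : ℕ)
    (h : ∀ μ ≥ n₀, ‖(s.map fun ω => ω ^ (2 * μ)).sum‖ ≤ C * r ^ (2 * μ)) :
    ‖(s.map fun ω => ω ^ 1).sum‖ ≤ s.card * r := by
  have h1 := norm_le_one_of_bounded_power_sums (s.map fun ω : ℂ => (ω / (r : ℂ)) ^ 2) C n₀ (by
    intro n hn
    have h2 : ((s.map fun ω : ℂ => (ω / (r : ℂ)) ^ 2).map fun ω => ω ^ n) =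
        s.map fun ω => ω ^ (2 * n) * ((r : ℂ) ^ (2 * n))⁻¹ := by
      rw [Multiset.map_map]
      refine Multiset.map_congr rfl fun ω _ => ?_
      simp only [Function.comp]
      rw [← pow_mul, div_pow, div_eq_mul_inv]
    rw [h2, Multiset.sum_map_mul_right, norm_mul, norm_inv, norm_pow, Complex.norm_real,
      Real.norm_of_nonneg hr.le, ← div_eq_mul_inv]
    exact (div_le_iff₀ (by positivity)).2 (h n hn))
  have h3 : ∀ ω ∈ s, ‖ω‖ ≤ r := by
    intro ω hω
    have := h1 _ (Multiset.mem_map_of_mem _ hω)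
    rw [norm_pow, norm_div, Complex.norm_real, Real.norm_of_nonneg hr.le] at this
    have h4 := (pow_le_one_iff_of_nonneg (by positivity) two_ne_zero).1 this
    exact (div_le_one hr).1 h4
  simp only [pow_one, Multiset.map_id']
  refine (Multiset.le_sum_of_subadditive norm norm_zero.le (fun _ _ => norm_add_le _ _) s).trans ?_
  have h5 := Multiset.sum_le_card_nsmul (s.map norm) r (by
    intro y hy
    obtain ⟨ω, hω, rfl⟩ := Multiset.mem_map.1 hy
    exact h3 ω hω)
  rwa [Multiset.card_map, nsmul_eq_mul] at h5

end

section

open Polynomial nonZeroDivisors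

variable {p : ℕ} [hp : Fact p.Prime] {F : (ZMod p)[X][X]} [hirr : Fact (Irreducible (genF F))]

instance {k : Type*} [Field k] {F : k[X][X]} [Fact (Irreducible (genF F))] :
    Infinite (CoordRing F) :=
  Infinite.of_injective _ (aeval_coordRing_injective (F := F))

theorem exists_ideal_of_algHom {k : Type*} [Field k] {F : k[X][X]} [Fact (Irreducible (genF F))]
    (φ : CoordRing F →ₐ[k] k) :
    ∃ P : Ideal (CoordRing F), P.IsMaximal ∧ P ≠ ⊥ ∧ Module.finrank k (CoordRing F ⧸ P) = 1 := by
  have hsurj : Function.Surjective φ := fun c => ⟨algebraMap k _ c, φ.commutes c⟩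
  refine ⟨RingHom.ker φ, RingHom.ker_isMaximal_of_surjective (φ : CoordRing F →+* k) hsurj, ?_, ?_⟩
  · intro h
    have h1 : (algebraMap k[X] (CoordRing F) X) -
        algebraMap k (CoordRing F) (φ (algebraMap k[X] (CoordRing F) X)) ∈ RingHom.ker φ := by
      rw [RingHom.mem_ker, map_sub, φ.commutes]; exact sub_self _
    rw [h, Ideal.mem_bot] at h1
    have h2 : aeval (algebraMap k[X] (CoordRing F) X) (X - C (φ (algebraMap k[X] (CoordRing F) X))) =
        aeval (algebraMap k[X] (CoordRing F) X) (0 : k[X]) := by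
      rw [map_sub, aeval_X, aeval_C, map_zero, h1]
    exact X_sub_C_ne_zero _ (aeval_coordRing_injective h2)
  · rw [(Ideal.quotientKerAlgEquivOfSurjective hsurj).toLinearEquiv.finrank_eq, Module.finrank_self]

theorem norm_charSum_sub_le (hF : F.Monic) (hG : (DegFilt.deg (ZMod p)).Good 2 F)
    (he : (F.natDegree : ZMod p) ≠ 0) (ψ : AddChar (ZMod p) ℂ)
    [∀ n, Fintype (GaloisField p n)] [∀ n, DecidableEq (GaloisField p n)] (B : ℝ) (μ₀ : ℕ)
    (hS : ∀ μ ≥ μ₀, ‖∑ a : GaloisField p (2 * μ), (fibrePts F a).card *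
      ψ (Algebra.trace (ZMod p) _ a) - (if ψ = 1 then (p : ℂ) else 0) ^ (2 * μ)‖ ≤ B * p ^ μ)
    (h : ψ = 1 → Nonempty (CoordRing F →ₐ[ZMod p] ZMod p)) :
    ‖∑ a : ZMod p, (fibrePts F a).card * ψ a - (if ψ = 1 then (p : ℂ) else 0)‖ ≤
      (4 * F.natDegree ^ 2 + 1) * √p + 2 * F.natDegree ^ 3 := by
  have := isDedekindDomain_coordRing he
  let G := curveInftyFilt hF hG he
  obtain ⟨s, hs, hpow⟩ := G.exists_primeSum_eq ψ fun h1 => by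
    obtain ⟨φ⟩ := h h1
    exact exists_ideal_of_algHom φ
  have hp0 : (0 : ℝ) < p := by exact_mod_cast hp.out.pos
  have hψ : ∀ a, ‖ψ a‖ ≤ 1 := fun a => (ψ.norm_apply a).le
  rw [ZMod.card] at hpow
  have hsq : ∀ μ : ℕ, (√p) ^ (2 * μ) = (p : ℝ) ^ μ := fun μ => by
    rw [pow_mul, Real.sq_sqrt hp0.le]
  have h1 : ∀ μ ≥ max μ₀ 1, ‖(s.map (· ^ (2 * μ))).sum‖ ≤ (B + 2 * F.natDegree ^ 3) * (√p) ^ (2 * μ) := by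
    intro μ hμ
    have hμ1 : 1 ≤ μ := (le_max_right _ _).trans hμ
    have h2 := hS μ ((le_max_left _ _).trans hμ)
    have := finite_algHom_coordRing (F := F) (L := GaloisField p (2 * μ)) he
    have := Fintype.ofFinite (CoordRing F →ₐ[ZMod p] GaloisField p (2 * μ))
    have h3 := G.primeSum_eq (L := GaloisField p (2 * μ)) ψ
    rw [GaloisField.finrank p (by omega), hpow _ (by omega)] at h3
    have h4 := norm_sum_algHom_sub_le (L := GaloisField p (2 * μ)) hF hG he
      (fun a => ψ (Algebra.trace (ZMod p) _ a)) fun a => hψ _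
    rw [← h3] at h4
    rw [hsq]
    have h5 : (s.map (· ^ (2 * μ))).sum = -((∑ a : GaloisField p (2 * μ), (fibrePts F a).card *
      ψ (Algebra.trace (ZMod p) _ a) - (if ψ = 1 then (p : ℂ) else 0) ^ (2 * μ)) +
      ((if ψ = 1 then (p : ℂ) else 0) ^ (2 * μ) - (s.map (· ^ (2 * μ))).sum -
        ∑ a : GaloisField p (2 * μ), (fibrePts F a).card * ψ (Algebra.trace (ZMod p) _ a))) := by
      ring
    rw [h5, norm_neg]
    refine (norm_add_le_of_le h2 h4).trans ?_
    rw [add_mul]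
    have h6 : (1 : ℝ) ≤ (p : ℝ) ^ μ := one_le_pow₀ (by exact_mod_cast hp.out.one_le)
    have h7 : (0 : ℝ) ≤ 2 * F.natDegree ^ 3 := by positivity
    nlinarith
  have h2 := norm_sum_le_of_even_power_sums s (Real.sqrt_pos.2 hp0) _ _ h1
  have := finite_algHom_coordRing (F := F) (L := ZMod p) he
  have := Fintype.ofFinite (CoordRing F →ₐ[ZMod p] ZMod p)
  have h3 := G.primeSum_eq (L := ZMod p) ψ
  rw [Module.finrank_self, hpow _ le_rfl, pow_one] at h3
  have h4 := norm_sum_algHom_sub_le (L := ZMod p) hF hG he (fun a => ψ a) fun a => hψ _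
  simp only [Algebra.trace_self_apply] at h3
  rw [← h3, norm_sub_rev] at h4
  have h5 : ∑ a : ZMod p, (fibrePts F a).card * ψ a - (if ψ = 1 then (p : ℂ) else 0) =
      (∑ a : ZMod p, (fibrePts F a).card * ψ a - ((if ψ = 1 then (p : ℂ) else 0) -
        (s.map (· ^ 1)).sum)) - (s.map (· ^ 1)).sum := by ring
  rw [h5]
  refine (norm_sub_le_of_le h4 h2).trans ?_
  have h6 : (s.card : ℝ) ≤ 4 * F.natDegree ^ 2 + 1 := by exact_mod_cast hs
  have := mul_le_mul_of_nonneg_right h6 (Real.sqrt_nonneg p)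
  linarith

theorem norm_charSum_le (hF : F.Monic) (hG : (DegFilt.deg (ZMod p)).Good 2 F)
    (he : (F.natDegree : ZMod p) ≠ 0) (ψ : AddChar (ZMod p) ℂ)
    [∀ n, Fintype (GaloisField p n)] [∀ n, DecidableEq (GaloisField p n)] (B : ℝ) (μ₀ : ℕ)
    (hS : ∀ μ ≥ μ₀, ‖∑ a : GaloisField p (2 * μ), (fibrePts F a).card *
      ψ (Algebra.trace (ZMod p) _ a) - (if ψ = 1 then (p : ℂ) else 0) ^ (2 * μ)‖ ≤ B * p ^ μ) :
    ‖∑ a : ZMod p, (fibrePts F a).card * ψ a‖ ≤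
      (if ψ = 1 then (p : ℝ) else 0) + ((4 * F.natDegree ^ 2 + 1) * √p + 2 * F.natDegree ^ 3) := by
  by_cases h : ψ = 1 → Nonempty (CoordRing F →ₐ[ZMod p] ZMod p)
  · have h1 := norm_charSum_sub_le hF hG he ψ B μ₀ hS h
    have h2 := norm_add_le_of_le h1 (le_refl ‖(if ψ = 1 then (p : ℂ) else 0)‖)
    rw [sub_add_cancel] at h2
    refine h2.trans ?_
    split_ifs <;> simp [add_comm]
  · push Not at h
    have := h.2
    have := Fintype.ofFinite (CoordRing F →ₐ[ZMod p] ZMod p)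
    have h4 := norm_sum_algHom_sub_le (L := ZMod p) hF hG he (fun a => ψ a) fun a =>
      (ψ.norm_apply a).le
    rw [Finset.univ_eq_empty, Finset.sum_empty, zero_sub, norm_neg] at h4
    rw [if_pos h.1]
    have : 0 ≤ (4 * (F.natDegree : ℝ) ^ 2 + 1) * √p := by positivity
    have : (0 : ℝ) ≤ p := by positivity
    linarith

end

section

open Polynomial

theorem irreducible_map_adjoinRoot_of_coprime {K : Type*} [Field K] {h g : K[X]}
    (hh : Irreducible h) (hg : Irreducible g) (hc : h.natDegree.Coprime g.natDegree) :
    haveI := Fact.mk hg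
    Irreducible (h.map (AdjoinRoot.of g)) := by
  have := Fact.mk hg
  have hfd : FiniteDimensional K (AdjoinRoot g) := (AdjoinRoot.powerBasis hg.ne_zero).finite
  have hfr : Module.finrank K (AdjoinRoot g) = g.natDegree := by
    rw [(AdjoinRoot.powerBasis hg.ne_zero).finrank, AdjoinRoot.powerBasis_dim]
  have hnu : ¬IsUnit (h.map (AdjoinRoot.of g)) := by
    rw [isUnit_iff_degree_eq_zero, degree_map]
    exact fun hd => hh.not_isUnit (isUnit_iff_degree_eq_zero.2 hd)
  obtain ⟨q, hq, r, hr⟩ := WfDvdMonoid.exists_irreducible_factor hnu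
    (Polynomial.map_ne_zero hh.ne_zero)
  have := Fact.mk hq
  have hfd' : FiniteDimensional (AdjoinRoot g) (AdjoinRoot q) :=
    (AdjoinRoot.powerBasis hq.ne_zero).finite
  have hfr' : Module.finrank (AdjoinRoot g) (AdjoinRoot q) = q.natDegree := by
    rw [(AdjoinRoot.powerBasis hq.ne_zero).finrank, AdjoinRoot.powerBasis_dim]
  have hfd2 : FiniteDimensional K (AdjoinRoot q) := Module.Finite.trans (AdjoinRoot g) _
  have hdvd : h.natDegree ∣ Module.finrank K (AdjoinRoot q) := by
    have hroot : aeval (AdjoinRoot.root q) h = 0 := by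
      rw [aeval_def, IsScalarTower.algebraMap_eq K (AdjoinRoot g) (AdjoinRoot q), ← eval₂_map]
      change eval₂ (AdjoinRoot.of q) (AdjoinRoot.root q) (map (AdjoinRoot.of g) h) = 0
      rw [hr, eval₂_mul, AdjoinRoot.eval₂_root, zero_mul]
    have hint : IsIntegral K (AdjoinRoot.root q) := IsIntegral.of_finite K _
    have hass : Associated (minpoly K (AdjoinRoot.root q)) h :=
      (minpoly.irreducible hint).associated_of_dvd hh (minpoly.dvd K _ hroot)
    rw [← natDegree_eq_of_degree_eq (degree_eq_degree_of_associated hass)]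
    exact minpoly.degree_dvd hint
  rw [← Module.finrank_mul_finrank K (AdjoinRoot g) (AdjoinRoot q), hfr, hfr'] at hdvd
  have hle : h.natDegree ≤ q.natDegree :=
    Nat.le_of_dvd hq.natDegree_pos (hc.dvd_of_dvd_mul_left hdvd)
  have hr0 : r ≠ 0 := by
    rintro rfl
    exact Polynomial.map_ne_zero hh.ne_zero (by rw [hr, mul_zero])
  have hdeg := congrArg natDegree hr
  rw [natDegree_map, natDegree_mul hq.ne_zero hr0] at hdeg
  have hru : IsUnit r := by
    rw [isUnit_iff_degree_eq_zero, degree_eq_natDegree hr0]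
    exact_mod_cast (by lia : r.natDegree = 0)
  have ha : Associated q (h.map (AdjoinRoot.of g)) := ⟨hru.unit, by simpa using hr.symm⟩
  exact ha.irreducible hq

theorem irreducible_map_C_sub_C_X {Λ : Type*} [Field Λ] (g : Λ[X]) :
    Irreducible (g.map C - C X : Λ[X][X]) := by
  have h1 : Irreducible (X - C g : Λ[X][X]) := irreducible_X_sub_C g
  have h2 := (MulEquiv.irreducible_iff (Bivariate.swap (R := Λ))).2 h1
  have h3 : Bivariate.swap (X - C g : Λ[X][X]) = -(g.map C - C X) := by
    rw [map_sub, Bivariate.swap_Y, Bivariate.swap_C]; ring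
  rw [h3] at h2
  exact (Associated.irreducible_iff (Associated.neg_left (Associated.refl _))).1 h2

theorem irreducible_map_compRingHom {Λ : Type*} [Field Λ] {H : Λ[X][X]} (hHm : H.Monic)
    (hH : Irreducible H) {G : Λ[X]} (hG : 0 < G.natDegree)
    (hc : H.natDegree.Coprime G.natDegree) : Irreducible (H.map (compRingHom G)) := by
  let K := RatFunc Λ
  let g0 : Λ[X][X] := G.map C - C X
  have hg0 : Irreducible g0 := irreducible_map_C_sub_C_X G
  have hnat : g0.natDegree = G.natDegree := by
    have : (G.map (C : Λ →+* Λ[X])).natDegree = G.natDegree := natDegree_map_eq_of_injective C_injective G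
    rw [← this]; exact natDegree_sub_C
  have hprim : g0.IsPrimitive := hg0.isPrimitive (by rw [hnat]; lia)
  have hg : Irreducible (g0.map (algebraMap Λ[X] K)) :=
    (hprim.irreducible_iff_irreducible_map_fraction_map).1 hg0
  have hh : Irreducible (H.map (algebraMap Λ[X] K)) :=
    (hHm.irreducible_iff_irreducible_map_fraction_map).1 hH
  have := Fact.mk hg
  set g := g0.map (algebraMap Λ[X] K) with hgdef
  have hinj : Function.Injective (algebraMap Λ[X] K) := IsFractionRing.injective _ _
  have key := irreducible_map_adjoinRoot_of_coprime hh hg (by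
    rw [natDegree_map_eq_of_injective hinj, natDegree_map_eq_of_injective hinj, hnat]
    exact hc)
  let φ : Λ[X] →+* AdjoinRoot g :=
    eval₂RingHom ((AdjoinRoot.of g).comp ((algebraMap Λ[X] K).comp C)) (AdjoinRoot.root g)
  have hφG : φ G = AdjoinRoot.of g (algebraMap Λ[X] K X) := by
    have h1 := AdjoinRoot.eval₂_root g
    have h2 : g = (G.map ((algebraMap Λ[X] K).comp C)) - C (algebraMap Λ[X] K X) := by
      simp [hgdef, g0, Polynomial.map_map]
    rw [h2, eval₂_sub, eval₂_C, eval₂_map, sub_eq_zero] at h1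
    rw [← h2] at h1
    exact h1
  have hcomp : φ.comp (compRingHom G) = (AdjoinRoot.of g).comp (algebraMap Λ[X] K) := by
    ext a
    · simp [φ]
    · simpa using hφG
  have hmap : (H.map (compRingHom G)).map φ =
      (H.map (algebraMap Λ[X] K)).map (AdjoinRoot.of g) := by
    rw [Polynomial.map_map, Polynomial.map_map, hcomp]
  exact (hHm.map _).irreducible_of_irreducible_map φ _ (by rw [hmap]; exact key)

theorem irreducible_map_C_sub_C {Λ : Type*} [Field Λ] {f g : Λ[X]} (hg : g.Monic)
    (hg0 : 0 < g.natDegree) (hf : 0 < f.natDegree) (hc : g.natDegree.Coprime f.natDegree) :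
    Irreducible (g.map C - C f : Λ[X][X]) := by
  have hnat : (g.map C - C X : Λ[X][X]).natDegree = g.natDegree := by
    rw [natDegree_sub_C, natDegree_map_eq_of_injective C_injective]
  have h1 := irreducible_map_compRingHom (H := g.map C - C X) (G := f)
    (by
      refine Monic.sub_of_left (hg.map _) ?_
      rw [degree_eq_natDegree ((hg.map _).ne_zero), natDegree_map_eq_of_injective C_injective]
      exact degree_C_le.trans_lt (by exact_mod_cast hg0))
    (irreducible_map_C_sub_C_X g) hf (by rwa [hnat])
  have h2 : (g.map C - C X : Λ[X][X]).map (compRingHom f) = g.map C - C f := by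
    rw [Polynomial.map_sub, Polynomial.map_map, map_C]
    congr 2
    · ext a; simp
    · simp
  rwa [h2] at h1

end

section

open Polynomial

variable {p : ℕ} [hp : Fact p.Prime] {Λ : Type*} [Field Λ] [Algebra (ZMod p) Λ]

/-- Base change of a bivariate polynomial. -/
noncomputable def bmap {k : Type*} [Field k] (Λ : Type*) [Field Λ] [Algebra k Λ] (F : k[X][X]) :
    Λ[X][X] := F.map (mapRingHom (algebraMap k Λ))

theorem bmap_eval {F : (ZMod p)[X][X]} (x y : Λ) :
    (bmap Λ F).eval₂ (evalRingHom x) y = F.eval₂ (eval₂RingHom (algebraMap (ZMod p) Λ) x) y := by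
  rw [bmap, eval₂_map]
  congr 1
  ext <;> simp

theorem eval_frobenius {F : (ZMod p)[X][X]} (x y : Λ) (n : ℕ) :
    F.eval₂ (eval₂RingHom (algebraMap (ZMod p) Λ) (x ^ p ^ n)) (y ^ p ^ n) =
      (F.eval₂ (eval₂RingHom (algebraMap (ZMod p) Λ) x) y) ^ p ^ n := by
  have := charP_of_injective_algebraMap (algebraMap (ZMod p) Λ).injective p
  rw [← iterateFrobenius_def, ← iterateFrobenius_def, ← iterateFrobenius_def, hom_eval₂]
  congr 1
  refine ringHom_ext (fun a => ?_) ?_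
  · simp only [coe_eval₂RingHom, eval₂_C, RingHom.comp_apply]
    exact (DFunLike.congr_fun (RingHom.ext_zmod (algebraMap (ZMod p) Λ)
      ((iterateFrobenius Λ p n).comp (algebraMap (ZMod p) Λ))) a)
  · simp

theorem eval_algHom {L : Type*} [Field L] [Algebra (ZMod p) L] (σ : L →ₐ[ZMod p] Λ)
    {F : (ZMod p)[X][X]} (x y : L) :
    F.eval₂ (eval₂RingHom (algebraMap (ZMod p) Λ) (σ x)) (σ y) =
      σ (F.eval₂ (eval₂RingHom (algebraMap (ZMod p) L) x) y) := by
  have h := hom_eval₂ F (eval₂RingHom (algebraMap (ZMod p) L) x) (σ : L →+* Λ) y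
  rw [RingHom.coe_coe] at h
  rw [h]
  congr 1
  ext <;> simp

theorem eval_bmap_comp {F : (ZMod p)[X][X]} (w y : Λ) (G : Λ[X]) :
    ((bmap Λ F).map (compRingHom G)).eval₂ (evalRingHom w) y =
      F.eval₂ (eval₂RingHom (algebraMap (ZMod p) Λ) (G.eval w)) y := by
  rw [← bmap_eval, eval₂_map]
  congr 1
  ext <;> simp

theorem card_roots_X_pow_sub [IsAlgClosed Λ] [DecidableEq Λ] {n : ℕ} (hn : n ≠ 0) (a : Λ) :
    (X ^ p ^ n - X - C a : Λ[X]).roots.toFinset.card = p ^ n := by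
  have := charP_of_injective_algebraMap (algebraMap (ZMod p) Λ).injective p
  have h1 : 1 < p ^ n := Nat.one_lt_pow hn hp.out.one_lt
  have hd : (X ^ p ^ n - X - C a : Λ[X]).natDegree = p ^ n := by
    rw [natDegree_sub_C, natDegree_sub_eq_left_of_natDegree_lt (by simpa using h1), natDegree_X_pow]
  rw [Multiset.toFinset_card_of_nodup, splits_iff_card_roots.1 (IsAlgClosed.splits _), hd]
  refine nodup_roots ?_
  rw [separable_def']
  refine ⟨0, -1, ?_⟩
  have : derivative (X ^ p ^ n : Λ[X]) = 0 := by
    rw [derivative_X_pow, Nat.cast_pow, CharP.cast_eq_zero, zero_pow hn, C_0, zero_mul]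
  simp [this]

theorem mem_roots_X_pow_sub [DecidableEq Λ] {n : ℕ} (hn : n ≠ 0) (a w : Λ) :
    w ∈ (X ^ p ^ n - X - C a : Λ[X]).roots.toFinset ↔ w ^ p ^ n = w + a := by
  have h1 : 1 < p ^ n := Nat.one_lt_pow hn hp.out.one_lt
  have h0 : (X ^ p ^ n - X - C a : Λ[X]) ≠ 0 := by
    intro h
    have hd : (X ^ p ^ n - X - C a : Λ[X]).natDegree = p ^ n := by
      rw [natDegree_sub_C, natDegree_sub_eq_left_of_natDegree_lt (by simpa using h1),
        natDegree_X_pow]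
    rw [h, natDegree_zero] at hd
    lia
  rw [Multiset.mem_toFinset, mem_roots h0, IsRoot]
  simp only [eval_sub, eval_pow, eval_X, eval_C]
  rw [sub_sub, sub_eq_zero]

theorem mem_range_algHom [DecidableEq Λ] {L : Type*} [Field L] [Algebra (ZMod p) L] [Fintype L]
    (σ : L →ₐ[ZMod p] Λ) {n : ℕ} (hn : n ≠ 0) (hL : Fintype.card L = p ^ n) {z : Λ}
    (hz : z ^ p ^ n = z) : ∃ a, σ a = z := by
  have h1 : 1 < p ^ n := Nat.one_lt_pow hn hp.out.one_lt
  have hd : (X ^ p ^ n - X - C 0 : Λ[X]).natDegree = p ^ n := by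
    rw [natDegree_sub_C, natDegree_sub_eq_left_of_natDegree_lt (by simpa using h1),
      natDegree_X_pow]
  have h2 : Finset.univ.image σ = (X ^ p ^ n - X - C 0 : Λ[X]).roots.toFinset := by
    refine Finset.eq_of_subset_of_card_le ?_ ?_
    · intro z hz
      obtain ⟨a, -, rfl⟩ := Finset.mem_image.1 hz
      rw [mem_roots_X_pow_sub hn, add_zero, ← map_pow, ← hL, FiniteField.pow_card]
    · rw [Finset.card_image_of_injective (f := σ) _ (RingHom.injective (σ : L →+* Λ)), Finset.card_univ, hL]
      exact (Multiset.toFinset_card_le _).trans ((card_roots' _).trans hd.le)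
  have h3 : z ∈ (X ^ p ^ n - X - C 0 : Λ[X]).roots.toFinset := by
    rw [mem_roots_X_pow_sub hn, add_zero, hz]
  rw [← h2] at h3
  obtain ⟨a, -, h⟩ := Finset.mem_image.1 h3
  exact ⟨a, h⟩

theorem artinSchreier_trace {L : Type*} [Field L] [Algebra (ZMod p) L] [Finite L]
    (σ : L →ₐ[ZMod p] Λ) {n : ℕ} (hL : Module.finrank (ZMod p) L = n) {w : Λ} {a : L}
    (h : w ^ p = w + σ a) :
    w ^ p ^ n = w + algebraMap (ZMod p) Λ (Algebra.trace (ZMod p) L a) := by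
  have := charP_of_injective_algebraMap (algebraMap (ZMod p) Λ).injective p
  rw [← σ.commutes, FiniteField.algebraMap_trace_eq_sum_pow, hL, map_sum]
  clear hL
  induction n with
  | zero => simp
  | succ n ih =>
    rw [Finset.sum_range_succ, ← add_assoc, ← ih, Nat.card_zmod, map_pow, ← add_pow_char_pow, ← h,
      ← pow_mul, pow_succ, mul_comm]

theorem card_artinSchreier [IsAlgClosed Λ] [DecidableEq Λ] {L : Type*} [Field L]
    [Algebra (ZMod p) L] [Fintype L] [DecidableEq L] (σ : L →ₐ[ZMod p] Λ) {n : ℕ} (hn : n ≠ 0)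
    (hL : Module.finrank (ZMod p) L = n) {F : (ZMod p)[X][X]} (τ : ZMod p) {A : Finset (Λ × Λ)}
    (hA : ∀ x, x ∈ A ↔ x.1 ^ p ^ n = x.1 + algebraMap (ZMod p) Λ τ ∧
      F.eval₂ (eval₂RingHom (algebraMap (ZMod p) Λ) (x.1 ^ p - x.1)) x.2 = 0 ∧
        x.2 ^ p ^ n = x.2) :
    A.card = p * ∑ a : L with Algebra.trace (ZMod p) L a = τ, (fibrePts F a).card := by
  have := charP_of_injective_algebraMap (algebraMap (ZMod p) Λ).injective p
  have hcard : Fintype.card L = p ^ n := by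
    rw [Module.card_eq_pow_finrank (K := ZMod p), ZMod.card, hL]
  let R (a : L) : Finset Λ := (X ^ p ^ 1 - X - C (σ a) : Λ[X]).roots.toFinset
  have hR (a : L) (w : Λ) : w ∈ R a ↔ w ^ p = w + σ a := by
    have := mem_roots_X_pow_sub (p := p) one_ne_zero (σ a) w
    simp only [R]
    rwa [pow_one] at this ⊢
  have hRc (a : L) : (R a).card = p := by
    have := card_roots_X_pow_sub (p := p) one_ne_zero (σ a)
    simpa [R] using this
  let S : Finset (Σ _ : L, L) := (Finset.univ.filter fun a : L =>
    Algebra.trace (ZMod p) L a = τ).sigma fun a => fibrePts F a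
  have hAS : A = S.biUnion fun s => (R s.1).image fun w => (w, σ s.2) := by
    ext ⟨w, y⟩
    simp only [hA, Finset.mem_biUnion, S, Finset.mem_sigma, Finset.mem_filter, Finset.mem_univ,
      true_and, fibrePts, Finset.mem_image, Prod.mk.injEq]
    constructor
    · rintro ⟨h1, h2, h3⟩
      obtain ⟨a, ha⟩ := mem_range_algHom σ hn hcard (z := w ^ p - w) (by
        rw [sub_pow_char_pow, ← pow_mul, mul_comm, pow_mul, h1, add_pow_char, ← map_pow,
          ZMod.pow_card]
        ring)
      obtain ⟨z, rfl⟩ := mem_range_algHom σ hn hcard h3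
      have h4 := artinSchreier_trace σ hL (w := w) (a := a) (by rw [ha]; ring)
      refine ⟨⟨a, z⟩, ⟨?_, ?_⟩, w, ?_, rfl, rfl⟩
      · rw [h1] at h4
        exact ((algebraMap (ZMod p) Λ).injective (add_left_cancel h4)).symm
      · rw [← ha, eval_algHom] at h2
        exact (map_eq_zero σ).1 h2
      · rw [hR, ha]; ring
    · rintro ⟨⟨a, z⟩, ⟨h1, h2⟩, w', hw', rfl, rfl⟩
      rw [hR] at hw'
      refine ⟨?_, ?_, ?_⟩
      · rw [← h1]; exact artinSchreier_trace σ hL hw'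
      · have : w' ^ p - w' = σ a := by rw [hw']; ring
        rw [this, eval_algHom, h2, map_zero]
      · rw [← map_pow, ← hcard, FiniteField.pow_card]
  rw [hAS, Finset.card_biUnion]
  · have : ∀ s ∈ S, ((R s.1).image fun w => (w, σ s.2)).card = p := fun s _ => by
      rw [Finset.card_image_of_injective _ (fun a b h => (Prod.ext_iff.1 h).1), hRc]
    rw [Finset.sum_congr rfl this, Finset.sum_const, Finset.card_sigma, smul_eq_mul, mul_comm]
  · rintro ⟨a, z⟩ _ ⟨a', z'⟩ _ hne
    rw [Function.onFun, Finset.disjoint_left]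
    intro x hx hx'
    obtain ⟨w, hw, rfl⟩ := Finset.mem_image.1 hx
    obtain ⟨w', hw', h⟩ := Finset.mem_image.1 hx'
    simp only [Prod.mk.injEq] at h
    obtain ⟨rfl, h⟩ := h
    rw [hR] at hw hw'
    have h5 : σ a = σ a' := add_left_cancel (hw.symm.trans hw')
    have h6 := RingHom.injective (σ : L →+* Λ) h5
    have h7 := RingHom.injective (σ : L →+* Λ) h
    exact hne (by rw [h6, h7])

theorem good_comp_artinSchreier {G : Λ[X][X]} (hG : G.Monic) (hc : (DegFilt.deg Λ).Good 2 G) :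
    (DegFilt.deg Λ).Good ((2 * p : ℕ) : ℤ) (G.map (compRingHom (X ^ p - X))) := by
  rw [DegFilt.good_deg_iff (hG.map _), hG.natDegree_map]
  have hc' := (DegFilt.good_deg_iff (c := 2) hG).1 hc
  intro i hi
  rw [coeff_map, coe_compRingHom_apply, natDegree_comp,
    natDegree_sub_eq_left_of_natDegree_lt (by simpa using hp.out.one_lt), natDegree_X_pow]
  have := Nat.mul_le_mul_right p (hc' i hi)
  calc _ ≤ _ := this
    _ = _ := by ring

end

section

open Polynomial

variable {p : ℕ} [hp : Fact p.Prime] {F : (ZMod p)[X][X]}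

theorem irreducible_genF {Λ : Type*} [Field Λ] [Algebra (ZMod p) Λ] (hF : F.Monic)
    (h : Irreducible (bmap Λ F)) : Irreducible (genF F) := by
  have h1 : Irreducible F := hF.irreducible_of_irreducible_map _ _ h
  exact (hF.irreducible_iff_irreducible_map_fraction_map).1 h1

theorem norm_sum_fibres_sub_le {L : Type*} [Fintype L] {t : L → ZMod p} {N : L → ℕ}
    (ψ : AddChar (ZMod p) ℂ) {q : ℕ} {B : ℝ}
    (h : ∀ τ, |(p : ℝ) * (∑ a : L with t a = τ, N a : ℕ) - q| ≤ B) :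
    ‖∑ a, (N a : ℂ) * ψ (t a) - (if ψ = 1 then (q : ℂ) else 0)‖ ≤ B := by
  classical
  have hp0 : (0 : ℝ) < p := by exact_mod_cast hp.out.pos
  have hp0' : (p : ℂ) ≠ 0 := by exact_mod_cast hp.out.ne_zero
  have h1 : ∑ a, (N a : ℂ) * ψ (t a) =
      ∑ τ, ((∑ a : L with t a = τ, N a : ℕ) : ℂ) * ψ τ := by
    rw [← Finset.sum_fiberwise Finset.univ t]
    refine Finset.sum_congr rfl fun τ _ => ?_
    rw [Nat.cast_sum, Finset.sum_mul]
    refine Finset.sum_congr rfl fun a ha => ?_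
    rw [(Finset.mem_filter.1 ha).2]
  have h2 : (if ψ = 1 then (q : ℂ) else 0) = ∑ τ : ZMod p, (q / p : ℂ) * ψ τ := by
    rw [← Finset.mul_sum, AddChar.sum_eq_ite]
    split_ifs with h0 h3 h3
    · rw [ZMod.card]; field_simp
    · exact absurd h0 h3
    · exact absurd h3 h0
    · rw [mul_zero]
  rw [h1, h2, ← Finset.sum_sub_distrib]
  refine (norm_sum_le _ _).trans ?_
  have h3 : ∀ τ ∈ (Finset.univ : Finset (ZMod p)),
      ‖((∑ a : L with t a = τ, N a : ℕ) : ℂ) * ψ τ - (q / p : ℂ) * ψ τ‖ ≤ B / p := by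
    intro τ _
    rw [← sub_mul, norm_mul, AddChar.norm_apply, mul_one, le_div_iff₀ hp0]
    refine le_trans (le_of_eq ?_) (h τ)
    rw [← Real.norm_eq_abs, ← Complex.norm_real]
    have : (p : ℝ) = ‖(p : ℂ)‖ := by simp
    rw [this, ← norm_mul]
    congr 1
    push_cast
    field_simp
    simp
  refine (Finset.sum_le_sum h3).trans (le_of_eq ?_)
  rw [Finset.sum_const, Finset.card_univ, ZMod.card, nsmul_eq_mul]
  field_simp

set_option maxHeartbeats 800000 in
theorem exists_charSum_galoisField_bound {Λ : Type*} [Field Λ] [Algebra (ZMod p) Λ]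
    [IsAlgClosed Λ] (hF : F.Monic) (hG : (DegFilt.deg (ZMod p)).Good 2 F) (he2 : 2 ≤ F.natDegree)
    (hep : F.natDegree < p) (hirr : Irreducible (bmap Λ F)) (ψ : AddChar (ZMod p) ℂ)
    [∀ n, Fintype (GaloisField p n)] [∀ n, DecidableEq (GaloisField p n)] :
    ∃ (B : ℝ) (μ₀ : ℕ), ∀ μ ≥ μ₀, ‖∑ a : GaloisField p (2 * μ), (fibrePts F a).card *
      ψ (Algebra.trace (ZMod p) _ a) - (if ψ = 1 then (p : ℂ) else 0) ^ (2 * μ)‖ ≤ B * p ^ μ := by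
  classical
  have := charP_of_injective_algebraMap (algebraMap (ZMod p) Λ).injective p
  have hbm : (bmap Λ F).Monic := hF.map _
  have hbd : (bmap Λ F).natDegree = F.natDegree := hF.natDegree_map _
  have hbg : (DegFilt.deg Λ).Good 2 (bmap Λ F) := by
    have h := (DegFilt.good_deg_iff (c := 2) hF).1 hG
    refine (DegFilt.good_deg_iff (c := 2) hbm).2 ?_
    rw [hbd]
    intro i hi
    rw [bmap, coeff_map, coe_mapRingHom]
    exact natDegree_map_le.trans (h i hi)
  have hcop : (bmap Λ F).natDegree.Coprime (X ^ p - X : Λ[X]).natDegree := by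
    rw [natDegree_sub_eq_left_of_natDegree_lt (by simpa using hp.out.one_lt), natDegree_X_pow, hbd]
    exact (Nat.coprime_of_lt_prime (by lia) hep hp.out).symm
  have hASd : 0 < (X ^ p - X : Λ[X]).natDegree := by
    rw [natDegree_sub_eq_left_of_natDegree_lt (by simpa using hp.out.one_lt), natDegree_X_pow]
    exact hp.out.pos
  have hF2 := irreducible_map_compRingHom hbm hirr hASd hcop
  have hF2m := hbm.map (compRingHom (X ^ p - X : Λ[X]))
  have hF2d : ((bmap Λ F).map (compRingHom (X ^ p - X : Λ[X]))).natDegree = F.natDegree := by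
    rw [hbm.natDegree_map, hbd]
  obtain ⟨D, μ₀, hC⟩ := card_fixed_points_approx (p := p) hF2m hF2 (good_comp_artinSchreier hbm hbg)
    (by rw [hF2d]; exact he2) (by
      rw [hF2d, Ne, CharP.cast_eq_zero_iff Λ p]
      exact Nat.not_dvd_of_pos_of_lt (by lia) hep)
  refine ⟨D, max μ₀ 1, fun μ hμ => ?_⟩
  have hn : 2 * μ ≠ 0 := by
    have := le_of_max_le_right hμ
    lia
  have hq : (p ^ μ) ^ 2 = p ^ (2 * μ) := by rw [← pow_mul, mul_comm]
  have hif : (if ψ = 1 then (p : ℂ) else 0) ^ (2 * μ) =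
      if ψ = 1 then ((p ^ (2 * μ) : ℕ) : ℂ) else 0 := by
    split_ifs
    · push_cast; rfl
    · rw [zero_pow hn]
  rw [hif]
  refine norm_sum_fibres_sub_le ψ fun τ => ?_
  let σ : GaloisField p (2 * μ) →ₐ[ZMod p] Λ := IsAlgClosed.lift
  let T : Finset Λ := (X ^ p ^ (2 * μ) - X - C (algebraMap (ZMod p) Λ τ) : Λ[X]).roots.toFinset
  have hT (w : Λ) : w ∈ T ↔ w ^ p ^ (2 * μ) = w + algebraMap (ZMod p) Λ τ :=
    mem_roots_X_pow_sub hn _ _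
  let Z : Finset Λ := (X ^ p ^ (2 * μ) - X - C 0 : Λ[X]).roots.toFinset
  have hZ (w : Λ) : w ∈ Z ↔ w ^ p ^ (2 * μ) = w := by
    have := mem_roots_X_pow_sub (p := p) hn 0 w
    rwa [add_zero] at this
  have hfix {w : Λ} (hw : w ^ p ^ (2 * μ) = w + algebraMap (ZMod p) Λ τ) :
      (w ^ p - w) ^ p ^ (2 * μ) = w ^ p - w := by
    rw [sub_pow_char_pow, ← pow_mul, mul_comm, pow_mul, hw, add_pow_char, ← map_pow,
      ZMod.pow_card]
    ring
  have heval (w y : Λ) : ((bmap Λ F).map (compRingHom (X ^ p - X))).eval₂ (evalRingHom w) y =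
      F.eval₂ (eval₂RingHom (algebraMap (ZMod p) Λ) (w ^ p - w)) y := by
    rw [eval_bmap_comp]; simp
  let A : Finset (Λ × Λ) := (T ×ˢ Z).filter fun x =>
    F.eval₂ (eval₂RingHom (algebraMap (ZMod p) Λ) (x.1 ^ p - x.1)) x.2 = 0
  have hA (x) : x ∈ A ↔ x.1 ^ p ^ (2 * μ) = x.1 + algebraMap (ZMod p) Λ τ ∧
      F.eval₂ (eval₂RingHom (algebraMap (ZMod p) Λ) (x.1 ^ p - x.1)) x.2 = 0 ∧
        x.2 ^ p ^ (2 * μ) = x.2 := by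
    simp only [A, Finset.mem_filter, Finset.mem_product, hT, hZ]
    tauto
  have key := hC (algebraMap (ZMod p) Λ τ) μ (le_of_max_le_left hμ) T
    (by rw [hq]; exact card_roots_X_pow_sub hn _) (fun w hw => by rw [hq]; exact (hT w).1 hw)
    (fun w hw y hy => by
      rw [heval] at hy ⊢
      rw [hq]
      have := eval_frobenius (F := F) (w ^ p - w) y (2 * μ)
      rw [hfix ((hT w).1 hw), hy, zero_pow (pow_ne_zero _ hp.out.ne_zero)] at this
      exact this) A
    (fun x => by rw [hA, hT, heval, hq])
  rw [hq, card_artinSchreier σ hn (GaloisField.finrank p hn) τ hA] at key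
  obtain ⟨k1, k2⟩ := key
  have k1' : (p : ℝ) * (∑ a : GaloisField p (2 * μ) with Algebra.trace (ZMod p) _ a = τ,
      (fibrePts F a).card : ℕ) ≤ (p ^ (2 * μ) : ℕ) + D * p ^ μ := by exact_mod_cast k1
  have k2' : ((p ^ (2 * μ) : ℕ) : ℝ) ≤ (p : ℝ) * (∑ a : GaloisField p (2 * μ) with
      Algebra.trace (ZMod p) _ a = τ, (fibrePts F a).card : ℕ) + D * p ^ μ := by exact_mod_cast k2
  rw [abs_le]
  constructor <;> linarith

/-- Weil's bound for additive character sums along the fibres of a plane curve. -/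
theorem norm_charSum_fibrePts_le (Λ : Type*) [Field Λ] [Algebra (ZMod p) Λ]
    [IsAlgClosed Λ] (hF : F.Monic) (hG : ∀ i < F.natDegree, (F.coeff i).natDegree ≤
      2 * (F.natDegree - i)) (he2 : 2 ≤ F.natDegree)
    (hep : F.natDegree < p) (hirr : Irreducible (bmap Λ F)) (ψ : AddChar (ZMod p) ℂ) :
    ‖∑ a : ZMod p, (fibrePts F a).card * ψ a‖ ≤
      (if ψ = 1 then (p : ℝ) else 0) + ((4 * F.natDegree ^ 2 + 1) * √p + 2 * F.natDegree ^ 3) := by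
  classical
  let _ (n : ℕ) : Fintype (GaloisField p n) := Fintype.ofFinite _
  have hG' := (DegFilt.good_deg_iff (c := 2) hF).2 hG
  obtain ⟨B, μ₀, h⟩ := exists_charSum_galoisField_bound hF hG' he2 hep hirr ψ
  have := Fact.mk (irreducible_genF hF hirr)
  refine norm_charSum_le hF hG' ?_ ψ B μ₀ h
  rw [Ne, ZMod.natCast_eq_zero_iff]
  exact Nat.not_dvd_of_pos_of_lt (by lia) hep

end

section

open Polynomial

theorem eq_const_of_conv_eq {j : ℕ} [Fact j.Prime] (a : ZMod j → ℤ)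
    (h : ∀ t, ∑ u, a u * a (t - u) = j * a t) {s t : ZMod j} (hs : s ≠ 0) (ht : t ≠ 0) :
    a s = a t := by
  have hj : j.Prime := Fact.out
  set ω : ℂ := Complex.exp (2 * Real.pi * Complex.I / j)
  have hω : IsPrimitiveRoot ω j := Complex.isPrimitiveRoot_exp j hj.ne_zero
  let χ : AddChar (ZMod j) ℂ := AddChar.zmodChar j hω.pow_eq_one
  have hχ : ∀ x : ZMod j, χ x = ω ^ x.val := fun x => rfl
  set c : ℂ := ∑ t, (a t : ℂ) * χ t with hc
  have hcc : c * c = j * c := by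
    have h1 : ∀ t, ((∑ u, a u * a (t - u) : ℤ) : ℂ) * χ t = (j * a t : ℂ) * χ t := fun t => by
      rw [h t]; push_cast; rfl
    have h2 := Finset.sum_congr rfl (fun t (_ : t ∈ Finset.univ) => h1 t)
    have h3 : ∑ t, (j * a t : ℂ) * χ t = j * c := by
      rw [hc, Finset.mul_sum]; exact Finset.sum_congr rfl fun _ _ => by ring
    rw [h3] at h2
    rw [← h2, hc, Finset.sum_mul_sum]
    simp_rw [Int.cast_sum, Finset.sum_mul]
    rw [Finset.sum_comm]
    conv_rhs => rw [Finset.sum_comm]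
    rw [Finset.sum_comm]
    refine Finset.sum_congr rfl fun u _ => ?_
    refine Fintype.sum_equiv (Equiv.addRight u) _ _ fun v => ?_
    simp only [Equiv.coe_addRight, add_sub_cancel_right, AddChar.map_add_eq_mul]
    push_cast; ring
  obtain ⟨n, hn⟩ : ∃ n : ℤ, c = n := by
    rcases eq_or_ne c 0 with h0 | h0
    · exact ⟨0, by simpa using h0⟩
    · exact ⟨j, by simpa using mul_right_cancel₀ h0 hcc⟩
  let P : ℚ[X] := ∑ t : ZMod j, C (a t : ℚ) * X ^ t.val - C (n : ℚ)
  have hcoef : ∀ s : ZMod j, s ≠ 0 → P.coeff s.val = a s := fun s hs => by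
    have h0 : s.val ≠ 0 := by rwa [Ne, ZMod.val_eq_zero]
    simp only [P, coeff_sub, finsetSum_coeff, coeff_C_mul_X_pow, coeff_C, if_neg h0, sub_zero]
    rw [Finset.sum_eq_single s]
    · simp
    · intro b _ hb
      rw [if_neg fun h => hb (ZMod.val_injective j h).symm]
    · simp
  have hPdeg : P.degree < j := by
    refine (degree_sub_le _ _).trans_lt (max_lt ?_ ?_)
    · refine (degree_sum_le _ _).trans_lt ?_
      refine (Finset.sup_lt_iff (WithBot.bot_lt_coe j)).2 fun t _ => (degree_C_mul_X_pow_le _ _).trans_lt (WithBot.coe_lt_coe.2 (ZMod.val_lt t))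
    · exact degree_C_le.trans_lt (by exact_mod_cast hj.pos)
  have hP0 : aeval ω P = 0 := by
    simp only [P, map_sub, map_sum, map_mul, aeval_C, map_pow, aeval_X]
    simp only [map_intCast]
    rw [sub_eq_zero, ← hn, hc]
    rfl
  have hdvd : cyclotomic j ℚ ∣ P := by
    rw [cyclotomic_eq_minpoly_rat hω hj.pos]
    exact minpoly.dvd _ _ hP0
  obtain ⟨R, hR⟩ := hdvd
  have hRdeg : R.natDegree = 0 := by
    rcases eq_or_ne R 0 with h0 | h0
    · simp [h0]
    have hcy := cyclotomic_ne_zero j ℚ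
    rw [hR, degree_mul, degree_eq_natDegree hcy, degree_eq_natDegree h0, natDegree_cyclotomic,
      Nat.totient_prime hj] at hPdeg
    have : j - 1 + R.natDegree < j := by exact_mod_cast hPdeg
    lia
  rw [eq_C_of_natDegree_eq_zero hRdeg] at hR
  have hcy : ∀ s : ZMod j, (cyclotomic j ℚ).coeff s.val = 1 := fun s => by
    rw [cyclotomic_prime]
    simp [finsetSum_coeff, coeff_X_pow, ZMod.val_lt s]
  have h1 := hcoef s hs
  have h2 := hcoef t ht
  rw [hR, coeff_mul_C, hcy, one_mul] at h1 h2
  exact_mod_cast h1.symm.trans h2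

theorem mem_iff_of_small_sums {Λ : Type*} [Field Λ] {p j : ℕ} [CharP Λ p] [Fact j.Prime]
    (hp : 2 * j ^ 5 < p) {ψ : AddChar (ZMod j) Λ} (hψ : ψ.IsPrimitive) (S : Finset (ZMod j))
    (a : ZMod j → ℤ) (ha : ∀ k, |a k| ≤ j ^ 2) (haS : ∀ k, (a k : Λ) = ∑ s ∈ S, ψ (k * s))
    {s t : ZMod j} (hs : s ≠ 0) (ht : t ≠ 0) : s ∈ S ↔ t ∈ S := by
  classical
  have hj : j.Prime := Fact.out
  have hj1 := hj.one_lt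
  have hjp : j < p := by nlinarith [Nat.pow_le_pow_right hj.pos (show 1 ≤ 5 by norm_num)]
  have hj0 : (j : Λ) ≠ 0 := by
    rw [Ne, CharP.cast_eq_zero_iff Λ p]
    exact fun h => absurd (Nat.le_of_dvd hj.pos h) (by lia)
  have hconv : ∀ t, ∑ u, a u * a (t - u) = j * a t := fun t => by
    have h1 : ((∑ u, a u * a (t - u) - j * a t : ℤ) : Λ) = 0 := by
      push_cast
      simp_rw [haS, Finset.sum_mul_sum, ← AddChar.map_add_eq_mul]
      rw [Finset.sum_comm]
      have h2 : ∀ x ∈ S, ∑ u, ∑ y ∈ S, ψ (u * x + (t - u) * y) = j * ψ (t * x) := fun x hx => by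
        rw [Finset.sum_comm]
        have h3 : ∀ y ∈ S, ∑ u, ψ (u * x + (t - u) * y) = if y = x then j * ψ (t * x) else 0 :=
          fun y _ => by
          have h4 : ∀ u, ψ (u * x + (t - u) * y) = ψ (t * y) * ψ (u * (x - y)) := fun u => by
            rw [← AddChar.map_add_eq_mul]; congr 1; ring
          simp_rw [h4, ← Finset.mul_sum]
          rw [AddChar.sum_mulShift _ hψ]
          by_cases hxy : y = x
          · subst hxy; simp [ZMod.card, mul_comm]
          · rw [if_neg (sub_ne_zero.2 (Ne.symm hxy)), if_neg hxy]; simp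
        rw [Finset.sum_congr rfl h3]
        simp [hx]
      rw [Finset.sum_congr rfl h2, ← Finset.mul_sum, sub_self]
    rw [CharP.intCast_eq_zero_iff Λ p] at h1
    have h5 : |∑ u, a u * a (t - u) - j * a t| < p := by
      calc |∑ u, a u * a (t - u) - j * a t| ≤ |∑ u, a u * a (t - u)| + |j * a t| := abs_sub _ _
        _ ≤ ∑ u : ZMod j, (j ^ 2 * j ^ 2 : ℤ) + j * j ^ 2 := by
          refine add_le_add ((Finset.abs_sum_le_sum_abs _ _).trans
            (Finset.sum_le_sum fun u _ => ?_)) ?_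
          · rw [abs_mul]; exact mul_le_mul (ha _) (ha _) (abs_nonneg _) (by positivity)
          · rw [abs_mul, Nat.abs_cast]
            exact mul_le_mul_of_nonneg_left (ha t) (by positivity)
        _ ≤ 2 * j ^ 5 := by
          simp only [Finset.sum_const, Finset.card_univ, ZMod.card, nsmul_eq_mul]
          have : (1 : ℤ) ≤ j := by exact_mod_cast hj.pos
          have h6 : (j : ℤ) ^ 3 ≤ j ^ 5 := pow_le_pow_right₀ this (by norm_num)
          nlinarith
        _ < p := by exact_mod_cast hp
    exact sub_eq_zero.1 (Int.eq_zero_of_abs_lt_dvd h1 h5)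
  have hinv : ∀ s : ZMod j, s ≠ 0 → (if s ∈ S then (j : Λ) else 0) = a 0 - a 1 := fun s hs => by
    have h1 : ∑ t, (a t : Λ) * ψ (t * -s) = if s ∈ S then (j : Λ) else 0 := by
      simp_rw [haS, Finset.sum_mul, ← AddChar.map_add_eq_mul]
      rw [Finset.sum_comm]
      have h3 : ∀ y ∈ S, ∑ u, ψ (u * y + u * -s) = if y = s then (j : Λ) else 0 := fun y _ => by
        simp_rw [← mul_add]
        rw [AddChar.sum_mulShift _ hψ]
        simp [ZMod.card, ← sub_eq_add_neg, sub_eq_zero]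
      rw [Finset.sum_congr rfl h3]
      simp
    rw [← h1]
    have h2 : ∀ t, (a t : Λ) * ψ (t * -s) = (a 1 : Λ) * ψ (t * -s) +
        if t = 0 then (a 0 - a 1 : Λ) else 0 := fun t => by
      by_cases ht : t = 0
      · subst ht; simp
      · rw [eq_const_of_conv_eq a hconv ht one_ne_zero]; simp [ht]
    simp_rw [h2]
    rw [Finset.sum_add_distrib, ← Finset.mul_sum, AddChar.sum_mulShift _ hψ]
    simp [hs]
  have h1 := (hinv s hs).trans (hinv t ht).symm
  by_cases h2 : s ∈ S <;> by_cases h3 : t ∈ S <;> simp_all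

end

section

open Polynomial

theorem exists_cyclic_labelling {K : Type*} [Field K] {g : K[X]} (hg : Irreducible g)
    (hs : g.Separable) {j : ℕ} [Fact j.Prime] (hj : g.natDegree = j) :
    ∃ (c : g.SplittingField ≃ₐ[K] g.SplittingField) (x : ZMod j → g.SplittingField),
      Function.Injective x ∧ (∀ z, aeval z g = 0 ↔ ∃ i, z = x i) ∧ ∀ i, c (x i) = x (i + 1) := by
  classical
  have hjp : j.Prime := Fact.out
  have hgal : IsGalois K g.SplittingField := IsGalois.of_separable_splitting_field hs
  have hdvd : j ∣ Nat.card (g.SplittingField ≃ₐ[K] g.SplittingField) := by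
    rw [IsGalois.card_aut_eq_finrank]
    have hp : (g.map (algebraMap K g.SplittingField)).degree ≠ 0 := by
      rw [degree_map, degree_eq_natDegree hg.ne_zero, hj]
      exact_mod_cast hjp.ne_zero
    let α := rootOfSplits (SplittingField.splits g) hp
    have hα : aeval α g = 0 := by
      rw [← eval_map_algebraMap]; exact eval_rootOfSplits _ _
    have hint : IsIntegral K α := IsIntegral.of_finite K α
    have hass : Associated (minpoly K α) g :=
      (minpoly.irreducible hint).associated_of_dvd hg (minpoly.dvd K _ hα)
    rw [← hj, ← natDegree_eq_of_degree_eq (degree_eq_degree_of_associated hass)]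
    exact minpoly.degree_dvd hint
  have hfin : Finite (g.SplittingField ≃ₐ[K] g.SplittingField) := inferInstance
  obtain ⟨c, hc⟩ := exists_prime_orderOf_dvd_card' j hdvd
  obtain ⟨x₀, hx₀, hcx⟩ : ∃ x₀, aeval x₀ g = 0 ∧ c x₀ ≠ x₀ := by
    by_contra! hcon
    have : c = 1 := by
      have h1 : (c : g.SplittingField →ₐ[K] g.SplittingField) = AlgHom.id K _ := by
        refine AlgHom.ext_of_adjoin_eq_top (IsSplittingField.adjoin_rootSet _ g) fun z hz => ?_
        exact hcon z (mem_rootSet.1 hz).2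
      ext z
      exact DFunLike.congr_fun h1 z
    rw [this, orderOf_one] at hc
    exact hjp.one_lt.ne hc
  have hpow : ∀ (n : ℕ) z, c^[n] z = (c ^ n) z := fun n z => by
    induction n with
    | zero => rfl
    | succ n ih => rw [Function.iterate_succ_apply', ih, pow_succ']; rfl
  have hper : Function.minimalPeriod c x₀ = j := by
    refine Function.minimalPeriod_eq_prime (p := j) ?_ hcx
    rw [Function.IsPeriodicPt, Function.IsFixedPt, hpow, ← hc, pow_orderOf_eq_one]; rfl
  let x : ZMod j → g.SplittingField := fun i => c^[i.val] x₀
  have hxn : ∀ n : ℕ, x (n : ZMod j) = c^[n] x₀ := fun n => by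
    simp only [x, ZMod.val_natCast]
    conv_lhs => rw [← hper]
    rw [Function.iterate_mod_minimalPeriod_eq]
  have hxinj : Function.Injective x := by
    intro a b hab
    refine ZMod.val_injective j (Function.iterate_injOn_Iio_minimalPeriod (f := c) (x := x₀) ?_ ?_ hab)
    · rw [hper]; exact ZMod.val_lt a
    · rw [hper]; exact ZMod.val_lt b
  have hxroot : ∀ i, aeval (x i) g = 0 := fun i => by
    simp only [x, hpow]
    rw [aeval_algHom_apply, hx₀, map_zero]
  refine ⟨c, x, hxinj, fun z => ⟨fun hz => ?_, ?_⟩, fun i => ?_⟩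
  · have hcard : Fintype.card (g.rootSet g.SplittingField) = j := by
      rw [card_rootSet_eq_natDegree hs (SplittingField.splits g), hj]
    let y : ZMod j → g.rootSet g.SplittingField := fun i =>
      ⟨x i, mem_rootSet.2 ⟨hg.ne_zero, hxroot i⟩⟩
    have hyb : Function.Bijective y := by
      rw [Fintype.bijective_iff_injective_and_card]
      exact ⟨fun a b hab => hxinj (congrArg Subtype.val hab), by rw [ZMod.card, hcard]⟩
    obtain ⟨i, hi⟩ := hyb.2 ⟨z, mem_rootSet.2 ⟨hg.ne_zero, hz⟩⟩
    exact ⟨i, (congrArg Subtype.val hi).symm⟩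
  · rintro ⟨i, rfl⟩; exact hxroot i
  · have h1 : (i + 1 : ZMod j) = ((i.val + 1 : ℕ) : ZMod j) := by simp
    rw [h1, hxn, Function.iterate_succ_apply']

theorem mul_prime_invariant {j r : ℕ} [Fact j.Prime] [Fact r.Prime] (hr : r ≠ j)
    (π : Equiv.Perm (ZMod j)) (S : Finset (ZMod j))
    (hS : ∀ i k, π k - π i ∈ S ↔ k - i ∈ S) (i k : ZMod j) :
    π k - π i ∈ S.image ((r : ZMod j) * ·) ↔ k - i ∈ S.image ((r : ZMod j) * ·) := by
  classical
  have hr0 : (r : ZMod j) ≠ 0 := by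
    rw [Ne, ZMod.natCast_eq_zero_iff, Nat.prime_dvd_prime_iff_eq Fact.out Fact.out]
    exact hr.symm
  let P : Matrix (ZMod j) (ZMod j) (ZMod r) := fun i k => if k - i = 1 then 1 else 0
  have hP : ∀ (n : ℕ) i k, (P ^ n) i k = if k - i = (n : ZMod j) then 1 else 0 := by
    intro n
    induction n with
    | zero => intro i k; simp [Matrix.one_apply, sub_eq_zero, eq_comm]
    | succ n ih =>
      intro i k
      rw [pow_succ, Matrix.mul_apply]
      simp_rw [ih, P]
      rw [Finset.sum_eq_single (i + n)]
      · simp only [add_sub_cancel_left, if_true, one_mul]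
        push_cast
        congr 1
        rw [eq_iff_iff]
        constructor
        · intro h; rw [← h]; ring
        · intro h; linear_combination h
      · intro b _ hb
        rw [if_neg, zero_mul]
        intro h; exact hb (by rw [← h]; ring)
      · simp
  let f : (ZMod r)[X] := ∑ s ∈ S, X ^ s.val
  let M := aeval P f
  have hM : ∀ i k, M i k = if k - i ∈ S then 1 else 0 := fun i k => by
    simp only [M, f, map_sum, map_pow, aeval_X, Matrix.sum_apply, hP, ZMod.natCast_val,
      ZMod.cast_id', id]
    simp
  have hMr : ∀ i k, (M ^ r) i k = if k - i ∈ S.image ((r : ZMod j) * ·) then 1 else 0 :=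
    fun i k => by
    have h1 : M ^ r = ∑ s ∈ S, P ^ (r * s.val) := by
      simp only [M]
      rw [← map_pow, ← ZMod.expand_card]
      simp only [f, map_sum, map_pow, expand_X, aeval_X, ← pow_mul]
    rw [h1]
    simp only [Matrix.sum_apply, hP, Nat.cast_mul, ZMod.natCast_val, ZMod.cast_id', id]
    rw [← Finset.sum_image (s := S) (g := ((r : ZMod j) * ·))
      (f := fun t => if k - i = t then (1 : ZMod r) else 0)
      (fun a _ b _ h => mul_left_cancel₀ hr0 h)]
    simp
  have hinv : M.submatrix π π = M := by
    ext i k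
    simp only [Matrix.submatrix_apply, hM, hS]
  have hinvn : ∀ n : ℕ, (M ^ n).submatrix π π = M ^ n := by
    intro n
    induction n with
    | zero => simp
    | succ n ih => rw [pow_succ, ← Matrix.submatrix_mul_equiv _ _ π π π, ih, hinv]
  have h2 := congrFun (congrFun (hinvn r) i) k
  rw [Matrix.submatrix_apply, hMr, hMr] at h2
  constructor
  · intro h; by_contra h'; rw [if_pos h, if_neg h'] at h2; exact one_ne_zero h2
  · intro h; by_contra h'; rw [if_pos h, if_neg h'] at h2; exact one_ne_zero h2.symm

theorem mul_invariant {j : ℕ} [Fact j.Prime] (π : Equiv.Perm (ZMod j)) (n : ℕ)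
    (hn : (n : ZMod j) ≠ 0) (S : Finset (ZMod j))
    (hS : ∀ i k, π k - π i ∈ S ↔ k - i ∈ S) (i k : ZMod j) :
    π k - π i ∈ S.image ((n : ZMod j) * ·) ↔ k - i ∈ S.image ((n : ZMod j) * ·) := by
  classical
  induction n using induction_on_primes generalizing S i k with
  | zero => simp at hn
  | one => simpa using hS i k
  | prime_mul r n hr ih =>
    have := Fact.mk hr
    push_cast at hn
    have hrj : r ≠ j := by rintro rfl; simp at hn
    have h1 := ih (right_ne_zero_of_mul hn) S hS
    have h2 := mul_prime_invariant hrj π _ h1 i k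
    simpa [Finset.image_image, Function.comp_def, mul_assoc] using h2

end

section

open Polynomial

variable {R : Type*} [CommRing R]

/-- The ring homomorphism `x ↦ T`, `y ↦ w T` recording the total degree as the degree in `T`. -/
noncomputable def homogen (R : Type*) [CommRing R] : R[X][X] →+* R[X][X] :=
  eval₂RingHom (eval₂RingHom (C.comp C) X) (C X * X)

theorem coeff_coeff_homogen (A : R[X][X]) (n k : ℕ) :
    ((homogen R A).coeff n).coeff k = if k ≤ n then (A.coeff k).coeff (n - k) else 0 := by
  induction A using Polynomial.induction_on' with
  | add p q hp hq => simp only [map_add, coeff_add, hp, hq]; split_ifs <;> simp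
  | monomial i a =>
    induction a using Polynomial.induction_on' with
    | add p q hp hq => simp only [map_add, coeff_add, hp, hq]; split_ifs <;> simp
    | monomial m a =>
      have h1 : homogen R (monomial i (monomial m a)) = C (C a * X ^ i) * X ^ (m + i) := by
        simp only [homogen, coe_eval₂RingHom, eval₂_monomial, RingHom.comp_apply, mul_pow, C_mul,
          C_pow]
        ring
      rw [h1, coeff_C_mul_X_pow]
      by_cases hki : k = i
      · subst hki
        simp only [coeff_monomial, if_true]
        by_cases hn : n = m + k
        · subst hn; simp
        · rw [if_neg hn]
          split_ifs <;> first | rfl | lia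
      · have h2 : i ≠ k := fun h => hki h.symm
        rw [coeff_monomial, if_neg h2]
        split_ifs <;> simp [hki]

theorem coeff_coeff_eq_zero_of_mul [IsDomain R] {A B D : R[X][X]} (hA : A.Monic) (hB : B.Monic)
    (hAB : A * B = D)
    (hD : ∀ k m, D.natDegree < k + m → (D.coeff k).coeff m = 0) {k m : ℕ}
    (hkm : A.natDegree < k + m) : (A.coeff k).coeff m = 0 := by
  have hge : ∀ A : R[X][X], A.Monic → A.natDegree ≤ (homogen R A).natDegree := fun A hA => by
    refine le_natDegree_of_ne_zero fun h0 => ?_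
    have h1 := coeff_coeff_homogen A A.natDegree A.natDegree
    rw [h0] at h1
    simp [hA.coeff_natDegree] at h1
  have hle : (homogen R D).natDegree ≤ D.natDegree := by
    refine natDegree_le_iff_coeff_eq_zero.2 fun n hn => ?_
    ext k
    rw [coeff_coeff_homogen, coeff_zero]
    split_ifs with h
    · exact hD _ _ (by lia)
    · rfl
  have hne : ∀ A : R[X][X], A.Monic → homogen R A ≠ 0 := fun A hA h0 => by
    have h1 := coeff_coeff_homogen A A.natDegree A.natDegree
    simp [hA.coeff_natDegree, h0] at h1
  have h1 : (homogen R A).natDegree + (homogen R B).natDegree = (homogen R D).natDegree := by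
    rw [← natDegree_mul (hne A hA) (hne B hB), ← map_mul, hAB]
  have h2 : A.natDegree + B.natDegree = D.natDegree := by rw [← hAB, hA.natDegree_mul hB]
  have h3 := hge B hB
  have h4 := coeff_coeff_homogen A (k + m) k
  have h5 : (homogen R A).natDegree < k + m := by lia
  rw [coeff_eq_zero_of_natDegree_lt h5] at h4
  simpa using h4.symm

theorem monic_dvd_prod_X_sub_C {F ι : Type*} [Field F] {s : Finset ι} {x : ι → F}
    (hx : Set.InjOn x s) {a : F[X]} (ha : a.Monic) (hd : a ∣ ∏ i ∈ s, (X - C (x i))) :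
    ∃ t ⊆ s, a = ∏ i ∈ t, (X - C (x i)) := by
  classical
  refine ⟨s.filter fun i => a.eval (x i) = 0, Finset.filter_subset _ _, ?_⟩
  have hP0 : ∏ i ∈ s, (X - C (x i)) ≠ 0 := (monic_prod_X_sub_C x s).ne_zero
  have hroots : (∏ i ∈ s, (X - C (x i))).roots = s.val.map x := by
    have h := roots_multiset_prod_X_sub_C (s.val.map x)
    rwa [Multiset.map_map] at h
  have hsp : a.Splits := Splits.of_dvd (Splits.prod fun i _ => Splits.X_sub_C _) hP0 hd
  refine (hsp.eq_prod_roots_of_monic ha).trans ?_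
  have hnd : (s.val.map x).Nodup := Multiset.Nodup.map_on (fun i hi k hk h => hx hi hk h) s.nodup
  have hle := roots.le_of_dvd hP0 hd
  rw [hroots] at hle
  have : a.roots = (s.filter fun i => a.eval (x i) = 0).val.map x := by
    rw [Multiset.Nodup.ext (Multiset.nodup_of_le hle hnd)]
    · intro z
      simp only [Finset.filter_val, Multiset.mem_map, Multiset.mem_filter]
      constructor
      · intro hz
        obtain ⟨i, hi, rfl⟩ := Multiset.mem_map.1 (Multiset.mem_of_le hle hz)
        exact ⟨i, ⟨hi, (mem_roots ha.ne_zero).1 hz⟩, rfl⟩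
      · rintro ⟨i, ⟨hi, h⟩, rfl⟩
        exact (mem_roots ha.ne_zero).2 h
    · exact Multiset.Nodup.map_on (fun i hi k hk h =>
        hx (Finset.mem_of_mem_filter _ hi) (Finset.mem_of_mem_filter _ hk) h) (Finset.nodup _)
  rw [this, Multiset.map_map]
  rfl

/-- The linear coefficient of the subleading coefficient of a factor of `f(y) - f(x)`, where
`f = (X + 1) ⋯ (X + j)`, is a small integer. -/
theorem exists_int_coeff_factor {Λ : Type*} [Field Λ] {p j : ℕ} [CharP Λ p] (hj : 2 ≤ j)
    (hp : j < p) {A B : Λ[X][X]} (hA : A.Monic) {f : Λ[X]}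
    (hf : f = ∏ i ∈ Finset.Icc 1 j, (X + C (i : Λ)))
    (hAB : A * B = f.map C - C f) (hA0 : 0 < A.natDegree)
    (hlin : (A.coeff (A.natDegree - 1)).natDegree ≤ 1) :
    ∃ a : ℤ, |a| ≤ j ^ 2 ∧ (a : Λ) = -(A.coeff (A.natDegree - 1)).coeff 1 := by
  classical
  have hinj : Set.InjOn (fun i : ℕ => -(i : Λ)) (Finset.Icc 1 j : Finset ℕ) := by
    intro a ha b hb hab
    have h1 : (a : Λ) = b := neg_injective hab
    rw [CharP.cast_eq_iff_mod_eq Λ p] at h1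
    simp only [Finset.coe_Icc, Set.mem_Icc] at ha hb
    rwa [Nat.mod_eq_of_lt (by lia), Nat.mod_eq_of_lt (by lia)] at h1
  have key : ∀ m ∈ Finset.Icc 1 j, ∃ n : ℕ, n ≤ j ^ 2 ∧
      (n : Λ) = (A.coeff (A.natDegree - 1)).eval (-(m : Λ)) := by
    intro m hm
    let ev : Λ[X] →+* Λ := evalRingHom (-(m : Λ))
    have h1 : A.map ev * B.map ev = ∏ i ∈ Finset.Icc 1 j, (X - C (-(i : Λ))) := by
      rw [← Polynomial.map_mul, hAB, Polynomial.map_sub, map_C, Polynomial.map_map]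
      have h2 : ev.comp C = RingHom.id Λ := by ext; simp [ev]
      have h3 : ev f = 0 := by
        simp only [ev, coe_evalRingHom, hf, eval_prod, Finset.prod_eq_zero_iff]
        exact ⟨m, hm, by simp⟩
      rw [h2, Polynomial.map_id, h3, map_zero, sub_zero, hf]
      exact Finset.prod_congr rfl fun i _ => by simp
    obtain ⟨t, ht, hAt⟩ := monic_dvd_prod_X_sub_C hinj (hA.map ev) ⟨_, h1.symm⟩
    refine ⟨∑ i ∈ t, i, ?_, ?_⟩
    · calc ∑ i ∈ t, i ≤ ∑ i ∈ Finset.Icc 1 j, i := Finset.sum_le_sum_of_subset ht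
        _ ≤ ∑ i ∈ Finset.Icc 1 j, j := Finset.sum_le_sum fun i hi => (Finset.mem_Icc.1 hi).2
        _ = j ^ 2 := by simp [sq]
    · have h4 : (A.map ev).natDegree = A.natDegree := hA.natDegree_map ev
      have h5 : (A.map ev).nextCoeff = ev (A.coeff (A.natDegree - 1)) := by
        rw [nextCoeff_of_natDegree_pos (by rwa [h4]), h4, coeff_map]
      rw [hAt, prod_X_sub_C_nextCoeff] at h5
      push_cast
      rw [show (A.coeff (A.natDegree - 1)).eval (-(m : Λ)) = ev (A.coeff (A.natDegree - 1)) from rfl,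
        ← h5, Finset.sum_neg_distrib, neg_neg]
  obtain ⟨n1, h1, h1'⟩ := key 1 (by simp; lia)
  obtain ⟨n2, h2, h2'⟩ := key 2 (by simp; lia)
  refine ⟨(n2 : ℤ) - n1, ?_, ?_⟩
  · have : (n1 : ℤ) ≤ j ^ 2 := by exact_mod_cast h1
    have : (n2 : ℤ) ≤ j ^ 2 := by exact_mod_cast h2
    rw [abs_le]; constructor <;> lia
  · push_cast
    rw [h1', h2']
    rw [eq_X_add_C_of_natDegree_le_one hlin]
    simp
    ring

end

section

open Polynomial

theorem exists_map_eq_prod_X_sub_C {R K E ι : Type*} [CommRing R] [IsDomain R]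
    [IsIntegrallyClosed R] [Field K] [Algebra R K] [IsFractionRing R K] [Field E] (φ : K →+* E)
    (x : ι → E) (S : Finset ι)
    (h1 : ∀ i ∈ S, (φ.comp (algebraMap R K)).IsIntegralElem (x i))
    (h2 : ∀ n, (∏ i ∈ S, (X - C (x i))).coeff n ∈ φ.range) :
    ∃ A : R[X], A.Monic ∧ A.map (φ.comp (algebraMap R K)) = ∏ i ∈ S, (X - C (x i)) := by
  let : Algebra R E := (φ.comp (algebraMap R K)).toAlgebra
  let : Algebra K E := φ.toAlgebra
  have : IsScalarTower R K E := IsScalarTower.of_algebraMap_eq fun _ => rfl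
  have hint : ∏ i ∈ S, (X - C (x i)) ∈ lifts (algebraMap (integralClosure R E) E) := by
    refine Subsemiring.prod_mem _ fun i hi => ?_
    refine ⟨X - C ⟨x i, h1 i hi⟩, ?_⟩
    simp
  have hlift : ∏ i ∈ S, (X - C (x i)) ∈ lifts (algebraMap R E) := by
    rw [lifts_iff_coeff_lifts]
    intro n
    obtain ⟨k, hk⟩ := h2 n
    have h3 : IsIntegral R ((∏ i ∈ S, (X - C (x i))).coeff n) := by
      obtain ⟨c, hc⟩ := (lifts_iff_coeff_lifts _).1 hint n
      rw [← hc]; exact c.2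
    rw [← hk] at h3 ⊢
    have h4 : IsIntegral R k := (isIntegral_algebraMap_iff (A := K) (B := E) φ.injective).1 h3
    obtain ⟨r, hr⟩ := IsIntegrallyClosed.isIntegral_iff.1 h4
    exact ⟨r, by rw [← hr]; rfl⟩
  obtain ⟨A, hA, -, hm⟩ := lifts_and_natDegree_eq_and_monic hlift (monic_prod_X_sub_C x S)
  exact ⟨A, hm, hA⟩

theorem exists_addChar_sum_ne_zero {Λ E : Type*} [Field Λ] [Field E] [Algebra Λ E] {j : ℕ}
    [Fact j.Prime] (hj0 : (j : Λ) ≠ 0) {ψ : AddChar (ZMod j) Λ} (hψ : ψ.IsPrimitive)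
    {x : ZMod j → E} (hx : Function.Injective x) :
    ∃ m : ZMod j, m ≠ 0 ∧ ∑ i, ψ (-(m * i)) • x i ≠ 0 := by
  classical
  by_contra! hcon
  have h1 : ∀ k, (j : Λ) • x k = ∑ i, x i := fun k => by
    have h2 : ∑ m, ψ (m * k) • ∑ i, ψ (-(m * i)) • x i = (j : Λ) • x k := by
      simp_rw [Finset.smul_sum, smul_smul, ← AddChar.map_add_eq_mul]
      rw [Finset.sum_comm]
      rw [Finset.sum_eq_single k]
      · simp [ZMod.card, Nat.cast_smul_eq_nsmul]
      · intro b _ hb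
        rw [← Finset.sum_smul]
        have : ∀ m, ψ (m * k + -(m * b)) = ψ (m * (k - b)) := fun m => by congr 1; ring
        simp_rw [this]
        rw [AddChar.sum_mulShift _ hψ, if_neg (sub_ne_zero.2 hb.symm)]; simp
      · simp
    rw [← h2, Finset.sum_eq_single 0]
    · simp
    · intro b _ hb; rw [hcon b hb, smul_zero]
    · simp
  have h3 := (h1 0).trans (h1 1).symm
  exact zero_ne_one (hx (smul_right_injective E hj0 h3))

theorem eval₂_galois {Λ K E : Type*} [Field Λ] [Field K] [Field E] [Algebra Λ K] [Algebra K E]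
    [Algebra Λ E] [IsScalarTower Λ K E] (γ : E ≃ₐ[K] E) (A : Λ[X][X]) (a b : E) :
    γ (A.eval₂ (aeval a : Λ[X] →ₐ[Λ] E).toRingHom b) =
      A.eval₂ (aeval (γ a) : Λ[X] →ₐ[Λ] E).toRingHom (γ b) := by
  have h1 := hom_eval₂ A (aeval a : Λ[X] →ₐ[Λ] E).toRingHom (γ : E →+* E) b
  refine h1.trans ?_
  congr 1
  refine Polynomial.ringHom_ext (fun r => ?_) ?_
  · simp only [RingHom.comp_apply, AlgHom.toRingHom_eq_coe, RingHom.coe_coe, aeval_C]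
    rw [IsScalarTower.algebraMap_apply Λ K E]
    exact γ.commutes _
  · simp

theorem exists_factor_of_invariant {Λ E : Type*} [Field Λ] [Field E] [Algebra Λ E]
    [Algebra (RatFunc Λ) E] [IsScalarTower Λ (RatFunc Λ) E] [FiniteDimensional (RatFunc Λ) E]
    [IsGalois (RatFunc Λ) E] {j : ℕ} {f : Λ[X]} (hfm : f.Monic) (hf0 : 0 < f.natDegree)
    {x : ZMod j → E} (hx : Function.Injective x) 
    (hft : ∀ i, aeval (x i) f = algebraMap (RatFunc Λ) E (algebraMap Λ[X] (RatFunc Λ) X))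
    (hinj : Function.Injective (aeval (x 0) : Λ[X] →ₐ[Λ] E))
    (S : Finset (ZMod j))
    (hS : ∀ (γ : E ≃ₐ[RatFunc Λ] E) (i : ZMod j), γ (x 0) = x 0 →
      i ∈ S → ∃ k ∈ S, γ (x i) = x k) :
    ∃ A : Λ[X][X], A.Monic ∧
      A.map (aeval (x 0) : Λ[X] →ₐ[Λ] E).toRingHom = ∏ s ∈ S, (X - C (x s)) := by
  classical
  let ev : Λ[X] →+* E := (aeval (x 0) : Λ[X] →ₐ[Λ] E).toRingHom
  let φ : RatFunc Λ →+* E := IsFractionRing.lift (g := ev) hinj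
  have hφ : φ.comp (algebraMap Λ[X] (RatFunc Λ)) = ev :=
    RingHom.ext fun a => IsFractionRing.lift_algebraMap hinj a
  have hφ' : ∀ a, φ (algebraMap Λ[X] (RatFunc Λ) a) = ev a := fun a =>
    IsFractionRing.lift_algebraMap hinj a
  have hmap : ∀ a : Λ[X], algebraMap (RatFunc Λ) E
      (algebraMap Λ[X] (RatFunc Λ) a) = ev (a.comp f) := fun a => by
    have h1 : ev (a.comp f) = aeval (aeval (x 0) f) a := by
      simp only [ev, AlgHom.toRingHom_eq_coe, RingHom.coe_coe, aeval_comp]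
    rw [h1, hft, aeval_algebraMap_apply, aeval_algebraMap_apply, aeval_X_left_apply]
  have hrange : ∀ k : RatFunc Λ, algebraMap (RatFunc Λ) E k ∈ φ.fieldRange := by
    intro k
    obtain ⟨a, b, hb, rfl⟩ := IsFractionRing.div_surjective (A := Λ[X]) k
    rw [map_div₀, hmap, hmap, ← hφ', ← hφ']
    exact div_mem ⟨_, rfl⟩ ⟨_, rfl⟩
  let L : IntermediateField (RatFunc Λ) E :=
    φ.fieldRange.toIntermediateField hrange
  have hL : IntermediateField.adjoin (RatFunc Λ) {x 0} ≤ L := by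
    rw [IntermediateField.adjoin_le_iff, Set.singleton_subset_iff]
    exact ⟨algebraMap Λ[X] (RatFunc Λ) X, by rw [hφ']; simp [ev]⟩
  have hint : ∀ i ∈ S, (φ.comp (algebraMap Λ[X] (RatFunc Λ))).IsIntegralElem (x i) := by
    intro i _
    rw [hφ]
    refine ⟨f.map C - C f, Monic.sub_of_left (hfm.map _) ?_, ?_⟩
    · rw [degree_eq_natDegree ((hfm.map _).ne_zero), natDegree_map_eq_of_injective C_injective]
      exact degree_C_le.trans_lt (by exact_mod_cast hf0)
    · have h3 : ev.comp C = algebraMap Λ E := by ext a; simp [ev]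
      rw [eval₂_sub, eval₂_C, eval₂_map, h3, ← aeval_def, hft i, ← hft 0]
      exact sub_self _
  have hco : ∀ n, (∏ i ∈ S, (X - C (x i))).coeff n ∈ φ.range := by
    intro n
    refine hL ?_
    rw [← IsGalois.fixedField_fixingSubgroup (IntermediateField.adjoin (RatFunc Λ) {x 0}),
      IntermediateField.mem_fixedField_iff]
    intro γ hγ
    have h0 : γ (x 0) = x 0 := by
      rw [IntermediateField.mem_fixingSubgroup_iff] at hγ
      exact hγ _ (IntermediateField.mem_adjoin_simple_self _ _)
    have h1 : (∏ s ∈ S, (X - C (x s))).map (γ : E →+* E) =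
        ∏ s ∈ S, (X - C (x s)) := by
      rw [Polynomial.map_prod]
      choose! π hπ hπ' using fun i hi => hS γ i h0 hi
      have hπinj : Set.InjOn π S := fun a ha b hb hab => by
        have := (hπ' a ha).trans ((congrArg x hab).trans (hπ' b hb).symm)
        exact hx (γ.injective this)
      have himg : S.image π = S := Finset.eq_of_subset_of_card_le
        (Finset.image_subset_iff.2 hπ) (Finset.card_image_of_injOn hπinj).ge
      conv_rhs => rw [← himg, Finset.prod_image hπinj]
      refine Finset.prod_congr rfl fun i hi => ?_
      simp [hπ' i hi]
    have h2 := congrArg (fun P => P.coeff n) h1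
    simp only [coeff_map] at h2
    exact h2
  obtain ⟨A, hA, hAm⟩ := exists_map_eq_prod_X_sub_C (R := Λ[X]) φ x S hint hco
  exact ⟨A, hA, by rw [← hAm, hφ]⟩

end

section

open Polynomial

theorem factor_diff_quotient {Λ E : Type*} [Field Λ] [IsAlgClosed Λ] [Field E] [Algebra Λ E]
    [Algebra (RatFunc Λ) E] [IsScalarTower Λ (RatFunc Λ) E] [FiniteDimensional (RatFunc Λ) E]
    [IsGalois (RatFunc Λ) E] {p j : ℕ} [CharP Λ p] [Fact j.Prime] (hp : 2 * j ^ 5 < p)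
    {f : Λ[X]} (hf : f = ∏ i ∈ Finset.Icc 1 j, (X + C (i : Λ)))
    {x : ZMod j → E} (hx : Function.Injective x)
    (hft : ∀ i, aeval (x i) f = algebraMap (RatFunc Λ) E (algebraMap Λ[X] (RatFunc Λ) X))
    (hinj : Function.Injective (aeval (x 0) : Λ[X] →ₐ[Λ] E))
    (c : E ≃ₐ[RatFunc Λ] E) (hc : ∀ i, c (x i) = x (i + 1))
    (hperm : ∀ (γ : E ≃ₐ[RatFunc Λ] E) i, ∃ k, γ (x i) = x k)
    {A B : Λ[X][X]} (hA : A.Monic) (hAB : (X - C X) * (A * B) = f.map C - C f) :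
    A.natDegree = 0 ∨ A.natDegree = j - 1 := by
  classical
  have hjp : j.Prime := Fact.out
  have hj1 := hjp.one_lt
  have hjlt : j < p := by nlinarith [Nat.pow_le_pow_right hjp.pos (show 1 ≤ 5 by norm_num)]
  have hj0 : (j : Λ) ≠ 0 := by
    rw [Ne, CharP.cast_eq_zero_iff Λ p]
    exact Nat.not_dvd_of_pos_of_lt hjp.pos hjlt
  have hfm : f.Monic := hf ▸ monic_prod_of_monic _ _ fun i _ => monic_X_add_C _
  have hfd : f.natDegree = j := by
    rw [hf, natDegree_prod_of_monic _ _ fun i _ => monic_X_add_C _,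
      Finset.sum_congr rfl fun (i : ℕ) _ => natDegree_X_add_C (i : Λ)]
    simp
  set D : Λ[X][X] := f.map C - C f with hD
  have hDlt : (C f : Λ[X][X]).degree < (f.map C).degree := by
    rw [degree_eq_natDegree ((hfm.map _).ne_zero), natDegree_map_eq_of_injective C_injective, hfd]
    exact degree_C_le.trans_lt (by exact_mod_cast hjp.pos)
  have hDm : D.Monic := Monic.sub_of_left (hfm.map _) hDlt
  have hDd : D.natDegree = j := by
    rw [hD, natDegree_sub_eq_left_of_natDegree_lt, natDegree_map_eq_of_injective C_injective, hfd]
    rw [natDegree_map_eq_of_injective C_injective, hfd, natDegree_C]; exact hjp.pos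
  have hDlin : ∀ k m, D.natDegree < k + m → (D.coeff k).coeff m = 0 := by
    intro k m hkm
    rw [hDd] at hkm
    rw [hD, coeff_sub, coeff_map, coeff_C, coeff_sub, coeff_C]
    rcases Nat.eq_zero_or_pos k with rfl | hk
    · rw [if_neg (by omega), if_pos rfl, coeff_eq_zero_of_natDegree_lt (by omega), sub_zero]
    · rw [if_neg hk.ne', coeff_zero, sub_zero]
      split_ifs with hm
      · exact coeff_eq_zero_of_natDegree_lt (by omega)
      · rfl
  let ev : E → Λ[X] →+* E := fun a => (aeval a : Λ[X] →ₐ[Λ] E).toRingHom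
  have hevC : ∀ a b, ev a (C b) = algebraMap Λ E b := fun a b => by simp [ev]
  have hevinj : Function.Injective (ev (x 0)) := hinj
  have hDev : D.map (ev (x 0)) = ∏ k, (X - C (x k)) := by
    have hdvd : ∏ k, (X - C (x k)) ∣ D.map (ev (x 0)) := by
      refine Finset.prod_dvd_of_coprime (fun a _ b _ hab => ?_) fun k _ => ?_
      · exact pairwise_coprime_X_sub_C hx hab
      · rw [dvd_iff_isRoot, IsRoot, eval_map, hD, eval₂_sub, eval₂_C, eval₂_map]
        have h3 : (ev (x 0)).comp C = algebraMap Λ E := by ext a; simp [ev]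
        rw [h3, ← aeval_def, hft k, ← hft 0]; exact sub_self _
    refine (eq_of_monic_of_dvd_of_natDegree_le (monic_prod_X_sub_C _ _) (hDm.map _) hdvd ?_)
    rw [hDm.natDegree_map, hDd, natDegree_prod_of_monic _ _ fun i _ => monic_X_sub_C _]
    simp [ZMod.card]
  obtain ⟨S, hS0, hAS⟩ : ∃ S ⊆ Finset.univ.erase (0 : ZMod j),
      A.map (ev (x 0)) = ∏ k ∈ S, (X - C (x k)) := by
    refine monic_dvd_prod_X_sub_C hx.injOn (hA.map _) ?_
    have h1 := congrArg (map (ev (x 0))) hAB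
    rw [hDev, ← Finset.mul_prod_erase _ _ (Finset.mem_univ 0), Polynomial.map_mul, Polynomial.map_sub,
      map_X, map_C] at h1
    have h2 : ev (x 0) X = x 0 := by simp [ev]
    rw [h2] at h1
    have h3 := mul_left_cancel₀ (X_sub_C_ne_zero (x 0)) h1
    rw [← h3, Polynomial.map_mul]
    exact dvd_mul_right _ _
  have hAd : A.natDegree = S.card := by
    have h1 := congrArg natDegree hAS
    rw [hA.natDegree_map, natDegree_prod_of_monic _ _ fun i _ => monic_X_sub_C _] at h1
    simpa using h1
  have hmemS : ∀ k, k ∈ S ↔ A.eval₂ (ev (x 0)) (x k) = 0 := fun k => by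
    rw [← eval_map, hAS, eval_prod, Finset.prod_eq_zero_iff]
    constructor
    · intro hk; exact ⟨k, hk, by simp⟩
    · rintro ⟨i, hi, h0⟩
      rw [eval_sub, eval_X, eval_C, sub_eq_zero] at h0
      exact hx h0 ▸ hi
  have hcpow : ∀ n : ℕ, ∀ i, (c ^ n) (x i) = x (i + n) := fun n => by
    induction n with
    | zero => simp
    | succ n ih => intro i; rw [pow_succ', AlgEquiv.mul_apply, ih, hc]; push_cast; ring_nf
  have hcp : ∀ i k : ZMod j, (c ^ i.val) (x k) = x (k + i) := fun i k => by
    rw [hcpow, ZMod.natCast_val, ZMod.cast_id]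
  have hmemS' : ∀ i k, k - i ∈ S ↔ A.eval₂ (ev (x i)) (x k) = 0 := fun i k => by
    rw [hmemS, ← (map_eq_zero_iff (c ^ i.val) (c ^ i.val).injective)]
    have h1 := eval₂_galois (c ^ i.val) A (x 0) (x (k - i))
    rw [hcp, hcp, zero_add, sub_add_cancel] at h1
    rw [← h1]
  choose π hπ using hperm
  have hπinj : ∀ γ, Function.Injective (π γ) := fun γ a b hab => by
    apply hx; apply γ.injective; rw [hπ, hπ, hab]
  let ρ : (E ≃ₐ[RatFunc Λ] E) → Equiv.Perm (ZMod j) := fun γ =>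
    Equiv.ofBijective (π γ) (Finite.injective_iff_bijective.1 (hπinj γ))
  have hρ : ∀ γ i, γ (x i) = x (ρ γ i) := hπ
  have hinv : ∀ γ i k, ρ γ k - ρ γ i ∈ S ↔ k - i ∈ S := fun γ i k => by
    have h1 := eval₂_galois γ A (x i) (x k)
    rw [hρ, hρ] at h1
    rw [hmemS', hmemS', ← map_eq_zero_iff γ γ.injective (x := A.eval₂ (ev (x i)) (x k))]
    rw [h1]
  rcases S.eq_empty_or_nonempty with hSe | hSne
  · left; rw [hAd, hSe]; rfl
  right
  have hnz : NeZero (j : Λ) := ⟨hj0⟩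
  obtain ⟨ζ, hζ⟩ := HasEnoughRootsOfUnity.exists_primitiveRoot Λ j
  have hψ := AddChar.zmodChar_primitive_of_primitive_root j hζ
  set ψ := AddChar.zmodChar j ((IsPrimitiveRoot.iff_def ζ j).mp hζ).left
  obtain ⟨m, hm, hV⟩ := exists_addChar_sum_ne_zero (Λ := Λ) hj0 hψ hx
  have key : ∀ k : ZMod j, ∃ a : ℤ, |a| ≤ j ^ 2 ∧ (a : Λ) = ∑ s ∈ S, ψ.mulShift m (k * s) := by
    intro k
    rcases eq_or_ne k 0 with rfl | hk
    · refine ⟨S.card, ?_, by simp⟩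
      rw [abs_of_nonneg (by positivity)]
      have h1 : S.card ≤ j := by simpa [ZMod.card] using S.card_le_univ
      have : j ≤ j ^ 2 := Nat.le_self_pow two_ne_zero j
      exact_mod_cast h1.trans this
    have hkv : ((k.val : ℕ) : ZMod j) = k := by rw [ZMod.natCast_val, ZMod.cast_id]
    have hT1 := fun γ => mul_invariant (ρ γ) k.val (by rwa [hkv]) S (hinv γ)
    rw [hkv] at hT1
    set T := S.image (k * ·) with hT
    have hρ0 : ∀ γ : E ≃ₐ[RatFunc Λ] E, γ (x 0) = x 0 → ρ γ 0 = 0 := fun γ h => by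
      rw [hρ] at h; exact hx h
    obtain ⟨A₁, hA₁, hA₁T⟩ := exists_factor_of_invariant hfm (by omega) hx hft hinj T
      (fun γ i h0 hi => ⟨ρ γ i, by
        have := (hT1 γ 0 i).2 (by simpa using hi)
        rwa [hρ0 γ h0, sub_zero] at this, hρ γ i⟩)
    obtain ⟨A₂, hA₂, hA₂T⟩ := exists_factor_of_invariant hfm (by omega) hx hft hinj Tᶜ
      (fun γ i h0 hi => ⟨ρ γ i, by
        have := (hT1 γ 0 i).not.2 (by simpa using hi)
        rw [hρ0 γ h0, sub_zero] at this
        simpa using this, hρ γ i⟩)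
    have hA12 : A₁ * A₂ = D := by
      apply map_injective _ hevinj
      rw [Polynomial.map_mul, hDev]
      refine (congrArg₂ _ hA₁T hA₂T).trans ?_
      exact Finset.prod_mul_prod_compl T _
    have hA₁d : A₁.natDegree = T.card := by
      have h1 := congrArg natDegree hA₁T
      rw [hA₁.natDegree_map, natDegree_prod_of_monic _ _ fun i _ => monic_X_sub_C _] at h1
      simpa using h1
    have hTpos : 0 < T.card := (hSne.image _).card_pos
    have hlin : (A₁.coeff (A₁.natDegree - 1)).natDegree ≤ 1 := by
      refine natDegree_le_iff_coeff_eq_zero.2 fun n hn => ?_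
      exact coeff_coeff_eq_zero_of_mul hA₁ hA₂ hA12 hDlin (by omega)
    obtain ⟨a, ha, haA⟩ := exists_int_coeff_factor hjp.two_le hjlt hA₁ hf hA12 (by omega) hlin
    refine ⟨a, ha, ?_⟩
    have hsum : ∑ s ∈ T, x s = (a : Λ) • x 0 +
        algebraMap Λ E (-(A₁.coeff (A₁.natDegree - 1)).coeff 0) := by
      have h1 := congrArg (fun P => P.coeff (T.card - 1)) hA₁T
      simp only [coeff_map] at h1
      rw [prod_X_sub_C_coeff_card_pred _ _ hTpos] at h1
      rw [← hA₁d] at h1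
      rw [eq_X_add_C_of_natDegree_le_one hlin] at h1
      simp only [AlgHom.toRingHom_eq_coe, RingHom.coe_coe, map_add, map_mul, aeval_C, aeval_X] at h1
      rw [haA, neg_smul, Algebra.smul_def, map_neg, ← neg_add, h1, neg_neg]
    have hsumi : ∀ i, ∑ s ∈ T, x (s + i) = (a : Λ) • x i +
        algebraMap Λ E (-(A₁.coeff (A₁.natDegree - 1)).coeff 0) := fun i => by
      have h1 := congrArg (c ^ i.val) hsum
      rw [map_sum, map_add, IsScalarTower.algebraMap_apply Λ (RatFunc Λ) E, AlgEquiv.commutes,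
        ← IsScalarTower.algebraMap_smul (RatFunc Λ) (a : Λ) (x 0), map_smul, hcp, zero_add,
        IsScalarTower.algebraMap_smul] at h1
      simp_rw [hcp] at h1
      rw [h1, ← IsScalarTower.algebraMap_apply Λ (RatFunc Λ) E]
    set V := ∑ i, ψ (-(m * i)) • x i with hVdef
    have h1 : ∑ i, ψ (-(m * i)) • ∑ s ∈ T, x (s + i) = (∑ s ∈ T, ψ (m * s)) • V := by
      simp_rw [Finset.smul_sum]
      rw [Finset.sum_comm, Finset.sum_smul]
      refine Finset.sum_congr rfl fun s _ => ?_
      rw [hVdef, Finset.smul_sum]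
      refine Eq.trans ?_ (Equiv.sum_comp (Equiv.addLeft s) fun i => ψ (m * s) • ψ (-(m * i)) • x i)
      refine Finset.sum_congr rfl fun i _ => ?_
      rw [smul_smul, ← AddChar.map_add_eq_mul]
      simp only [Equiv.coe_addLeft]
      congr 2; ring
    have h2 : ∑ i, ψ (-(m * i)) • ∑ s ∈ T, x (s + i) = (a : Λ) • V := by
      simp_rw [hsumi, smul_add]
      rw [Finset.sum_add_distrib, ← Finset.sum_smul]
      have : ∑ i, ψ (-(m * i)) = 0 := by
        have := AddChar.sum_mulShift (-m) hψ
        rw [if_neg (neg_ne_zero.2 hm)] at this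
        rw [← Nat.cast_zero, ← this]
        exact Finset.sum_congr rfl fun i _ => by congr 1; ring
      rw [this, zero_smul, add_zero, hVdef, Finset.smul_sum]
      exact Finset.sum_congr rfl fun i _ => smul_comm _ _ _
    have h3 := smul_left_injective Λ hV (h2.symm.trans h1)
    refine h3.trans ?_
    rw [hT, Finset.sum_image (fun a _ b _ h => mul_left_cancel₀ hk h)]
    exact Finset.sum_congr rfl fun s _ => by rw [AddChar.mulShift_apply]
  choose a ha haS using key
  have hψm : (ψ.mulShift m).IsPrimitive := AddChar.IsPrimitive.of_ne_one (hψ hm)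
  have hiff := fun s t (hs : s ≠ 0) (ht : t ≠ 0) => mem_iff_of_small_sums hp hψm S a ha haS hs ht
  obtain ⟨s, hs⟩ := hSne
  have hs0 : s ≠ 0 := (Finset.mem_erase.1 (hS0 hs)).1
  have hSeq : S = Finset.univ.erase 0 := by
    refine Finset.Subset.antisymm hS0 fun t ht => ?_
    exact (hiff s t hs0 (Finset.mem_erase.1 ht).1).1 hs
  rw [hAd, hSeq, Finset.card_erase_of_mem (Finset.mem_univ _), Finset.card_univ, ZMod.card]

theorem aeval_map_sub_C_X_eq_zero_iff {Λ E : Type*} [Field Λ] [Field E] [Algebra Λ E]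
    [Algebra (RatFunc Λ) E] [IsScalarTower Λ (RatFunc Λ) E] (f : Λ[X]) (z : E) :
    aeval z ((f.map C - C X : Λ[X][X]).map (algebraMap Λ[X] (RatFunc Λ))) = 0 ↔
      aeval z f = algebraMap (RatFunc Λ) E (algebraMap Λ[X] (RatFunc Λ) X) := by
  have h2 : aeval z ((f.map C - C X : Λ[X][X]).map (algebraMap Λ[X] (RatFunc Λ))) =
      (f.map C - C X : Λ[X][X]).eval₂ ((algebraMap (RatFunc Λ) E).comp
        (algebraMap Λ[X] (RatFunc Λ))) z := by
    rw [aeval_def, ← eval₂_map]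
  have h3 : ((algebraMap (RatFunc Λ) E).comp (algebraMap Λ[X] (RatFunc Λ))).comp C =
      algebraMap Λ E := by
    ext a
    rw [IsScalarTower.algebraMap_eq Λ (RatFunc Λ) E]
    simp
  rw [h2, eval₂_sub, eval₂_C, eval₂_map, sub_eq_zero, h3, ← aeval_def]
  rfl

theorem aeval_injective_of_aeval_eq_X {Λ E : Type*} [Field Λ] [IsAlgClosed Λ] [Field E]
    [Algebra Λ E] [Algebra (RatFunc Λ) E] [IsScalarTower Λ (RatFunc Λ) E] {f : Λ[X]} {z : E}
    (hz : aeval z f = algebraMap (RatFunc Λ) E (algebraMap Λ[X] (RatFunc Λ) X)) :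
    Function.Injective (aeval z : Λ[X] →ₐ[Λ] E) := by
  rw [← transcendental_iff_injective]
  intro halg
  obtain ⟨a, rfl⟩ : z ∈ (algebraMap Λ E).range :=
    halg.isIntegral.mem_range_algebraMap_of_minpoly_splits (R := Λ) (K := Λ)
      (IsAlgClosed.splits _)
  rw [aeval_algebraMap_apply, IsScalarTower.algebraMap_apply Λ (RatFunc Λ) E] at hz
  have h1 := (algebraMap (RatFunc Λ) E).injective hz
  rw [IsScalarTower.algebraMap_apply Λ Λ[X] (RatFunc Λ)] at h1
  have h2 := IsFractionRing.injective Λ[X] (RatFunc Λ) h1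
  have h3 := congrArg natDegree h2
  rw [natDegree_X] at h3
  exact absurd h3 (by simp [algebraMap_eq])

theorem irreducible_diff_quotient {Λ : Type*} [Field Λ] [IsAlgClosed Λ] {p j : ℕ} [CharP Λ p]
    (hjp : j.Prime) (hp : 2 * j ^ 5 < p) {f : Λ[X]}
    (hf : f = ∏ i ∈ Finset.Icc 1 j, (X + C (i : Λ))) {Q : Λ[X][X]}
    (hQ : (X - C X) * Q = f.map C - C f) : Irreducible Q := by
  classical
  have : Fact j.Prime := ⟨hjp⟩
  have hj1 := hjp.one_lt
  have hjlt : j < p := by nlinarith [Nat.pow_le_pow_right hjp.pos (show 1 ≤ 5 by norm_num)]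
  have hj0 : (j : Λ) ≠ 0 := by
    rw [Ne, CharP.cast_eq_zero_iff Λ p]
    exact Nat.not_dvd_of_pos_of_lt hjp.pos hjlt
  have hfm : f.Monic := hf ▸ monic_prod_of_monic _ _ fun i _ => monic_X_add_C _
  have hfd : f.natDegree = j := by
    rw [hf, natDegree_prod_of_monic _ _ fun i _ => monic_X_add_C _,
      Finset.sum_congr rfl fun (i : ℕ) _ => natDegree_X_add_C (i : Λ)]
    simp
  have hmapd : (f.map C : Λ[X][X]).natDegree = j := by
    rw [natDegree_map_eq_of_injective C_injective, hfd]
  have hlt : ∀ a : Λ[X], (C a : Λ[X][X]).degree < (f.map C).degree := fun a => by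
    rw [degree_eq_natDegree ((hfm.map _).ne_zero), hmapd]
    exact degree_C_le.trans_lt (by exact_mod_cast hjp.pos)
  have hDm : (f.map C - C f : Λ[X][X]).Monic := Monic.sub_of_left (hfm.map _) (hlt f)
  have hDd : (f.map C - C f : Λ[X][X]).natDegree = j := by
    rw [natDegree_sub_eq_left_of_natDegree_lt, hmapd]
    rw [hmapd, natDegree_C]; exact hjp.pos
  have hQm : Q.Monic := (monic_X_sub_C X).of_mul_monic_left (hQ ▸ hDm)
  have hQd : Q.natDegree = j - 1 := by
    have h1 := congrArg natDegree hQ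
    rw [(monic_X_sub_C X).natDegree_mul hQm, natDegree_X_sub_C, hDd] at h1
    omega
  set G : Λ[X][X] := f.map C - C X with hG
  have hGm : G.Monic := Monic.sub_of_left (hfm.map _) (hlt X)
  have hGd : G.natDegree = j := by
    rw [hG, natDegree_sub_eq_left_of_natDegree_lt, hmapd]
    rw [hmapd, natDegree_C]; exact hjp.pos
  have hGi : Irreducible G := irreducible_map_C_sub_C_X f
  set g : (RatFunc Λ)[X] := G.map (algebraMap Λ[X] (RatFunc Λ)) with hg
  have hgi : Irreducible g := hGm.irreducible_iff_irreducible_map_fraction_map.1 hGi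
  have hgm : g.Monic := hGm.map _
  have hgd : g.natDegree = j := by rw [hg, hGm.natDegree_map, hGd]
  have hsep : g.Separable := by
    rw [separable_iff_derivative_ne_zero hgi]
    intro h0
    have h1 := congrArg (fun P => P.coeff (j - 1)) h0
    simp only [coeff_derivative, coeff_zero] at h1
    rw [Nat.cast_sub hjp.one_le, Nat.cast_one, sub_add_cancel, Nat.sub_add_cancel hjp.one_le] at h1
    have h2 : g.coeff j = 1 := by rw [← hgd]; exact hgm
    rw [h2, one_mul, ← map_natCast (algebraMap Λ (RatFunc Λ)),
      map_eq_zero_iff _ (algebraMap Λ (RatFunc Λ)).injective] at h1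
    exact hj0 h1
  obtain ⟨c, x, hx, hroot, hc⟩ := exists_cyclic_labelling hgi hsep hgd
  have hgal : IsGalois (RatFunc Λ) g.SplittingField := IsGalois.of_separable_splitting_field hsep
  have hft : ∀ i, aeval (x i) f = algebraMap (RatFunc Λ) g.SplittingField
      (algebraMap Λ[X] (RatFunc Λ) X) := fun i =>
    (aeval_map_sub_C_X_eq_zero_iff f (x i)).1 ((hroot _).2 ⟨i, rfl⟩)
  have hperm : ∀ (γ : g.SplittingField ≃ₐ[RatFunc Λ] g.SplittingField) i, ∃ k, γ (x i) = x k :=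
    fun γ i => (hroot _).1 (by
      have h1 : aeval (γ (x i)) g = γ (aeval (x i) g) := aeval_algHom_apply γ.toAlgHom (x i) g
      rw [h1, (hroot _).2 ⟨i, rfl⟩, map_zero])
  rw [hQm.irreducible_iff_natDegree]
  refine ⟨fun h => ?_, fun A B hA hB hAB => ?_⟩
  · rw [h, natDegree_one] at hQd; omega
  · have h1 := factor_diff_quotient hp hf hx hft (aeval_injective_of_aeval_eq_X (hft 0)) c hc hperm
      hA (B := B) (by rw [hAB, hQ])
    have h2 := congrArg natDegree hAB
    rw [hA.natDegree_mul hB, hQd] at h2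
    omega

end

section

open Polynomial

section

variable {k : Type*} [CommRing k]

/-- The linear form `U - c * Y` in `k[U][Y]`. -/
noncomputable def linForm (c : k) : k[X][X] := C X - C (C c) * X

/-- The substitution `U ↦ U - c * Y` in `k[U][Y]`. -/
noncomputable def shear (c : k) : k[X][X] →+* k[X][X] :=
  eval₂RingHom (eval₂RingHom (C.comp C) (linForm c)) X

@[simp] theorem shear_X (c : k) : shear c X = X := by simp [shear]

@[simp] theorem shear_C_X (c : k) : shear c (C X) = linForm c := by simp [shear]

@[simp] theorem shear_C_C (c a : k) : shear c (C (C a)) = C (C a) := by simp [shear]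

theorem shear_C (c : k) (f : k[X]) : shear c (C f) = f.eval₂ (C.comp C) (linForm c) := by
  simp [shear]

theorem shear_map_C (c : k) (f : k[X]) : shear c (f.map C) = f.map C := by
  rw [shear, coe_eval₂RingHom, eval₂_map]
  have : ((eval₂RingHom (C.comp C) (linForm c)).comp C : k →+* k[X][X]) = C.comp C := by
    ext; simp
  rw [this, ← eval₂_map, eval₂_C_X]

@[simp] theorem shear_linForm (c d : k) : shear c (linForm d) = linForm (c + d) := by
  rw [linForm, map_sub, map_mul, shear_C_X, shear_C_C, shear_X, linForm, linForm, C_add, C_add]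
  ring

theorem linForm_zero : linForm (0 : k) = C X := by simp [linForm]

theorem shear_comp_shear {c d : k} (h : c + d = 0) :
    (shear c).comp (shear d) = RingHom.id k[X][X] := by
  have hl : linForm (c + d) = C X := by rw [h, linForm_zero]
  refine ringHom_ext' (ringHom_ext' ?_ ?_) ?_
  · ext a; simp
  · simp [hl]
  · simp

/-- `shear c` as an automorphism. -/
noncomputable def shearEquiv (c : k) : k[X][X] ≃+* k[X][X] :=
  RingEquiv.ofRingHom (shear c) (shear (-c)) (shear_comp_shear (by ring))
    (shear_comp_shear (by ring))

theorem irreducible_shear_iff {c : k} {G : k[X][X]} : Irreducible (shear c G) ↔ Irreducible G :=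
  MulEquiv.irreducible_iff (shearEquiv c)

theorem eval_shear (c u y : k) (G : k[X][X]) :
    (shear c G).eval₂ (evalRingHom u) y = G.eval₂ (evalRingHom (u - c * y)) y := by
  rw [← coe_eval₂RingHom, ← coe_eval₂RingHom, ← RingHom.comp_apply]
  congr 1
  refine ringHom_ext' (ringHom_ext' ?_ ?_) ?_
  · ext a; simp
  · simp [linForm]
  · simp

theorem linForm_mem (c : k) : linForm c ∈ ((DegFilt.deg k).poly 1).D 1 := by
  have hX : (X : k[X]) ∈ (DegFilt.deg k).D 1 := by
    have := DegFilt.mem_deg_nat (a := (X : k[X])) (n := 1)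
    rw [Nat.cast_one] at this
    rw [this]; exact natDegree_X_le
  have hC : (C c : k[X]) ∈ (DegFilt.deg k).D 0 := by
    have := DegFilt.mem_deg_nat (a := (C c : k[X])) (n := 0)
    rw [Nat.cast_zero] at this
    rw [this]; exact natDegree_C c |>.le
  refine AddSubgroup.sub_mem _ (DegFilt.C_mem_poly _ hX) ?_
  have := ((DegFilt.deg k).poly 1).mul_mem (DegFilt.C_mem_poly _ (c := 1) hC) (DegFilt.X_mem_poly _)
  rwa [zero_add] at this

theorem C_C_mem (a : k) : (C (C a) : k[X][X]) ∈ ((DegFilt.deg k).poly 1).D 0 := by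
  refine DegFilt.C_mem_poly _ ?_
  have := DegFilt.mem_deg_nat (a := (C a : k[X])) (n := 0)
  rw [Nat.cast_zero] at this
  rw [this]; exact natDegree_C a |>.le

theorem eval₂_C_C_mem {l : k[X][X]} (hl : l ∈ ((DegFilt.deg k).poly 1).D 1) (f : k[X]) {n : ℕ}
    (hn : f.natDegree ≤ n) : f.eval₂ (C.comp C) l ∈ ((DegFilt.deg k).poly 1).D n := by
  rw [eval₂_eq_sum_range]
  refine AddSubgroup.sum_mem _ fun i hi => ?_
  have := ((DegFilt.deg k).poly 1).mul_mem (C_C_mem (f.coeff i))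
    (((DegFilt.deg k).poly 1).pow_mem hl i)
  refine ((DegFilt.deg k).poly 1).mono ?_ this
  rw [Finset.mem_range] at hi
  lia

theorem coeff_natDegree_le_of_mem {G : k[X][X]} {n : ℕ}
    (h : G ∈ ((DegFilt.deg k).poly 1).D n) {i : ℕ} (hi : i ≤ n) :
    (G.coeff i).natDegree ≤ n - i := by
  have := h i
  rw [← DegFilt.mem_deg_nat, Nat.cast_sub hi]
  rwa [one_mul] at this

theorem coeff_eq_zero_of_mem {G : k[X][X]} {n : ℤ}
    (h : G ∈ ((DegFilt.deg k).poly 1).D n) {i : ℕ} (hi : n < i) : G.coeff i = 0 := by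
  have := h i
  rw [DegFilt.mem_deg] at this
  ext j
  rw [coeff_zero]
  exact this j (by lia)

theorem natDegree_le_of_mem {G : k[X][X]} {n : ℕ}
    (h : G ∈ ((DegFilt.deg k).poly 1).D n) : G.natDegree ≤ n :=
  natDegree_le_iff_coeff_eq_zero.2 fun _ hi => coeff_eq_zero_of_mem h (by exact_mod_cast hi)

end

variable {p : ℕ} [hp : Fact p.Prime]

theorem bmap_shear {k Λ : Type*} [Field k] [Field Λ] [Algebra k Λ] (c : k) (G : k[X][X]) :
    bmap Λ (shear c G) = shear (algebraMap k Λ c) (bmap Λ G) := by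
  unfold bmap
  rw [← coe_mapRingHom, ← RingHom.comp_apply, ← RingHom.comp_apply]
  congr 1
  refine ringHom_ext' (ringHom_ext' ?_ ?_) ?_
  · ext a; simp
  · simp [linForm]
  · simp

theorem fibrePts_zmod (F : (ZMod p)[X][X]) (a : ZMod p) :
    fibrePts F a = Finset.univ.filter fun y => F.eval₂ (evalRingHom a) y = 0 := by
  have : eval₂RingHom (algebraMap (ZMod p) (ZMod p)) a = evalRingHom a := by
    refine ringHom_ext' (RingHom.ext_zmod _ _) (by simp)
  rw [fibrePts, this]

theorem fibrePts_C_C_mul {F : (ZMod p)[X][X]} {b : ZMod p} (hb : b ≠ 0)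
    (a : ZMod p) : fibrePts (C (C b) * F) a = fibrePts F a := by
  rw [fibrePts_zmod, fibrePts_zmod]
  ext y
  simp [hb, eval₂_mul]

theorem sum_shear (G : (ZMod p)[X][X]) (c : ZMod p)
    (ψ : AddChar (ZMod p) ℂ) :
    ∑ x : ZMod p × ZMod p with G.eval₂ (evalRingHom x.1) x.2 = 0, ψ (x.1 + c * x.2) =
      ∑ u : ZMod p, (fibrePts (shear c G) u).card * ψ u := by
  have h1 : ∀ u : ZMod p, ((fibrePts (shear c G) u).card : ℂ) * ψ u =
      ∑ y : ZMod p, if G.eval₂ (evalRingHom (u - c * y)) y = 0 then ψ u else 0 := fun u => by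
    rw [fibrePts_zmod, ← Finset.sum_filter, Finset.sum_const, nsmul_eq_mul]
    simp only [eval_shear]
  rw [Finset.sum_congr rfl fun u _ => h1 u, Finset.sum_comm, Finset.sum_filter,
    Fintype.sum_prod_type_right]
  refine Finset.sum_congr rfl fun y _ => ?_
  rw [← Equiv.sum_comp (Equiv.addRight (c * y)) fun u => if G.eval₂ (evalRingHom (u - c * y)) y = 0
    then ψ u else 0]
  simp

/-- The error term in Weil's bound for curves of degree `n`. -/
noncomputable def weilError (p n : ℕ) : ℝ := (4 * n ^ 2 + 1) * √p + 2 * n ^ 3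

theorem weilError_mono {m n : ℕ} (h : m ≤ n) : weilError p m ≤ weilError p n := by
  unfold weilError
  gcongr

theorem norm_sum_curve_le (Λ : Type*) [Field Λ] [Algebra (ZMod p) Λ] [IsAlgClosed Λ]
    {G : (ZMod p)[X][X]} (hirr : Irreducible (bmap Λ G)) {n : ℕ}
    (hn2 : 2 ≤ n) (hnp : n < p) {b : ZMod p} (hb : b ≠ 0) (c : ZMod p)
    (hd : shear c G ∈ ((DegFilt.deg (ZMod p)).poly 1).D n) (hc : (shear c G).coeff n = C b)
    (ψ : AddChar (ZMod p) ℂ) :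
    ‖∑ x : ZMod p × ZMod p with G.eval₂ (evalRingHom x.1) x.2 = 0, ψ (x.1 + c * x.2)‖ ≤
      (if ψ = 1 then (p : ℝ) else 0) + weilError p n := by
  rw [sum_shear]
  set F := C (C b⁻¹) * shear c G with hF
  have hbi : b⁻¹ ≠ 0 := inv_ne_zero hb
  have hFd : F.natDegree ≤ n := by
    rw [hF, natDegree_C_mul (by simpa using hb)]
    exact natDegree_le_of_mem hd
  have hFc : F.coeff n = 1 := by
    rw [hF, coeff_C_mul, hc, ← C_mul, inv_mul_cancel₀ hb, C_1]
  have hFm : F.Monic := monic_of_natDegree_le_of_coeff_eq_one n hFd hFc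
  have hFn : F.natDegree = n := le_antisymm hFd (le_natDegree_of_ne_zero (by rw [hFc]; simp))
  have h1 := norm_charSum_fibrePts_le Λ hFm (by
    intro i hi
    rw [hFn] at hi ⊢
    rw [hF, coeff_C_mul, natDegree_C_mul hbi]
    exact (coeff_natDegree_le_of_mem hd hi.le).trans (by lia)) (by lia) (by lia) (by
    have h2 : bmap Λ F = C (C (algebraMap _ Λ b⁻¹)) * shear (algebraMap _ Λ c) (bmap Λ G) := by
      rw [← bmap_shear, hF, bmap, Polynomial.map_mul]
      simp [bmap]
    rw [h2]
    have h3 : IsUnit (C (C (algebraMap (ZMod p) Λ b⁻¹)) : Λ[X][X]) := by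
      refine IsUnit.map C (IsUnit.map C ?_)
      exact isUnit_iff_ne_zero.2 (by simpa using hb)
    rw [irreducible_isUnit_mul h3]
    exact irreducible_shear_iff.2 hirr) ψ
  rw [hFn] at h1
  refine le_trans (le_of_eq ?_) h1
  simp only [hF, fibrePts_C_C_mul hbi]

end

section

open Polynomial

variable {p : ℕ} [hp : Fact p.Prime]

/-- The polynomial `(X + 1) ⋯ (X + j)`. -/
noncomputable def risingPoly (k : Type*) [CommRing k] (j : ℕ) : k[X] :=
  ∏ i ∈ Finset.Icc 1 j, (X + C (i : k))

theorem risingPoly_monic (k : Type*) [CommRing k] (j : ℕ) : (risingPoly k j).Monic :=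
  monic_prod_of_monic _ _ fun _ _ => monic_X_add_C _

theorem natDegree_risingPoly (k : Type*) [CommRing k] [Nontrivial k] (j : ℕ) :
    (risingPoly k j).natDegree = j := by
  rw [risingPoly, natDegree_prod_of_monic _ _ fun _ _ => monic_X_add_C _]
  simp only [natDegree_X_add_C]
  simp

theorem map_risingPoly {k l : Type*} [CommRing k] [CommRing l] (f : k →+* l) (j : ℕ) :
    (risingPoly k j).map f = risingPoly l j := by
  simp [risingPoly, Polynomial.map_prod]

theorem norm_sum_mulShift_le {ψ : AddChar (ZMod p) ℂ} (hψ : ψ ≠ 1) {Z : Finset (ZMod p × ZMod p)}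
    {E : ℝ} (h1 : ∀ (φ : AddChar (ZMod p) ℂ) (c : ZMod p),
      ‖∑ x ∈ Z, φ (x.1 + c * x.2)‖ ≤ (if φ = 1 then (p : ℝ) else 0) + E)
    (h2 : ∀ φ : AddChar (ZMod p) ℂ, ‖∑ x ∈ Z, φ x.2‖ ≤ (if φ = 1 then (p : ℝ) else 0) + E)
    (α β : ZMod p) :
    ‖∑ x ∈ Z, ψ (α * x.1 + β * x.2)‖ ≤ (if α = 0 ∧ β = 0 then (p : ℝ) else 0) + E := by
  have hprim := AddChar.IsPrimitive.of_ne_one hψ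
  have hsh (a : ZMod p) : ψ.mulShift a = 1 ↔ a = 0 := by
    refine ⟨fun h => by_contra fun h0 => hprim h0 h, ?_⟩
    rintro rfl
    exact AddChar.mulShift_zero ψ
  by_cases ha : α = 0
  · subst ha
    have := h2 (ψ.mulShift β)
    simpa [hsh, AddChar.mulShift_apply] using this
  · have := h1 (ψ.mulShift α) (β / α)
    rw [if_neg (by rw [hsh]; exact ha)] at this
    rw [if_neg (by tauto)]
    have hx (x : ZMod p × ZMod p) : ψ.mulShift α (x.1 + β / α * x.2) = ψ (α * x.1 + β * x.2) := by
      rw [AddChar.mulShift_apply]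
      congr 1
      field_simp
    simpa only [hx] using this

theorem norm_sum_two_risingPoly_le_of_lt {d e : ℕ} (hd : d.Prime) (he : e.Prime) (hde : d < e)
    (hed : e ≤ 2 * d) (hep : e < p) {ψ : AddChar (ZMod p) ℂ} (hψ : ψ ≠ 1) (α β : ZMod p) :
    ‖∑ x : ZMod p × ZMod p with
        (risingPoly (ZMod p) d).eval x.1 = (risingPoly (ZMod p) e).eval x.2,
      ψ (α * x.1 + β * x.2)‖ ≤ (if α = 0 ∧ β = 0 then (p : ℝ) else 0) + weilError p e := by
  let Λ := AlgebraicClosure (ZMod p)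
  have hcop : d.Coprime e := (Nat.coprime_primes hd he).2 hde.ne
  have hirr {d e : ℕ} (h : d.Coprime e) (hd : d.Prime) (he : e.Prime) : Irreducible (bmap Λ
      ((risingPoly (ZMod p) e).map C - C (risingPoly (ZMod p) d))) := by
    have h1 : bmap Λ ((risingPoly (ZMod p) e).map C - C (risingPoly (ZMod p) d)) =
        (risingPoly Λ e).map C - C (risingPoly Λ d) := by
      simp only [bmap, Polynomial.map_sub, map_C, coe_mapRingHom, map_risingPoly]
    rw [h1]
    refine irreducible_map_C_sub_C (risingPoly_monic _ _) ?_ ?_ ?_ <;>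
      simp only [natDegree_risingPoly]
    exacts [he.pos, hd.pos, h.symm]
  have hset : (Finset.univ.filter fun x : ZMod p × ZMod p =>
      (risingPoly (ZMod p) d).eval x.1 = (risingPoly (ZMod p) e).eval x.2) =
      Finset.univ.filter fun x => ((risingPoly (ZMod p) e).map C -
        C (risingPoly (ZMod p) d)).eval₂ (evalRingHom x.1) x.2 = 0 := by
    ext x
    have : (evalRingHom x.1).comp C = RingHom.id (ZMod p) := by ext; simp
    rw [Finset.mem_filter, Finset.mem_filter, eval₂_sub, eval₂_C, eval₂_map, this, eval₂_id,
      coe_evalRingHom, sub_eq_zero]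
    exact and_congr_right fun _ => eq_comm
  have hset' : (Finset.univ.filter fun x : ZMod p × ZMod p =>
      (risingPoly (ZMod p) d).eval x.1 = (risingPoly (ZMod p) e).eval x.2) =
      (Finset.univ.filter fun x : ZMod p × ZMod p => ((risingPoly (ZMod p) d).map C -
        C (risingPoly (ZMod p) e)).eval₂ (evalRingHom x.1) x.2 = 0).map
        (Equiv.prodComm _ _).toEmbedding := by
    ext ⟨x, y⟩
    have : (evalRingHom y).comp C = RingHom.id (ZMod p) := by ext; simp
    simp [eval₂_sub, eval₂_map, this, sub_eq_zero, eval₂_id]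
  refine norm_sum_mulShift_le hψ (fun φ c => ?_) (fun φ => ?_) α β
  · rw [hset]
    have hX : (X : (ZMod p)[X][X]) ∈ ((DegFilt.deg (ZMod p)).poly 1).D 1 :=
      DegFilt.X_mem_poly _
    have hX' : (risingPoly (ZMod p) e).eval₂ (C.comp C) X =
        ((risingPoly (ZMod p) e).map C : (ZMod p)[X][X]) := by
      rw [← eval₂_map, eval₂_C_X]
    have hm1 := eval₂_C_C_mem hX (risingPoly (ZMod p) e) (natDegree_risingPoly (ZMod p) e).le
    have hm2 := eval₂_C_C_mem (linForm_mem c) (risingPoly (ZMod p) d)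
      (natDegree_risingPoly (ZMod p) d).le
    have hs : shear c ((risingPoly (ZMod p) e).map C - C (risingPoly (ZMod p) d)) =
        (risingPoly (ZMod p) e).eval₂ (C.comp C) X -
          (risingPoly (ZMod p) d).eval₂ (C.comp C) (linForm c) := by
      rw [map_sub, shear_map_C, shear_C, hX']
    refine norm_sum_curve_le Λ (hirr hcop hd he) he.two_le hep one_ne_zero c ?_ ?_ φ
    · rw [hs]
      exact AddSubgroup.sub_mem _ hm1 (((DegFilt.deg (ZMod p)).poly 1).mono (by lia) hm2)
    · rw [hs, coeff_sub, coeff_eq_zero_of_mem hm2 (by exact_mod_cast hde), hX', coeff_map, sub_zero]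
      have := (risingPoly_monic (ZMod p) e).coeff_natDegree
      rw [natDegree_risingPoly] at this
      rw [this]
  · rw [hset', Finset.sum_map]
    have h1 := sum_shear ((risingPoly (ZMod p) d).map C - C (risingPoly (ZMod p) e)) 0 φ
    have h2 : shear (0 : ZMod p) ((risingPoly (ZMod p) d).map C - C (risingPoly (ZMod p) e)) =
        (risingPoly (ZMod p) d).map C - C (risingPoly (ZMod p) e) := by
      have h3 := shear_comp_shear (c := (0 : ZMod p)) (d := 0) (by ring)
      have h4 : shear (0 : ZMod p) = RingHom.id _ := by
        refine ringHom_ext' (ringHom_ext' ?_ ?_) ?_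
        · ext a; simp
        · simp [linForm]
        · simp
      rw [h4, RingHom.id_apply]
    have hm : ((risingPoly (ZMod p) d).map C - C (risingPoly (ZMod p) e)).natDegree = d := by
      rw [natDegree_sub_C, natDegree_map_eq_of_injective C_injective, natDegree_risingPoly]
    have h3 := norm_charSum_fibrePts_le Λ
      (F := (risingPoly (ZMod p) d).map C - C (risingPoly (ZMod p) e)) (by
        refine Monic.sub_of_left ((risingPoly_monic _ _).map _) ?_
        rw [degree_eq_natDegree ((risingPoly_monic _ _).map _).ne_zero,
          natDegree_map_eq_of_injective C_injective, natDegree_risingPoly]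
        exact degree_C_le.trans_lt (by exact_mod_cast hd.pos)) (by
        rw [hm]
        intro i hi
        rw [coeff_sub, coeff_map, coeff_C]
        refine (natDegree_sub_le _ _).trans ?_
        rw [natDegree_C]
        split_ifs with h0
        · subst h0; rw [natDegree_risingPoly]; simpa using hed
        · simp) (by rw [hm]; exact hd.two_le) (by lia) (hirr hcop.symm he hd) φ
    rw [h2] at h1
    rw [← h1, hm] at h3
    simp only [zero_mul, add_zero] at h3
    refine h3.trans (add_le_add_right (weilError_mono hde.le) _)

theorem norm_sum_two_risingPoly_le {d e n : ℕ} (hd : d.Prime) (he : e.Prime) (hne : d ≠ e)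
    (hed : e ≤ 2 * d) (hde : d ≤ 2 * e) (hdn : d ≤ n) (hen : e ≤ n) (hnp : n < p)
    {ψ : AddChar (ZMod p) ℂ} (hψ : ψ ≠ 1) (α β : ZMod p) :
    ‖∑ x : ZMod p × ZMod p with
        (risingPoly (ZMod p) d).eval x.1 = (risingPoly (ZMod p) e).eval x.2,
      ψ (α * x.1 + β * x.2)‖ ≤ (if α = 0 ∧ β = 0 then (p : ℝ) else 0) + weilError p n := by
  rcases hne.lt_or_gt with h | h
  · exact (norm_sum_two_risingPoly_le_of_lt hd he h hed (by lia) hψ α β).trans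
      (add_le_add_right (weilError_mono hen) _)
  · have h1 := (norm_sum_two_risingPoly_le_of_lt he hd h hde (by lia) hψ β α).trans
      (add_le_add_right (weilError_mono hdn) _)
    have hset : (Finset.univ.filter fun x : ZMod p × ZMod p =>
      (risingPoly (ZMod p) d).eval x.1 = (risingPoly (ZMod p) e).eval x.2) =
      (Finset.univ.filter fun x : ZMod p × ZMod p =>
        (risingPoly (ZMod p) e).eval x.1 = (risingPoly (ZMod p) d).eval x.2).map
        (Equiv.prodComm _ _).toEmbedding := by
      ext ⟨x, y⟩
      simp [eq_comm]
    rw [hset, Finset.sum_map]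
    refine (le_of_eq ?_).trans (h1.trans (le_of_eq ?_))
    · congr 1
      refine Finset.sum_congr rfl fun x _ => ?_
      congr 1
      exact add_comm _ _
    · congr 1
      exact if_congr and_comm rfl rfl

end

section

open Polynomial

variable {p : ℕ} [hp : Fact p.Prime]

/-- The divided difference `(f(Y) - f(l)) / (Y - l)`. -/
noncomputable def divDiff {k : Type*} [CommRing k] (f : k[X]) (l : k[X][X]) : k[X][X] :=
  ∑ n ∈ Finset.range (f.natDegree + 1), C (C (f.coeff n)) *
    ∑ i ∈ Finset.range n, X ^ i * l ^ (n - 1 - i)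

section

variable {k : Type*} [CommRing k]

theorem mul_divDiff (f : k[X]) (l : k[X][X]) :
    (X - l) * divDiff f l = f.map C - f.eval₂ (C.comp C) l := by
  have h1 : (f.map C : k[X][X]) = f.eval₂ (C.comp C) X := by rw [← eval₂_map, eval₂_C_X]
  rw [h1, eval₂_eq_sum_range, eval₂_eq_sum_range, ← Finset.sum_sub_distrib, divDiff,
    Finset.mul_sum]
  refine Finset.sum_congr rfl fun n _ => ?_
  rw [← mul_sub, ← (Commute.all (X : k[X][X]) l).geom_sum₂_mul]
  simp only [RingHom.comp_apply]
  ring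

theorem shear_divDiff (c : k) (f : k[X]) : shear c (divDiff f (C X)) = divDiff f (linForm c) := by
  simp [divDiff, map_sum]

theorem eval_divDiff (f : k[X]) (x y : k) : (divDiff f (C X)).eval₂ (evalRingHom x) y =
    ∑ n ∈ Finset.range (f.natDegree + 1), f.coeff n *
      ∑ i ∈ Finset.range n, y ^ i * x ^ (n - 1 - i) := by
  simp [divDiff, eval₂_finsetSum, eval₂_mul, eval₂_pow]

theorem eval_divDiff_comm (f : k[X]) (x y : k) : (divDiff f (C X)).eval₂ (evalRingHom x) y =
    (divDiff f (C X)).eval₂ (evalRingHom y) x := by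
  rw [eval_divDiff, eval_divDiff]
  refine Finset.sum_congr rfl fun n _ => ?_
  congr 1
  rw [← Finset.sum_range_reflect]
  refine Finset.sum_congr rfl fun i hi => ?_
  rw [Finset.mem_range] at hi
  rw [mul_comm, show n - 1 - (n - 1 - i) = i by lia]

theorem mul_eval_divDiff (f : k[X]) (x y : k) :
    (y - x) * (divDiff f (C X)).eval₂ (evalRingHom x) y = f.eval y - f.eval x := by
  have h := congrArg (eval₂ (evalRingHom x) y) (mul_divDiff f (C X))
  have h1 : (evalRingHom x).comp C = RingHom.id k := by ext; simp
  have h2 : f.eval₂ (C.comp C) (C X : k[X][X]) = C f := by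
    rw [← hom_eval₂, eval₂_C_X]
  rw [h2, eval₂_mul, eval₂_sub, eval₂_sub, eval₂_map, eval₂_X, eval₂_C, eval₂_C, h1,
    eval₂_id] at h
  simpa using h

theorem divDiff_mem {l : k[X][X]} (hl : l ∈ ((DegFilt.deg k).poly 1).D 1) (f : k[X]) {n : ℕ}
    (hn : f.natDegree ≤ n + 1) : divDiff f l ∈ ((DegFilt.deg k).poly 1).D n := by
  refine AddSubgroup.sum_mem _ fun m hm => ?_
  rw [Finset.mem_range] at hm
  have hX : (X : k[X][X]) ∈ ((DegFilt.deg k).poly 1).D 1 := DegFilt.X_mem_poly _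
  have h2 : ∑ i ∈ Finset.range m, X ^ i * l ^ (m - 1 - i) ∈ ((DegFilt.deg k).poly 1).D n := by
    refine AddSubgroup.sum_mem _ fun i hi => ?_
    rw [Finset.mem_range] at hi
    have := ((DegFilt.deg k).poly 1).mul_mem (((DegFilt.deg k).poly 1).pow_mem hX i)
      (((DegFilt.deg k).poly 1).pow_mem hl (m - 1 - i))
    exact ((DegFilt.deg k).poly 1).mono (by lia) this
  have := ((DegFilt.deg k).poly 1).mul_mem (C_C_mem (f.coeff m)) h2
  rwa [zero_add] at this

theorem coeff_divDiff (c : k) {f : k[X]} (hf : f.Monic) {n : ℕ} (hn : f.natDegree = n + 1) :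
    (divDiff f (linForm c)).coeff n = C (∑ i ∈ Finset.range (n + 1), (-c) ^ i) := by
  have hX : (X : k[X][X]) ∈ ((DegFilt.deg k).poly 1).D 1 := DegFilt.X_mem_poly _
  have hl : (linForm c).natDegree ≤ 1 := natDegree_le_of_mem (linForm_mem c)
  rw [divDiff, hn, Finset.sum_range_succ, coeff_add, finsetSum_coeff, Finset.sum_eq_zero,
    zero_add, ← hn, hf.coeff_natDegree, C_1, C_1, one_mul, hn, finsetSum_coeff,
    ← Finset.sum_range_reflect, map_sum]
  · refine Finset.sum_congr rfl fun i hi => ?_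
    rw [Finset.mem_range] at hi
    obtain ⟨d, rfl⟩ : ∃ d, n = d + i := ⟨n - i, by lia⟩
    rw [show d + i + 1 - 1 - i = d by lia, show d + i + 1 - 1 - d = i by lia, add_comm d i,
      coeff_X_pow_mul]
    have := coeff_pow_of_natDegree_le hl (m := i)
    rw [mul_one] at this
    rw [this, C_pow]
    congr 1
    simp [linForm]
  · intro m hm
    rw [Finset.mem_range] at hm
    rw [coeff_C_mul, finsetSum_coeff, Finset.sum_eq_zero, mul_zero]
    intro i hi
    rw [Finset.mem_range] at hi
    have h := ((DegFilt.deg k).poly 1).mul_mem (((DegFilt.deg k).poly 1).pow_mem hX i)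
      (((DegFilt.deg k).poly 1).pow_mem (linForm_mem c) (m - 1 - i))
    exact coeff_eq_zero_of_mem h (by lia)

end

theorem geom_sum_ne_zero_of_not_dvd {j : ℕ} (hj : j.Prime) (hjp : j < p) (hjd : ¬ j ∣ p - 1)
    (x : ZMod p) : ∑ i ∈ Finset.range j, x ^ i ≠ 0 := by
  by_cases hx : x = 1
  · subst hx
    simp only [one_pow, Finset.sum_const, Finset.card_range, nsmul_eq_mul, mul_one]
    rw [Ne, ZMod.natCast_eq_zero_iff]
    exact Nat.not_dvd_of_pos_of_lt hj.pos hjp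
  · intro h
    have h1 := geom_sum_mul x j
    rw [h, zero_mul] at h1
    have h2 : x ^ j = 1 := (sub_eq_zero.1 h1.symm)
    have hx0 : x ≠ 0 := by
      rintro rfl
      rw [zero_pow hj.ne_zero] at h2
      exact zero_ne_one h2
    have h3 := ZMod.pow_card_sub_one_eq_one hx0
    have h4 := Nat.dvd_gcd (orderOf_dvd_of_pow_eq_one h2) (orderOf_dvd_of_pow_eq_one h3)
    rw [(Nat.Prime.coprime_iff_not_dvd hj).2 hjd, Nat.dvd_one, orderOf_eq_one_iff] at h4
    exact hx h4

theorem norm_sum_divDiff_risingPoly_le {j n : ℕ} (hj : j.Prime) (hj3 : 3 ≤ j)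
    (hjp : 2 * j ^ 5 < p) (hjd : ¬ j ∣ p - 1) (hjn : j ≤ n)
    {ψ : AddChar (ZMod p) ℂ} (hψ : ψ ≠ 1) (α β : ZMod p) :
    ‖∑ x : ZMod p × ZMod p with
        (divDiff (risingPoly (ZMod p) j) (C X)).eval₂ (evalRingHom x.1) x.2 = 0,
      ψ (α * x.1 + β * x.2)‖ ≤ (if α = 0 ∧ β = 0 then (p : ℝ) else 0) + weilError p n := by
  let Λ := AlgebraicClosure (ZMod p)
  have : CharP Λ p := charP_of_injective_algebraMap (algebraMap (ZMod p) Λ).injective p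
  have hjlt : j < p := by nlinarith [Nat.pow_le_pow_right hj.pos (show 1 ≤ 5 by norm_num)]
  set G := divDiff (risingPoly (ZMod p) j) (C X) with hGdef
  have hirr : Irreducible (bmap Λ G) := by
    refine irreducible_diff_quotient hj hjp (f := risingPoly Λ j) rfl ?_
    have h := congrArg (bmap Λ) (mul_divDiff (risingPoly (ZMod p) j) (C X))
    rw [← hom_eval₂, eval₂_C_X] at h
    simp only [bmap, Polynomial.map_sub, map_C, coe_mapRingHom, map_risingPoly,
      Polynomial.map_mul, map_X] at h ⊢
    exact h
  obtain ⟨d, rfl⟩ : ∃ d, j = d + 1 := ⟨j - 1, by lia⟩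
  have hdeg := natDegree_risingPoly (ZMod p) (d + 1)
  have h1 (φ : AddChar (ZMod p) ℂ) (c : ZMod p) :
      ‖∑ x : ZMod p × ZMod p with G.eval₂ (evalRingHom x.1) x.2 = 0, φ (x.1 + c * x.2)‖ ≤
        (if φ = 1 then (p : ℝ) else 0) + weilError p n := by
    refine (norm_sum_curve_le Λ hirr (n := d) (by lia) (by lia)
      (geom_sum_ne_zero_of_not_dvd hj hjlt hjd (-c)) c ?_ ?_ φ).trans
      (add_le_add_right (weilError_mono (by lia)) _)
    · rw [hGdef, shear_divDiff]
      exact divDiff_mem (linForm_mem c) _ hdeg.le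
    · rw [hGdef, shear_divDiff]
      exact coeff_divDiff c (risingPoly_monic _ _) hdeg
  refine norm_sum_mulShift_le hψ h1 (fun φ => ?_) α β
  have hset : (Finset.univ.filter fun x : ZMod p × ZMod p =>
      G.eval₂ (evalRingHom x.1) x.2 = 0) =
      (Finset.univ.filter fun x : ZMod p × ZMod p =>
        G.eval₂ (evalRingHom x.1) x.2 = 0).map (Equiv.prodComm _ _).toEmbedding := by
    ext ⟨x, y⟩
    have := eval_divDiff_comm (risingPoly (ZMod p) (d + 1)) x y
    rw [← hGdef] at this
    simp [this]
  rw [hset, Finset.sum_map]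
  simpa using h1 φ 0

end

section

open Finset

variable {p : ℕ} [hp : Fact p.Prime]

/-- The Fejér weight of width `H` centred at `x₀`. -/
noncomputable def fejerWeight (H : ℕ) (x₀ x : ZMod p) : ℝ :=
  (∑ u ∈ range H, ∑ v ∈ range H, if x = x₀ + u - v then 1 else 0) / H

/-- The Fourier coefficients of the Fejér weight. -/
noncomputable def fejerCoeff (ψ : AddChar (ZMod p) ℂ) (H : ℕ) (a : ZMod p) : ℝ :=
  ‖∑ u ∈ range H, ψ (a * u)‖ ^ 2 / (p * H)

theorem fejerWeight_nonneg (H : ℕ) (x₀ x : ZMod p) : 0 ≤ fejerWeight H x₀ x := by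
  unfold fejerWeight
  positivity

theorem fejerCoeff_nonneg (ψ : AddChar (ZMod p) ℂ) (H : ℕ) (a : ZMod p) :
    0 ≤ fejerCoeff ψ H a := by
  unfold fejerCoeff
  positivity

theorem exists_of_fejerWeight_ne_zero {H : ℕ} {x₀ x : ZMod p} (h : fejerWeight H x₀ x ≠ 0) :
    ∃ u < H, ∃ v < H, x = x₀ + u - v := by
  by_contra! hc
  refine h ?_
  rw [fejerWeight, sum_eq_zero, zero_div]
  intro u hu
  refine sum_eq_zero fun v hv => if_neg (hc u (mem_range.mp hu) v (mem_range.mp hv))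

theorem natCast_inj_of_lt {u v : ℕ} (hu : u < p) (hv : v < p) (h : (u : ZMod p) = v) : u = v := by
  rw [ZMod.natCast_eq_natCast_iff] at h
  exact Nat.ModEq.eq_of_lt_of_lt h hu hv

theorem sum_fejerWeight {H : ℕ} (hH : 0 < H) (x₀ : ZMod p) : ∑ x, fejerWeight H x₀ x = H := by
  simp only [fejerWeight]
  rw [← sum_div, sum_comm]
  have (u : ℕ) : ∑ x : ZMod p, ∑ v ∈ range H, (if x = x₀ + u - v then (1 : ℝ) else 0) = H := by
    rw [sum_comm]
    simp
  simp only [this, sum_const, card_range, nsmul_eq_mul]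
  field_simp

theorem fejerWeight_le_one {H : ℕ} (hHp : H ≤ p) (x₀ x : ZMod p) : fejerWeight H x₀ x ≤ 1 := by
  refine div_le_one_of_le₀ ?_ (by positivity)
  calc _ ≤ ∑ u ∈ range H, (1 : ℝ) := sum_le_sum fun u hu => ?_
    _ = H := by simp
  rw [sum_boole]
  norm_cast
  refine card_le_one.mpr fun v hv w hw => ?_
  simp only [mem_filter, mem_range] at hv hw
  refine natCast_inj_of_lt (hv.1.trans_le hHp) (hw.1.trans_le hHp) ?_
  have := hv.2.symm.trans hw.2
  simpa using this

theorem fejerWeight_self {H : ℕ} (hH : 0 < H) (hHp : H ≤ p) (x₀ : ZMod p) :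
    fejerWeight H x₀ x₀ = 1 := by
  rw [fejerWeight, div_eq_one_iff_eq (by positivity)]
  calc _ = ∑ u ∈ range H, (1 : ℝ) := sum_congr rfl fun u hu => ?_
    _ = H := by simp
  rw [sum_eq_single_of_mem u hu, if_pos (by ring)]
  intro v hv hvu
  refine if_neg fun h => hvu ?_
  rw [mem_range] at hu hv
  refine natCast_inj_of_lt (hv.trans_le hHp) (hu.trans_le hHp) ?_
  linear_combination h

theorem fejerWeight_eq_sum {ψ : AddChar (ZMod p) ℂ} (hψ : ψ ≠ 1) (H : ℕ) (x₀ x : ZMod p) :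
    (fejerWeight H x₀ x : ℂ) = ∑ a, (fejerCoeff ψ H a : ℂ) * ψ (a * (x - x₀)) := by
  have hp0 : (p : ℂ) ≠ 0 := Nat.cast_ne_zero.mpr hp.out.ne_zero
  have hprim : ψ.IsPrimitive := AddChar.IsPrimitive.of_ne_one hψ
  have key (a : ZMod p) : (fejerCoeff ψ H a : ℂ) * ψ (a * (x - x₀)) =
      (∑ u ∈ range H, ∑ v ∈ range H, ψ (a * (x - (x₀ + u - v)))) / (p * H) := by
    rw [fejerCoeff]
    push_cast
    rw [← Complex.conj_mul', map_sum, sum_mul_sum, div_mul_eq_mul_div, sum_mul]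
    congr 1
    refine sum_congr rfl fun u _ => ?_
    rw [sum_mul]
    refine sum_congr rfl fun v _ => ?_
    rw [← AddChar.map_neg_eq_conj, ← AddChar.map_add_eq_mul, ← AddChar.map_add_eq_mul]
    congr 1
    ring
  simp only [key]
  rw [← sum_div, sum_comm]
  have (u : ℕ) : ∑ a : ZMod p, ∑ v ∈ range H, ψ (a * (x - (x₀ + u - v))) =
      p * ∑ v ∈ range H, if x = x₀ + u - v then (1 : ℂ) else 0 := by
    rw [sum_comm, mul_sum]
    refine sum_congr rfl fun v _ => ?_
    rw [AddChar.sum_mulShift _ hprim, ZMod.card]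
    simp [sub_eq_zero]
  simp only [this]
  rw [← mul_sum, mul_div_mul_left _ _ hp0, fejerWeight]
  simp only [Complex.ofReal_div, Complex.ofReal_sum, apply_ite Complex.ofReal, Complex.ofReal_one,
    Complex.ofReal_zero, Complex.ofReal_natCast]

theorem sum_fejerCoeff {ψ : AddChar (ZMod p) ℂ} (hψ : ψ ≠ 1) {H : ℕ} (hH : 0 < H) (hHp : H ≤ p) :
    ∑ a, fejerCoeff ψ H a = 1 := by
  have h := fejerWeight_eq_sum hψ H (0 : ZMod p) 0
  rw [fejerWeight_self hH hHp] at h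
  simp only [sub_zero, mul_zero, AddChar.map_zero_eq_one, mul_one] at h
  exact_mod_cast h.symm

theorem fejerCoeff_zero (ψ : AddChar (ZMod p) ℂ) {H : ℕ} (hH : 0 < H) :
    fejerCoeff ψ H 0 = H / p := by
  have : (H : ℝ) ≠ 0 := by positivity
  simp only [fejerCoeff, zero_mul, AddChar.map_zero_eq_one, sum_const, card_range, nsmul_eq_mul,
    mul_one, Complex.norm_natCast]
  field_simp

theorem sum_fejerWeight_mul_le {ψ : AddChar (ZMod p) ℂ} (hψ : ψ ≠ 1) {H : ℕ} (hH : 0 < H)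
    (hHp : H ≤ p) (x₀ : ZMod p) {E : ℝ} (Z : Finset (ZMod p × ZMod p))
    (hZ : ∀ α β : ZMod p, ‖∑ x ∈ Z, ψ (α * x.1 + β * x.2)‖ ≤
      (if α = 0 ∧ β = 0 then (p : ℝ) else 0) + E) :
    ∑ x ∈ Z, fejerWeight H x₀ x.1 * fejerWeight H x₀ x.2 ≤ (H : ℝ) ^ 2 / p + E := by
  have hp0 : (p : ℝ) ≠ 0 := Nat.cast_ne_zero.mpr hp.out.ne_zero
  set w := fejerCoeff ψ H with hw
  have hw0 (a) : 0 ≤ w a := fejerCoeff_nonneg ψ H a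
  have h1 : ((∑ x ∈ Z, fejerWeight H x₀ x.1 * fejerWeight H x₀ x.2 : ℝ) : ℂ) =
      ∑ α, ∑ β, (w α * w β : ℂ) * ψ (-((α + β) * x₀)) * ∑ x ∈ Z, ψ (α * x.1 + β * x.2) := by
    push_cast
    simp only [fejerWeight_eq_sum hψ, sum_mul_sum]
    rw [sum_comm]
    refine sum_congr rfl fun α _ => ?_
    rw [sum_comm]
    refine sum_congr rfl fun β _ => ?_
    rw [mul_sum]
    refine sum_congr rfl fun x _ => ?_
    have : α * (x.1 - x₀) + β * (x.2 - x₀) = -((α + β) * x₀) + (α * x.1 + β * x.2) := by ring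
    rw [mul_mul_mul_comm, ← AddChar.map_add_eq_mul, this, AddChar.map_add_eq_mul, mul_assoc,
      mul_assoc, mul_assoc]
  calc _ ≤ ‖((∑ x ∈ Z, fejerWeight H x₀ x.1 * fejerWeight H x₀ x.2 : ℝ) : ℂ)‖ := by
        rw [Complex.norm_real]; exact le_abs_self _
    _ ≤ ∑ α, ∑ β, w α * w β * ((if α = 0 ∧ β = 0 then (p : ℝ) else 0) + E) := by
        rw [h1]
        refine norm_sum_le_of_le _ fun α _ => norm_sum_le_of_le _ fun β _ => ?_
        rw [norm_mul, norm_mul, norm_mul, AddChar.norm_apply, Complex.norm_real, Complex.norm_real,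
          Real.norm_of_nonneg (hw0 α), Real.norm_of_nonneg (hw0 β), mul_one]
        exact mul_le_mul_of_nonneg_left (hZ α β) (mul_nonneg (hw0 α) (hw0 β))
    _ = w 0 * w 0 * p + (∑ α, w α) * (∑ β, w β) * E := by
        rw [sum_mul_sum, sum_mul]
        simp only [mul_add, sum_add_distrib, sum_mul, ite_and, mul_ite, mul_zero]
        simp
    _ = _ := by
        rw [hw, sum_fejerCoeff hψ hH hHp, fejerCoeff_zero ψ hH]
        field_simp

end

section

open Finset Polynomial

variable {p : ℕ} [hp : Fact p.Prime]

/-- The number of representations `y = P j x` with `j ∈ J`, where `x` is counted with weight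
`g x`. -/
def weightedRep {ι : Type*} (J : Finset ι) (P : ι → ZMod p → ZMod p) (g : ZMod p → ℝ)
    (y : ZMod p) : ℝ :=
  ∑ j ∈ J, ∑ x, if P j x = y then g x else 0

theorem sum_weightedRep {ι : Type*} (J : Finset ι) (P : ι → ZMod p → ZMod p) (g : ZMod p → ℝ) :
    ∑ y, weightedRep J P g y = J.card * ∑ x, g x := by
  simp only [weightedRep]
  rw [sum_comm, ← nsmul_eq_mul, ← sum_const]
  refine sum_congr rfl fun j _ => ?_
  rw [sum_comm]
  simp

theorem sum_sq_weightedRep {ι : Type*} (J : Finset ι) (P : ι → ZMod p → ZMod p)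
    (g : ZMod p → ℝ) :
    ∑ y, weightedRep J P g y ^ 2 =
      ∑ j ∈ J, ∑ k ∈ J, ∑ x : ZMod p × ZMod p with P j x.1 = P k x.2, g x.1 * g x.2 := by
  simp only [weightedRep, sq, sum_mul_sum]
  rw [sum_comm]
  refine sum_congr rfl fun j _ => ?_
  rw [sum_comm]
  refine sum_congr rfl fun k _ => ?_
  rw [sum_filter, Fintype.sum_prod_type, sum_comm]
  refine sum_congr rfl fun x _ => ?_
  rw [sum_comm]
  refine sum_congr rfl fun z _ => ?_
  simp only [ite_mul, zero_mul, mul_ite, mul_zero]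
  rw [sum_ite_eq]
  simp

theorem card_ge_of_weightedRep {ι : Type*} (J : Finset ι) (P : ι → ZMod p → ZMod p)
    (g : ZMod p → ℝ) {H E : ℝ} (hH : 0 < H) (hJ : J.Nonempty) (hE : 0 ≤ E)
    (hg : ∑ x, g x = H)
    (hoff : ∀ j ∈ J, ∀ k ∈ J, j ≠ k →
      ∑ x : ZMod p × ZMod p with P j x.1 = P k x.2, g x.1 * g x.2 ≤ H ^ 2 / p + E)
    (hdiag : ∀ j ∈ J,
      ∑ x : ZMod p × ZMod p with P j x.1 = P j x.2, g x.1 * g x.2 ≤ H ^ 2 / p + E + H)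
    (S : Finset (ZMod p)) (hS : ∀ j ∈ J, ∀ x, g x ≠ 0 → P j x ∈ S) :
    (p : ℝ) - p ^ 2 * (E / H ^ 2 + 1 / (J.card * H)) ≤ S.card := by
  have hJ0 : (0 : ℝ) < J.card := by exact_mod_cast hJ.card_pos
  have hp0 : (0 : ℝ) < p := Nat.cast_pos.mpr hp.out.pos
  have hsupp (y) (hy : y ∉ S) : weightedRep J P g y = 0 := by
    refine sum_eq_zero fun j hj => sum_eq_zero fun x _ => ?_
    split_ifs with h
    · by_contra hne
      exact hy (h ▸ hS j hj x hne)
    · rfl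
  have h1 : ∑ y ∈ S, weightedRep J P g y = J.card * H := by
    rw [← hg, ← sum_weightedRep]
    exact sum_subset (subset_univ _) fun y _ hy => hsupp y hy
  have h2 : ∑ y, weightedRep J P g y ^ 2 ≤ J.card ^ 2 * (H ^ 2 / p + E) + J.card * H := by
    classical
    rw [sum_sq_weightedRep]
    calc _ ≤ ∑ j ∈ J, ∑ k ∈ J, ((H ^ 2 / p + E) + if j = k then H else 0) := by
          refine sum_le_sum fun j hj => sum_le_sum fun k hk => ?_
          split_ifs with h
          · subst h
            exact hdiag j hj
          · rw [add_zero]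
            exact hoff j hj k hk h
      _ = _ := by
          simp only [sum_add_distrib, sum_const, nsmul_eq_mul, sum_ite_eq, sum_ite_mem, inter_self]
          ring
  have h3 : (J.card * H) ^ 2 ≤ S.card * (J.card ^ 2 * (H ^ 2 / p + E) + J.card * H) := by
    rw [← h1]
    refine sq_sum_le_card_mul_sum_sq.trans (mul_le_mul_of_nonneg_left (le_trans ?_ (h1 ▸ h2))
      (by positivity))
    exact sum_le_sum_of_subset_of_nonneg (subset_univ _) fun _ _ _ => sq_nonneg _
  have hSp : (S.card : ℝ) ≤ p := by
    have := S.card_le_univ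
    rw [ZMod.card] at this
    exact_mod_cast this
  have h4 : (J.card * H) ^ 2 ≤ S.card * (J.card * H) ^ 2 / p + p * (J.card ^ 2 * E + J.card * H) := by
    calc _ ≤ _ := h3
      _ = S.card * (J.card * H) ^ 2 / p + S.card * (J.card ^ 2 * E + J.card * H) := by
        field_simp
        ring
      _ ≤ _ := by gcongr
  have h5 : (p : ℝ) - p ^ 2 * (E / H ^ 2 + 1 / (J.card * H)) =
      p / (J.card * H) ^ 2 * ((J.card * H) ^ 2 - p * (J.card ^ 2 * E + J.card * H)) := by
    field_simp
  have h6 : (S.card : ℝ) = p / (J.card * H) ^ 2 * (S.card * (J.card * H) ^ 2 / p) := by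
    field_simp
  rw [h5, h6]
  exact mul_le_mul_of_nonneg_left (sub_le_iff_le_add.mpr h4)
    (div_nonneg hp0.le (sq_nonneg _))

theorem card_ge_of_risingPoly {n H : ℕ} (J : Finset ℕ) (hJ : J.Nonempty) (hH : 0 < H) (hHp : H ≤ p)
    (hprime : ∀ j ∈ J, j.Prime) (hdvd : ∀ j ∈ J, ¬ j ∣ p - 1) (h3 : ∀ j ∈ J, 3 ≤ j)
    (h5 : ∀ j ∈ J, 2 * j ^ 5 < p) (hJn : ∀ j ∈ J, j ≤ n) (hnp : n < p)
    (hJJ : ∀ j ∈ J, ∀ k ∈ J, j ≤ 2 * k) (x₀ : ZMod p) (S : Finset (ZMod p))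
    (hS : ∀ j ∈ J, ∀ u < H, ∀ v < H, (risingPoly (ZMod p) j).eval (x₀ + u - v) ∈ S) :
    (p : ℝ) - p ^ 2 * (weilError p n / H ^ 2 + 1 / (J.card * H)) ≤ S.card := by
  obtain ⟨ψ, hψ⟩ : ∃ ψ : AddChar (ZMod p) ℂ, ψ ≠ 1 :=
    ⟨ZMod.stdAddChar, by
      have := ZMod.isPrimitive_stdAddChar p (one_ne_zero : (1 : ZMod p) ≠ 0)
      rwa [AddChar.mulShift_one] at this⟩
  have hE : 0 ≤ weilError p n := by unfold weilError; positivity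
  refine card_ge_of_weightedRep J (fun j x => (risingPoly (ZMod p) j).eval x)
    (fejerWeight H x₀) (by exact_mod_cast hH) hJ hE (sum_fejerWeight hH x₀) ?_ ?_ S ?_
  · intro j hj k hk hjk
    exact sum_fejerWeight_mul_le hψ hH hHp x₀ _ fun α β => norm_sum_two_risingPoly_le
      (hprime j hj) (hprime k hk) hjk (hJJ k hk j hj) (hJJ j hj k hk) (hJn j hj) (hJn k hk) hnp
      hψ α β
  · intro j hj
    have hg0 (x : ZMod p × ZMod p) : 0 ≤ fejerWeight H x₀ x.1 * fejerWeight H x₀ x.2 :=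
      mul_nonneg (fejerWeight_nonneg _ _ _) (fejerWeight_nonneg _ _ _)
    set Z := univ.filter fun x : ZMod p × ZMod p =>
      (divDiff (risingPoly (ZMod p) j) (C X)).eval₂ (evalRingHom x.1) x.2 = 0
    have hZ : ∑ x ∈ Z, fejerWeight H x₀ x.1 * fejerWeight H x₀ x.2 ≤
        (H : ℝ) ^ 2 / p + weilError p n :=
      sum_fejerWeight_mul_le hψ hH hHp x₀ _ fun α β => norm_sum_divDiff_risingPoly_le
        (hprime j hj) (h3 j hj) (h5 j hj) (hdvd j hj) (hJn j hj) hψ α β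
    have hD : ∑ x ∈ univ.filter (fun x : ZMod p × ZMod p => x.1 = x.2),
        fejerWeight H x₀ x.1 * fejerWeight H x₀ x.2 ≤ H := by
      rw [sum_filter, Fintype.sum_prod_type, ← sum_fejerWeight hH x₀]
      refine sum_le_sum fun x _ => ?_
      rw [sum_ite_eq, if_pos (mem_univ _)]
      exact mul_le_of_le_one_right (fejerWeight_nonneg _ _ _) (fejerWeight_le_one hHp _ _)
    refine le_trans ?_ (add_le_add hZ hD)
    rw [← sum_union_inter]
    refine le_trans (sum_le_sum_of_subset_of_nonneg ?_ fun x _ _ => hg0 x)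
      (le_add_of_nonneg_right (sum_nonneg fun x _ => hg0 x))
    intro x hx
    simp only [mem_filter, mem_univ, true_and, mem_union, Z] at hx ⊢
    by_cases hxx : x.1 = x.2
    · exact Or.inr hxx
    · refine Or.inl ((mul_eq_zero.mp ?_).resolve_left (sub_ne_zero.mpr (Ne.symm hxx)))
      rw [mul_eval_divDiff, hx, sub_self]
  · intro j hj x hx
    obtain ⟨u, hu, v, hv, rfl⟩ := exists_of_fejerWeight_ne_zero hx
    exact hS j hj u hu v hv

theorem eval_risingPoly_natCast (j m : ℕ) :
    (risingPoly (ZMod p) j).eval (m : ZMod p) * (m.factorial : ZMod p) = (m + j).factorial := by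
  induction j with
  | zero => simp [risingPoly]
  | succ j ih =>
    have : risingPoly (ZMod p) (j + 1) = risingPoly (ZMod p) j * (X + C ((j + 1 : ℕ) : ZMod p)) := by
      rw [risingPoly, prod_Icc_succ_top (by omega), risingPoly]
    rw [this, eval_mul, mul_right_comm, ih, ← add_assoc, Nat.factorial_succ]
    simp
    ring

theorem eval_risingPoly_mem_ratio {L N j m : ℕ} (hLN : L + N < p) (h1 : L + 1 ≤ m)
    (h2 : m + j ≤ L + N) :
    (risingPoly (ZMod p) j).eval (m : ZMod p) ∈ intervalFactorialsRatio p L N := by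
  refine mem_image₂.mpr ⟨((m + j).factorial : ZMod p), ?_, (m.factorial : ZMod p), ?_, ?_⟩
  · exact mem_image_of_mem _ (mem_Icc.mpr ⟨by omega, h2⟩)
  · exact mem_image_of_mem _ (mem_Icc.mpr ⟨by omega, by omega⟩)
  · have : (m.factorial : ZMod p) ≠ 0 := by
      rw [Ne, ZMod.natCast_eq_zero_iff, hp.out.dvd_factorial]
      omega
    rw [← eval_risingPoly_natCast, mul_assoc, mul_inv_cancel₀ this, mul_one]

theorem card_intervalFactorialsRatio_ge_of_primes {L N n H : ℕ} (hLN : L + N < p) (J : Finset ℕ)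
    (hJ : J.Nonempty) (hH : 0 < H) (hHN : 2 * H + n ≤ N)
    (hprime : ∀ j ∈ J, j.Prime) (hdvd : ∀ j ∈ J, ¬ j ∣ p - 1) (h3 : ∀ j ∈ J, 3 ≤ j)
    (h5 : ∀ j ∈ J, 2 * j ^ 5 < p) (hJn : ∀ j ∈ J, j ≤ n)
    (hJJ : ∀ j ∈ J, ∀ k ∈ J, j ≤ 2 * k) :
    (p : ℝ) - p ^ 2 * (weilError p n / H ^ 2 + 1 / (J.card * H)) ≤
      (intervalFactorialsRatio p L N).card := by
  refine card_ge_of_risingPoly J hJ hH (by omega) hprime hdvd h3 h5 hJn (by omega) hJJ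
    ((L + H : ℕ) : ZMod p) _ fun j hj u hu v hv => ?_
  have : ((L + H : ℕ) : ZMod p) + u - v = ((L + H + u - v : ℕ) : ZMod p) := by
    rw [Nat.cast_sub (by omega)]
    push_cast
    ring
  rw [this]
  have := hJn j hj
  exact eval_risingPoly_mem_ratio hLN (by omega) (by omega)

end

section

open Finset Chebyshev Filter Asymptotics

theorem sum_log_primes_Ioc_le {M n : ℕ} (hMn : 2 * M ≤ n) :
    ∑ q ∈ Ioc M (2 * M) with q.Prime, Real.log q ≤
      ((Ioc M (2 * M)).filter Nat.Prime).card * Real.log n := by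
  rw [← nsmul_eq_mul]
  refine sum_le_card_nsmul _ _ _ fun q hq => ?_
  simp only [mem_filter, mem_Ioc] at hq
  exact Real.log_le_log (by exact_mod_cast hq.2.pos) (by exact_mod_cast hq.1.2.trans hMn)

theorem theta_add_sum_primes_Ioc (M : ℕ) :
    theta M + ∑ q ∈ Ioc M (2 * M) with q.Prime, Real.log q = theta (2 * M : ℕ) := by
  simp only [theta, Nat.floor_natCast, sum_filter]
  exact sum_Ioc_consecutive _ (Nat.zero_le M) (by omega)

theorem eventually_le_theta_sub_theta :
    ∀ᶠ T : ℕ in atTop, (T : ℝ) ≤ theta (4 * T : ℕ) - theta T := by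
  have h1 : (fun T : ℕ => Real.log ((4 * T : ℕ) + 1)) =o[atTop] fun T : ℕ => (T : ℝ) := by
    have h := Real.isLittleO_log_id_atTop.comp_tendsto
      ((tendsto_natCast_atTop_atTop.comp
        (tendsto_id.const_mul_atTop' (four_pos : (0 : ℕ) < 4))).atTop_add
        (tendsto_const_nhds (x := (1 : ℝ))))
    refine h.trans_isBigO (IsBigO.of_bound 5 ?_)
    filter_upwards [eventually_ge_atTop 1] with T hT
    have : (1 : ℝ) ≤ T := by exact_mod_cast hT
    simp only [Function.comp_apply, id, Real.norm_eq_abs]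
    push_cast
    rw [abs_of_nonneg (by positivity), abs_of_nonneg (by positivity)]
    linarith
  have h2 : (fun T : ℕ => 2 * √(4 * T : ℕ) * Real.log (4 * T : ℕ)) =o[atTop]
      fun T : ℕ => (T : ℝ) := by
    have h0 : (fun x : ℝ => 2 * √x * Real.log x) =o[atTop] fun x : ℝ => x := by
      have h3 : (fun x : ℝ => √x * Real.log x) =o[atTop] fun x : ℝ => √x * √x := by
        refine (isBigO_refl _ _).mul_isLittleO ?_
        rw [show Real.sqrt = fun x => x ^ (1 / 2 : ℝ) from funext Real.sqrt_eq_rpow]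
        exact isLittleO_log_rpow_atTop (by norm_num : (0 : ℝ) < 1 / 2)
      have h4 : (fun x : ℝ => √x * √x) =ᶠ[atTop] fun x => x := by
        filter_upwards [eventually_ge_atTop 0] with x hx using Real.mul_self_sqrt hx
      simpa only [mul_assoc] using (h3.trans_eventuallyEq h4).const_mul_left 2
    have h := h0.comp_tendsto
      (tendsto_natCast_atTop_atTop.comp (tendsto_id.const_mul_atTop' (four_pos : (0 : ℕ) < 4)))
    refine h.trans_isBigO (IsBigO.of_bound 4 ?_)
    filter_upwards with T
    simp
  filter_upwards [h1.bound (by norm_num : (0 : ℝ) < 1 / 10),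
    h2.bound (by norm_num : (0 : ℝ) < 1 / 10)] with T hT1 hT2
  have hge := theta_ge (4 * T)
  have hle := theta_le_log4_mul_x (Nat.cast_nonneg T)
  have hlog4 : Real.log 4 = 2 * Real.log 2 := by
    rw [show (4 : ℝ) = 2 ^ 2 by norm_num, Real.log_pow]
    norm_num
  have hlog2 := Real.log_two_gt_d9
  rw [Real.norm_natCast] at hT1 hT2
  have hT1' := (le_abs_self _).trans hT1
  have hT2' := (le_abs_self _).trans hT2
  rw [hlog4] at hle
  push_cast at hge hT1' hT2' ⊢
  have hT0 : (0 : ℝ) ≤ T := Nat.cast_nonneg T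
  nlinarith

theorem card_primeDivisors_lt {T m q : ℕ} (hq : 0 < q) (hqT : q < T ^ m) (J : Finset ℕ)
    (hJ : ∀ j ∈ J, j.Prime ∧ T ≤ j ∧ j ∣ q) : J.card < m := by
  by_contra! hm
  have h1 : ∏ j ∈ J, j ∣ q := by
    refine Finset.prod_primes_dvd q (fun j hj => (hJ j hj).1.prime) fun j hj => (hJ j hj).2.2
  have h2 : T ^ J.card ≤ ∏ j ∈ J, j := pow_card_le_prod _ _ _ fun j hj => (hJ j hj).2.1
  have hT : 1 ≤ T := by
    by_contra! h
    obtain rfl : T = 0 := by omega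
    rcases m with _ | m
    · simp at hqT; omega
    · simp at hqT
  have := (Nat.pow_le_pow_right hT hm).trans (h2.trans (Nat.le_of_dvd hq h1))
  omega

theorem exists_primes_not_dvd : ∃ T₀ : ℕ, ∀ T ≥ T₀, ∀ q : ℕ, 0 < q → q < T ^ 8 →
    ∃ J : Finset ℕ, (T : ℝ) ≤ J.card * (4 * Real.log (4 * T : ℕ)) ∧
      (∀ j ∈ J, j.Prime ∧ ¬ j ∣ q ∧ T < j ∧ j ≤ 4 * T) ∧ ∀ j ∈ J, ∀ k ∈ J, j ≤ 2 * k := by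
  have h1 : (fun T : ℕ => Real.log (4 * T : ℕ)) =o[atTop] fun T : ℕ => (T : ℝ) := by
    have h := Real.isLittleO_log_id_atTop.comp_tendsto
      (tendsto_natCast_atTop_atTop.comp (tendsto_id.const_mul_atTop' (four_pos : (0 : ℕ) < 4)))
    refine h.trans_isBigO (IsBigO.of_bound 4 ?_)
    filter_upwards with T
    simp
  obtain ⟨T₀, hT₀⟩ := eventually_atTop.mp
    ((eventually_le_theta_sub_theta.and (h1.bound (by norm_num : (0 : ℝ) < 1 / 32))).and
      (eventually_ge_atTop 1))
  refine ⟨T₀, fun T hT q hq hqT => ?_⟩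
  obtain ⟨⟨hth, hlog⟩, hT1⟩ := hT₀ T hT
  have hl0 : 0 ≤ Real.log (4 * T : ℕ) := Real.log_natCast_nonneg _
  rw [Real.norm_natCast, Real.norm_of_nonneg hl0] at hlog
  obtain ⟨M, hM1, hM2, hM⟩ : ∃ M, T ≤ M ∧ 2 * M ≤ 4 * T ∧
      (T : ℝ) ≤ ((Ioc M (2 * M)).filter Nat.Prime).card * (2 * Real.log (4 * T : ℕ)) := by
    by_contra! hc
    have ha := hc T le_rfl (by omega)
    have hb := hc (2 * T) (by omega) (by omega)
    have e1 := theta_add_sum_primes_Ioc T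
    have e2 := theta_add_sum_primes_Ioc (2 * T)
    have f1 := sum_log_primes_Ioc_le (M := T) (n := 4 * T) (by omega)
    have f2 := sum_log_primes_Ioc_le (M := 2 * T) (n := 4 * T) (by omega)
    rw [show 2 * (2 * T) = 4 * T by ring] at e2 f2 hb
    linarith
  set P := (Ioc M (2 * M)).filter Nat.Prime with hP
  refine ⟨P.filter fun j => ¬ j ∣ q, ?_, ?_, ?_⟩
  · have hD : (P.filter fun j => j ∣ q).card < 8 := by
      refine card_primeDivisors_lt hq hqT _ fun j hj => ?_
      simp only [hP, mem_filter, mem_Ioc] at hj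
      exact ⟨hj.1.2, by omega, hj.2⟩
    have hsum := card_filter_add_card_filter_not (s := P) (fun j => j ∣ q)
    have : (P.card : ℝ) ≤ (P.filter fun j => ¬ j ∣ q).card + 8 := by
      norm_cast
      omega
    have := mul_le_mul_of_nonneg_right this (mul_nonneg (zero_le_two (α := ℝ)) hl0)
    linarith
  · intro j hj
    simp only [hP, mem_filter, mem_Ioc] at hj
    exact ⟨hj.1.2, hj.2, by omega, by omega⟩
  · intro j hj k hk
    simp only [hP, mem_filter, mem_Ioc] at hj hk
    omega

end

section

theorem weilError_four_mul_le {p T : ℕ} {a : ℝ} (ha : 1 ≤ a) (hp : (p : ℝ) = a ^ 24) (hT : 1 ≤ T)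
    (hTa : (T : ℝ) ≤ a ^ 4) : weilError p (4 * T) ≤ 193 * T ^ 2 * a ^ 12 := by
  have hT' : (1 : ℝ) ≤ T := by exact_mod_cast hT
  have ha0 : 0 ≤ a := by linarith
  have hsqrt : √(p : ℝ) = a ^ 12 := by
    rw [hp, show a ^ 24 = (a ^ 12) ^ 2 by ring, Real.sqrt_sq (by positivity)]
  have h1 : (T : ℝ) ≤ a ^ 12 := hTa.trans (pow_le_pow_right₀ ha (by norm_num))
  have h2 : (1 : ℝ) * a ^ 12 ≤ T ^ 2 * a ^ 12 := by
    gcongr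
    exact one_le_pow₀ hT'
  have h3 : (T : ℝ) ^ 2 * T ≤ T ^ 2 * a ^ 12 := by gcongr
  rw [weilError, hsqrt]
  push_cast
  nlinarith

theorem error_le {a b l p N T H E J : ℝ} (ha : 0 < a) (hb : 0 < b) (hl : 1 ≤ l)
    (hp : p = a ^ 24) (hN : N = b ^ 3 * a ^ 24) (hT1 : T ≤ a ^ 4 * b) (hT2 : a ^ 4 * b ≤ 2 * T)
    (hH : N ≤ 8 * H) (hE : E ≤ 193 * T ^ 2 * a ^ 12) (hJ : T ≤ J * (4 * l)) :
    p ^ 2 * (E / H ^ 2 + 1 / (J * H)) ≤ 13000 * a ^ 20 * (1 / b ^ 4) * l := by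
  have hx : 0 < a ^ 4 * b := by positivity
  have hT0 : 0 < T := by linarith
  have hN0 : 0 < N := by rw [hN]; positivity
  have hH0 : 0 < H := by linarith
  have hJ0 : 0 < J := by
    by_contra! h
    have : J * (4 * l) ≤ 0 := mul_nonpos_of_nonpos_of_nonneg h (by linarith)
    linarith
  have h1 : E / H ^ 2 ≤ 193 * (a ^ 4 * b) ^ 2 * a ^ 12 / (N / 8) ^ 2 := by
    have : N / 8 ≤ H := by linarith
    have : E ≤ 193 * (a ^ 4 * b) ^ 2 * a ^ 12 := hE.trans (by gcongr)
    gcongr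
  have h2 : 1 / (J * H) ≤ 64 * l / (a ^ 4 * b * N) := by
    rw [div_le_div_iff₀ (by positivity) (by positivity)]
    have : a ^ 4 * b * N ≤ (2 * (J * (4 * l))) * (8 * H) :=
      mul_le_mul (by linarith) hH hN0.le (by positivity)
    linarith
  calc _ ≤ p ^ 2 * (193 * (a ^ 4 * b) ^ 2 * a ^ 12 / (N / 8) ^ 2 + 64 * l / (a ^ 4 * b * N)) := by
        gcongr
    _ = a ^ 20 * (1 / b ^ 4) * (12352 + 64 * l) := by
        rw [hp, hN]
        field_simp
        ring
    _ ≤ a ^ 20 * (1 / b ^ 4) * (13000 * l) := by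
        gcongr
        linarith
    _ = _ := by ring

theorem le_card_intervalFactorialsRatio {T₀ p L N : ℕ}
    (hT₀ : ∀ T ≥ T₀, ∀ q : ℕ, 0 < q → q < T ^ 8 →
      ∃ J : Finset ℕ, (T : ℝ) ≤ J.card * (4 * Real.log (4 * T : ℕ)) ∧
        (∀ j ∈ J, j.Prime ∧ ¬ j ∣ q ∧ T < j ∧ j ≤ 4 * T) ∧ ∀ j ∈ J, ∀ k ∈ J, j ≤ 2 * k)
    (hp : p.Prime) (hLN : L + N < p) {a b : ℝ} (ha : T₀ + 2 ^ 20 ≤ a ^ 3) (ha0 : 0 < a)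
    (hb : 0 < b) (hpa : (p : ℝ) = a ^ 24) (hN : (N : ℝ) = b ^ 3 * a ^ 24) (hab : 8 ≤ a * b) :
    (p : ℝ) - 13000 * a ^ 20 * (1 / b ^ 4) * Real.log p ≤
      (intervalFactorialsRatio p L N).card := by
  have : Fact p.Prime := ⟨hp⟩
  have hT₀0 : (0 : ℝ) ≤ T₀ := Nat.cast_nonneg _
  have ha2 : 100 ≤ a := by
    by_contra! h
    have : a ^ 3 ≤ 100 ^ 3 := by gcongr
    norm_num at this ha
    linarith
  have ha1 : 1 ≤ a := by linarith
  have hNp : (N : ℝ) < p := by exact_mod_cast (by omega : N < p)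
  have hb1 : b ≤ 1 := by
    by_contra! h
    have : (1 : ℝ) ≤ b ^ 3 := one_le_pow₀ h.le
    rw [hN, hpa] at hNp
    have : 0 < a ^ 24 := by positivity
    nlinarith
  have hl : 1 ≤ Real.log p := by
    rw [Real.le_log_iff_exp_le (by exact_mod_cast hp.pos), hpa]
    have := Real.exp_one_lt_d9
    have : a ≤ a ^ 24 := le_self_pow₀ ha1 (by norm_num)
    linarith
  set T := ⌊a ^ 4 * b⌋₊ with hT
  have hx8 : a ^ 3 * 8 ≤ a ^ 4 * b := by
    calc a ^ 3 * 8 ≤ a ^ 3 * (a * b) := by gcongr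
      _ = _ := by ring
  have hTle : (T : ℝ) ≤ a ^ 4 * b := Nat.floor_le (by positivity)
  have hTgt : a ^ 4 * b < T + 1 := Nat.lt_floor_add_one _
  have hTa3 : a ^ 3 ≤ T := by linarith
  have hTa4 : (T : ℝ) ≤ a ^ 4 := hTle.trans (mul_le_of_le_one_right (by positivity) hb1)
  have hTT₀ : T₀ ≤ T := by
    have : (T₀ : ℝ) ≤ T := by linarith
    exact_mod_cast this
  have hT3 : 3 ≤ T := by
    have : (3 : ℝ) ≤ T := by linarith
    exact_mod_cast this
  have hpT : p ≤ T ^ 8 := by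
    have : (p : ℝ) ≤ (T : ℝ) ^ 8 := by
      calc (p : ℝ) = (a ^ 3) ^ 8 := by rw [hpa]; ring
        _ ≤ _ := by gcongr
    exact_mod_cast this
  have hp2 := hp.two_le
  obtain ⟨J, hJc, hJ, hJJ⟩ := hT₀ T hTT₀ (p - 1) (by omega) (by omega)
  have hT4 : 2 * (4 * T) ^ 5 < p := by
    have : 2 * (4 * (T : ℝ)) ^ 5 < p := by
      calc 2 * (4 * (T : ℝ)) ^ 5 ≤ 2 * (4 * a ^ 4) ^ 5 := by gcongr
        _ = 2048 * a ^ 20 := by ring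
        _ < a ^ 3 * a ^ 20 := by
          have : 0 < a ^ 20 := by positivity
          exact mul_lt_mul_of_pos_right (by linarith) this
        _ = a ^ 23 := by ring
        _ ≤ a ^ 24 := pow_le_pow_right₀ ha1 (by norm_num)
        _ = p := hpa.symm
    exact_mod_cast this
  have hTp : 4 * T ≤ p := by
    have : 4 * T ≤ (4 * T) ^ 5 := Nat.le_self_pow (by norm_num) _
    omega
  have hlogT : Real.log (4 * T : ℕ) ≤ Real.log p :=
    Real.log_le_log (by exact_mod_cast (by omega : 0 < 4 * T)) (by exact_mod_cast hTp)
  have hJl : (T : ℝ) ≤ J.card * (4 * Real.log p) := hJc.trans (by gcongr)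
  have hJne : J.Nonempty := by
    rw [Finset.nonempty_iff_ne_empty]
    rintro rfl
    simp at hJl
    omega
  have hN8 : 16 * T ≤ N := by
    have : 16 * (T : ℝ) ≤ N := by
      calc 16 * (T : ℝ) ≤ 16 * a ^ 4 := by gcongr
        _ ≤ 8 ^ 3 * a ^ 4 * a ^ 17 := by
          have : (1 : ℝ) ≤ a ^ 17 := one_le_pow₀ ha1
          have : 0 < a ^ 4 := by positivity
          nlinarith
        _ ≤ (a * b) ^ 3 * a ^ 4 * a ^ 17 := by gcongr
        _ = N := by rw [hN]; ring
    exact_mod_cast this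
  refine le_trans (sub_le_sub_left ?_ _) (card_intervalFactorialsRatio_ge_of_primes (n := 4 * T)
    (H := N / 4) hLN J hJne (by omega) (by omega) (fun j hj => (hJ j hj).1)
    (fun j hj => (hJ j hj).2.1) (fun j hj => hT3.trans (hJ j hj).2.2.1.le) (fun j hj => ?_)
    (fun j hj => (hJ j hj).2.2.2) hJJ)
  · refine error_le ha0 hb hl hpa hN hTle ?_ ?_
      (weilError_four_mul_le ha1 hpa (by omega) hTa4) hJl
    · have : (1 : ℝ) ≤ T := by exact_mod_cast (by omega : 1 ≤ T)
      linarith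
    · exact_mod_cast (by omega : N ≤ 8 * (N / 4))
  · refine lt_of_le_of_lt ?_ hT4
    have := (hJ j hj).2.2.2
    gcongr

/-- **Theorem 2, Case 2.** If `c₂·p^{7/8}·log p ≤ N ≤ c₁·p^{13/14}·(log p)^{4/7}` then
`|A_N / A_N| ≥ p − C·p^{5/6}·K^{4/3}·(log p)^{4/3}` where `K = p/N`. -/
theorem card_intervalFactorialsRatio_ge_case2 :
    ∃ c₁ c₂ C : ℝ, c₁ > 0 ∧ c₂ > 0 ∧ C > 0 ∧ ∀ p L N : ℕ, p.Prime →
      0 < L + 1 → L + 1 < L + N → L + N < p →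
      c₂ * (p : ℝ) ^ ((7 : ℝ) / 8) * Real.log p ≤ (N : ℝ) →
      (N : ℝ) ≤ c₁ * (p : ℝ) ^ ((13 : ℝ) / 14) * (Real.log p) ^ ((4 : ℝ) / 7) →
      ((intervalFactorialsRatio p L N).card : ℝ) ≥
        (p : ℝ) - C * (p : ℝ) ^ ((5 : ℝ) / 6) * ((p : ℝ) / (N : ℝ)) ^ ((4 : ℝ) / 3) *
          (Real.log p) ^ ((4 : ℝ) / 3) := by
  obtain ⟨T₀, hT₀⟩ := exists_primes_not_dvd
  refine ⟨1, 2 * (T₀ + 2 ^ 20), 13000, one_pos, by positivity, by norm_num, ?_⟩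
  intro p L N hp _ hN1 hLN hc _
  have hT₀0 : (0 : ℝ) ≤ T₀ := Nat.cast_nonneg _
  have hp0 : (0 : ℝ) < p := Nat.cast_pos.mpr hp.pos
  have hN0 : (0 : ℝ) < N := Nat.cast_pos.mpr (by omega)
  have hNp : (N : ℝ) < p := by exact_mod_cast (by omega : N < p)
  have hlog : 1 / 2 ≤ Real.log p := by
    have := Real.log_two_gt_d9
    have := Real.log_le_log two_pos (by exact_mod_cast hp.two_le : (2 : ℝ) ≤ p)
    linarith
  set a : ℝ := (p : ℝ) ^ ((1 : ℝ) / 24) with ha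
  set b : ℝ := ((N : ℝ) / p) ^ ((1 : ℝ) / 3) with hb
  have ha0 : 0 < a := Real.rpow_pos_of_pos hp0 _
  have hb0 : 0 < b := Real.rpow_pos_of_pos (by positivity) _
  have hapow (m : ℕ) : a ^ m = (p : ℝ) ^ ((m : ℝ) / 24) := by
    rw [ha, ← Real.rpow_mul_natCast hp0.le]
    congr 1
    ring
  have hpa : (p : ℝ) = a ^ 24 := by
    rw [hapow]
    norm_num
  have h78 : (p : ℝ) ^ ((7 : ℝ) / 8) = a ^ 21 := by
    rw [hapow]
    norm_num
  have h56 : (p : ℝ) ^ ((5 : ℝ) / 6) = a ^ 20 := by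
    rw [hapow]
    norm_num
  have hb3 : b ^ 3 = N / p := by
    rw [hb, ← Real.rpow_mul_natCast (by positivity)]
    norm_num
  have hb4 : ((p : ℝ) / N) ^ ((4 : ℝ) / 3) = 1 / b ^ 4 := by
    rw [hb, ← Real.rpow_mul_natCast (by positivity), ← inv_div, Real.inv_rpow (by positivity),
      one_div]
    norm_num
  have hN : (N : ℝ) = b ^ 3 * a ^ 24 := by
    rw [← hpa, hb3]
    field_simp
  have hab3 : T₀ + 2 ^ 20 ≤ (a * b) ^ 3 := by
    rw [h78, hN, show b ^ 3 * a ^ 24 = (a * b) ^ 3 * a ^ 21 by ring, mul_right_comm] at hc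
    refine le_trans ?_ (le_of_mul_le_mul_right hc (by positivity))
    nlinarith
  have hb1 : b ≤ 1 := Real.rpow_le_one (by positivity) ((div_le_one hp0).mpr hNp.le) (by norm_num)
  have ha3 : T₀ + 2 ^ 20 ≤ a ^ 3 := hab3.trans
    (pow_le_pow_left₀ (by positivity) (mul_le_of_le_one_right ha0.le hb1) 3)
  have hab : 8 ≤ a * b := by
    by_contra! h
    have : (a * b) ^ 3 ≤ 8 ^ 3 := by gcongr
    norm_num at this hab3
    linarith
  have hmain := le_card_intervalFactorialsRatio (L := L) hT₀ hp hLN ha3 ha0 hb0 hpa hN hab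
  have hl1 : 1 ≤ Real.log p := by
    rw [Real.le_log_iff_exp_le hp0, hpa]
    have := Real.exp_one_lt_d9
    have h1 : 1 ≤ a := by
      by_contra! h
      have : a ^ 3 ≤ 1 := pow_le_one₀ ha0.le h.le
      linarith
    have : a ^ 3 ≤ a ^ 24 := pow_le_pow_right₀ h1 (by norm_num)
    linarith
  have hl : Real.log p ≤ Real.log p ^ ((4 : ℝ) / 3) :=
    Real.self_le_rpow_of_one_le hl1 (by norm_num)
  rw [h56, hb4]
  refine le_trans (sub_le_sub_left ?_ _) hmain
  gcongr

end
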